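/- For every prime p ≥ 5, the number L^{(2*)}(p) of distinct roots of ss_p^{(2*)}(X) in 𝔽_p equals (1/8)·(2 + (1 − (−1|p))·(4 + (−2|p)))·h(√−p) + (1/4)·h(√−2p). -/

import Mathlib

open Polynomial

noncomputable section

/-- The class number h(√-d) of the imaginary quadratic field ℚ(√-d),
realized as the subfield of ℂ generated by i·√d. -/
def classNumberSqrtNeg (d : ℕ) : ℕ :=
  haveI : FiniteDimensional ℚ (IntermediateField.adjoin ℚ {(Complex.I * Real.sqrt d : ℂ)}) :=
    IntermediateField.adjoin.finiteDimensional
      ⟨X ^ 2 + C (d : ℚ), monic_X_pow_add_C _ (by norm_num), by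
        have h : (Complex.I * (Real.sqrt d : ℂ)) ^ 2 = -(d : ℂ) := by
          rw [mul_pow, Complex.I_sq, ← Complex.ofReal_pow, Real.sq_sqrt (Nat.cast_nonneg d)]
          simp
        simp [h]⟩
  haveI : NumberField (IntermediateField.adjoin ℚ {(Complex.I * Real.sqrt d : ℂ)}) := ⟨⟩
  NumberField.classNumber (IntermediateField.adjoin ℚ {(Complex.I * Real.sqrt d : ℂ)})

variable (p : ℕ) [Fact p.Prime]

/-- ε = (1 - (-1|p))/2 -/
def eps : ℕ := ((1 - legendreSym p (-1)) / 2).toNat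
/-- δ = (1 - (-3|p))/2 -/
def del : ℕ := ((1 - legendreSym p (-3)) / 2).toNat
/-- ν = (1 - (-2|p))/2 -/
def nu : ℕ := ((1 - legendreSym p (-2)) / 2).toNat

/-- The Pochhammer symbol (x)_n = x(x+1)⋯(x+n-1) in 𝔽_p. -/
def poch (x : ZMod p) (n : ℕ) : ZMod p := (ascPochhammer (ZMod p) n).eval x

/-- The level-2 Fricke supersingular polynomial ss_p^{(2*)}(X) ∈ 𝔽_p[X]:
(X-256)^ν · Σ_{n=0}^{m₂} ((-m₂)_n (β₂)_n / (n!)²) 256^n X^{m₂+ε-n},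
with m₂ = ⌊p/8⌋ and β₂ = 3/8 - (ε-2ν)/4. -/
def ss2Star : (ZMod p)[X] :=
  (X - C 256) ^ nu p *
    ∑ n ∈ Finset.range (p / 8 + 1),
      C (poch p (-(p / 8 : ℕ) : ZMod p) n *
         poch p ((3 : ZMod p) / 8 - ((((eps p : ℤ) - 2 * (nu p : ℤ)) : ℤ) : ZMod p) / 4) n /
         ((n.factorial : ZMod p)) ^ 2 * 256 ^ n) *
      X ^ (p / 8 + eps p - n)

/-- L^{(2*)}(p): the number of distinct roots of ss_p^{(2*)}(X) in 𝔽_p. -/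
def L2Star : ℕ := (ss2Star p).roots.toFinset.card

/-- A telescoping sum of hypergeometric type. -/
theorem sum_range_hypergeometric_telescope {R : Type*} [CommRing R] (N : ℕ)
    (a α β T : ℕ → R) (A B : R)
    (hT : ∀ i < N, A * T (i + 1) = B * T i)
    (ha : ∀ i < N, a (i + 1) * α (i + 1) = a i * β i) (h0 : α 0 = 0) (hN : β N = 0) :
    ∑ i ∈ Finset.range (N + 1), a i * (α i * A - β i * B) * T i = 0 := by
  have h1 : ∑ i ∈ Finset.range (N + 1), a i * (α i * A) * T i =
      ∑ i ∈ Finset.range N, a i * β i * (B * T i) := by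
    rw [Finset.sum_range_succ', h0]
    simp only [zero_mul, mul_zero, add_zero]
    refine Finset.sum_congr rfl fun i hi ↦ ?_
    rw [← hT i (Finset.mem_range.1 hi), ← ha i (Finset.mem_range.1 hi)]
    ring
  have h2 : ∑ i ∈ Finset.range (N + 1), a i * (β i * B) * T i =
      ∑ i ∈ Finset.range N, a i * β i * (B * T i) := by
    rw [Finset.sum_range_succ, hN]
    simp only [zero_mul, mul_zero, add_zero]
    exact Finset.sum_congr rfl fun i _ ↦ by ring
  simp only [mul_sub, sub_mul, Finset.sum_sub_distrib, h1, h2, sub_self]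

theorem mul_derivative_pow {R : Type*} [CommRing R] (f : R[X]) (n : ℕ) :
    f * derivative (f ^ n) = (n : R[X]) * derivative f * f ^ n := by
  cases n with
  | zero => simp
  | succ n => rw [derivative_pow_succ]; push_cast; simp only [map_add, map_natCast, map_one]; ring

section

variable {K : Type*} [Field K] {p : ℕ} [CharP K p]

theorem natCast_ne_zero_of_pos_of_lt {n : ℕ} (h0 : 0 < n) (h : n < p) : (n : K) ≠ 0 := fun h1 ↦ by
  rw [CharP.cast_eq_zero_iff K p] at h1
  exact absurd (Nat.le_of_dvd h0 h1) (by omega)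

/-- Uniqueness of polynomial solutions of small degree of the hypergeometric equation
with parameters `1/2, 1/2; 1`. -/
theorem eq_of_hypergeometric_ode (hp : 2 < p) {f g : K[X]} (hf : f.natDegree < p)
    (hg : g.natDegree < p) (h0 : f.coeff 0 = g.coeff 0)
    (of : 4 * (1 - X) * X * derivative (derivative f) + 4 * (1 - 2 * X) * derivative f - f = 0)
    (og : 4 * (1 - X) * X * derivative (derivative g) + 4 * (1 - 2 * X) * derivative g - g = 0) :
    f = g := by
  have hrec : ∀ f : K[X], 4 * (1 - X) * X * derivative (derivative f)
      + 4 * (1 - 2 * X) * derivative f - f = 0 → ∀ n : ℕ,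
      4 * ((n : K) + 1) ^ 2 * f.coeff (n + 1) = (2 * n + 1) ^ 2 * f.coeff n := by
    intro f hf n
    have h : C 4 * (X * derivative (derivative f)) - C 4 * (X * (X * derivative (derivative f)))
      + C 4 * derivative f - C 8 * (X * derivative f) - f = 0 := by
      rw [← hf]; simp only [map_ofNat]; ring
    have := congrArg (fun q ↦ coeff q n) h
    simp only [coeff_sub, coeff_add, coeff_C_mul, coeff_zero] at this
    match n with
    | 0 => simp [coeff_derivative, mul_coeff_zero] at this; simp; linear_combination this
    | 1 =>
      simp [coeff_derivative, coeff_X_mul, mul_coeff_zero] at this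
      push_cast; linear_combination this
    | n + 2 =>
      simp [coeff_derivative, coeff_X_mul] at this
      push_cast; linear_combination this
  have key : ∀ n < p, f.coeff n = g.coeff n := by
    intro n
    induction n with
    | zero => intro _; exact h0
    | succ n ih =>
      intro hn
      have h1 := hrec f of n
      have h2 := hrec g og n
      rw [ih (by omega), ← h2] at h1
      have h3 : ((n : K) + 1) ≠ 0 := by
        exact_mod_cast natCast_ne_zero_of_pos_of_lt (K := K) (p := p) (Nat.succ_pos n) hn
      have h4 : (4 : K) ≠ 0 := by
        have : ((2 : ℕ) : K) ≠ 0 := natCast_ne_zero_of_pos_of_lt (p := p) (by norm_num) hp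
        have h5 : (4 : K) = (2 : ℕ) * (2 : ℕ) := by norm_num
        rw [h5]; exact mul_ne_zero this this
      exact mul_left_cancel₀ (mul_ne_zero h4 (pow_ne_zero 2 h3)) h1
  ext n
  rcases lt_or_ge n p with h | h
  · exact key n h
  · rw [coeff_eq_zero_of_natDegree_lt (hf.trans_le h), coeff_eq_zero_of_natDegree_lt (hg.trans_le h)]

end

/-- The homogeneous form `∑ (m choose i)² a^(m-i) b^i`, related to the Hasse invariant of the
Legendre family of elliptic curves. -/
def hasseForm {R : Type*} [CommRing R] (m : ℕ) (a b : R) : R :=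
  ∑ i ∈ Finset.range (m + 1), (m.choose i : R) ^ 2 * a ^ (m - i) * b ^ i

theorem map_hasseForm {R S : Type*} [CommRing R] [CommRing S] (φ : R →+* S) (m : ℕ) (a b : R) :
    φ (hasseForm m a b) = hasseForm m (φ a) (φ b) := by
  simp [hasseForm]

section

variable {K : Type*} [Field K] {p : ℕ} [CharP K p] {m : ℕ}

theorem two_mul_cast_half (hm : p = 2 * m + 1) : 2 * (m : K) = -1 := by
  have : ((p : ℕ) : K) = 0 := CharP.cast_eq_zero K p
  rw [hm] at this
  push_cast at this
  linear_combination this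

theorem four_mul_choose_sq (hm : p = 2 * m + 1) (i : ℕ) (hi : i < m) :
    4 * ((i : K) + 1) ^ 2 * (m.choose (i + 1) : K) ^ 2 = (2 * i + 1) ^ 2 * (m.choose i : K) ^ 2 := by
  have h := Nat.choose_succ_right_eq m i
  have h' : (m.choose (i + 1) : K) * (i + 1) = m.choose i * (m - i) := by
    have := congrArg (Nat.cast : ℕ → K) h
    rw [Nat.cast_mul, Nat.cast_mul, Nat.cast_sub hi.le] at this
    exact_mod_cast this
  have h2 := two_mul_cast_half (K := K) hm
  calc 4 * ((i : K) + 1) ^ 2 * (m.choose (i + 1) : K) ^ 2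
      = 4 * ((m.choose (i + 1) : K) * (i + 1)) ^ 2 := by ring
    _ = (2 * m - 2 * i) ^ 2 * (m.choose i : K) ^ 2 := by rw [h']; ring
    _ = _ := by rw [h2]; ring

theorem hasseForm_one_X_ode (hm : p = 2 * m + 1) :
    4 * (1 - X) * X * derivative (derivative (hasseForm m 1 (X : K[X])))
      + 4 * (1 - 2 * X) * derivative (hasseForm m 1 (X : K[X])) - hasseForm m 1 (X : K[X]) = 0 := by
  have hc : ∀ n, (hasseForm m 1 (X : K[X])).coeff n = (m.choose n : K) ^ 2 := by
    intro n
    simp only [hasseForm, one_pow, mul_one, finsetSum_coeff]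
    have : ∀ i, (m.choose i : K[X]) ^ 2 = C ((m.choose i : K) ^ 2) := by intro i; simp
    simp only [this, coeff_C_mul, coeff_X_pow]
    simp
    intro h
    rw [Nat.choose_eq_zero_of_lt (by omega)]; simp
  set f := hasseForm m 1 (X : K[X])
  have h : C 4 * (X * derivative (derivative f)) - C 4 * (X * (X * derivative (derivative f)))
      + C 4 * derivative f - C 8 * (X * derivative f) - f = 0 := by
    have rc : ∀ n : ℕ, 4 * ((n : K) + 1) ^ 2 * f.coeff (n + 1) = (2 * n + 1) ^ 2 * f.coeff n := by
      intro n
      rw [hc, hc]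
      rcases lt_trichotomy n m with h | h | h
      · exact four_mul_choose_sq hm n h
      · subst h
        have := two_mul_cast_half (K := K) hm
        simp [this]
      · rw [Nat.choose_eq_zero_of_lt h, Nat.choose_eq_zero_of_lt (by omega)]; simp
    ext n
    simp only [coeff_sub, coeff_add, coeff_C_mul, coeff_zero]
    match n with
    | 0 => have := rc 0; simp [coeff_derivative, mul_coeff_zero] at this ⊢; linear_combination this
    | 1 =>
      have := rc 1
      simp [coeff_derivative, coeff_X_mul, mul_coeff_zero] at this ⊢
      linear_combination this
    | n + 2 =>
      have := rc (n + 2)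
      simp [coeff_derivative, coeff_X_mul] at this ⊢
      linear_combination this
  rw [← h]; simp only [map_ofNat]; ring

end

section

variable {K : Type*} [Field K] {p : ℕ} [CharP K p] {m : ℕ}

theorem eq_of_landen_ode {f g : K[X]} (hf : f.natDegree < p)
    (hg : g.natDegree < p) (h0 : f.coeff 0 = g.coeff 0)
    (of : X * (1 - X ^ 2) * derivative (derivative f) + (1 - 3 * X ^ 2) * derivative f - X * f = 0)
    (og : X * (1 - X ^ 2) * derivative (derivative g) + (1 - 3 * X ^ 2) * derivative g - X * g = 0) :
    f = g := by
  have hrec : ∀ f : K[X], X * (1 - X ^ 2) * derivative (derivative f)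
      + (1 - 3 * X ^ 2) * derivative f - X * f = 0 → f.coeff 1 = 0 ∧ ∀ n : ℕ,
      ((n : K) + 2) ^ 2 * f.coeff (n + 2) = (n + 1) ^ 2 * f.coeff n := by
    intro f hf
    have h : X * derivative (derivative f) - X * (X * (X * derivative (derivative f)))
      + derivative f - C 3 * (X * (X * derivative f)) - X * f = 0 := by
      rw [← hf]; simp only [map_ofNat]; ring
    have key := fun n ↦ congrArg (fun q ↦ coeff q n) h
    simp only [coeff_sub, coeff_add, coeff_C_mul, coeff_zero] at key
    refine ⟨?_, fun n ↦ ?_⟩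
    · have := key 0
      simpa [coeff_derivative, mul_coeff_zero] using this
    · have := key (n + 1)
      match n with
      | 0 =>
        simp [coeff_derivative, coeff_X_mul, mul_coeff_zero] at this ⊢; linear_combination this
      | 1 =>
        simp [coeff_derivative, coeff_X_mul, mul_coeff_zero] at this ⊢; linear_combination this
      | n + 2 =>
        simp [coeff_derivative, coeff_X_mul] at this ⊢
        linear_combination this
  have key : ∀ n < p, f.coeff n = g.coeff n := by
    intro n
    induction n using Nat.strong_induction_on with
    | _ n ih =>
      intro hn
      match n with
      | 0 => exact h0
      | 1 => rw [(hrec f of).1, (hrec g og).1]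
      | n + 2 =>
        have h1 := (hrec f of).2 n
        have h2 := (hrec g og).2 n
        rw [ih n (by omega) (by omega), ← h2] at h1
        have h3 : ((n : K) + 2) ≠ 0 := by
          exact_mod_cast natCast_ne_zero_of_pos_of_lt (K := K) (p := p) (Nat.succ_pos (n + 1)) hn
        exact mul_left_cancel₀ (pow_ne_zero 2 h3) h1
  ext n
  rcases lt_or_ge n p with h | h
  · exact key n h
  · rw [coeff_eq_zero_of_natDegree_lt (hf.trans_le h), coeff_eq_zero_of_natDegree_lt (hg.trans_le h)]

theorem hasseForm_landen_ode (hm : p = 2 * m + 1) :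
    X * (1 - X ^ 2) * derivative (derivative (hasseForm m ((1 + X) ^ 2) (4 * X : K[X])))
      + (1 - 3 * X ^ 2) * derivative (hasseForm m ((1 + X) ^ 2) (4 * X : K[X]))
      - X * hasseForm m ((1 + X) ^ 2) (4 * X : K[X]) = 0 := by
  have h2m : 2 * (m : K[X]) = -1 := by
    have := congrArg (C : K → K[X]) (two_mul_cast_half (K := K) hm)
    simp only [map_mul, map_neg, map_one, map_ofNat, map_natCast] at this
    exact this
  set T : ℕ → K[X] := fun i ↦ X ^ i * (1 + X) ^ (2 * (m - i)) with hT
  set a : ℕ → K[X] := fun i ↦ (m.choose i : K[X]) ^ 2 * 4 ^ i with ha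
  have hf : hasseForm m ((1 + X) ^ 2) (4 * X : K[X]) = ∑ i ∈ Finset.range (m + 1), a i * T i := by
    simp only [hasseForm, hT, ha]
    refine Finset.sum_congr rfl fun i _ ↦ ?_
    rw [mul_pow, pow_mul]; ring
  have hda : ∀ i f, derivative (a i * f) = a i * derivative f := by
    intro i f
    have : a i = C ((m.choose i : K) ^ 2 * 4 ^ i) := by
      simp only [ha, map_mul, map_pow, map_ofNat, map_natCast]
    rw [this, derivative_C_mul]
  have hT1 : ∀ i ≤ m, X * (1 + X) * (derivative (T i) : K[X]) =
      ((i : K[X]) - (1 + (i : K[X])) * X) * T i := by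
    intro i hi
    have e1 := mul_derivative_pow (X : K[X]) i
    have e2 := mul_derivative_pow (1 + X : K[X]) (2 * (m - i))
    rw [Nat.cast_mul, Nat.cast_sub hi] at e2
    simp only [derivative_add, derivative_one, derivative_X, zero_add, Nat.cast_ofNat] at e1 e2
    simp only [hT, derivative_mul]
    linear_combination (1 + X) ^ (2 * (m - i)) * (1 + X) * e1 + X ^ i * X * e2
      + h2m * X * (X ^ i * (1 + X) ^ (2 * (m - i)))
  have hT2 : ∀ i ≤ m, (X * (1 + X) ^ 2) * (X * (1 - X ^ 2) * derivative (derivative (T i : K[X]))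
      + (1 - 3 * X ^ 2) * derivative (T i : K[X]) - X * T i) =
      (1 - X ^ 2) * (((i : K[X]) ^ 2 * (1 + X) ^ 2 - (2 * (i : K[X]) + 1) ^ 2 * X) * T i) := by
    intro i hi
    have e1 := hT1 i hi
    have e2 := congrArg derivative e1
    have hi' : derivative (i : K[X]) = 0 := derivative_natCast
    simp only [derivative_mul, derivative_add, derivative_sub, derivative_one, derivative_X,
      zero_add, hi'] at e2
    linear_combination (1 - X ^ 2) * X * (1 + X) * e2
      + ((1 - 3 * X ^ 2) * (1 + X) - (1 - X ^ 2) * (1 + 2 * X) 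
        + (1 - X^2) * ((i : K[X]) - (1 + i) * X)) * e1
  have hne : (X * (1 + X) ^ 2 : K[X]) ≠ 0 := by
    refine mul_ne_zero X_ne_zero (pow_ne_zero 2 ?_)
    rw [add_comm]; exact X_add_C_ne_zero (1 : K)
  have hsum := sum_range_hypergeometric_telescope m a (fun i ↦ (i : K[X]) ^ 2)
    (fun i ↦ (2 * i + 1) ^ 2) T ((1 + X) ^ 2) X (by
      intro i hi
      simp only [hT]
      have : 2 * (m - i) = 2 * (m - (i + 1)) + 2 := by omega
      rw [this]; ring) (by
      intro i hi
      have := congrArg (C : K → K[X]) (four_mul_choose_sq (K := K) hm i hi)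
      simp only [map_mul, map_pow, map_add, map_one, map_ofNat, map_natCast] at this
      simp only [ha]; push_cast
      linear_combination 4 ^ i * this) (by simp) (by
      rw [h2m]; ring)
  apply mul_left_cancel₀ hne
  rw [mul_zero, hf]
  simp only [derivative_sum, hda]
  calc _ = ∑ i ∈ Finset.range (m + 1), a i * ((X * (1 + X) ^ 2) *
        (X * (1 - X ^ 2) * derivative (derivative (T i : K[X]))
      + (1 - 3 * X ^ 2) * derivative (T i : K[X]) - X * T i)) := by
        simp only [Finset.mul_sum, ← Finset.sum_add_distrib, ← Finset.sum_sub_distrib]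
        exact Finset.sum_congr rfl fun i _ ↦ by ring
    _ = (1 - X ^ 2) * ∑ i ∈ Finset.range (m + 1), a i *
        ((i : K[X]) ^ 2 * (1 + X) ^ 2 - (2 * (i : K[X]) + 1) ^ 2 * X) * T i := by
        rw [Finset.mul_sum]
        refine Finset.sum_congr rfl fun i hi ↦ ?_
        rw [hT2 i (by simp at hi; omega)]; ring
    _ = 0 := by rw [hsum, mul_zero]

theorem natDegree_hasseForm_le (m : ℕ) {a b : K[X]} {d : ℕ} (ha : a.natDegree ≤ d)
    (hb : b.natDegree ≤ d) : (hasseForm m a b).natDegree ≤ d * m := by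
  refine natDegree_sum_le_of_forall_le _ _ fun i hi ↦ ?_
  have hi : i ≤ m := by simp at hi; omega
  have h1 : ((m.choose i : K[X]) ^ 2).natDegree = 0 := by
    rw [← map_natCast C, ← C_pow, natDegree_C]
  have h2 : (a ^ (m - i)).natDegree ≤ (m - i) * d :=
    natDegree_pow_le.trans (Nat.mul_le_mul_left _ ha)
  have h3 : (b ^ i).natDegree ≤ i * d := natDegree_pow_le.trans (Nat.mul_le_mul_left _ hb)
  refine natDegree_mul_le.trans ?_
  have h4 : ((m.choose i : K[X]) ^ 2 * a ^ (m - i)).natDegree ≤ (m - i) * d :=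
    natDegree_mul_le.trans (by omega)
  calc _ ≤ (m - i) * d + i * d := by omega
    _ = d * m := by rw [← add_mul, Nat.sub_add_cancel hi, mul_comm]

theorem hasseForm_coeff_zero_eq {a b : K[X]} (ha : a.coeff 0 = 1) (hb : b.coeff 0 = 0) :
    (hasseForm m a b).coeff 0 = 1 := by
  simp only [coeff_zero_eq_eval_zero] at *
  have := map_hasseForm (evalRingHom (0 : K)) m a b
  simp only [coe_evalRingHom, ha, hb] at this
  rw [this]
  simp only [hasseForm, one_pow, mul_one]
  rw [Finset.sum_range_succ']
  simp

/-- Landen's transformation for the truncated hypergeometric series. -/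
theorem hasseForm_landen (hm : p = 2 * m + 1) :
    hasseForm m ((1 + X) ^ 2) (4 * X : K[X]) = hasseForm m 1 (X ^ 2) := by
  have hcomp : hasseForm m 1 (X ^ 2 : K[X]) = (hasseForm m 1 (X : K[X])).comp (X ^ 2) := by
    have := map_hasseForm (compRingHom (X ^ 2 : K[X])) m 1 X
    simp only [map_one, coe_compRingHom_apply, X_comp] at this
    exact this.symm
  have hd1 : (1 : K[X]).natDegree ≤ 2 := by simp
  refine eq_of_landen_ode (p := p) ?_ ?_ ?_ (hasseForm_landen_ode hm) ?_
  · refine (natDegree_hasseForm_le (d := 2) m ?_ ?_).trans_lt (by omega)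
    · compute_degree
    · compute_degree; norm_num
  · exact (natDegree_hasseForm_le (d := 2) m hd1 (by simp)).trans_lt (by omega)
  · rw [hasseForm_coeff_zero_eq (by simp [coeff_zero_eq_eval_zero]) (by simp),
      hasseForm_coeff_zero_eq (by simp) (by simp)]
  · have ode := congrArg (fun f : K[X] ↦ f.comp (X ^ 2)) (hasseForm_one_X_ode (K := K) hm)
    rw [hcomp]
    simp only [derivative_comp, derivative_mul, sub_comp, add_comp, mul_comp, X_comp, one_comp,
      zero_comp, ofNat_comp] at ode ⊢
    simp only [derivative_X_pow, map_ofNat, Nat.cast_ofNat, Nat.add_one_sub_one, pow_one,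
      derivative_mul, derivative_X, derivative_ofNat] at ode ⊢
    linear_combination X * ode

end

section

variable {K : Type*} [Field K] {p : ℕ} [CharP K p] {m : ℕ}

/-- The second order equation for the summands of the pullback, deduced from their logarithmic
derivative. -/
theorem fricke_ode_of_log_derivative {v : ℕ} (hv : v ≤ 1) (n : ℕ) (t : K[X])
    (h : 2 * ((1 + X) * (1 - X) * (1 - 6 * X + X ^ 2) ^ v) * X * derivative t =
      (2 * ((1 + X) * (1 - X) * (1 - 6 * X + X ^ 2) ^ v) * (n : K[X]) +
    (-1 - 4 * (v : K[X]) - 8 * (n : K[X])) * X * (1 - X) * (1 - 6 * X + X ^ 2) ^ v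
    - 4 * (n : K[X]) * X * (1 + X) * (1 - 6 * X + X ^ 2) ^ v +
      2 * ((v : K[X]) * (2 * X ^ 2 - 6 * X)) * (1 - X ^ 2)) * t) :
    (4 * ((1 + X) * (1 - X) * (1 - 6 * X + X ^ 2) ^ v) ^ 2 * X) *
      (4 * (1 - X) * X * derivative (derivative t) + 4 * (1 - 2 * X) * derivative t - t) =
      (4 * (1 - X) * ((1 - 6 * X + X ^ 2) ^ v) ^ 2) * ((4 * (n : K[X]) ^ 2 * (1 + X) ^ 4 -
        (8 * (n : K[X]) + 1 + 4 * (v : K[X])) *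
        (8 * (n : K[X]) + 3 + 4 * (v : K[X])) * (X * (1 - X) ^ 2)) * t) := by
  have e2 := congrArg derivative h
  have hi' : derivative (n : K[X]) = 0 := derivative_natCast
  rcases Nat.le_one_iff_eq_zero_or_eq_one.1 hv with rfl | rfl
  · simp only [pow_zero, mul_one, derivative_mul, derivative_add, derivative_sub, derivative_one,
      derivative_X, derivative_X_pow, derivative_ofNat, map_ofNat, Nat.cast_ofNat, Nat.cast_zero,
      Nat.add_one_sub_one, pow_one, derivative_neg, derivative_zero,
      zero_add, hi'] at h e2 ⊢
    linear_combination (8 * ((1 + X) * (1 - X)) * (1 - X) * X) * e2 + (4 * (1 - X) *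
      (2 * ((1 + X) * (1 - X)) * (n : K[X]) + (-1 - 8 * (n : K[X])) * X * (1 - X)
        - 4 * (n : K[X]) * X * (1 + X))
      - 8 * (1 - X) * (1 - 3 * X ^ 2) + 8 * (1 - 2 * X) * ((1 + X) * (1 - X))) * h
  · simp only [pow_one, mul_one, derivative_mul, derivative_add, derivative_sub, derivative_one,
      derivative_X, derivative_X_pow, derivative_ofNat, map_ofNat, Nat.cast_ofNat, Nat.cast_one,
      Nat.add_one_sub_one, pow_one, derivative_neg,
      zero_add, hi'] at h e2 ⊢
    linear_combination (8 * ((1 + X) * (1 - X) * (1 - 6 * X + X ^ 2)) * (1 - X) * X) * e2 +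
      (4 * (1 - X) * (2 * ((1 + X) * (1 - X) * (1 - 6 * X + X ^ 2)) * (n : K[X]) +
        (-1 - 4 - 8 * (n : K[X])) * X * (1 - X) * (1 - 6 * X + X ^ 2)
        - 4 * (n : K[X]) * X * (1 + X) * (1 - 6 * X + X ^ 2) +
        2 * (2 * X ^ 2 - 6 * X) * (1 - X ^ 2))
      - 8 * (1 - X) * (1 - 12 * X + 24 * X ^ 3 - 5 * X ^ 4)
      + 8 * (1 - 2 * X) * ((1 + X) * (1 - X) * (1 - 6 * X + X ^ 2))) * h

/-- The pullback to the `λ`-line of the level two Fricke hypergeometric polynomial. -/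
theorem fricke_pullback_eq_hasseForm (h2p : 2 < p) (hm : p = 2 * m + 1) {m₂ e v : ℕ}
    (hv : v ≤ 1) (hm₂ : m = 4 * m₂ + e + 2 * v) (c : ℕ → K) (c0 : c 0 = 1)
    (hc : ∀ n < m₂, 64 * ((n : K) + 1) ^ 2 * c (n + 1) =
      (8 * n + 1 + 4 * v) * (8 * n + 3 + 4 * v) * c n)
    (hend : (8 * (m₂ : K) + 1 + 4 * v) * (8 * m₂ + 3 + 4 * v) = 0) :
    (1 + X) ^ e * (1 - 6 * X + X ^ 2) ^ v * ∑ n ∈ Finset.range (m₂ + 1),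
      C (c n) * (16 * X * (1 - X) ^ 2) ^ n * ((1 + X) ^ 4) ^ (m₂ - n) =
      hasseForm m 1 (X : K[X]) := by
  have h2m : 2 * (4 * (m₂ : K[X]) + e + 2 * v) = -1 := by
    have := congrArg (C : K → K[X]) (two_mul_cast_half (K := K) hm)
    rw [hm₂] at this
    push_cast at this
    simp only [map_mul, map_neg, map_one, map_ofNat, map_natCast, map_add] at this
    exact this
  set Q : K[X] := (1 - 6 * X + X ^ 2) ^ v with hQ
  set w : K[X] := (1 + X) * (1 - X) * Q with hw
  set T : ℕ → K[X] := fun n ↦ (1 + X) ^ (e + 4 * (m₂ - n)) * Q * (X ^ n * (1 - X) ^ (2 * n)) with hT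
  set a : ℕ → K[X] := fun n ↦ C (c n * 16 ^ n) with ha
  set V : ℕ → K[X] := fun n ↦ 2 * w * (n : K[X]) +
    (-1 - 4 * (v : K[X]) - 8 * (n : K[X])) * X * (1 - X) * Q
    - 4 * (n : K[X]) * X * (1 + X) * Q + 2 * ((v : K[X]) * (2 * X ^ 2 - 6 * X)) * (1 - X ^ 2) with hV
  have hf : (1 + X) ^ e * Q * ∑ n ∈ Finset.range (m₂ + 1),
      C (c n) * (16 * X * (1 - X) ^ 2) ^ n * ((1 + X) ^ 4) ^ (m₂ - n) =
      ∑ n ∈ Finset.range (m₂ + 1), a n * T n := by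
    rw [Finset.mul_sum]
    refine Finset.sum_congr rfl fun n _ ↦ ?_
    simp only [hT, ha, map_mul, map_pow, map_ofNat, pow_add, pow_mul, mul_pow]
    ring
  have hda : ∀ (i : ℕ) (f : K[X]), derivative (a i * f) = a i * derivative f := fun i f ↦ derivative_C_mul _ _
  have hQd : X * derivative Q = (v : K[X]) * (2 * X ^ 2 - 6 * X) := by
    rw [hQ]
    rcases Nat.le_one_iff_eq_zero_or_eq_one.1 hv with rfl | rfl
    · simp
    · simp; ring
  have hT1 : ∀ n ≤ m₂, 2 * w * X * (derivative (T n) : K[X]) = V n * T n := by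
    intro n hn
    have e1 := mul_derivative_pow (X : K[X]) n
    have e2 := mul_derivative_pow (1 + X : K[X]) (e + 4 * (m₂ - n))
    have e3 := mul_derivative_pow (1 - X : K[X]) (2 * n)
    rw [Nat.cast_add, Nat.cast_mul, Nat.cast_sub hn] at e2
    rw [Nat.cast_mul] at e3
    simp only [derivative_add, derivative_sub, derivative_one, derivative_X, zero_add,
      Nat.cast_ofNat] at e1 e2 e3
    simp only [hT, hV, hw, derivative_mul]
    linear_combination 2 * Q * (1 + X) * (1 - X) * (1 + X) ^ (e + 4 * (m₂ - n)) * Q *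
        (1 - X) ^ (2 * n) * e1 + 2 * Q * (1 - X) * X * Q * (X ^ n * (1 - X) ^ (2 * n)) * e2
      + 2 * Q * (1 + X) * X * Q * X ^ n * (1 + X) ^ (e + 4 * (m₂ - n)) * e3
      + 2 * (1 + X) * (1 - X) * Q * (1 + X) ^ (e + 4 * (m₂ - n)) * (X ^ n * (1 - X) ^ (2 * n)) * hQd
      + Q * (1 - X) * X * Q * (1 + X) ^ (e + 4 * (m₂ - n)) * (X ^ n * (1 - X) ^ (2 * n)) * h2m
  have hT2 : ∀ n ≤ m₂, (4 * w ^ 2 * X) * (4 * (1 - X) * X * derivative (derivative (T n : K[X]))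
      + 4 * (1 - 2 * X) * derivative (T n : K[X]) - T n) =
      (4 * (1 - X) * Q ^ 2) * ((4 * (n : K[X]) ^ 2 * (1 + X) ^ 4 -
        (8 * (n : K[X]) + 1 + 4 * (v : K[X])) *
        (8 * (n : K[X]) + 3 + 4 * (v : K[X])) * (X * (1 - X) ^ 2)) * T n) :=
    fun n hn ↦ fricke_ode_of_log_derivative hv n (T n) (hT1 n hn)
  have hX0 : ∀ f : K[X], f.eval 0 ≠ 0 → f ≠ 0 := fun f hf h ↦ hf (by rw [h, eval_zero])
  have h20 : (2 : K) ≠ 0 := by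
    exact_mod_cast natCast_ne_zero_of_pos_of_lt (K := K) (p := p) (by norm_num : 0 < 2) h2p
  have hne : (4 * w ^ 2 * X : K[X]) ≠ 0 := by
    refine mul_ne_zero (hX0 _ ?_) X_ne_zero
    have : (4 : K) = 2 * 2 := by norm_num
    simp [hw, hQ, this, h20]
  have hsum := sum_range_hypergeometric_telescope m₂ a (fun i ↦ 4 * (i : K[X]) ^ 2)
    (fun n ↦ (8 * (n : K[X]) + 1 + 4 * (v : K[X])) * (8 * (n : K[X]) + 3 + 4 * (v : K[X]))) T ((1 + X) ^ 4)
    (X * (1 - X) ^ 2) (by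
      intro n hn
      simp only [hT]
      have : e + 4 * (m₂ - n) = e + 4 * (m₂ - (n + 1)) + 4 := by omega
      rw [this]; ring) (by
      intro n hn
      have := congrArg (C : K → K[X]) (hc n hn)
      simp only [map_mul, map_pow, map_add, map_one, map_ofNat, map_natCast] at this
      simp only [ha, map_mul, map_pow, map_ofNat]; push_cast
      linear_combination 16 ^ n * this) (by simp) (by
      have := congrArg (C : K → K[X]) hend
      simpa only [map_mul, map_add, map_one, map_ofNat, map_natCast, map_zero] using this)
  have hdeg : ∀ n ≤ m₂, (a n * T n).natDegree ≤ m := by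
    intro n hn
    have h1 : (1 + X : K[X]).natDegree ≤ 1 := by compute_degree
    have h2 : (1 - X : K[X]).natDegree ≤ 1 := by compute_degree
    have h3 : Q.natDegree ≤ v * 2 := by
      refine natDegree_pow_le_of_le v ?_
      compute_degree
    have h4 := natDegree_pow_le_of_le (e + 4 * (m₂ - n)) h1
    have h5 := natDegree_pow_le_of_le (2 * n) h2
    have h6 : (X ^ n * (1 - X : K[X]) ^ (2 * n)).natDegree ≤ n + (2 * n) * 1 :=
      natDegree_mul_le_of_le (natDegree_X_pow_le n) h5
    have h7 := natDegree_mul_le_of_le (natDegree_mul_le_of_le h4 h3) h6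
    refine (natDegree_C_mul_le _ _).trans (h7.trans ?_)
    omega
  rw [hf]
  refine eq_of_hypergeometric_ode (p := p) h2p ?_ ?_ ?_ ?_ (hasseForm_one_X_ode hm)
  · refine (natDegree_sum_le_of_forall_le _ _ (n := m) fun n hn ↦
      hdeg n (by simp at hn; omega)).trans_lt (by omega)
  · exact (natDegree_hasseForm_le (d := 1) m (by simp) natDegree_X_le).trans_lt (by omega)
  · rw [hasseForm_coeff_zero_eq (by simp) (by simp), coeff_zero_eq_eval_zero, eval_finsetSum,
      Finset.sum_range_succ']
    simp [ha, hT, hQ, c0]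
  · apply mul_left_cancel₀ hne
    rw [mul_zero]
    simp only [derivative_sum, hda]
    calc _ = ∑ n ∈ Finset.range (m₂ + 1), a n * ((4 * w ^ 2 * X) *
          (4 * (1 - X) * X * derivative (derivative (T n : K[X]))
            + 4 * (1 - 2 * X) * derivative (T n : K[X]) - T n)) := by
          simp only [Finset.mul_sum, ← Finset.sum_add_distrib, ← Finset.sum_sub_distrib]
          exact Finset.sum_congr rfl fun i _ ↦ by ring
      _ = (4 * (1 - X) * Q ^ 2) * ∑ n ∈ Finset.range (m₂ + 1), a n *
          (4 * (n : K[X]) ^ 2 * (1 + X) ^ 4 - (8 * (n : K[X]) + 1 + 4 * (v : K[X])) *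
            (8 * (n : K[X]) + 3 + 4 * (v : K[X])) * (X * (1 - X) ^ 2)) * T n := by
          rw [Finset.mul_sum]
          refine Finset.sum_congr rfl fun i hi ↦ ?_
          rw [hT2 i (by simp at hi; omega)]; ring
      _ = 0 := by rw [hsum, mul_zero]

end

/-- The integral power series which converge absolutely on the open unit disc. -/
def convergentSeries : Subring (PowerSeries ℤ) where
  carrier := {f | ∀ z : ℂ, ‖z‖ < 1 → Summable fun n ↦ ‖((PowerSeries.coeff n f : ℤ) : ℂ) * z ^ n‖}
  mul_mem' := by
    intro f g hf hg z hz
    have := summable_norm_sum_mul_antidiagonal_of_summable_norm (hf z hz) (hg z hz)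
    refine this.congr fun n ↦ ?_
    rw [PowerSeries.coeff_mul]
    push_cast
    rw [Finset.sum_mul]
    congr 1
    refine Finset.sum_congr rfl fun kl hkl ↦ ?_
    rw [← Finset.HasAntidiagonal.mem_antidiagonal.1 hkl, pow_add]
    ring
  one_mem' := by
    intro z hz
    refine summable_of_ne_finset_zero (s := {0}) fun n hn ↦ ?_
    simp [PowerSeries.coeff_one, Finset.notMem_singleton.1 hn]
  add_mem' := by
    intro f g hf hg z hz
    refine Summable.of_nonneg_of_le (fun _ ↦ norm_nonneg _) (fun n ↦ ?_) ((hf z hz).add (hg z hz))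
    rw [map_add]
    push_cast
    rw [add_mul]
    exact norm_add_le _ _
  zero_mem' := by
    intro z hz
    simp
  neg_mem' := by
    intro f hf z hz
    simpa using hf z hz

/-- The value of a power series at a point of the unit disc. -/
def seriesEval (z : ℂ) (f : PowerSeries ℤ) : ℂ := ∑' n, ((PowerSeries.coeff n f : ℤ) : ℂ) * z ^ n

/-- Evaluation of convergent series, as a ring homomorphism. -/
def seriesEvalHom (z : ℂ) (hz : ‖z‖ < 1) : convergentSeries →+* ℂ where
  toFun f := seriesEval z f
  map_one' := by
    rw [seriesEval, tsum_eq_single 0]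
    · simp
    · intro n hn; simp [PowerSeries.coeff_one, hn]
  map_mul' f g := by
    rw [seriesEval, seriesEval, seriesEval, tsum_mul_tsum_eq_tsum_sum_antidiagonal_of_summable_norm
      (f.2 z hz) (g.2 z hz)]
    refine tsum_congr fun n ↦ ?_
    rw [Subring.coe_mul, PowerSeries.coeff_mul]
    push_cast
    rw [Finset.sum_mul]
    refine Finset.sum_congr rfl fun kl hkl ↦ ?_
    rw [← Finset.HasAntidiagonal.mem_antidiagonal.1 hkl, pow_add]
    ring
  map_zero' := by simp [seriesEval]
  map_add' f g := by
    rw [seriesEval, seriesEval, seriesEval, ← (f.2 z hz).of_norm.tsum_add (g.2 z hz).of_norm]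
    refine tsum_congr fun n ↦ ?_
    rw [Subring.coe_add, map_add]
    push_cast
    ring

theorem seriesEvalHom_apply {z : ℂ} (hz : ‖z‖ < 1) (f : convergentSeries) :
    seriesEvalHom z hz f = seriesEval z f := rfl

section

variable {z : ℂ} {f g : PowerSeries ℤ}

theorem seriesEval_mul (hz : ‖z‖ < 1) (hf : f ∈ convergentSeries) (hg : g ∈ convergentSeries) :
    seriesEval z (f * g) = seriesEval z f * seriesEval z g :=
  (seriesEvalHom z hz).map_mul (⟨f, hf⟩ : convergentSeries) ⟨g, hg⟩

theorem seriesEval_add (hz : ‖z‖ < 1) (hf : f ∈ convergentSeries) (hg : g ∈ convergentSeries) :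
    seriesEval z (f + g) = seriesEval z f + seriesEval z g :=
  (seriesEvalHom z hz).map_add (⟨f, hf⟩ : convergentSeries) ⟨g, hg⟩

theorem seriesEval_sub (hz : ‖z‖ < 1) (hf : f ∈ convergentSeries) (hg : g ∈ convergentSeries) :
    seriesEval z (f - g) = seriesEval z f - seriesEval z g :=
  (seriesEvalHom z hz).map_sub (⟨f, hf⟩ : convergentSeries) ⟨g, hg⟩

theorem seriesEval_pow (hz : ‖z‖ < 1) (hf : f ∈ convergentSeries) (n : ℕ) :
    seriesEval z (f ^ n) = seriesEval z f ^ n :=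
  (seriesEvalHom z hz).map_pow (⟨f, hf⟩ : convergentSeries) n

theorem seriesEval_intCast (n : ℤ) : seriesEval z (n : PowerSeries ℤ) = n := by
  rw [seriesEval, tsum_eq_single 0]
  · simp
  · intro k hk
    have : (n : PowerSeries ℤ) = PowerSeries.C n := by simp
    rw [this, PowerSeries.coeff_C, if_neg hk]; simp

theorem seriesEval_X : seriesEval z PowerSeries.X = z := by
  rw [seriesEval, tsum_eq_single 1]
  · simp
  · intro n hn; simp [PowerSeries.coeff_X, hn]

theorem X_mem_convergentSeries : PowerSeries.X ∈ convergentSeries := by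
  intro z hz
  refine summable_of_ne_finset_zero (s := {1}) fun n hn ↦ ?_
  simp [PowerSeries.coeff_X, Finset.notMem_singleton.1 hn]

theorem expand_mem_convergentSeries {k : ℕ} (hk : k ≠ 0) (hf : f ∈ convergentSeries) :
    PowerSeries.expand k hk f ∈ convergentSeries := by
  intro z hz
  have hinj : Function.Injective fun n : ℕ ↦ k * n := mul_right_injective₀ hk
  rw [← hinj.summable_iff]
  · have := hf (z ^ k) (by rw [norm_pow]; exact pow_lt_one₀ (norm_nonneg _) hz hk)
    refine this.congr fun n ↦ ?_
    simp [pow_mul]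
  · intro n hn
    rw [PowerSeries.coeff_expand_of_not_dvd]
    · simp
    · rintro ⟨m, rfl⟩
      exact hn ⟨m, rfl⟩

theorem seriesEval_expand {k : ℕ} (hk : k ≠ 0) :
    seriesEval z (PowerSeries.expand k hk f) = seriesEval (z ^ k) f := by
  have hinj : Function.Injective fun n : ℕ ↦ k * n := mul_right_injective₀ hk
  rw [seriesEval, seriesEval, ← hinj.tsum_eq]
  · refine tsum_congr fun n ↦ ?_
    simp [pow_mul]
  · intro n hn
    by_contra h
    refine hn ?_
    dsimp only
    rw [PowerSeries.coeff_expand_of_not_dvd]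
    · simp
    · rintro ⟨m, rfl⟩
      exact h ⟨m, rfl⟩

theorem differentiableOn_seriesEval (hf : f ∈ convergentSeries) :
    DifferentiableOn ℂ (fun z ↦ seriesEval z f) (Metric.ball 0 1) := by
  intro w hw
  have hw' : ‖w‖ < 1 := by simpa using hw
  obtain ⟨r, hr1, hr2⟩ := exists_between hw'
  have hr0 : 0 ≤ r := (norm_nonneg _).trans hr1.le
  have := Complex.differentiableOn_tsum_of_summable_norm (U := Metric.ball 0 r)
    (F := fun n z ↦ ((PowerSeries.coeff n f : ℤ) : ℂ) * z ^ n)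
    (u := fun n ↦ ‖((PowerSeries.coeff n f : ℤ) : ℂ) * (r : ℂ) ^ n‖)
    (hf r (by simpa [abs_of_nonneg hr0] using hr2))
    (fun n ↦ by fun_prop) Metric.isOpen_ball (fun n z hz ↦ by
      have : ‖z‖ ≤ r := by simpa using (Metric.mem_ball.1 hz).le
      rw [norm_mul, norm_mul, norm_pow, norm_pow, Complex.norm_real, Real.norm_of_nonneg hr0]
      gcongr)
  exact (this.differentiableAt (Metric.isOpen_ball.mem_nhds (by simpa using hr1))).differentiableWithinAt

theorem seriesEval_zero_left : seriesEval 0 f = (PowerSeries.constantCoeff f : ℤ) := by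
  rw [seriesEval, tsum_eq_single 0]
  · simp
  · intro n hn; simp [hn]

theorem tendsto_seriesEval_zero (hf : f ∈ convergentSeries) :
    Filter.Tendsto (fun z ↦ seriesEval z f) (nhds 0) (nhds ((PowerSeries.constantCoeff f : ℤ) : ℂ)) := by
  rw [← seriesEval_zero_left]
  exact ((differentiableOn_seriesEval hf).differentiableAt
    (Metric.isOpen_ball.mem_nhds (by simp))).continuousAt

theorem mem_convergentSeries_of_X_pow_mul {k : ℕ} (h : PowerSeries.X ^ k * f ∈ convergentSeries) :
    f ∈ convergentSeries := by
  intro z hz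
  rcases eq_or_ne z 0 with rfl | hz0
  · refine summable_of_ne_finset_zero (s := {0}) fun n hn ↦ ?_
    simp [Finset.notMem_singleton.1 hn]
  have h1 := (summable_nat_add_iff k).2 (h z hz)
  have h2 := h1.mul_left (‖z ^ k‖⁻¹)
  refine h2.congr fun n ↦ ?_
  have : ‖z‖ ≠ 0 := by simpa using hz0
  rw [PowerSeries.coeff_X_pow_mul, pow_add, norm_mul, norm_mul, norm_mul, norm_pow, norm_pow]
  field_simp

/-- A convergent series which vanishes near the origin is zero. -/
theorem eq_zero_of_seriesEval_eq_zero (hf : f ∈ convergentSeries)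
    (h : ∀ z : ℂ, z ≠ 0 → ‖z‖ < 1 → seriesEval z f = 0) : f = 0 := by
  by_contra h0
  obtain ⟨g, hg⟩ := PowerSeries.X_pow_order_dvd (φ := f)
  set k := f.order.toNat
  have hgc : g ∈ convergentSeries := mem_convergentSeries_of_X_pow_mul (k := k) (hg ▸ hf)
  have hg0 : PowerSeries.constantCoeff g ≠ 0 := by
    have := PowerSeries.coeff_order (φ := f) h0
    rw [hg] at this
    have h2 := PowerSeries.coeff_X_pow_mul g k 0
    rw [zero_add, PowerSeries.coeff_zero_eq_constantCoeff_apply] at h2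
    rw [← h2]
    rwa [← hg] at this ⊢
  have hz : ∀ᶠ z in nhdsWithin (0 : ℂ) {0}ᶜ, seriesEval z g = 0 := by
    have hb : Metric.ball (0 : ℂ) 1 ∈ nhds (0 : ℂ) := Metric.isOpen_ball.mem_nhds (by simp)
    filter_upwards [self_mem_nhdsWithin, mem_nhdsWithin_of_mem_nhds hb] with z hz hz1
    have hz1 : ‖z‖ < 1 := by simpa using hz1
    have hz0 : z ≠ 0 := hz
    have := h z hz0 hz1
    rw [hg, seriesEval_mul hz1 (pow_mem X_mem_convergentSeries k) hgc,
      seriesEval_pow hz1 X_mem_convergentSeries, seriesEval_X] at this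
    exact (mul_eq_zero.1 this).resolve_left (pow_ne_zero _ hz0)
  have h1 : Filter.Tendsto (fun z ↦ seriesEval z g) (nhdsWithin (0 : ℂ) {0}ᶜ)
      (nhds ((PowerSeries.constantCoeff g : ℤ) : ℂ)) :=
    (tendsto_seriesEval_zero hgc).mono_left nhdsWithin_le_nhds
  have h2 := tendsto_nhds_unique (h1.congr' hz) tendsto_const_nhds
  exact hg0 (by exact_mod_cast h2)

end

/-- The series formed by the coefficients with index congruent to `i` modulo `p`. -/
def seriesSection {R : Type*} [CommRing R] (p i : ℕ) (f : PowerSeries R) : PowerSeries R :=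
  PowerSeries.mk fun n ↦ PowerSeries.coeff (p * n + i) f

theorem sum_X_pow_mul_expand_seriesSection {R : Type*} [CommRing R] {p : ℕ} (hp : p ≠ 0)
    (f : PowerSeries R) :
    ∑ i ∈ Finset.range p, PowerSeries.X ^ i * PowerSeries.expand p hp (seriesSection p i f) = f := by
  ext n
  have hpos := Nat.pos_of_ne_zero hp
  rw [map_sum, Finset.sum_eq_single (n % p)]
  · rw [PowerSeries.coeff_X_pow_mul', if_pos (Nat.mod_le n p)]
    have : n - n % p = p * (n / p) := by have := Nat.mod_add_div n p; omega
    rw [this, PowerSeries.coeff_expand_mul, seriesSection, PowerSeries.coeff_mk, Nat.div_add_mod]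
  · intro i hi hne
    rw [PowerSeries.coeff_X_pow_mul']
    split_ifs with hin
    · refine PowerSeries.coeff_expand_of_not_dvd _ _ _ fun ⟨k, hk⟩ ↦ hne ?_
      have : n = i + p * k := by omega
      rw [this, Nat.add_mul_mod_self_left, Nat.mod_eq_of_lt (Finset.mem_range.1 hi)]
    · rfl
  · intro h
    exact absurd (Finset.mem_range.2 (Nat.mod_lt n hpos)) h

theorem seriesSection_mem_convergentSeries {p i : ℕ} (hp : p ≠ 0) {f : PowerSeries ℤ}
    (hf : f ∈ convergentSeries) : seriesSection p i f ∈ convergentSeries := by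
  intro z hz
  rcases eq_or_ne z 0 with rfl | hz0
  · refine summable_of_ne_finset_zero (s := {0}) fun n hn ↦ ?_
    simp [Finset.notMem_singleton.1 hn]
  obtain ⟨w, rfl⟩ := IsAlgClosed.exists_pow_nat_eq z (Nat.pos_of_ne_zero hp)
  have hw0 : ‖w‖ ≠ 0 := by
    rintro h; rw [norm_eq_zero] at h; exact hz0 (by rw [h, zero_pow hp])
  have hw : ‖w‖ < 1 := by
    by_contra! h
    rw [norm_pow] at hz
    exact absurd (one_le_pow₀ h) hz.not_ge
  have hinj : Function.Injective fun n : ℕ ↦ p * n + i := fun a b h ↦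
    mul_right_injective₀ hp (Nat.add_right_cancel h)
  have h2 := ((hf w hw).comp_injective hinj).mul_left (‖w‖ ^ i)⁻¹
  refine h2.congr fun n ↦ ?_
  simp only [seriesSection, PowerSeries.coeff_mk, Function.comp_apply, norm_mul, norm_pow, pow_add,
    pow_mul]
  field_simp

theorem map_seriesSection {R S : Type*} [CommRing R] [CommRing S] (φ : R →+* S) (p i : ℕ)
    (f : PowerSeries R) :
    PowerSeries.map φ (seriesSection p i f) = seriesSection p i (PowerSeries.map φ f) := by
  ext n
  simp [seriesSection]

theorem powerSeries_zmod_pow_eq_expand {p : ℕ} [hp : Fact p.Prime] (f : PowerSeries (ZMod p)) :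
    f ^ p = PowerSeries.expand p hp.out.ne_zero f := by
  have := MvPowerSeries.map_frobenius_expand (R := ZMod p) p hp.out.ne_zero (f := f)
  rw [← this]
  have h : frobenius (ZMod p) p = RingHom.id _ := by ext x; simp
  rw [h]
  ext n
  rfl

theorem powerSeries_expand_injective {R : Type*} [CommRing R] {p : ℕ} (hp : p ≠ 0) :
    Function.Injective (PowerSeries.expand (R := R) p hp) := fun f g h ↦ by
  ext n
  rw [← PowerSeries.coeff_expand_mul p hp, h, PowerSeries.coeff_expand_mul]

/-- The dissection of a series as a polynomial in the variable. -/
def dissectionPoly {R : Type*} [CommRing R] (p : ℕ) (c : ℕ → R) : R[X] :=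
  ∑ i ∈ Finset.range p, C (c i) * X ^ i

theorem natDegree_dissectionPoly_le {R : Type*} [CommRing R] (p : ℕ) (c : ℕ → R) :
    (dissectionPoly p c).natDegree ≤ p - 1 :=
  natDegree_sum_le_of_forall_le _ _ fun i hi ↦
    (natDegree_C_mul_X_pow_le _ _).trans (by have := Finset.mem_range.1 hi; omega)

theorem map_dissectionPoly {R S : Type*} [CommRing R] [CommRing S] (φ : R →+* S) (p : ℕ)
    (c : ℕ → R) : (dissectionPoly p c).map φ = dissectionPoly p fun i ↦ φ (c i) := by
  simp [dissectionPoly, Polynomial.map_sum]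

theorem eval_dissectionPoly {R : Type*} [CommRing R] (p : ℕ) (c : ℕ → R) (x : R) :
    (dissectionPoly p c).eval x = ∑ i ∈ Finset.range p, c i * x ^ i := by
  simp [dissectionPoly, eval_finsetSum]

theorem norm_root_of_unity_mul {p : ℕ} {ζ : ℂ} (hζ : IsPrimitiveRoot ζ p) (hp : p ≠ 0) (b : ℕ)
    (z : ℂ) : ‖ζ ^ b * z‖ = ‖z‖ := by
  rw [norm_mul, norm_pow, hζ.norm'_eq_one hp, one_pow, one_mul]

/-- The norm of a convergent series from `ℤ⟦x⟧` to `ℤ⟦x ^ p⟧`: it converges and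
is congruent to the series itself modulo `p`. -/
theorem exists_series_norm {p : ℕ} [hp : Fact p.Prime] {ζ : ℂ}
    (hζ : IsPrimitiveRoot ζ p) {β : PowerSeries ℤ} (hβ : β ∈ convergentSeries) :
    ∃ N ∈ convergentSeries, (∀ z : ℂ, ‖z‖ < 1 →
      ∏ b ∈ Finset.range p, seriesEval (ζ ^ b * z) β = seriesEval (z ^ p) N) ∧
      PowerSeries.map (Int.castRingHom (ZMod p)) N = PowerSeries.map (Int.castRingHom (ZMod p)) β := by
  have hp0 := hp.out.ne_zero
  let c : ℕ → convergentSeries := fun i ↦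
    ⟨seriesSection p i β, seriesSection_mem_convergentSeries hp0 hβ⟩
  let x : convergentSeries := ⟨PowerSeries.X, X_mem_convergentSeries⟩
  let N : convergentSeries := resultant (X ^ p - C x) (dissectionPoly p c) p (p - 1)
  refine ⟨N, N.2, fun z hz ↦ ?_, ?_⟩
  · have hzp : ‖z ^ p‖ < 1 := by rw [norm_pow]; exact pow_lt_one₀ (norm_nonneg _) hz hp0
    have key : seriesEvalHom (z ^ p) hzp N = resultant (X ^ p - C (z ^ p))
        (dissectionPoly p fun i ↦ seriesEval (z ^ p) (seriesSection p i β)) p (p - 1) := by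
      rw [← resultant_map_map, Polynomial.map_sub, Polynomial.map_pow, map_X, map_C,
        map_dissectionPoly]
      congr 3
      rw [seriesEvalHom_apply]
      exact seriesEval_X
    have hev : ∀ b : ℕ, seriesEval (ζ ^ b * z) β =
        (dissectionPoly p fun i ↦ seriesEval (z ^ p) (seriesSection p i β)).eval (ζ ^ b * z) := by
      intro b
      have hz' : ‖ζ ^ b * z‖ < 1 := by rwa [norm_root_of_unity_mul hζ hp0]
      have hpow : (ζ ^ b * z) ^ p = z ^ p := by
        rw [mul_pow, ← pow_mul, mul_comm b, pow_mul, hζ.pow_eq_one, one_pow, one_mul]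
      rw [eval_dissectionPoly]
      have h1 : (⟨β, hβ⟩ : convergentSeries) = ∑ i ∈ Finset.range p, x ^ i *
          ⟨PowerSeries.expand p hp0 (seriesSection p i β), expand_mem_convergentSeries hp0
            (seriesSection_mem_convergentSeries hp0 hβ)⟩ := by
        apply Subtype.ext
        rw [AddSubmonoidClass.coe_finsetSum]
        exact (sum_X_pow_mul_expand_seriesSection hp0 β).symm
      have h2 := congrArg (seriesEvalHom _ hz') h1
      rw [map_sum, seriesEvalHom_apply] at h2
      refine h2.trans (Finset.sum_congr rfl fun i _ ↦ ?_)
      rw [map_mul, map_pow, seriesEvalHom_apply, seriesEvalHom_apply, seriesEval_X,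
        seriesEval_expand, hpow, mul_comm]
    rw [seriesEvalHom_apply] at key
    rw [key, Finset.prod_congr rfl fun b _ ↦ hev b]
    have hdeg : (X ^ p - C (z ^ p) : ℂ[X]).natDegree = p := natDegree_X_pow_sub_C
    have hroots : (X ^ p - C (z ^ p) : ℂ[X]).roots =
        (Multiset.range p).map fun b ↦ ζ ^ b * z := hζ.nthRoots_eq rfl
    have := resultant_eq_prod_eval (X ^ p - C (z ^ p) : ℂ[X])
        (dissectionPoly p fun i ↦ seriesEval (z ^ p) (seriesSection p i β)) (p - 1)
        (natDegree_dissectionPoly_le _ _) (IsAlgClosed.splits _)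
    rw [hdeg, hroots, (monic_X_pow_sub_C _ hp0).leadingCoeff, one_pow, one_mul, Multiset.map_map] at this
    rw [this]
    rfl
  · apply powerSeries_expand_injective hp0
    let φ : convergentSeries →+* PowerSeries (ZMod p) :=
      ((PowerSeries.expand p hp0 : _ →ₐ[ZMod p] _) : PowerSeries (ZMod p) →+* _).comp
        ((PowerSeries.map (Int.castRingHom (ZMod p))).comp convergentSeries.subtype)
    have key : φ N = resultant (X ^ p - C (φ x)) (dissectionPoly p fun i ↦ φ (c i)) p (p - 1) := by
      rw [← map_dissectionPoly, ← map_X φ, ← map_C φ, ← Polynomial.map_pow, ← Polynomial.map_sub,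
        resultant_map_map]
    have hx : φ x = PowerSeries.X ^ p := by
      simp [φ, x]
    have : CharP (PowerSeries (ZMod p)) p :=
      charP_of_injective_ringHom (f := PowerSeries.C) PowerSeries.C_injective p
    change φ N = _
    rw [key, hx, map_pow, ← sub_pow_char, resultant_X_sub_C_pow_left _ _ _ _
      (natDegree_dissectionPoly_le _ _), eval_dissectionPoly, ← powerSeries_zmod_pow_eq_expand]
    congr 1
    rw [← sum_X_pow_mul_expand_seriesSection hp0 (PowerSeries.map (Int.castRingHom (ZMod p)) β)]
    refine Finset.sum_congr rfl fun i _ ↦ ?_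
    rw [mul_comm, ← map_seriesSection]
    rfl

theorem mem_convergentSeries_of_bounded {f : PowerSeries ℤ} {c : ℝ}
    (h : ∀ n, |((PowerSeries.coeff n f : ℤ) : ℝ)| ≤ c) : f ∈ convergentSeries := by
  intro z hz
  refine Summable.of_nonneg_of_le (fun _ ↦ norm_nonneg _) (fun n ↦ ?_)
    ((summable_geometric_of_lt_one (norm_nonneg z) hz).mul_left c)
  rw [norm_mul, norm_pow, Complex.norm_intCast]
  exact mul_le_mul_of_nonneg_right (h n) (by positivity)

open scoped Classical in
/-- The series `∑ q ^ (n ^ 2)` over all integers `n`. -/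
def thetaSeries : PowerSeries ℤ :=
  PowerSeries.mk fun n ↦ if n = 0 then 1 else if IsSquare n then 2 else 0

open scoped Classical in
/-- The series `∑ q ^ (2 * k * (k + 1))` over all natural numbers `k`. -/
def psiSeries : PowerSeries ℤ :=
  PowerSeries.mk fun n ↦ if ∃ k, n = 2 * (k * (k + 1)) then 1 else 0

theorem thetaSeries_mem : thetaSeries ∈ convergentSeries := by
  refine mem_convergentSeries_of_bounded (c := 2) fun n ↦ ?_
  rw [thetaSeries, PowerSeries.coeff_mk]
  split_ifs <;> norm_num

theorem psiSeries_mem : psiSeries ∈ convergentSeries := by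
  refine mem_convergentSeries_of_bounded (c := 2) fun n ↦ ?_
  rw [psiSeries, PowerSeries.coeff_mk]
  split_ifs <;> norm_num

/-- Separation of the even and the odd part of the theta series. -/
theorem thetaSeries_eq_even_add_odd : thetaSeries =
    PowerSeries.expand 4 (by norm_num) thetaSeries +
      2 * PowerSeries.X * PowerSeries.expand 2 two_ne_zero psiSeries := by
  ext n
  have hn := Nat.div_add_mod n 4
  have h4 : n % 4 < 4 := Nat.mod_lt _ (by norm_num)
  have hC : (2 : PowerSeries ℤ) = PowerSeries.C 2 := by simp
  rw [map_add, hC, mul_assoc, PowerSeries.coeff_C_mul]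
  rcases n with - | n
  · simp [thetaSeries]
  rw [PowerSeries.coeff_succ_X_mul, PowerSeries.coeff_expand, PowerSeries.coeff_expand]
  simp only [thetaSeries, psiSeries, PowerSeries.coeff_mk]
  by_cases hs : IsSquare (n + 1)
  · obtain ⟨r, hr⟩ := hs
    rw [if_neg (by omega), if_pos ⟨r, hr⟩]
    rcases Nat.even_or_odd' r with ⟨k, rfl | rfl⟩
    · have h1 : n + 1 = 4 * (k * k) := by rw [hr]; ring
      have h2 : (n + 1) / 4 = k * k := by omega
      have h3 : ¬ 2 ∣ n := by omega
      rw [if_pos ⟨_, h1⟩, h2, if_neg (by omega), if_pos ⟨k, rfl⟩, if_neg h3]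
      norm_num
    · have h1 : n = 2 * (2 * (k * (k + 1))) := by
        have : n + 1 = 2 * (2 * (k * (k + 1))) + 1 := by rw [hr]; ring
        omega
      rw [if_neg (by omega), if_pos ⟨_, h1⟩, h1, Nat.mul_div_cancel_left _ (by norm_num),
        if_pos ⟨k, rfl⟩]
      norm_num
  · rw [if_neg (by omega), if_neg hs]
    have h1 : (if 4 ∣ n + 1 then (if (n + 1) / 4 = 0 then (1 : ℤ) else
        if IsSquare ((n + 1) / 4) then 2 else 0) else 0) = 0 := by
      split_ifs with h1 h2 h3
      · omega
      · obtain ⟨r, hr⟩ := h3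
        refine absurd ⟨2 * r, ?_⟩ hs
        obtain ⟨k, hk⟩ := h1
        rw [hk, Nat.mul_div_cancel_left _ (by norm_num)] at hr
        rw [hk, hr]; ring
      · rfl
      · rfl
    rw [h1, zero_add]
    split_ifs with h2 h3
    · obtain ⟨k, hk⟩ := h3
      refine absurd ⟨2 * k + 1, ?_⟩ hs
      obtain ⟨l, rfl⟩ := h2
      rw [Nat.mul_div_cancel_left _ (by norm_num)] at hk
      rw [hk]; ring
    · rfl
    · rfl

/-- The local parameter at the cusp. -/
def cuspParam (τ : ℂ) : ℂ := Complex.exp (2 * Real.pi * Complex.I * τ)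

theorem norm_cuspParam (τ : ℂ) : ‖cuspParam τ‖ = Real.exp (-2 * Real.pi * τ.im) := by
  rw [cuspParam, Complex.norm_exp]
  congr 1
  simp

theorem norm_cuspParam_lt_one {τ : ℂ} (hτ : 0 < τ.im) : ‖cuspParam τ‖ < 1 := by
  rw [norm_cuspParam, Real.exp_lt_one_iff]
  have := mul_pos Real.pi_pos hτ
  nlinarith

theorem cuspParam_ne_zero (τ : ℂ) : cuspParam τ ≠ 0 := Complex.exp_ne_zero _

theorem cuspParam_natCast_mul (n : ℕ) (τ : ℂ) : cuspParam (n * τ) = cuspParam τ ^ n := by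
  rw [cuspParam, cuspParam, ← Complex.exp_nat_mul]
  ring_nf

theorem cuspParam_add (σ τ : ℂ) : cuspParam (σ + τ) = cuspParam σ * cuspParam τ := by
  rw [cuspParam, cuspParam, cuspParam, ← Complex.exp_add]
  ring_nf

theorem cuspParam_intCast (n : ℤ) : cuspParam n = 1 := by
  rw [cuspParam, Complex.exp_eq_one_iff]
  exact ⟨n, by ring⟩

theorem exists_cuspParam_eq {z : ℂ} (h0 : z ≠ 0) (h1 : ‖z‖ < 1) :
    ∃ τ : ℂ, 0 < τ.im ∧ cuspParam τ = z := by
  have hpi : (2 * Real.pi * Complex.I : ℂ) ≠ 0 := Complex.two_pi_I_ne_zero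
  have h : cuspParam (Complex.log z / (2 * Real.pi * Complex.I)) = z := by
    rw [cuspParam, mul_div_cancel₀ _ hpi, Complex.exp_log h0]
  refine ⟨_, ?_, h⟩
  have h2 := norm_cuspParam (Complex.log z / (2 * Real.pi * Complex.I))
  rw [h] at h2
  rw [h2, Real.exp_lt_one_iff] at h1
  have := Real.pi_pos
  by_contra! h3
  nlinarith

theorem jacobiTheta_eq_seriesEval {τ : ℂ} (hτ : 0 < τ.im) :
    jacobiTheta τ = seriesEval (cuspParam (τ / 2)) thetaSeries := by
  have hτ2 : 0 < (τ / 2).im := by simpa using hτ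
  have h1 := (hasSum_nat_jacobiTheta hτ).mul_left 2
  rw [mul_div_cancel₀ _ two_ne_zero] at h1
  have hinj : Function.Injective fun n : ℕ ↦ (n + 1) ^ 2 := fun a b h ↦ by
    have : a + 1 = b + 1 := Nat.pow_left_injective two_ne_zero h
    omega
  let g : ℕ → ℂ := fun n ↦ if n = 0 then 0 else
    ((PowerSeries.coeff n thetaSeries : ℤ) : ℂ) * cuspParam (τ / 2) ^ n
  have h2 : HasSum g (jacobiTheta τ - 1) := by
    rw [← hinj.hasSum_iff]
    · refine h1.congr_fun fun n ↦ ?_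
      simp only [g, Function.comp_apply, thetaSeries, PowerSeries.coeff_mk]
      rw [if_neg (by positivity), if_neg (by positivity), if_pos ⟨n + 1, by ring⟩, cuspParam,
        ← Complex.exp_nat_mul]
      push_cast
      congr 2
      ring
    · intro n hn
      simp only [g]
      split_ifs with h0
      · rfl
      · rw [thetaSeries, PowerSeries.coeff_mk, if_neg h0, if_neg]
        · simp
        · rintro ⟨r, hr⟩
          refine hn ⟨r - 1, ?_⟩
          have : r ≠ 0 := by rintro rfl; exact h0 hr
          dsimp only
          rw [Nat.sub_add_cancel (Nat.one_le_iff_ne_zero.2 this), hr, sq]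
  have h3 : HasSum (fun n : ℕ ↦ if n = 0 then (1 : ℂ) else 0) 1 := hasSum_ite_eq 0 1
  have h4 := h2.add h3
  rw [sub_add_cancel] at h4
  rw [seriesEval, ← h4.tsum_eq]
  refine tsum_congr fun n ↦ ?_
  simp only [g]
  split_ifs with h
  · subst h; simp [thetaSeries]
  · simp

theorem summable_norm_jacobiTheta {τ : ℂ} (hτ : 0 < τ.im) :
    Summable fun n : ℤ ↦ ‖Complex.exp (Real.pi * Complex.I * (n : ℂ) ^ 2 * τ)‖ := by
  have := (hasSum_jacobiTheta₂_term 0 hτ).summable.norm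
  simpa [jacobiTheta₂_term] using this

theorem hasSum_jacobiTheta_sq {τ : ℂ} (hτ : 0 < τ.im) :
    HasSum (fun n : ℤ × ℤ ↦ Complex.exp (Real.pi * Complex.I * (n.1 : ℂ) ^ 2 * τ) *
      Complex.exp (Real.pi * Complex.I * (n.2 : ℂ) ^ 2 * τ)) (jacobiTheta τ ^ 2) := by
  have h := summable_norm_jacobiTheta hτ
  rw [sq, jacobiTheta, tsum_mul_tsum_of_summable_norm h h]
  exact (summable_mul_of_summable_norm h h).hasSum

theorem jacobiTheta_sq_add_sq {τ : ℂ} (hτ : 0 < τ.im) :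
    jacobiTheta τ ^ 2 + jacobiTheta (τ + 1) ^ 2 = 2 * jacobiTheta (2 * τ) ^ 2 := by
  have h1 := (hasSum_jacobiTheta_sq hτ).add
    (hasSum_jacobiTheta_sq (τ := τ + 1) (by simpa using hτ))
  have h2 := (hasSum_jacobiTheta_sq (τ := 2 * τ) (by simpa using hτ)).mul_left 2
  refine h1.unique ?_
  have hinj : Function.Injective fun n : ℤ × ℤ ↦ (n.1 + n.2, n.1 - n.2) := fun a b h ↦ by
    simp only [Prod.mk.injEq] at h
    exact Prod.ext (by omega) (by omega)
  have hsq : ∀ n : ℤ, Complex.exp (Real.pi * Complex.I * (n : ℂ) ^ 2) = (-1) ^ n := by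
    intro n
    rw [← Complex.exp_pi_mul_I, ← Complex.exp_int_mul, Complex.exp_eq_exp_iff_exists_int]
    obtain ⟨k, hk⟩ := (Int.even_mul_pred_self n).two_dvd
    refine ⟨k, ?_⟩
    have : (n : ℂ) * (n - 1) = 2 * k := by exact_mod_cast hk
    linear_combination Real.pi * Complex.I * this
  have hexp : ∀ n : ℤ, Complex.exp (Real.pi * Complex.I * (n : ℂ) ^ 2 * (τ + 1)) =
      Complex.exp (Real.pi * Complex.I * (n : ℂ) ^ 2 * τ) * (-1) ^ n := by
    intro n
    rw [mul_add, mul_one, Complex.exp_add, hsq]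
  rw [← hinj.hasSum_iff]
  · refine h2.congr_fun fun n ↦ ?_
    simp only [Function.comp_apply, hexp]
    have h3 : ((-1 : ℂ) ^ (n.1 + n.2)) * (-1) ^ (n.1 - n.2) = 1 := by
      rw [← zpow_add₀ (by norm_num), show n.1 + n.2 + (n.1 - n.2) = 2 * n.1 by ring, zpow_mul]
      norm_num
    have h4 : Complex.exp (Real.pi * Complex.I * ((n.1 + n.2 : ℤ) : ℂ) ^ 2 * τ) *
        Complex.exp (Real.pi * Complex.I * ((n.1 - n.2 : ℤ) : ℂ) ^ 2 * τ) =
        Complex.exp (Real.pi * Complex.I * (n.1 : ℂ) ^ 2 * (2 * τ)) *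
        Complex.exp (Real.pi * Complex.I * (n.2 : ℂ) ^ 2 * (2 * τ)) := by
      rw [← Complex.exp_add, ← Complex.exp_add]
      push_cast
      congr 1
      ring
    linear_combination 2 * h4 + (Complex.exp (Real.pi * Complex.I * ((n.1 + n.2 : ℤ) : ℂ) ^ 2 * τ) *
        Complex.exp (Real.pi * Complex.I * ((n.1 - n.2 : ℤ) : ℂ) ^ 2 * τ)) * h3
  · intro n hn
    have hodd : Odd (n.1 + n.2) := by
      rw [← Int.not_even_iff_odd]
      rintro ⟨k, hk⟩
      exact hn ⟨(k, n.1 - k), Prod.ext (by dsimp only; omega) (by dsimp only; omega)⟩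
    have h3 : ((-1 : ℂ) ^ n.1) * (-1) ^ n.2 = -1 := by
      rw [← zpow_add₀ (by norm_num), hodd.neg_one_zpow]
    simp only [hexp]
    linear_combination (Complex.exp (Real.pi * Complex.I * (n.1 : ℂ) ^ 2 * τ) *
      Complex.exp (Real.pi * Complex.I * (n.2 : ℂ) ^ 2 * τ)) * h3

theorem expand_thetaSeries_mem {k : ℕ} (hk : k ≠ 0) :
    PowerSeries.expand k hk thetaSeries ∈ convergentSeries :=
  expand_mem_convergentSeries hk thetaSeries_mem

theorem seriesEval_natCast {z : ℂ} (n : ℕ) : seriesEval z (n : PowerSeries ℤ) = n := by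
  simpa using seriesEval_intCast (z := z) n

theorem seriesEval_ofNat {z : ℂ} (n : ℕ) [n.AtLeastTwo] :
    seriesEval z (OfNat.ofNat n : PowerSeries ℤ) = OfNat.ofNat n :=
  seriesEval_natCast n

theorem jacobiTheta_eq_even_add_odd {τ : ℂ} (hτ : 0 < τ.im) : jacobiTheta τ =
    jacobiTheta (4 * τ) + 2 * cuspParam (τ / 2) * seriesEval (cuspParam τ) psiSeries := by
  have hτ2 : 0 < (τ / 2).im := by simpa using hτ
  have hz := norm_cuspParam_lt_one hτ2
  have h4 : cuspParam (τ / 2) ^ 4 = cuspParam (4 * τ / 2) := by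
    rw [← cuspParam_natCast_mul]; congr 1; push_cast; ring
  have h2 : cuspParam (τ / 2) ^ 2 = cuspParam τ := by
    rw [← cuspParam_natCast_mul]; congr 1; push_cast; ring
  rw [jacobiTheta_eq_seriesEval hτ, jacobiTheta_eq_seriesEval (by simpa using hτ)]
  conv_lhs => rw [thetaSeries_eq_even_add_odd]
  have hpsi := expand_mem_convergentSeries two_ne_zero psiSeries_mem
  have h2m : (2 : PowerSeries ℤ) ∈ convergentSeries := ofNat_mem _ 2
  rw [seriesEval_add hz (expand_thetaSeries_mem _)
    (mul_mem (mul_mem h2m X_mem_convergentSeries) hpsi),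
    seriesEval_mul hz (mul_mem h2m X_mem_convergentSeries) hpsi,
    seriesEval_mul hz h2m X_mem_convergentSeries, seriesEval_X, seriesEval_expand,
    seriesEval_expand, h4, h2, seriesEval_ofNat]

theorem jacobiTheta_add_int_mul_two (τ : ℂ) (n : ℕ) : jacobiTheta (τ + 2 * n) = jacobiTheta τ := by
  induction n with
  | zero => simp
  | succ n ih =>
    rw [← ih, ← jacobiTheta_two_add (τ + 2 * n)]
    congr 1; push_cast; ring

theorem cuspParam_add_one (τ : ℂ) : cuspParam (τ + 1) = cuspParam τ := by
  rw [cuspParam_add]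
  have := cuspParam_intCast 1
  rw [Int.cast_one] at this
  rw [this, mul_one]

theorem cuspParam_half : cuspParam (1 / 2) = -1 := by
  rw [cuspParam, ← Complex.exp_pi_mul_I]
  congr 1; ring

theorem jacobiTheta_add_one {τ : ℂ} (hτ : 0 < τ.im) : jacobiTheta (τ + 1) =
    jacobiTheta (4 * τ) - 2 * cuspParam (τ / 2) * seriesEval (cuspParam τ) psiSeries := by
  rw [jacobiTheta_eq_even_add_odd (by simpa using hτ), cuspParam_add_one, add_div, cuspParam_add,
    cuspParam_half, ← jacobiTheta_add_int_mul_two (4 * τ) 2]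
  have : 4 * (τ + 1) = 4 * τ + 2 * (2 : ℕ) := by push_cast; ring
  rw [this]
  ring

theorem cuspParam_half_sq (τ : ℂ) : cuspParam (τ / 2) ^ 2 = cuspParam τ := by
  rw [← cuspParam_natCast_mul]; congr 1; push_cast; ring

theorem jacobiTheta_two_mul_sq {τ : ℂ} (hτ : 0 < τ.im) : jacobiTheta (2 * τ) ^ 2 =
    jacobiTheta (4 * τ) ^ 2 + 4 * cuspParam τ * seriesEval (cuspParam τ) psiSeries ^ 2 := by
  have h := jacobiTheta_sq_add_sq hτ
  rw [jacobiTheta_add_one hτ, jacobiTheta_eq_even_add_odd hτ] at h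
  linear_combination -h / 2 + 4 * seriesEval (cuspParam τ) psiSeries ^ 2 * cuspParam_half_sq τ

theorem jacobiTheta_two_mul {τ : ℂ} (hτ : 0 < τ.im) :
    jacobiTheta (2 * τ) = seriesEval (cuspParam τ) thetaSeries := by
  rw [jacobiTheta_eq_seriesEval (by simpa using hτ), mul_div_cancel_left₀ _ two_ne_zero]

theorem jacobiTheta_four_mul {τ : ℂ} (hτ : 0 < τ.im) :
    jacobiTheta (4 * τ) = seriesEval (cuspParam τ) (PowerSeries.expand 2 two_ne_zero thetaSeries) := by
  rw [seriesEval_expand, ← cuspParam_natCast_mul, ← jacobiTheta_two_mul (by simpa using hτ)]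
  congr 1; push_cast; ring

/-- Two convergent series agree if they take the same values on the upper half plane. -/
theorem eq_of_seriesEval_cuspParam_eq {f g : PowerSeries ℤ} (hf : f ∈ convergentSeries)
    (hg : g ∈ convergentSeries)
    (h : ∀ τ : ℂ, 0 < τ.im → seriesEval (cuspParam τ) f = seriesEval (cuspParam τ) g) : f = g := by
  rw [← sub_eq_zero]
  refine eq_zero_of_seriesEval_eq_zero (sub_mem hf hg) fun z h0 h1 ↦ ?_
  obtain ⟨τ, hτ, rfl⟩ := exists_cuspParam_eq h0 h1
  rw [seriesEval_sub h1 hf hg, h τ hτ, sub_self]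

theorem four_X_psiSq_mem : 4 * PowerSeries.X * psiSeries ^ 2 ∈ convergentSeries :=
  mul_mem (mul_mem (ofNat_mem _ 4) X_mem_convergentSeries) (pow_mem psiSeries_mem 2)

theorem thetaSeries_sq : thetaSeries ^ 2 = PowerSeries.expand 2 two_ne_zero thetaSeries ^ 2 +
    4 * PowerSeries.X * psiSeries ^ 2 := by
  have hE := expand_thetaSeries_mem two_ne_zero
  have h4 : (4 : PowerSeries ℤ) ∈ convergentSeries := ofNat_mem _ 4
  refine eq_of_seriesEval_cuspParam_eq (pow_mem thetaSeries_mem 2)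
    (add_mem (pow_mem hE 2) four_X_psiSq_mem) fun τ hτ ↦ ?_
  have hz := norm_cuspParam_lt_one hτ
  rw [seriesEval_add hz (pow_mem hE 2) four_X_psiSq_mem, seriesEval_pow hz thetaSeries_mem,
    seriesEval_pow hz hE, seriesEval_mul hz (mul_mem h4 X_mem_convergentSeries)
      (pow_mem psiSeries_mem 2), seriesEval_mul hz h4 X_mem_convergentSeries, seriesEval_X,
    seriesEval_pow hz psiSeries_mem, ← jacobiTheta_two_mul hτ, ← jacobiTheta_four_mul hτ,
    seriesEval_ofNat, jacobiTheta_two_mul_sq hτ]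

/-- The weight four series `θ(q) ^ 4`. -/
def thetaFourth : PowerSeries ℤ := thetaSeries ^ 4

/-- The companion `16 q θ(q²)² ψ²` of `θ(q) ^ 4`. -/
def thetaCompanion : PowerSeries ℤ :=
  16 * PowerSeries.X * PowerSeries.expand 2 two_ne_zero thetaSeries ^ 2 * psiSeries ^ 2

/-- The Eisenstein-type series of weight four. -/
def frickeP : PowerSeries ℤ := thetaFourth + thetaCompanion

/-- The cusp form of weight eight. -/
def frickeD : PowerSeries ℤ :=
  PowerSeries.X * (PowerSeries.expand 2 two_ne_zero thetaSeries ^ 2 * psiSeries ^ 2 *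
    thetaSeries ^ 4 * (thetaFourth - thetaCompanion) ^ 2)

theorem thetaFourth_mem : thetaFourth ∈ convergentSeries := pow_mem thetaSeries_mem 4

theorem thetaCompanion_mem : thetaCompanion ∈ convergentSeries :=
  mul_mem (mul_mem (mul_mem (ofNat_mem _ 16) X_mem_convergentSeries)
    (pow_mem (expand_thetaSeries_mem two_ne_zero) 2)) (pow_mem psiSeries_mem 2)

theorem frickeP_mem : frickeP ∈ convergentSeries := add_mem thetaFourth_mem thetaCompanion_mem

theorem frickeD_mem : frickeD ∈ convergentSeries :=
  mul_mem X_mem_convergentSeries (mul_mem (mul_mem (mul_mem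
    (pow_mem (expand_thetaSeries_mem two_ne_zero) 2) (pow_mem psiSeries_mem 2))
    (pow_mem thetaSeries_mem 4)) (pow_mem (sub_mem thetaFourth_mem thetaCompanion_mem) 2))

theorem sixteen_mul_frickeD :
    16 * frickeD = thetaFourth * thetaCompanion * (thetaFourth - thetaCompanion) ^ 2 := by
  rw [frickeD]
  conv_rhs => rw [thetaCompanion]
  conv_lhs => rw [thetaCompanion]
  rw [thetaFourth]
  ring

theorem jacobiTheta_inv_sq {τ : ℂ} (hτ : 0 < τ.im) :
    jacobiTheta (-1 / τ) ^ 2 = -Complex.I * τ * jacobiTheta τ ^ 2 := by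
  have h := jacobiTheta_S_smul ⟨τ, hτ⟩
  rw [UpperHalfPlane.modular_S_smul] at h
  have h1 : (-τ)⁻¹ = -1 / τ := by rw [inv_neg, neg_div, one_div]
  change jacobiTheta ((-τ)⁻¹) = (-Complex.I * τ) ^ (1 / 2 : ℂ) * jacobiTheta τ at h
  rw [← h1, h, mul_pow, ← Complex.cpow_nat_mul]
  norm_num

theorem seriesEval_thetaFourth {τ : ℂ} (hτ : 0 < τ.im) :
    seriesEval (cuspParam τ) thetaFourth = (jacobiTheta (2 * τ) ^ 2) ^ 2 := by
  rw [thetaFourth, seriesEval_pow (norm_cuspParam_lt_one hτ) thetaSeries_mem,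
    ← jacobiTheta_two_mul hτ]
  ring

theorem seriesEval_thetaCompanion {τ : ℂ} (hτ : 0 < τ.im) :
    seriesEval (cuspParam τ) thetaCompanion = (jacobiTheta τ ^ 2 - jacobiTheta (2 * τ) ^ 2) ^ 2 := by
  have hz := norm_cuspParam_lt_one hτ
  have hE := expand_thetaSeries_mem two_ne_zero
  have h16 : (16 : PowerSeries ℤ) ∈ convergentSeries := ofNat_mem _ 16
  have h1 := mul_mem h16 X_mem_convergentSeries
  rw [thetaCompanion, seriesEval_mul hz (mul_mem h1 (pow_mem hE 2)) (pow_mem psiSeries_mem 2),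
    seriesEval_mul hz h1 (pow_mem hE 2), seriesEval_mul hz h16 X_mem_convergentSeries,
    seriesEval_X, seriesEval_ofNat, seriesEval_pow hz hE, seriesEval_pow hz psiSeries_mem,
    ← jacobiTheta_four_mul hτ, jacobiTheta_two_mul_sq hτ, jacobiTheta_eq_even_add_odd hτ]
  have h : (jacobiTheta (4 * τ) + 2 * cuspParam (τ / 2) * seriesEval (cuspParam τ) psiSeries) ^ 2 -
      (jacobiTheta (4 * τ) ^ 2 + 4 * cuspParam τ * seriesEval (cuspParam τ) psiSeries ^ 2) =
      4 * jacobiTheta (4 * τ) * cuspParam (τ / 2) * seriesEval (cuspParam τ) psiSeries := by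
    linear_combination 4 * seriesEval (cuspParam τ) psiSeries ^ 2 * cuspParam_half_sq τ
  rw [h]
  linear_combination (-16) * jacobiTheta (4 * τ) ^ 2 * seriesEval (cuspParam τ) psiSeries ^ 2 *
    cuspParam_half_sq τ

/-- The weight four form attached to `frickeP`. -/
def formP (τ : ℂ) : ℂ := seriesEval (cuspParam τ) frickeP

/-- The weight eight cusp form attached to `frickeD`. -/
def formD (τ : ℂ) : ℂ := seriesEval (cuspParam τ) frickeD

theorem formP_add_one (τ : ℂ) : formP (τ + 1) = formP τ := by
  rw [formP, formP, cuspParam_add_one]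

theorem formD_add_one (τ : ℂ) : formD (τ + 1) = formD τ := by
  rw [formD, formD, cuspParam_add_one]

theorem formP_eq {τ : ℂ} (hτ : 0 < τ.im) : formP τ =
    (jacobiTheta (2 * τ) ^ 2) ^ 2 + (jacobiTheta τ ^ 2 - jacobiTheta (2 * τ) ^ 2) ^ 2 := by
  rw [formP, frickeP, seriesEval_add (norm_cuspParam_lt_one hτ) thetaFourth_mem thetaCompanion_mem,
    seriesEval_thetaFourth hτ, seriesEval_thetaCompanion hτ]

theorem sixteen_mul_formD {τ : ℂ} (hτ : 0 < τ.im) : 16 * formD τ =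
    (jacobiTheta (2 * τ) ^ 2) ^ 2 * (jacobiTheta τ ^ 2 - jacobiTheta (2 * τ) ^ 2) ^ 2 *
      ((jacobiTheta (2 * τ) ^ 2) ^ 2 - (jacobiTheta τ ^ 2 - jacobiTheta (2 * τ) ^ 2) ^ 2) ^ 2 := by
  have hz := norm_cuspParam_lt_one hτ
  have hs := sub_mem thetaFourth_mem thetaCompanion_mem
  have h16 : (16 : PowerSeries ℤ) ∈ convergentSeries := ofNat_mem _ 16
  rw [← seriesEval_thetaFourth hτ, ← seriesEval_thetaCompanion hτ,
    ← seriesEval_sub hz thetaFourth_mem thetaCompanion_mem, ← seriesEval_pow hz hs,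
    ← seriesEval_mul hz thetaFourth_mem thetaCompanion_mem, ← seriesEval_mul hz
    (mul_mem thetaFourth_mem thetaCompanion_mem) (pow_mem hs 2), ← sixteen_mul_frickeD,
    seriesEval_mul hz h16 frickeD_mem, seriesEval_ofNat, formD]

/-- The Fricke involution. -/
def frickeInv (τ : ℂ) : ℂ := -1 / (2 * τ)

theorem ne_zero_of_im_pos {τ : ℂ} (hτ : 0 < τ.im) : τ ≠ 0 := by
  rintro rfl; simp at hτ

theorem frickeInv_im (τ : ℂ) : (frickeInv τ).im = τ.im / (2 * Complex.normSq τ) := by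
  rw [frickeInv, Complex.div_im]
  simp [Complex.normSq_apply]
  rcases eq_or_ne (τ.re * τ.re + τ.im * τ.im) 0 with h | h
  · have : 2 * τ.re * (2 * τ.re) + 2 * τ.im * (2 * τ.im) = 0 := by linear_combination 4 * h
    rw [this, h]; simp
  · have : 2 * τ.re * (2 * τ.re) + 2 * τ.im * (2 * τ.im) ≠ 0 := fun h2 ↦ h (by linarith)
    field_simp

theorem frickeInv_im_pos {τ : ℂ} (hτ : 0 < τ.im) : 0 < (frickeInv τ).im := by
  rw [frickeInv_im]
  have := Complex.normSq_pos.2 (ne_zero_of_im_pos hτ)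
  positivity

theorem jacobiTheta_frickeInv {τ : ℂ} (hτ : 0 < τ.im) :
    jacobiTheta (frickeInv τ) ^ 2 = -Complex.I * (2 * τ) * jacobiTheta (2 * τ) ^ 2 :=
  jacobiTheta_inv_sq (by simpa using hτ)

theorem jacobiTheta_two_mul_frickeInv {τ : ℂ} (hτ : 0 < τ.im) :
    jacobiTheta (2 * frickeInv τ) ^ 2 = -Complex.I * τ * jacobiTheta τ ^ 2 := by
  rw [← jacobiTheta_inv_sq hτ]
  have := ne_zero_of_im_pos hτ
  congr 2
  rw [frickeInv]; field_simp

theorem formP_frickeInv {τ : ℂ} (hτ : 0 < τ.im) : formP (frickeInv τ) = -2 * τ ^ 2 * formP τ := by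
  rw [formP_eq (frickeInv_im_pos hτ), formP_eq hτ, jacobiTheta_frickeInv hτ,
    jacobiTheta_two_mul_frickeInv hτ]
  linear_combination (2 * τ ^ 2 * ((jacobiTheta (2 * τ) ^ 2) ^ 2 +
    (jacobiTheta τ ^ 2 - jacobiTheta (2 * τ) ^ 2) ^ 2)) * Complex.I_sq

theorem formD_frickeInv {τ : ℂ} (hτ : 0 < τ.im) : formD (frickeInv τ) = 16 * τ ^ 8 * formD τ := by
  have h1 := sixteen_mul_formD hτ
  have h2 := sixteen_mul_formD (frickeInv_im_pos hτ)
  rw [jacobiTheta_frickeInv hτ, jacobiTheta_two_mul_frickeInv hτ] at h2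
  have h8 : Complex.I ^ 8 = 1 := by
    rw [show (8 : ℕ) = 4 * 2 by norm_num, pow_mul, Complex.I_pow_four, one_pow]
  apply mul_left_cancel₀ (by norm_num : (16 : ℂ) ≠ 0)
  rw [h2]
  rw [show 16 * (16 * τ ^ 8 * formD τ) = 16 * τ ^ 8 * (16 * formD τ) by ring, h1]
  generalize jacobiTheta τ = x
  generalize jacobiTheta (2 * τ) = y
  have : ∀ c : ℂ, c = -Complex.I * τ → (c * x ^ 2) ^ 2 * (2 * c * y ^ 2 - c * x ^ 2) ^ 2 *
      ((c * x ^ 2) ^ 2 - (2 * c * y ^ 2 - c * x ^ 2) ^ 2) ^ 2 =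
      (c ^ 8) * (16 * ((y ^ 2) ^ 2 * (x ^ 2 - y ^ 2) ^ 2 *
        ((y ^ 2) ^ 2 - (x ^ 2 - y ^ 2) ^ 2) ^ 2)) := by
    intro c _; ring
  have h3 := this _ rfl
  have hc8 : (-Complex.I * τ) ^ 8 = τ ^ 8 := by linear_combination τ ^ 8 * h8
  rw [hc8] at h3
  linear_combination h3

theorem psiSeries_sq : psiSeries ^ 2 = PowerSeries.expand 4 (by norm_num) thetaSeries *
    PowerSeries.expand 2 two_ne_zero psiSeries := by
  have h1 := thetaSeries_sq
  have h2 := congrArg (PowerSeries.expand 2 two_ne_zero) thetaSeries_sq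
  have h3 := thetaSeries_eq_even_add_odd
  have h4 : PowerSeries.expand 2 two_ne_zero (PowerSeries.expand 2 two_ne_zero thetaSeries) =
      PowerSeries.expand 4 (by norm_num) thetaSeries := by
    rw [← PowerSeries.expand_mul]
  simp only [map_add, map_mul, map_pow, PowerSeries.expand_X, map_ofNat, h4] at h2
  have h4X : (4 * PowerSeries.X : PowerSeries ℤ) ≠ 0 :=
    mul_ne_zero
    (fun h ↦ by simpa [map_ofNat] using congrArg PowerSeries.constantCoeff h) PowerSeries.X_ne_zero
  apply mul_left_cancel₀ h4X
  linear_combination -h1 - h2 + (thetaSeries + (PowerSeries.expand 4 (by norm_num) thetaSeries +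
      2 * PowerSeries.X * PowerSeries.expand 2 two_ne_zero psiSeries)) * h3

theorem constantCoeff_thetaSeries : PowerSeries.constantCoeff thetaSeries = 1 := by
  rw [← PowerSeries.coeff_zero_eq_constantCoeff_apply, thetaSeries, PowerSeries.coeff_mk]
  simp

theorem constantCoeff_psiSeries : PowerSeries.constantCoeff psiSeries = 1 := by
  rw [← PowerSeries.coeff_zero_eq_constantCoeff_apply, psiSeries, PowerSeries.coeff_mk,
    if_pos ⟨0, rfl⟩]

theorem expand_two_thetaFourth : PowerSeries.expand 2 two_ne_zero thetaFourth =
    (PowerSeries.expand 2 two_ne_zero thetaSeries ^ 2) ^ 2 := by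
  rw [thetaFourth, map_pow]; ring

theorem expand_two_thetaCompanion : PowerSeries.expand 2 two_ne_zero thetaCompanion =
    (4 * PowerSeries.X * psiSeries ^ 2) ^ 2 := by
  have h4 : PowerSeries.expand 2 two_ne_zero (PowerSeries.expand 2 two_ne_zero thetaSeries) =
      PowerSeries.expand 4 (by norm_num) thetaSeries := by
    rw [← PowerSeries.expand_mul]
  simp only [thetaCompanion, map_mul, map_pow, PowerSeries.expand_X, map_ofNat, h4]
  rw [psiSeries_sq]
  ring

theorem eq_C_of_expand_two_eq {R : Type*} [CommRing R] {f : PowerSeries R}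
    (h : PowerSeries.expand 2 two_ne_zero f = f) :
    f = PowerSeries.C (PowerSeries.constantCoeff f) := by
  ext n
  induction n using Nat.strong_induction_on with
  | _ n ih =>
    rcases Nat.eq_zero_or_pos n with rfl | hn
    · simp
    · rw [← h, PowerSeries.coeff_expand]
      simp only [PowerSeries.coeff_C, if_neg hn.ne', PowerSeries.constantCoeff_expand]
      split_ifs with h2
      · rw [ih _ (by omega), PowerSeries.coeff_C, if_neg (by omega)]
      · rfl

theorem hasseForm_mul_mul {R : Type*} [CommRing R] (m : ℕ) (c a b : R) :
    hasseForm m (c * a) (c * b) = c ^ m * hasseForm m a b := by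
  rw [hasseForm, hasseForm, Finset.mul_sum]
  refine Finset.sum_congr rfl fun i hi ↦ ?_
  have : c ^ m = c ^ (m - i) * c ^ i := by
    rw [← pow_add]
    congr 1
    have := Finset.mem_range.1 hi
    omega
  rw [this, mul_pow, mul_pow]
  ring

theorem exists_mul_eq_of_constantCoeff_eq_one {K : Type*} [Field K] {f : PowerSeries K}
    (hf : PowerSeries.constantCoeff f = 1) (g : PowerSeries K) : ∃ u, f * u = g :=
  ⟨f⁻¹ * g, by rw [← mul_assoc, PowerSeries.mul_inv_cancel _ (by rw [hf]; exact one_ne_zero),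
    one_mul]⟩

section CharP

variable {K : Type*} [Field K] {p : ℕ} [CharP K p] {m : ℕ}

theorem hasseForm_sq_four_mul {A : Type*} [CommRing A] [Algebra K A] (hm : p = 2 * m + 1)
    {x y u : A} (hu : x * u = y) :
    hasseForm m ((x + y) ^ 2) (4 * x * y) = hasseForm m (x ^ 2) (y ^ 2) := by
  have h := congrArg (aeval u) (hasseForm_landen (K := K) hm)
  have h1 := map_hasseForm (aeval u : K[X] →ₐ[K] A).toRingHom m ((1 + X) ^ 2) (4 * X)
  have h2 := map_hasseForm (aeval u : K[X] →ₐ[K] A).toRingHom m 1 (X ^ 2)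
  simp only [AlgHom.toRingHom_eq_coe, RingHom.coe_coe, map_pow, map_add, map_one, aeval_X,
    map_mul, map_ofNat] at h1 h2
  rw [h1, h2] at h
  have e1 : (x + y) ^ 2 = x ^ 2 * (1 + u) ^ 2 := by rw [← hu]; ring
  have e2 : 4 * x * y = x ^ 2 * (4 * u) := by rw [← hu]; ring
  have e3 : y ^ 2 = x ^ 2 * u ^ 2 := by rw [← hu]; ring
  rw [e1, e2, e3, hasseForm_mul_mul, h, ← hasseForm_mul_mul, mul_one]

theorem constantCoeff_map_of_eq_one {f : PowerSeries ℤ} (hf : PowerSeries.constantCoeff f = 1) :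
    PowerSeries.constantCoeff (PowerSeries.map (Int.castRingHom K) f) = 1 := by
  rw [← PowerSeries.coeff_zero_eq_constantCoeff_apply, PowerSeries.coeff_map,
    PowerSeries.coeff_zero_eq_constantCoeff_apply, hf, map_one]

theorem hasseForm_theta_eq_one (hm : p = 2 * m + 1) :
    hasseForm m (PowerSeries.map (Int.castRingHom K) thetaFourth)
      (PowerSeries.map (Int.castRingHom K) thetaCompanion) = 1 := by
  set π := PowerSeries.map (Int.castRingHom K)
  have hexp : ∀ f, π (PowerSeries.expand 2 two_ne_zero f) =
      PowerSeries.expand 2 two_ne_zero (π f) := fun f ↦ PowerSeries.map_expand _ two_ne_zero _ f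
  set x := PowerSeries.expand 2 two_ne_zero thetaSeries ^ 2 with hx
  set y := 4 * PowerSeries.X * psiSeries ^ 2 with hy
  have hx1 : PowerSeries.constantCoeff x = 1 := by
    rw [hx, map_pow, PowerSeries.constantCoeff_expand, constantCoeff_thetaSeries, one_pow]
  obtain ⟨u, hu⟩ := exists_mul_eq_of_constantCoeff_eq_one (K := K)
    (constantCoeff_map_of_eq_one hx1) (π y)
  have e1 : π thetaFourth = (π x + π y) ^ 2 := by
    rw [← map_add, hx, hy, ← thetaSeries_sq, ← map_pow, thetaFourth]
    congr 1; ring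
  have e2 : π thetaCompanion = 4 * π x * π y := by
    rw [← map_ofNat π 4, ← map_mul, ← map_mul, hx, hy, thetaCompanion]
    congr 1; ring
  have h := hasseForm_sq_four_mul (K := K) hm hu
  rw [← e1, ← e2, ← map_pow, ← map_pow, ← expand_two_thetaFourth, ← expand_two_thetaCompanion,
    hexp, hexp] at h
  have h2 := map_hasseForm (PowerSeries.expand (R := K) 2 two_ne_zero).toRingHom m
    (π thetaFourth) (π thetaCompanion)
  simp only [AlgHom.toRingHom_eq_coe, RingHom.coe_coe] at h2
  rw [← h2] at h
  rw [eq_C_of_expand_two_eq h.symm, map_hasseForm,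
    constantCoeff_map_of_eq_one (by rw [thetaFourth, map_pow, constantCoeff_thetaSeries, one_pow])]
  have h3 : PowerSeries.constantCoeff (π thetaCompanion) = 0 := by
    rw [e2, hy]; simp [π]
  rw [h3, hasseForm, Finset.sum_eq_single 0]
  · simp
  · intro i _ hi; simp [hi]
  · simp

theorem fricke_series_identity (h2p : 2 < p) (hm : p = 2 * m + 1) {m₂ e v : ℕ}
    (hv : v ≤ 1) (hm₂ : m = 4 * m₂ + e + 2 * v) (c : ℕ → K) (c0 : c 0 = 1)
    (hc : ∀ n < m₂, 64 * ((n : K) + 1) ^ 2 * c (n + 1) =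
      (8 * n + 1 + 4 * v) * (8 * n + 3 + 4 * v) * c n)
    (hend : (8 * (m₂ : K) + 1 + 4 * v) * (8 * m₂ + 3 + 4 * v) = 0)
    {P D : PowerSeries K} (hP : P = PowerSeries.map (Int.castRingHom K) frickeP)
    (hD : D = PowerSeries.map (Int.castRingHom K) frickeD) :
    (P ^ 4) ^ e * (P ^ 4 - 256 * D) ^ (2 * v) * (∑ n ∈ Finset.range (m₂ + 1),
      PowerSeries.C (c n * 256 ^ n) * D ^ n * (P ^ 4) ^ (m₂ - n)) ^ 4 = 1 := by
  set π := PowerSeries.map (Int.castRingHom K)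
  set a := π thetaFourth with ha
  set b := π thetaCompanion with hb
  have ha1 : PowerSeries.constantCoeff a = 1 := constantCoeff_map_of_eq_one
    (by rw [thetaFourth, map_pow, constantCoeff_thetaSeries, one_pow])
  obtain ⟨u, hu⟩ := exists_mul_eq_of_constantCoeff_eq_one (K := K) ha1 b
  have hPab : P = a + b := by rw [hP, frickeP, map_add]
  have hDab : 256 * D = 16 * a * b * (a - b) ^ 2 := by
    have := congrArg π sixteen_mul_frickeD
    simp only [map_mul, map_ofNat, map_pow, map_sub] at this
    rw [hD]
    linear_combination 16 * this
  have hPD : P ^ 4 - 256 * D = (a ^ 2 - 6 * a * b + b ^ 2) ^ 2 := by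
    rw [hPab, hDab]; ring
  have h := congrArg (aeval u) (fricke_pullback_eq_hasseForm h2p hm hv hm₂ c c0 hc hend)
  have h1 := map_hasseForm (aeval u : K[X] →ₐ[K] PowerSeries K).toRingHom m 1 X
  simp only [AlgHom.toRingHom_eq_coe, RingHom.coe_coe, map_one, aeval_X] at h1
  rw [h1] at h
  have h2 := hasseForm_theta_eq_one (K := K) hm
  rw [← ha, ← hb, ← hu] at h2
  have h3 := hasseForm_mul_mul m a 1 u
  rw [mul_one, h2, ← h] at h3
  simp only [map_mul, map_pow, map_add, map_sub, map_one, aeval_X, map_ofNat, map_sum,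
    aeval_C] at h3
  have h4 : (a + b) ^ e * (a ^ 2 - 6 * a * b + b ^ 2) ^ v * (∑ n ∈ Finset.range (m₂ + 1),
      PowerSeries.C (c n * 256 ^ n) * D ^ n * (P ^ 4) ^ (m₂ - n)) = 1 := by
    rw [h3, hm₂, pow_add, pow_add, pow_mul a 2 v, pow_mul a 4, hPab]
    have e1 : a + b = a * (1 + u) := by rw [← hu]; ring
    have e2 : a ^ 2 - 6 * a * b + b ^ 2 = a ^ 2 * (1 - 6 * u + u ^ 2) := by rw [← hu]; ring
    have e3 : ∑ n ∈ Finset.range (m₂ + 1),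
        PowerSeries.C (c n * 256 ^ n) * D ^ n * ((a + b) ^ 4) ^ (m₂ - n) =
        (a ^ 4) ^ m₂ * ∑ n ∈ Finset.range (m₂ + 1), algebraMap K (PowerSeries K) (c n) *
          (16 * u * (1 - u) ^ 2) ^ n * ((1 + u) ^ 4) ^ (m₂ - n) := by
      rw [Finset.mul_sum]
      refine Finset.sum_congr rfl fun n hn ↦ ?_
      have hn' : m₂ = n + (m₂ - n) := by
        have := Finset.mem_range.1 hn
        omega
      have e4 : (a ^ 4) ^ m₂ = (a ^ 4) ^ n * (a ^ 4) ^ (m₂ - n) := by rw [← pow_add, ← hn']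
      have e5 : 256 * D = a ^ 4 * (16 * u * (1 - u) ^ 2) := by rw [hDab, ← hu]; ring
      have e6 : PowerSeries.C (c n * 256 ^ n) * D ^ n =
          PowerSeries.C (c n) * (256 * D) ^ n := by
        rw [map_mul, map_pow, map_ofNat, mul_pow]; ring
      rw [e6, e5, e1, e4, PowerSeries.algebraMap_apply, Algebra.algebraMap_self, RingHom.id_apply,
        mul_pow a (1 + u) 4, mul_pow (a ^ 4), mul_pow (a ^ 4)]
      ring
    rw [e1, e2] at *
    rw [e3, mul_pow, mul_pow]
    ring
  rw [hPD, ← hPab] at *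
  have h5 := congrArg (· ^ 4) h4
  simp only [mul_pow, one_pow] at h5
  rw [← h5, ← pow_mul, ← pow_mul, ← pow_mul, ← pow_mul, mul_comm 4 e]
  congr 3
  ring

end CharP

/-- The linear fractional map attached to an integral two by two matrix. -/
def mob (a b c d : ℤ) (τ : ℂ) : ℂ := (a * τ + b) / (c * τ + d)

theorem denom_ne_zero {a b c d : ℤ} (h : 0 < a * d - b * c) {τ : ℂ} (hτ : 0 < τ.im) :
    (c * τ + d : ℂ) ≠ 0 := by
  intro h0
  have h1 := congrArg Complex.im h0
  have h2 := congrArg Complex.re h0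
  simp at h1 h2
  rcases h1 with rfl | h1
  · simp at h2
    subst h2
    simp at h
  · exact hτ.ne' h1

theorem mob_im (a b c d : ℤ) (τ : ℂ) : (mob a b c d τ).im =
    ((a * d - b * c : ℤ) : ℝ) * τ.im / Complex.normSq (c * τ + d) := by
  rw [mob, Complex.div_im, ← sub_div]
  congr 1
  simp
  ring

theorem mob_im_pos {a b c d : ℤ} (h : 0 < a * d - b * c) {τ : ℂ} (hτ : 0 < τ.im) :
    0 < (mob a b c d τ).im := by
  rw [mob_im]
  have h1 := Complex.normSq_pos.2 (denom_ne_zero h hτ)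
  have h2 : (0 : ℝ) < ((a * d - b * c : ℤ) : ℝ) := by exact_mod_cast h
  positivity

theorem mob_mob {a b c d a' b' c' d' : ℤ} {τ : ℂ} (h : (c' * τ + d' : ℂ) ≠ 0) :
    mob a b c d (mob a' b' c' d' τ) =
      mob (a * a' + b * c') (a * b' + b * d') (c * a' + d * c') (c * b' + d * d') τ := by
  rw [mob, mob, mob]
  have e1 : (a : ℂ) * ((a' * τ + b') / (c' * τ + d')) + b =
      (((a * a' + b * c' : ℤ) : ℂ) * τ + ((a * b' + b * d' : ℤ) : ℂ)) / (c' * τ + d') := by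
    rw [mul_div_assoc', div_add' _ _ _ h]; push_cast; congr 1; ring
  have e2 : (c : ℂ) * ((a' * τ + b') / (c' * τ + d')) + d =
      (((c * a' + d * c' : ℤ) : ℂ) * τ + ((c * b' + d * d' : ℤ) : ℂ)) / (c' * τ + d') := by
    rw [mul_div_assoc', div_add' _ _ _ h]; push_cast; congr 1; ring
  rw [e1, e2, div_div_div_cancel_right₀ h]

theorem mob_scale {k : ℤ} (hk : k ≠ 0) (a b c d : ℤ) (τ : ℂ) :
    mob (k * a) (k * b) (k * c) (k * d) τ = mob a b c d τ := by
  have : (k : ℂ) ≠ 0 := by exact_mod_cast hk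
  rw [mob, mob, ← mul_div_mul_left (a * τ + b : ℂ) _ this]
  push_cast
  congr 1 <;> ring

theorem mob_one (τ : ℂ) : mob 1 0 0 1 τ = τ := by simp [mob]

/-- Integral representatives of the level two Fricke group. -/
def IsFricke (a b c d : ℤ) : Prop :=
  2 ∣ c ∧ (a * d - b * c = 1 ∨ (2 ∣ a ∧ 2 ∣ d ∧ a * d - b * c = 2))

theorem IsFricke.det_pos {a b c d : ℤ} (h : IsFricke a b c d) : 0 < a * d - b * c := by
  rcases h with ⟨-, h | ⟨-, -, h⟩⟩ <;> omega

theorem Int.exists_natAbs_sub_mul_le (a : ℤ) {c : ℤ} (hc : c ≠ 0) :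
    ∃ k : ℤ, 2 * (a - c * k).natAbs ≤ c.natAbs := by
  refine ⟨if 2 * (a % c) ≤ c.natAbs then a / c else a / c + c.sign, ?_⟩
  have h1 := Int.emod_add_mul_ediv a c
  have h2 := Int.emod_nonneg a hc
  have h3 := Int.emod_lt_abs a hc
  have h4 := Int.mul_sign_self c
  rw [Int.abs_eq_natAbs] at h3
  split_ifs with h
  · have : a - c * (a / c) = a % c := by linarith
    rw [this]; omega
  · have : a - c * (a / c + c.sign) = a % c - c.natAbs := by linarith
    rw [this]; omega

/-- The Fricke group is generated, up to scalars, by the translation and the Fricke involution. -/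
theorem IsFricke.induction {Q : ℤ → ℤ → ℤ → ℤ → Prop} (one : Q 1 0 0 1)
    (shift : ∀ a b c d k : ℤ, Q (a - c * k) (b - d * k) c d → Q a b c d)
    (inv : ∀ a b c d : ℤ, 0 < a * d - b * c → Q (-c) (-d) (2 * a) (2 * b) → Q a b c d)
    (scale : ∀ k a b c d : ℤ, k ≠ 0 → (Q (k * a) (k * b) (k * c) (k * d) ↔ Q a b c d))
    {a b c d : ℤ} (h : IsFricke a b c d) : Q a b c d := by
  have key : ∀ n : ℕ, ∀ a b c d : ℤ, c.natAbs ≤ n → 2 ∣ c → a * d - b * c = 1 → Q a b c d := by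
    intro n
    induction n using Nat.strong_induction_on with
    | _ n ih =>
      intro a b c d hcn hc h
      by_cases hc0 : c = 0
      · subst hc0
        have h1 : a * d = 1 := by simpa using h
        rcases Int.mul_eq_one_iff_eq_one_or_neg_one.1 h1 with ⟨rfl, rfl⟩ | ⟨rfl, rfl⟩
        · refine shift _ _ _ _ b ?_
          simpa using one
        · refine (scale (-1) _ _ _ _ (by norm_num)).1 (shift _ _ _ _ (-b) ?_)
          simpa using one
      obtain ⟨k, hk⟩ := Int.exists_natAbs_sub_mul_le a hc0
      refine shift _ _ _ _ k ?_
      have hdet : (a - c * k) * d - (b - d * k) * c = 1 := by rw [← h]; ring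
      generalize b - d * k = b' at *
      generalize a - c * k = a' at *
      refine inv _ _ _ _ (by omega) ?_
      obtain ⟨c, rfl⟩ := hc
      have ha0 : a' ≠ 0 := by
        rintro rfl
        have : 2 * (-(b' * c)) = 1 := by linarith
        omega
      obtain ⟨l, hl⟩ := Int.exists_natAbs_sub_mul_le (-c) ha0
      refine shift _ _ _ _ l ?_
      have e1 : -(2 * c) - 2 * a' * l = 2 * (-c - a' * l) := by ring
      rw [e1]
      have hdet2 : (-c - a' * l) * (2 * b') - (-d - 2 * b' * l) * a' = 1 := by rw [← hdet]; ring
      generalize -c - a' * l = A at *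
      generalize -d - 2 * b' * l = B at *
      refine inv _ _ _ _ (by nlinarith) ?_
      have e2 := scale 2 (-a') (-b') (2 * A) B (by norm_num)
      refine (by simpa using e2 : _ ↔ _).2 ?_
      refine ih (2 * A).natAbs (by omega) _ _ _ _ le_rfl ⟨A, rfl⟩ ?_
      rw [← hdet2]; ring
  rcases h with ⟨hc, h | ⟨⟨a, rfl⟩, ⟨d, rfl⟩, h⟩⟩
  · exact key _ _ _ _ _ le_rfl hc h
  · obtain ⟨c, rfl⟩ := hc
    refine inv _ _ _ _ (by omega) ?_
    have e2 := scale 2 (-c) (-d) (2 * a) b (by norm_num)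
    refine (by simpa using e2 : _ ↔ _).2 ?_
    refine key _ _ _ _ _ le_rfl ⟨a, rfl⟩ ?_
    have : 2 * (2 * a * d - b * c) = 2 * 1 := by linarith
    linarith

theorem frickeInv_mob {a b c d : ℤ} (h : 0 < a * d - b * c) {τ : ℂ} (hτ : 0 < τ.im) :
    frickeInv (mob a b c d τ) = mob (-c) (-d) (2 * a) (2 * b) τ := by
  have h1 : frickeInv (mob a b c d τ) = mob 0 (-1) 2 0 (mob a b c d τ) := by
    simp [frickeInv, mob]
  rw [h1, mob_mob (denom_ne_zero h hτ)]
  simp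

theorem eq_add_int_of_periodic {α : Type*} {f : ℂ → α}
    (hT : ∀ τ : ℂ, 0 < τ.im → f (τ + 1) = f τ) {τ : ℂ} (hτ : 0 < τ.im) (k : ℤ) :
    f (τ + k) = f τ := by
  have h : ∀ (n : ℕ) (τ : ℂ), 0 < τ.im → f (τ + n) = f τ := by
    intro n
    induction n with
    | zero => intro τ _; simp
    | succ n ih =>
      intro τ hτ
      rw [Nat.cast_succ, ← add_assoc, hT _ (by simpa using hτ), ih _ hτ]
  obtain ⟨n, rfl | rfl⟩ := Int.eq_nat_or_neg k
  · exact_mod_cast h n τ hτ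
  · have := h n (τ + ((-n : ℤ) : ℂ)) (by simpa using hτ)
    rw [← this]
    congr 1; push_cast; ring

theorem mob_shift {a b c d : ℤ} {τ : ℂ} (h : (c * τ + d : ℂ) ≠ 0) (k : ℤ) :
    mob a b c d τ = mob (a - c * k) (b - d * k) c d τ + k := by
  rw [mob, mob, div_add' _ _ _ h]
  push_cast
  congr 1
  ring

theorem fricke_weight {f : ℂ → ℂ} (hT : ∀ τ : ℂ, 0 < τ.im → f (τ + 1) = f τ)
    (hW : ∀ τ : ℂ, 0 < τ.im → f (frickeInv τ) = 16 * τ ^ 8 * f τ) {a b c d : ℤ}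
    (h : IsFricke a b c d) {τ : ℂ} (hτ : 0 < τ.im) :
    (a * d - b * c : ℂ) ^ 4 * f (mob a b c d τ) = (c * τ + d) ^ 8 * f τ := by
  have key : 0 < a * d - b * c → ∀ τ : ℂ, 0 < τ.im →
      (a * d - b * c : ℂ) ^ 4 * f (mob a b c d τ) = (c * τ + d) ^ 8 * f τ := by
    refine h.induction (Q := fun a b c d ↦ 0 < a * d - b * c → ∀ τ : ℂ, 0 < τ.im →
      (a * d - b * c : ℂ) ^ 4 * f (mob a b c d τ) = (c * τ + d) ^ 8 * f τ) ?_ ?_ ?_ ?_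
    · intro _ τ _
      simp [mob_one]
    · intro a b c d k hQ hdet τ hτ
      have hdet2 : 0 < (a - c * k) * d - (b - d * k) * c := by
        convert hdet using 1; ring
      rw [mob_shift (denom_ne_zero hdet hτ) k, eq_add_int_of_periodic hT (mob_im_pos hdet2 hτ),
        ← hQ hdet2 τ hτ]
      push_cast
      ring
    · intro a b c d hdet hQ _ τ hτ
      have h1 := hQ (by linarith) τ hτ
      rw [← frickeInv_mob hdet hτ, hW _ (mob_im_pos hdet hτ)] at h1
      have h2 := denom_ne_zero hdet hτ
      have h3 : (a * τ + b : ℂ) ≠ 0 := by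
        intro h0
        have := mob_im_pos hdet hτ
        rw [mob, h0] at this
        simp at this
      have h4 : mob a b c d τ ^ 8 * (c * τ + d) ^ 8 = (a * τ + b) ^ 8 := by
        rw [mob, div_pow, div_mul_cancel₀ _ (pow_ne_zero _ h2)]
      push_cast at h1
      apply mul_left_cancel₀ (pow_ne_zero 8 h3)
      apply mul_left_cancel₀ (by norm_num : (256 : ℂ) ≠ 0)
      linear_combination (c * τ + d) ^ 8 * h1 -
        256 * (a * d - b * c : ℂ) ^ 4 * f (mob a b c d τ) * h4
    · intro k a b c d hk
      have hk2 : (k : ℂ) ≠ 0 := by exact_mod_cast hk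
      have e : k * a * (k * d) - k * b * (k * c) = k ^ 2 * (a * d - b * c) := by ring
      have hpos : 0 < k * a * (k * d) - k * b * (k * c) ↔ 0 < a * d - b * c := by
        rw [e]; exact mul_pos_iff_of_pos_left (by positivity)
      rw [hpos]
      refine forall_congr' fun _ ↦ forall_congr' fun τ ↦ forall_congr' fun _ ↦ ?_
      rw [mob_scale hk]
      push_cast
      constructor
      · intro h
        apply mul_left_cancel₀ (pow_ne_zero 8 hk2)
        linear_combination h
      · intro h
        linear_combination (k : ℂ) ^ 8 * h
  exact key h.det_pos τ hτ

theorem fricke_invariant {α : Type*} {f : ℂ → α} (hT : ∀ τ : ℂ, 0 < τ.im → f (τ + 1) = f τ)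
    (hW : ∀ τ : ℂ, 0 < τ.im → f (frickeInv τ) = f τ) {a b c d : ℤ}
    (h : IsFricke a b c d) {τ : ℂ} (hτ : 0 < τ.im) : f (mob a b c d τ) = f τ := by
  have key : 0 < a * d - b * c → f (mob a b c d τ) = f τ := by
    refine h.induction (Q := fun a b c d ↦ 0 < a * d - b * c → f (mob a b c d τ) = f τ) ?_ ?_ ?_ ?_
    · intro _
      rw [mob_one]
    · intro a b c d k hQ hdet
      have hdet2 : 0 < (a - c * k) * d - (b - d * k) * c := by
        convert hdet using 1; ring
      rw [mob_shift (denom_ne_zero hdet hτ) k, eq_add_int_of_periodic hT (mob_im_pos hdet2 hτ),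
        ← hQ hdet2]
    · intro a b c d hdet hQ _
      rw [← hQ (by linarith), ← frickeInv_mob hdet hτ, hW _ (mob_im_pos hdet hτ)]
    · intro k a b c d hk
      have e : k * a * (k * d) - k * b * (k * c) = k ^ 2 * (a * d - b * c) := by ring
      have hpos : 0 < k * a * (k * d) - k * b * (k * c) ↔ 0 < a * d - b * c := by
        rw [e]; exact mul_pos_iff_of_pos_left (by positivity)
      rw [hpos, mob_scale hk]
  exact key h.det_pos

/-- Every point of the upper half plane is equivalent to one with large imaginary part. -/
theorem exists_isFricke_im_ge {τ : ℂ} (hτ : 0 < τ.im) :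
    ∃ a b c d : ℤ, IsFricke a b c d ∧ 2 / 5 ≤ (mob a b c d τ).im := by
  obtain ⟨g, hg⟩ := ModularGroup.exists_smul_mem_fd ⟨τ, hτ⟩
  have h3 := ModularGroup.three_le_four_mul_im_sq_of_mem_fd hg
  have hdet : g 0 0 * g 1 1 - g 0 1 * g 1 0 = 1 := by
    rw [← Matrix.det_fin_two, g.det_coe]
  have hmob : ((g • (⟨τ, hτ⟩ : UpperHalfPlane) : UpperHalfPlane) : ℂ) =
      mob (g 0 0) (g 0 1) (g 1 0) (g 1 1) τ := by
    rw [UpperHalfPlane.specialLinearGroup_apply]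
    simp [mob]
  have him : (g • (⟨τ, hτ⟩ : UpperHalfPlane)).im = (mob (g 0 0) (g 0 1) (g 1 0) (g 1 1) τ).im := by
    rw [← hmob]; rfl
  rw [him] at h3
  generalize g 0 0 = a at *
  generalize g 0 1 = b at *
  generalize g 1 0 = c at *
  generalize g 1 1 = d at *
  have hpos := mob_im_pos (by omega : 0 < a * d - b * c) hτ
  have hlarge : 4 / 5 ≤ (mob a b c d τ).im := by nlinarith
  rcases Int.even_or_odd c with hc | hc
  · exact ⟨a, b, c, d, ⟨hc.two_dvd, .inl hdet⟩, by linarith⟩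
  · have half : ∀ e : ℤ, (mob (a + e * c) (b + e * d) (2 * c) (2 * d) τ).im =
        (mob a b c d τ).im / 2 := by
      intro e
      have h0 := denom_ne_zero (by omega : 0 < a * d - b * c) hτ
      have : mob 1 e 0 2 (mob a b c d τ) = mob (a + e * c) (b + e * d) (2 * c) (2 * d) τ := by
        rw [mob_mob h0]; simp
      rw [← this]
      simp [mob]
    rcases Int.even_or_odd a with ha | ha
    · refine ⟨a + 0 * c, b + 0 * d, 2 * c, 2 * d, ⟨⟨c, rfl⟩, .inr ⟨?_, ⟨d, rfl⟩, ?_⟩⟩, ?_⟩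
      · simpa using ha.two_dvd
      · linear_combination 2 * hdet
      · rw [half]; linarith
    · refine ⟨a + 1 * c, b + 1 * d, 2 * c, 2 * d, ⟨⟨c, rfl⟩, .inr ⟨?_, ⟨d, rfl⟩, ?_⟩⟩, ?_⟩
      · rw [one_mul]; exact (ha.add_odd hc).two_dvd
      · linear_combination 2 * hdet
      · rw [half]; linarith

theorem IsFricke.translate {a b c d : ℤ} (h : IsFricke a b c d) (k : ℤ) :
    IsFricke (a + k * c) (b + k * d) c d := by
  have e : (a + k * c) * d - (b + k * d) * c = a * d - b * c := by ring
  rcases h with ⟨hc, h | ⟨ha, hd, h⟩⟩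
  · exact ⟨hc, .inl (by rw [e, h])⟩
  · exact ⟨hc, .inr ⟨dvd_add ha (hc.mul_left k), hd, by rw [e, h]⟩⟩

/-- Every point is equivalent to one in a vertical strip bounded away from the real line. -/
theorem exists_isFricke_mem_strip {τ : ℂ} (hτ : 0 < τ.im) :
    ∃ a b c d : ℤ, IsFricke a b c d ∧ 2 / 5 ≤ (mob a b c d τ).im ∧ |(mob a b c d τ).re| ≤ 1 := by
  obtain ⟨a, b, c, d, h, him⟩ := exists_isFricke_im_ge hτ
  refine ⟨_, _, c, d, h.translate (-⌊(mob a b c d τ).re⌋), ?_⟩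
  set k := ⌊(mob a b c d τ).re⌋
  have e : mob (a + -k * c) (b + -k * d) c d τ = mob a b c d τ - k := by
    have := mob_shift (a := a) (b := b) (denom_ne_zero h.det_pos hτ) k
    rw [show a - c * k = a + -k * c by ring, show b - d * k = b + -k * d by ring] at this
    rw [this]; ring
  rw [e]
  refine ⟨by simpa using him, ?_⟩
  have h1 := Int.floor_le (mob a b c d τ).re
  have h2 := Int.lt_floor_add_one (mob a b c d τ).re
  rw [abs_le]
  simp only [Complex.sub_re, Complex.intCast_re]
  constructor <;> linarith

theorem isOpen_im_pos : IsOpen {τ : ℂ | 0 < τ.im} := isOpen_lt continuous_const Complex.continuous_im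

theorem isPreconnected_im_pos : IsPreconnected {τ : ℂ | 0 < τ.im} :=
  (convex_halfSpace_im_gt 0).isPreconnected

theorem differentiable_cuspParam : Differentiable ℂ cuspParam :=
  Complex.differentiable_exp.comp (differentiable_id.const_mul _)

/-- The filter of neighbourhoods of the cusp at infinity. -/
def imAtTop : Filter ℂ := Filter.comap Complex.im Filter.atTop

theorem eventually_imAtTop {P : ℂ → Prop} :
    (∀ᶠ τ in imAtTop, P τ) ↔ ∃ B : ℝ, ∀ τ : ℂ, B ≤ τ.im → P τ := by
  rw [imAtTop, Filter.eventually_comap, Filter.eventually_atTop]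
  exact ⟨fun ⟨B, h⟩ ↦ ⟨B, fun τ hτ ↦ h _ hτ τ rfl⟩, fun ⟨B, h⟩ ↦ ⟨B, fun b hb τ hτ ↦ h τ (hτ ▸ hb)⟩⟩

theorem eventually_im_pos : ∀ᶠ τ in imAtTop, 0 < τ.im :=
  eventually_imAtTop.2 ⟨1, fun _ h ↦ lt_of_lt_of_le one_pos h⟩

theorem tendsto_cuspParam : Filter.Tendsto cuspParam imAtTop (nhds 0) := by
  rw [tendsto_zero_iff_norm_tendsto_zero]
  simp only [norm_cuspParam]
  refine Real.tendsto_exp_atBot.comp ?_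
  refine Filter.Tendsto.const_mul_atTop_of_neg ?_ Filter.tendsto_comap
  have := Real.pi_pos
  linarith

theorem isCompact_strip (A B : ℝ) : IsCompact (Set.Icc (-1 : ℝ) 1 ×ℂ Set.Icc A B) :=
  isCompact_Icc.reProdIm isCompact_Icc

theorem mem_strip {A B : ℝ} {τ : ℂ} : τ ∈ Set.Icc (-1 : ℝ) 1 ×ℂ Set.Icc A B ↔
    |τ.re| ≤ 1 ∧ A ≤ τ.im ∧ τ.im ≤ B := by
  rw [Complex.mem_reProdIm, Set.mem_Icc, Set.mem_Icc, abs_le]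

/-- An invariant holomorphic function with a limit at the cusp is constant. -/
theorem eq_const_of_fricke_invariant {f : ℂ → ℂ}
    (hd : DifferentiableOn ℂ f {τ : ℂ | 0 < τ.im})
    (hT : ∀ τ : ℂ, 0 < τ.im → f (τ + 1) = f τ)
    (hW : ∀ τ : ℂ, 0 < τ.im → f (frickeInv τ) = f τ) {L : ℂ}
    (hL : Filter.Tendsto f imAtTop (nhds L)) {τ : ℂ} (hτ : 0 < τ.im) : f τ = L := by
  by_contra hne
  set g : ℂ → ℂ := fun τ ↦ f τ - L with hg
  have hgd : DifferentiableOn ℂ g {τ : ℂ | 0 < τ.im} := hd.sub_const L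
  have hc : 0 < ‖g τ‖ := norm_pos_iff.2 (sub_ne_zero.2 hne)
  have hinv : ∀ {a b c d : ℤ}, IsFricke a b c d → ∀ {σ : ℂ}, 0 < σ.im →
      g (mob a b c d σ) = g σ := fun h _ hσ ↦ by
    simp only [hg]; rw [fricke_invariant hT hW h hσ]
  have hev : ∀ᶠ σ in imAtTop, ‖g σ‖ < ‖g τ‖ := by
    have h0 : Filter.Tendsto g imAtTop (nhds 0) := by simpa [hg] using hL.sub_const L
    have := h0.norm
    rw [norm_zero] at this
    exact this.eventually_lt_const hc
  obtain ⟨B, hB⟩ := eventually_imAtTop.1 hev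
  set K := Set.Icc (-1 : ℝ) 1 ×ℂ Set.Icc (2 / 5) B
  have hred : ∀ σ : ℂ, 0 < σ.im → ‖g τ‖ ≤ ‖g σ‖ → ∃ σ' ∈ K, g σ' = g σ := by
    intro σ hσ hle
    obtain ⟨a, b, c, d, h, h1, h2⟩ := exists_isFricke_mem_strip hσ
    refine ⟨_, mem_strip.2 ⟨h2, h1, ?_⟩, hinv h hσ⟩
    by_contra! h3
    have := hB _ h3.le
    rw [hinv h hσ] at this
    linarith
  have hKpos : ∀ σ ∈ K, 0 < σ.im := fun σ hσ ↦ by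
    have := (mem_strip.1 hσ).2.1
    linarith
  obtain ⟨σ₁, hσ₁, -⟩ := hred τ hτ le_rfl
  obtain ⟨σ₀, hσ₀, hmax⟩ := (isCompact_strip (2 / 5) B).exists_isMaxOn ⟨σ₁, hσ₁⟩
    (f := fun σ ↦ ‖g σ‖) (hgd.continuousOn.norm.mono hKpos)
  have hmax2 : ∀ σ : ℂ, ‖g τ‖ ≤ ‖g σ‖ → 0 < σ.im → ‖g σ‖ ≤ ‖g σ₀‖ := by
    intro σ hle hσ
    obtain ⟨σ', h1, h2⟩ := hred σ hσ hle
    rw [← h2]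
    exact hmax h1
  have h1 : ‖g τ‖ ≤ ‖g σ₀‖ := hmax2 τ le_rfl hτ
  have hM : IsMaxOn (norm ∘ g) {τ : ℂ | 0 < τ.im} σ₀ := by
    intro σ hσ
    change ‖g σ‖ ≤ ‖g σ₀‖
    rcases le_total ‖g τ‖ ‖g σ‖ with h | h
    · exact hmax2 σ h hσ
    · exact h.trans h1
  have hconst := Complex.norm_eqOn_of_isPreconnected_of_isMaxOn isPreconnected_im_pos isOpen_im_pos
    hgd (hKpos _ hσ₀) hM
  have h2 : ‖g (max B 1 * Complex.I)‖ = ‖g σ₀‖ := hconst (by simp)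
  have h3 := hB (max B 1 * Complex.I) (by simp)
  rw [h2] at h3
  linarith

theorem differentiableOn_form {f : PowerSeries ℤ} (hf : f ∈ convergentSeries) :
    DifferentiableOn ℂ (fun τ ↦ seriesEval (cuspParam τ) f) {τ : ℂ | 0 < τ.im} :=
  (differentiableOn_seriesEval hf).comp differentiable_cuspParam.differentiableOn
    fun _ h ↦ by simpa using norm_cuspParam_lt_one h

theorem tendsto_form {f : PowerSeries ℤ} (hf : f ∈ convergentSeries) :
    Filter.Tendsto (fun τ ↦ seriesEval (cuspParam τ) f) imAtTop
      (nhds (PowerSeries.constantCoeff f : ℤ)) :=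
  (tendsto_seriesEval_zero hf).comp tendsto_cuspParam

open UpperHalfPlane ModularForm in
theorem eta_pow_eq {τ : ℂ} (hτ : 0 < τ.im) : ModularForm.eta τ ^ 24 =
    cuspParam τ * ∏' n : ℕ, (1 - cuspParam τ ^ (n + 1)) ^ 24 := by
  have h := discriminant_eq_q_prod ⟨τ, hτ⟩
  rw [discriminant] at h
  change ModularForm.eta τ ^ 24 = Function.Periodic.qParam 1 τ * ∏' n, (1 - eta_q n τ) ^ 24 at h
  rw [h]
  simp only [eta_q_eq_pow, ← cuspParam.eq_1]
  rw [Function.Periodic.qParam, cuspParam]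
  simp

open UpperHalfPlane ModularForm in
theorem eta_pow_inv {τ : ℂ} (hτ : 0 < τ.im) :
    ModularForm.eta ((-1 : ℂ) / τ) ^ 24 = τ ^ 12 * ModularForm.eta τ ^ 24 := by
  have h := ModularForm.eta_comp_eq_csqrt_I_inv hτ
  simp only [Function.comp_apply, Pi.smul_apply, Pi.mul_apply, smul_eq_mul] at h
  have hs : ∀ z : ℂ, z ≠ 0 → z.sqrt ^ 24 = z ^ 12 := by
    intro z hz
    rw [Complex.sqrt, Complex.cpow_def_of_ne_zero hz, ← Complex.exp_nat_mul,
      show ((24 : ℕ) : ℂ) * ((Complex.log z * 2⁻¹)) = (12 : ℕ) * Complex.log z by push_cast; ring,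
      Complex.exp_nat_mul, Complex.exp_log hz]
  rw [h, mul_pow, mul_pow, inv_pow, hs _ Complex.I_ne_zero, hs _ (ne_zero_of_im_pos hτ),
    show 12 = 4 * 3 by norm_num, pow_mul, Complex.I_pow_four]
  simp

/-- The unit part of `frickeD`. -/
def frickeDUnit : PowerSeries ℤ :=
  PowerSeries.expand 2 two_ne_zero thetaSeries ^ 2 * psiSeries ^ 2 *
    thetaSeries ^ 4 * (thetaFourth - thetaCompanion) ^ 2

theorem frickeD_eq : frickeD = PowerSeries.X * frickeDUnit := rfl

theorem frickeDUnit_mem : frickeDUnit ∈ convergentSeries :=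
  mul_mem (mul_mem (mul_mem (pow_mem (expand_thetaSeries_mem two_ne_zero) 2)
    (pow_mem psiSeries_mem 2)) (pow_mem thetaSeries_mem 4))
    (pow_mem (sub_mem thetaFourth_mem thetaCompanion_mem) 2)

theorem constantCoeff_thetaFourth : PowerSeries.constantCoeff thetaFourth = 1 := by
  rw [thetaFourth, map_pow, constantCoeff_thetaSeries, one_pow]

theorem constantCoeff_thetaCompanion : PowerSeries.constantCoeff thetaCompanion = 0 := by
  simp [thetaCompanion]

theorem constantCoeff_frickeDUnit : PowerSeries.constantCoeff frickeDUnit = 1 := by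
  simp [frickeDUnit, PowerSeries.constantCoeff_expand, constantCoeff_thetaSeries,
    constantCoeff_psiSeries, constantCoeff_thetaFourth, constantCoeff_thetaCompanion]

theorem constantCoeff_frickeP : PowerSeries.constantCoeff frickeP = 1 := by
  simp [frickeP, constantCoeff_thetaFourth, constantCoeff_thetaCompanion]

theorem formD_eq {τ : ℂ} (hτ : 0 < τ.im) :
    formD τ = cuspParam τ * seriesEval (cuspParam τ) frickeDUnit := by
  rw [formD, frickeD_eq, seriesEval_mul (norm_cuspParam_lt_one hτ) X_mem_convergentSeries
    frickeDUnit_mem, seriesEval_X]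

theorem formD_cube_eq {τ : ℂ} (hτ : 0 < τ.im) :
    formD τ ^ 3 = ModularForm.eta τ ^ 24 * ModularForm.eta (2 * τ) ^ 24 := by
  have him2 : ∀ {τ : ℂ}, 0 < τ.im → 0 < (2 * τ).im := fun h ↦ by simpa using h
  have hc2 : ∀ τ, cuspParam (2 * τ) = cuspParam τ ^ 2 := fun τ ↦ by
    simpa using cuspParam_natCast_mul 2 τ
  have hne : ∀ {τ : ℂ}, 0 < τ.im → ModularForm.eta τ ^ 24 ≠ 0 := fun h ↦
    pow_ne_zero _ (ModularForm.eta_ne_zero h)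
  set f : ℂ → ℂ := fun τ ↦ formD τ ^ 3 / (ModularForm.eta τ ^ 24 * ModularForm.eta (2 * τ) ^ 24)
    with hf
  have hT : ∀ τ : ℂ, 0 < τ.im → f (τ + 1) = f τ := by
    intro τ hτ
    have h1 : 0 < (τ + 1).im := by simpa using hτ
    simp only [hf]
    rw [formD_add_one, eta_pow_eq h1, eta_pow_eq hτ, eta_pow_eq (him2 h1), eta_pow_eq (him2 hτ),
      hc2, hc2, cuspParam_add_one]
  have hW : ∀ τ : ℂ, 0 < τ.im → f (frickeInv τ) = f τ := by
    intro τ hτ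
    have h0 := ne_zero_of_im_pos hτ
    have e1 : 2 * frickeInv τ = -1 / τ := by rw [frickeInv]; field_simp
    simp only [hf]
    rw [formD_frickeInv hτ, e1, eta_pow_inv hτ, frickeInv, eta_pow_inv (him2 hτ)]
    have := hne hτ
    have := hne (him2 hτ)
    field_simp
    ring
  have hd : DifferentiableOn ℂ f {τ : ℂ | 0 < τ.im} := by
    have he : DifferentiableOn ℂ ModularForm.eta {τ : ℂ | 0 < τ.im} := fun τ h ↦
      (ModularForm.differentiableAt_eta_of_mem_upperHalfPlaneSet h).differentiableWithinAt
    refine ((differentiableOn_form frickeD_mem).pow 3).div ((he.pow 24).mul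
      ((he.comp (differentiableOn_id.const_mul 2) fun _ h ↦ him2 h).pow 24)) ?_
    exact fun τ h ↦ mul_ne_zero (hne h) (hne (him2 h))
  have hL : Filter.Tendsto f imAtTop (nhds 1) := by
    set Φ : ℂ → ℂ := fun q ↦ ∏' n : ℕ, (1 - q ^ (n + 1)) ^ 24 with hΦ
    have hΦ0 : Φ 0 = 1 := by simp [hΦ]
    have hΦt : Filter.Tendsto Φ (nhds 0) (nhds 1) := by
      rw [← hΦ0]
      exact ((ModularForm.differentiableOn_tprod_one_sub_pow_pow 24).differentiableAt
        (Metric.ball_mem_nhds 0 one_pos)).continuousAt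
    have h1 := hΦt.comp tendsto_cuspParam
    have hsq : Filter.Tendsto (fun τ ↦ cuspParam τ ^ 2) imAtTop (nhds 0) := by
      simpa using tendsto_cuspParam.pow 2
    have h2 := hΦt.comp hsq
    have h3 := ((tendsto_form frickeDUnit_mem).pow 3).div (h1.mul h2) (by norm_num)
    rw [constantCoeff_frickeDUnit] at h3
    simp only [Int.cast_one, one_pow, mul_one, div_one] at h3
    refine h3.congr' ?_
    filter_upwards [eventually_im_pos] with τ hτ
    simp only [hf, Function.comp_apply, Pi.div_apply]
    rw [eta_pow_eq hτ, eta_pow_eq (him2 hτ), hc2, formD_eq hτ]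
    have := cuspParam_ne_zero τ
    rw [show (cuspParam τ * ∏' n : ℕ, (1 - cuspParam τ ^ (n + 1)) ^ 24) *
      (cuspParam τ ^ 2 * ∏' n : ℕ, (1 - (cuspParam τ ^ 2) ^ (n + 1)) ^ 24) =
      cuspParam τ ^ 3 * (Φ (cuspParam τ) * Φ (cuspParam τ ^ 2)) by simp only [hΦ]; ring,
      mul_pow, mul_div_mul_left _ _ (pow_ne_zero 3 this)]
  have h := eq_const_of_fricke_invariant hd hT hW hL hτ
  simp only [hf] at h
  rwa [div_eq_one_iff_eq (mul_ne_zero (hne hτ) (hne (him2 hτ)))] at h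

theorem formD_ne_zero {τ : ℂ} (hτ : 0 < τ.im) : formD τ ≠ 0 := by
  intro h
  have h1 := formD_cube_eq hτ
  rw [h, zero_pow (by norm_num)] at h1
  exact mul_ne_zero (pow_ne_zero 24 (ModularForm.eta_ne_zero hτ))
    (pow_ne_zero 24 (ModularForm.eta_ne_zero (z := 2 * τ) (by simpa [UpperHalfPlane.upperHalfPlaneSet] using hτ))) h1.symm

/-- The Hauptmodul `P ^ 4 / D`. -/
def hauptmodul (τ : ℂ) : ℂ := formP τ ^ 4 / formD τ

theorem hauptmodul_add_one (τ : ℂ) : hauptmodul (τ + 1) = hauptmodul τ := by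
  rw [hauptmodul, hauptmodul, formP_add_one, formD_add_one]

theorem hauptmodul_frickeInv {τ : ℂ} (hτ : 0 < τ.im) :
    hauptmodul (frickeInv τ) = hauptmodul τ := by
  have h0 := ne_zero_of_im_pos hτ
  have := formD_ne_zero hτ
  rw [hauptmodul, hauptmodul, formP_frickeInv hτ, formD_frickeInv hτ]
  field_simp
  ring

theorem hauptmodul_mob {a b c d : ℤ} (h : IsFricke a b c d) {τ : ℂ} (hτ : 0 < τ.im) :
    hauptmodul (mob a b c d τ) = hauptmodul τ :=
  fricke_invariant (fun τ _ ↦ hauptmodul_add_one τ) (fun _ h ↦ hauptmodul_frickeInv h) h hτ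

theorem differentiableOn_hauptmodul : DifferentiableOn ℂ hauptmodul {τ : ℂ | 0 < τ.im} :=
  ((differentiableOn_form frickeP_mem).pow 4).div (differentiableOn_form frickeD_mem)
    fun _ h ↦ formD_ne_zero h

theorem formD_mob {a b c d : ℤ} (h : IsFricke a b c d) {τ : ℂ} (hτ : 0 < τ.im) :
    (a * d - b * c : ℂ) ^ 4 * formD (mob a b c d τ) = (c * τ + d) ^ 8 * formD τ :=
  fricke_weight (fun τ _ ↦ formD_add_one τ) (fun _ h ↦ formD_frickeInv h) h hτ

theorem formP_mob {a b c d : ℤ} (h : IsFricke a b c d) {τ : ℂ} (hτ : 0 < τ.im) :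
    (a * d - b * c : ℂ) ^ 4 * formP (mob a b c d τ) ^ 4 = (c * τ + d) ^ 8 * formP τ ^ 4 :=
  fricke_weight (f := fun τ ↦ formP τ ^ 4) (fun τ _ ↦ by rw [formP_add_one])
    (fun τ h ↦ by rw [formP_frickeInv h]; ring) h hτ

/-- Homogeneous evaluation of an integer polynomial in degree `N`. -/
def homogEval {A : Type*} [CommRing A] (N : ℕ) (Q : ℤ[X]) (a d : A) : A :=
  ∑ i ∈ Finset.range (N + 1), ((Q.coeff i : ℤ) : A) * a ^ i * d ^ (N - i)

theorem map_homogEval {A B : Type*} [CommRing A] [CommRing B] (φ : A →+* B) (N : ℕ) (Q : ℤ[X])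
    (a d : A) : φ (homogEval N Q a d) = homogEval N Q (φ a) (φ d) := by
  simp [homogEval]

theorem homogEval_eq {K : Type*} [Field K] {N : ℕ} {Q : ℤ[X]} (hQ : Q.natDegree ≤ N) (a : K) {d : K}
    (hd : d ≠ 0) : homogEval N Q a d = d ^ N * Q.eval₂ (Int.castRingHom K) (a / d) := by
  rw [eval₂_eq_sum_range' _ (Nat.lt_succ_of_le hQ), Finset.mul_sum, homogEval]
  refine Finset.sum_congr rfl fun i hi ↦ ?_
  have hi : i ≤ N := Nat.lt_succ_iff.1 (Finset.mem_range.1 hi)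
  rw [div_pow, ← pow_sub_mul_pow d hi]
  simp only [eq_intCast]
  have := pow_ne_zero i hd
  field_simp

/-- The transformation law under the Fricke involution in weight `8 N`. -/
def IsFrickeForm (N : ℕ) (f : PowerSeries ℤ) : Prop :=
  f ∈ convergentSeries ∧ ∀ τ : ℂ, 0 < τ.im → seriesEval (cuspParam (frickeInv τ)) f =
    (16 * τ ^ 8) ^ N * seriesEval (cuspParam τ) f

theorem IsFrickeForm.sub {N : ℕ} {f g : PowerSeries ℤ} (hf : IsFrickeForm N f)
    (hg : IsFrickeForm N g) : IsFrickeForm N (f - g) := by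
  refine ⟨sub_mem hf.1 hg.1, fun τ hτ ↦ ?_⟩
  rw [seriesEval_sub (norm_cuspParam_lt_one (frickeInv_im_pos hτ)) hf.1 hg.1,
    seriesEval_sub (norm_cuspParam_lt_one hτ) hf.1 hg.1, hf.2 τ hτ, hg.2 τ hτ, mul_sub]

theorem isFrickeForm_monomial (n : ℤ) {N k : ℕ} (hk : k ≤ N) :
    IsFrickeForm N ((n : PowerSeries ℤ) * (frickeP ^ 4) ^ k * frickeD ^ (N - k)) := by
  have hn : (n : PowerSeries ℤ) ∈ convergentSeries := intCast_mem _ n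
  have hP := pow_mem (pow_mem frickeP_mem 4) k
  have hD := pow_mem frickeD_mem (N - k)
  refine ⟨mul_mem (mul_mem hn hP) hD, fun τ hτ ↦ ?_⟩
  have e : ∀ {z : ℂ}, ‖z‖ < 1 → seriesEval z ((n : PowerSeries ℤ) * (frickeP ^ 4) ^ k *
      frickeD ^ (N - k)) = n * (seriesEval z frickeP ^ 4) ^ k * seriesEval z frickeD ^ (N - k) := by
    intro z hz
    rw [seriesEval_mul hz (mul_mem hn hP) hD, seriesEval_mul hz hn hP, seriesEval_intCast,
      seriesEval_pow hz (pow_mem frickeP_mem 4), seriesEval_pow hz frickeP_mem,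
      seriesEval_pow hz frickeD_mem]
  rw [e (norm_cuspParam_lt_one (frickeInv_im_pos hτ)), e (norm_cuspParam_lt_one hτ)]
  change n * (formP (frickeInv τ) ^ 4) ^ k * formD (frickeInv τ) ^ (N - k) =
    (16 * τ ^ 8) ^ N * (n * (formP τ ^ 4) ^ k * formD τ ^ (N - k))
  rw [formP_frickeInv hτ, formD_frickeInv hτ, ← pow_mul_pow_sub (16 * τ ^ 8) hk]
  ring

theorem IsFrickeForm.eq_zero {N : ℕ} {f : PowerSeries ℤ} (hf : IsFrickeForm N f)
    (h : PowerSeries.X ^ (N + 1) ∣ f) : f = 0 := by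
  obtain ⟨g, rfl⟩ := h
  have hg : g ∈ convergentSeries := mem_convergentSeries_of_X_pow_mul hf.1
  set F : ℂ → ℂ := fun τ ↦ seriesEval (cuspParam τ) (PowerSeries.X ^ (N + 1) * g) / formD τ ^ N
    with hF
  have key : ∀ τ : ℂ, 0 < τ.im → F τ = 0 := by
    refine fun τ hτ ↦ eq_const_of_fricke_invariant (f := F) ?_ ?_ ?_ ?_ hτ
    · exact (differentiableOn_form hf.1).div ((differentiableOn_form frickeD_mem).pow N)
        fun τ hτ ↦ pow_ne_zero _ (formD_ne_zero hτ)
    · intro τ _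
      simp only [hF]
      rw [cuspParam_add_one, formD_add_one]
    · intro τ hτ
      simp only [hF]
      have h0 : (16 * τ ^ 8) ^ N ≠ 0 :=
        pow_ne_zero _ (mul_ne_zero (by norm_num) (pow_ne_zero 8 (ne_zero_of_im_pos hτ)))
      rw [hf.2 τ hτ, formD_frickeInv hτ, mul_pow _ (formD τ), mul_div_mul_left _ _ h0]
    · have h1 := (tendsto_cuspParam.mul (tendsto_form hg)).div
        ((tendsto_form frickeDUnit_mem).pow N) (by rw [constantCoeff_frickeDUnit]; simp)
      rw [zero_mul, zero_div] at h1
      refine h1.congr' ?_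
      filter_upwards [eventually_im_pos] with τ hτ
      simp only [hF, Pi.div_apply]
      have hz := norm_cuspParam_lt_one hτ
      rw [seriesEval_mul hz (pow_mem X_mem_convergentSeries _) hg,
        seriesEval_pow hz X_mem_convergentSeries, seriesEval_X, formD_eq hτ, mul_pow, pow_succ,
        mul_assoc (cuspParam τ ^ N), mul_div_mul_left _ _ (pow_ne_zero N (cuspParam_ne_zero τ))]
  refine eq_of_seriesEval_cuspParam_eq hf.1 (zero_mem _) fun τ hτ ↦ ?_
  have h1 := key τ hτ
  simp only [hF] at h1
  rw [div_eq_zero_iff, or_iff_left (pow_ne_zero _ (formD_ne_zero hτ))] at h1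
  rw [h1]
  simp [seriesEval]

/-- Forms of weight `8 N` are homogeneous polynomials in `P ^ 4` and `D`. -/
theorem IsFrickeForm.exists_polynomial {N : ℕ} {f : PowerSeries ℤ} {k : ℕ} (hf : IsFrickeForm N f)
    (hk : k ≤ N) (h : PowerSeries.X ^ (N - k) ∣ f) :
    ∃ Q : ℤ[X], Q.natDegree ≤ k ∧ Q.coeff k = PowerSeries.coeff (N - k) f ∧
      f = homogEval N Q (frickeP ^ 4) frickeD := by
  induction k generalizing f with
  | zero =>
    refine ⟨C (PowerSeries.coeff N f), by simp, by simp, ?_⟩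
    have h1 := hf.sub (isFrickeForm_monomial (PowerSeries.coeff N f) (Nat.zero_le N))
    rw [← sub_eq_zero, ← h1.eq_zero, homogEval, Finset.sum_range_succ',
      Finset.sum_eq_zero fun i _ ↦ by rw [coeff_C_succ]; simp]
    · simp
    · obtain ⟨g, rfl⟩ := h
      rw [frickeD_eq]
      simp only [pow_zero, mul_one, Nat.sub_zero, mul_pow]
      rw [show PowerSeries.X ^ N * g - ((PowerSeries.coeff N (PowerSeries.X ^ N * g) : ℤ) :
        PowerSeries ℤ) * (PowerSeries.X ^ N * frickeDUnit ^ N) = PowerSeries.X ^ N *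
        (g - ((PowerSeries.coeff N (PowerSeries.X ^ N * g) : ℤ) : PowerSeries ℤ) *
          frickeDUnit ^ N) by ring, pow_succ]
      refine mul_dvd_mul_left _ (PowerSeries.X_dvd_iff.2 ?_)
      have e := PowerSeries.coeff_X_pow_mul g N 0
      rw [zero_add] at e
      rw [e]
      simp [constantCoeff_frickeDUnit]
  | succ k ih =>
    set n := PowerSeries.coeff (N - (k + 1)) f with hn
    have h1 := hf.sub (isFrickeForm_monomial n hk)
    obtain ⟨Q, hQ1, -, hQ3⟩ := ih h1 (by omega) (by
      obtain ⟨g, rfl⟩ := h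
      rw [frickeD_eq]
      simp only [mul_pow]
      rw [show PowerSeries.X ^ (N - (k + 1)) * g - (n : PowerSeries ℤ) * (frickeP ^ 4) ^ (k + 1) *
        (PowerSeries.X ^ (N - (k + 1)) * frickeDUnit ^ (N - (k + 1))) =
        PowerSeries.X ^ (N - (k + 1)) * (g - (n : PowerSeries ℤ) * (frickeP ^ 4) ^ (k + 1) *
          frickeDUnit ^ (N - (k + 1))) by ring, show N - k = N - (k + 1) + 1 by omega, pow_succ]
      refine mul_dvd_mul_left _ (PowerSeries.X_dvd_iff.2 ?_)
      have e := PowerSeries.coeff_X_pow_mul g (N - (k + 1)) 0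
      rw [zero_add] at e
      rw [hn, e]
      simp [constantCoeff_frickeDUnit, constantCoeff_frickeP])
    have hdeg : Q.coeff (k + 1) = 0 := coeff_eq_zero_of_natDegree_lt (by omega)
    refine ⟨Q + C n * X ^ (k + 1), ?_, ?_, ?_⟩
    · refine natDegree_add_le_of_degree_le (by omega) (natDegree_C_mul_X_pow_le _ _)
    · simp [hdeg]
    · rw [sub_eq_iff_eq_add] at hQ3
      rw [hQ3, homogEval, homogEval]
      simp only [coeff_add, Int.cast_add, add_mul, Finset.sum_add_distrib, coeff_C_mul_X_pow]
      congr 1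
      rw [Finset.sum_eq_single (k + 1)]
      · simp
      · intro b _ hb; simp [hb]
      · intro hb; exact absurd (Finset.mem_range.2 (by omega)) hb

theorem exists_hauptmodul_eq (c : ℂ) : ∃ τ : ℂ, 0 < τ.im ∧ hauptmodul τ = c := by
  by_contra! hne
  set F : ℂ → ℂ := fun τ ↦ formD τ / (formP τ ^ 4 - c * formD τ) with hF
  have hne' : ∀ τ : ℂ, 0 < τ.im → formP τ ^ 4 - c * formD τ ≠ 0 := fun τ hτ h ↦
    hne τ hτ (by rw [hauptmodul, div_eq_iff (formD_ne_zero hτ)]; linear_combination h)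
  have key : ∀ τ : ℂ, 0 < τ.im → F τ = 0 := by
    refine fun τ hτ ↦ eq_const_of_fricke_invariant (f := F) ?_ ?_ ?_ ?_ hτ
    · exact (differentiableOn_form frickeD_mem).div (((differentiableOn_form frickeP_mem).pow 4).sub
        ((differentiableOn_form frickeD_mem).const_mul c)) hne'
    · intro τ _
      simp only [hF, formP_add_one, formD_add_one]
    · intro τ hτ
      simp only [hF]
      have h0 : 16 * τ ^ 8 ≠ 0 := mul_ne_zero (by norm_num) (pow_ne_zero 8 (ne_zero_of_im_pos hτ))
      rw [formP_frickeInv hτ, formD_frickeInv hτ, show (-2 * τ ^ 2 * formP τ) ^ 4 -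
        c * (16 * τ ^ 8 * formD τ) = 16 * τ ^ 8 * (formP τ ^ 4 - c * formD τ) by ring,
        mul_div_mul_left _ _ h0]
    · have hD := tendsto_form frickeD_mem
      have hP := tendsto_form frickeP_mem
      rw [constantCoeff_frickeP] at hP
      rw [frickeD_eq] at hD
      simp only [map_mul, PowerSeries.constantCoeff_X, zero_mul, Int.cast_zero, Int.cast_one]
        at hD hP
      rw [← frickeD_eq] at hD
      have h := hD.div ((hP.pow 4).sub (hD.const_mul c)) (by simp)
      rwa [zero_div] at h
  have h1 := key Complex.I (by simp)
  simp only [hF, div_eq_zero_iff] at h1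
  rcases h1 with h | h
  · exact formD_ne_zero (by simp) h
  · exact hne' _ (by simp) h

theorem continuousAt_mob {a b c d : ℤ} (h : 0 < a * d - b * c) {τ : ℂ} (hτ : 0 < τ.im) :
    ContinuousAt (mob a b c d) τ :=
  ContinuousAt.div (by fun_prop) (by fun_prop) (denom_ne_zero h hτ)

theorem abs_le_of_norm_le {a b : ℤ} {τ : ℂ} {R y B : ℝ} (hy : 0 < y) (h1 : y ≤ τ.im)
    (hR : ‖τ‖ ≤ R) (h : ‖(a * τ + b : ℂ)‖ ≤ B) : |(a : ℝ)| ≤ B / y ∧ |(b : ℝ)| ≤ B + B / y * R := by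
  have h2 : |(a : ℝ)| ≤ B / y := by
    rw [le_div_iff₀ hy]
    calc |(a : ℝ)| * y ≤ |(a : ℝ)| * τ.im := by gcongr
      _ = |(a * τ + b : ℂ).im| := by
        rw [show (a * τ + b : ℂ).im = a * τ.im by simp, abs_mul, abs_of_pos (hy.trans_le h1)]
      _ ≤ ‖(a * τ + b : ℂ)‖ := Complex.abs_im_le_norm _
      _ ≤ B := h
  refine ⟨h2, ?_⟩
  have h3 : |(b : ℝ)| = ‖(b : ℂ)‖ := by rw [Complex.norm_intCast]
  rw [h3, show (b : ℂ) = (a * τ + b) - a * τ by ring]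
  refine (norm_sub_le _ _).trans (add_le_add h ?_)
  rw [norm_mul, Complex.norm_intCast]
  have := (abs_nonneg _).trans h2
  gcongr

/-- Proper discontinuity of the Fricke group. -/
theorem finite_isFricke {R y : ℝ} (hy : 0 < y) :
    {m : ℤ × ℤ × ℤ × ℤ | IsFricke m.1 m.2.1 m.2.2.1 m.2.2.2 ∧ ∃ τ : ℂ, y ≤ τ.im ∧ ‖τ‖ ≤ R ∧
      y ≤ (mob m.1 m.2.1 m.2.2.1 m.2.2.2 τ).im ∧
      ‖mob m.1 m.2.1 m.2.2.1 m.2.2.2 τ‖ ≤ R}.Finite := by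
  set S := √(2 * R / y) with hS
  set B := max S (R * S) with hB
  set C := ⌈max (B / y) (B + B / y * R)⌉ with hC
  refine Set.Finite.subset (Set.Finite.prod (Set.finite_Icc (-C) C) (Set.Finite.prod
    (Set.finite_Icc (-C) C) (Set.Finite.prod (Set.finite_Icc (-C) C) (Set.finite_Icc (-C) C)))) ?_
  rintro ⟨a, b, c, d⟩ ⟨hF, τ, h1, h2, h3, h4⟩
  simp only at hF h3 h4
  have hτ : 0 < τ.im := hy.trans_le h1
  have hne := denom_ne_zero hF.det_pos hτ
  have hR : 0 ≤ R := (norm_nonneg _).trans h2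
  have hcd : ‖(c * τ + d : ℂ)‖ ≤ S := by
    refine Real.le_sqrt_of_sq_le ?_
    rw [← Complex.normSq_eq_norm_sq, le_div_iff₀ hy]
    have h5 := mob_im a b c d τ
    rw [eq_div_iff (Complex.normSq_pos.2 hne).ne'] at h5
    have h6 : ((a * d - b * c : ℤ) : ℝ) ≤ 2 := by
      have : a * d - b * c ≤ 2 := by rcases hF with ⟨-, h | ⟨-, -, h⟩⟩ <;> omega
      exact_mod_cast this
    have h7 : τ.im ≤ R := (Complex.im_le_norm τ).trans h2
    calc Complex.normSq (c * τ + d) * y ≤ (mob a b c d τ).im * Complex.normSq (c * τ + d) := by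
          rw [mul_comm]; gcongr; exact Complex.normSq_nonneg _
      _ = ((a * d - b * c : ℤ) : ℝ) * τ.im := h5
      _ ≤ 2 * R := by gcongr
  have hab : ‖(a * τ + b : ℂ)‖ ≤ R * S := by
    have : (a * τ + b : ℂ) = mob a b c d τ * (c * τ + d) := by rw [mob, div_mul_cancel₀ _ hne]
    rw [this, norm_mul]
    gcongr
  have key : ∀ {m : ℤ}, |(m : ℝ)| ≤ max (B / y) (B + B / y * R) → m ∈ Set.Icc (-C) C := by
    intro m hm
    rw [Set.mem_Icc, ← abs_le]
    have := hm.trans (Int.le_ceil _)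
    exact_mod_cast this
  obtain ⟨k1, k2⟩ := abs_le_of_norm_le hy h1 h2 (hcd.trans (le_max_left _ (R * S)))
  obtain ⟨k3, k4⟩ := abs_le_of_norm_le hy h1 h2 (hab.trans (le_max_right S _))
  exact ⟨key (le_max_of_le_left k3), key (le_max_of_le_right k4), key (le_max_of_le_left k1),
    key (le_max_of_le_right k2)⟩

/-- Equivalence of two points under the Fricke group. -/
def FrickeEquiv (x y : ℂ) : Prop := ∃ a b c d : ℤ, IsFricke a b c d ∧ mob a b c d x = y

theorem exists_isFricke_of_frequently {l : Filter (ℂ × ℂ)} {x y : ℂ} (hx : 0 < x.im) (hy : 0 < y.im)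
    (hl : l ≤ nhds (x, y)) (h : ∃ᶠ z in l, FrickeEquiv z.1 z.2) :
    ∃ a b c d : ℤ, IsFricke a b c d ∧ mob a b c d x = y ∧ ∃ᶠ z in l, mob a b c d z.1 = z.2 := by
  set η := min (x.im / 2) (y.im / 2)
  have hη : 0 < η := lt_min (by linarith) (by linarith)
  set R := max (‖x‖ + 1) (‖y‖ + 1)
  have hev : ∀ᶠ z : ℂ × ℂ in nhds (x, y), η ≤ z.1.im ∧ ‖z.1‖ ≤ R ∧ η ≤ z.2.im ∧ ‖z.2‖ ≤ R := by
    have e1 : ∀ᶠ z : ℂ in nhds x, η ≤ z.im ∧ ‖z‖ ≤ R := by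
      have k1 : η < x.im := (min_le_left _ _).trans_lt (by linarith)
      have k2 : ‖x‖ < R := (lt_add_one _).trans_le (le_max_left _ _)
      exact ((Complex.continuous_im.continuousAt.eventually_const_le k1)).and
        (continuous_norm.continuousAt.eventually_le_const k2)
    have e2 : ∀ᶠ z : ℂ in nhds y, η ≤ z.im ∧ ‖z‖ ≤ R := by
      have k1 : η < y.im := (min_le_right _ _).trans_lt (by linarith)
      have k2 : ‖y‖ < R := (lt_add_one _).trans_le (le_max_right _ _)
      exact ((Complex.continuous_im.continuousAt.eventually_const_le k1)).and
        (continuous_norm.continuousAt.eventually_le_const k2)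
    filter_upwards [e1.prod_nhds e2] with z hz
    exact ⟨hz.1.1, hz.1.2, hz.2.1, hz.2.2⟩
  have h2 := h.and_eventually (hl hev)
  have h3 : ∃ᶠ z in l, ∃ m ∈ {m : ℤ × ℤ × ℤ × ℤ | IsFricke m.1 m.2.1 m.2.2.1 m.2.2.2 ∧
      ∃ τ : ℂ, η ≤ τ.im ∧ ‖τ‖ ≤ R ∧ η ≤ (mob m.1 m.2.1 m.2.2.1 m.2.2.2 τ).im ∧
      ‖mob m.1 m.2.1 m.2.2.1 m.2.2.2 τ‖ ≤ R}, mob m.1 m.2.1 m.2.2.1 m.2.2.2 z.1 = z.2 := by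
    refine h2.mono ?_
    rintro z ⟨⟨a, b, c, d, hF, e⟩, k1, k2, k3, k4⟩
    exact ⟨(a, b, c, d), ⟨hF, z.1, k1, k2, by rwa [e], by rwa [e]⟩, e⟩
  have h4 : ∃ m ∈ {m : ℤ × ℤ × ℤ × ℤ | IsFricke m.1 m.2.1 m.2.2.1 m.2.2.2 ∧
      ∃ τ : ℂ, η ≤ τ.im ∧ ‖τ‖ ≤ R ∧ η ≤ (mob m.1 m.2.1 m.2.2.1 m.2.2.2 τ).im ∧
      ‖mob m.1 m.2.1 m.2.2.1 m.2.2.2 τ‖ ≤ R},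
      ∃ᶠ z in l, mob m.1 m.2.1 m.2.2.1 m.2.2.2 z.1 = z.2 := by
    by_contra! hcon
    refine h3 ?_
    have := (Filter.eventually_all_finite (finite_isFricke (R := R) hη) (l := l)
      (p := fun m z ↦ ¬ mob m.1 m.2.1 m.2.2.1 m.2.2.2 z.1 = z.2)).2 fun m hm ↦
        by simpa using hcon m hm
    filter_upwards [this] with z hz
    rintro ⟨m, hm, e⟩
    exact hz m hm e
  obtain ⟨⟨a, b, c, d⟩, ⟨hF, -⟩, hfr⟩ := h4
  refine ⟨a, b, c, d, hF, ?_, hfr⟩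
  by_contra hne
  have hc : ContinuousAt (fun z : ℂ × ℂ ↦ mob a b c d z.1) (x, y) :=
    (continuousAt_mob hF.det_pos hx).comp (f := Prod.fst) (x := (x, y)) continuousAt_fst
  have := hl ((hc.ne_iff_eventually_ne continuousAt_snd).1 hne)
  exact hfr (by filter_upwards [this] with z hz; exact hz)

theorem analyticOnNhd_hauptmodul : AnalyticOnNhd ℂ hauptmodul {τ : ℂ | 0 < τ.im} :=
  differentiableOn_hauptmodul.analyticOnNhd isOpen_im_pos

theorem hauptmodul_nonconstant (c : ℂ) : ¬ Set.EqOn hauptmodul (fun _ ↦ c) {τ : ℂ | 0 < τ.im} := by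
  intro h
  obtain ⟨τ, hτ, e⟩ := exists_hauptmodul_eq (c + 1)
  rw [h hτ] at e
  simp at e

theorem hauptmodul_nhds_le {τ : ℂ} (hτ : 0 < τ.im) :
    nhds (hauptmodul τ) ≤ Filter.map hauptmodul (nhds τ) := by
  rcases (analyticOnNhd_hauptmodul τ hτ).eventually_constant_or_nhds_le_map_nhds with h | h
  · exact absurd (analyticOnNhd_hauptmodul.eqOn_of_preconnected_of_eventuallyEq
      analyticOnNhd_const isPreconnected_im_pos hτ h) (hauptmodul_nonconstant _)
  · exact h

/-- Values of the Hauptmodul at which it is ramified. -/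
def criticalValues : Set ℂ := hauptmodul '' {τ : ℂ | 0 < τ.im ∧ deriv hauptmodul τ = 0}

theorem countable_criticalValues : criticalValues.Countable := by
  refine Set.Countable.image ?_ _
  have han : AnalyticOnNhd ℂ (deriv hauptmodul) {τ : ℂ | 0 < τ.im} := analyticOnNhd_hauptmodul.deriv
  obtain ⟨τ₁, h1, h2⟩ : ∃ τ₁ : ℂ, 0 < τ₁.im ∧ deriv hauptmodul τ₁ ≠ 0 := by
    by_contra! hcon
    refine hauptmodul_nonconstant (hauptmodul Complex.I) ?_
    intro τ hτ
    exact isOpen_im_pos.is_const_of_deriv_eq_zero isPreconnected_im_pos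
      differentiableOn_hauptmodul (fun x hx ↦ hcon x hx) hτ (show 0 < Complex.I.im by simp)
  have hco := han.preimage_zero_mem_codiscreteWithin h2 h1
    ⟨⟨τ₁, h1⟩, isPreconnected_im_pos⟩
  have hd := isDiscrete_of_codiscreteWithin (U := {τ : ℂ | 0 < τ.im})
    (s := (deriv hauptmodul ⁻¹' {0}ᶜ)ᶜ) (by rwa [compl_compl])
  refine ((HereditarilyLindelofSpace.isLindelof _).countable_of_isDiscrete hd).mono ?_
  rintro τ ⟨k1, k2⟩
  exact ⟨by simpa using k2, k1⟩

theorem HasStrictDerivAt.eventually_injective {f : ℂ → ℂ} {f' a : ℂ} (hf : HasStrictDerivAt f f' a)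
    (h : f' ≠ 0) : ∀ᶠ z : ℂ × ℂ in nhds (a, a), f z.1 = f z.2 → z.1 = z.2 := by
  have h1 := (hf.hasStrictFDerivAt_equiv h).eventually_left_inverse
  filter_upwards [h1.prod_nhds h1] with z hz e
  rw [← hz.1, ← hz.2, e]

theorem hauptmodul_eventually_injective {τ : ℂ} (hτ : 0 < τ.im) (h : deriv hauptmodul τ ≠ 0) :
    ∀ᶠ z : ℂ × ℂ in nhds (τ, τ), hauptmodul z.1 = hauptmodul z.2 → z.1 = z.2 :=
  (analyticOnNhd_hauptmodul τ hτ).hasStrictDerivAt.eventually_injective h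

theorem frickeEquiv_of_cuspParam_eq {x y : ℂ} (h : cuspParam x = cuspParam y) :
    FrickeEquiv x y := by
  rw [cuspParam, cuspParam, Complex.exp_eq_exp_iff_exists_int] at h
  obtain ⟨n, hn⟩ := h
  refine ⟨1, -n, 0, 1, ⟨dvd_zero _, Or.inl (by ring)⟩, ?_⟩
  have h2 : (2 * Real.pi * Complex.I : ℂ) ≠ 0 := Complex.two_pi_I_ne_zero
  have : x = y + n := mul_left_cancel₀ h2 (by linear_combination hn)
  rw [mob, this]
  push_cast
  ring

theorem exists_frickeEquiv_of_im_ge : ∃ B : ℝ, ∀ x y : ℂ, B ≤ x.im → B ≤ y.im →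
    hauptmodul x = hauptmodul y → FrickeEquiv x y := by
  set g : ℂ → ℂ := fun z ↦ seriesEval z frickeDUnit / seriesEval z frickeP ^ 4 with hg
  have hball := Metric.ball_mem_nhds (0 : ℂ) one_pos
  have han : ∀ {f : PowerSeries ℤ}, f ∈ convergentSeries →
      AnalyticAt ℂ (fun z ↦ seriesEval z f) 0 := fun hf ↦
    (differentiableOn_seriesEval hf).analyticAt hball
  have hP0 : seriesEval 0 frickeP ^ 4 ≠ 0 := by
    rw [seriesEval_zero_left, constantCoeff_frickeP]; simp
  have hga : AnalyticAt ℂ g 0 := (han frickeDUnit_mem).div ((han frickeP_mem).pow 4) hP0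
  have hg0 : g 0 = 1 := by
    simp only [hg]
    rw [seriesEval_zero_left, seriesEval_zero_left, constantCoeff_frickeP, constantCoeff_frickeDUnit]
    simp
  have hs : HasStrictDerivAt (fun z ↦ z * g z) (1 * g 0 + 0 * deriv g 0) 0 :=
    (hasStrictDerivAt_id (0 : ℂ)).mul hga.hasStrictDerivAt
  have hev := hs.eventually_injective (by simp [hg0])
  have hev2 := (Filter.Tendsto.prodMap tendsto_cuspParam tendsto_cuspParam).eventually
    (by rwa [nhds_prod_eq] at hev)
  obtain ⟨p, hp, p', hp', hpp⟩ := Filter.eventually_prod_iff.1 hev2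
  obtain ⟨B, hB⟩ := eventually_imAtTop.1 hp
  obtain ⟨B', hB'⟩ := eventually_imAtTop.1 hp'
  refine ⟨max 1 (max B B'), fun x y hx hy h ↦ frickeEquiv_of_cuspParam_eq ?_⟩
  refine hpp (hB x ((le_max_left _ _).trans ((le_max_right _ _).trans hx)))
    (hB' y ((le_max_right _ _).trans ((le_max_right _ _).trans hy))) ?_
  have key : ∀ τ : ℂ, max 1 (max B B') ≤ τ.im →
      cuspParam τ * g (cuspParam τ) = (hauptmodul τ)⁻¹ := by
    intro τ h
    have hτ : 0 < τ.im := one_pos.trans_le ((le_max_left _ _).trans h)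
    simp only [hg]
    rw [hauptmodul, inv_div, formD_eq hτ, mul_div_assoc, formP]
  change cuspParam x * g (cuspParam x) = cuspParam y * g (cuspParam y)
  rw [key x hx, key y hy, h]

theorem exists_norm_hauptmodul_le (B : ℝ) : ∃ R : ℝ, ∀ τ : ℂ, 2 / 5 ≤ τ.im → |τ.re| ≤ 1 →
    R < ‖hauptmodul τ‖ → B < τ.im := by
  have hc : ContinuousOn hauptmodul (Set.Icc (-1 : ℝ) 1 ×ℂ Set.Icc (2 / 5) B) :=
    differentiableOn_hauptmodul.continuousOn.mono fun τ h ↦ by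
      have := (mem_strip.1 h).2.1
      change 0 < τ.im; linarith
  obtain ⟨R, hR⟩ := (isCompact_strip (2 / 5) B).exists_bound_of_continuousOn hc
  refine ⟨R, fun τ h1 h2 h3 ↦ ?_⟩
  by_contra! h4
  exact absurd (hR τ (mem_strip.2 ⟨h2, h1, h4⟩)) (not_le.2 h3)

theorem exists_lt_norm_hauptmodul (R : ℝ) : ∃ B : ℝ, ∀ τ : ℂ, B ≤ τ.im → R < ‖hauptmodul τ‖ := by
  rw [← eventually_imAtTop]
  have hD := tendsto_form frickeD_mem
  have hP := tendsto_form frickeP_mem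
  rw [constantCoeff_frickeP] at hP
  rw [frickeD_eq, map_mul, PowerSeries.constantCoeff_X, zero_mul, ← frickeD_eq] at hD
  have h1 := (hD.div (hP.pow 4) (by simp)).norm
  rw [Int.cast_zero, zero_div, norm_zero] at h1
  have hR : 0 < 1 / (|R| + 1) := by positivity
  have hP1 : ∀ᶠ τ in imAtTop, seriesEval (cuspParam τ) frickeP ≠ 0 :=
    hP.eventually_ne (by simp)
  filter_upwards [h1.eventually_lt_const hR, eventually_im_pos, hP1] with τ e hτ hne
  simp only [Pi.div_apply] at e
  have hne' : (formP τ ^ 4) ≠ 0 := pow_ne_zero 4 hne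
  have e2 : ‖(hauptmodul τ)⁻¹‖ < 1 / (|R| + 1) := by
    rwa [hauptmodul, inv_div]
  rw [norm_inv, one_div] at e2
  have h3 : 0 < ‖hauptmodul τ‖ := norm_pos_iff.2 (div_ne_zero hne' (formD_ne_zero hτ))
  have h4 := (inv_lt_inv₀ h3 (by positivity)).1 e2
  have := le_abs_self R
  linarith

theorem FrickeEquiv.trans {x y z : ℂ} (hx : 0 < x.im) (h1 : FrickeEquiv x y)
    (h2 : FrickeEquiv y z) : FrickeEquiv x z := by
  obtain ⟨a, b, c, d, h, rfl⟩ := h1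
  obtain ⟨a', b', c', d', h', rfl⟩ := h2
  rw [mob_mob (denom_ne_zero h.det_pos hx)]
  obtain ⟨c₁, hc⟩ := h.1
  obtain ⟨c₁', hc'⟩ := h'.1
  rcases h.2 with hd | ⟨⟨a₁, ha⟩, ⟨d₁, hd₁⟩, hd⟩ <;>
  rcases h'.2 with hd' | ⟨⟨a₁', ha'⟩, ⟨d₁', hd₁'⟩, hd'⟩
  · exact ⟨_, _, _, _, ⟨⟨c₁' * a + d' * c₁, by rw [hc, hc']; ring⟩, Or.inl (by
      linear_combination hd' * (a * d - b * c) + hd)⟩, rfl⟩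
  · exact ⟨_, _, _, _, ⟨⟨c₁' * a + d' * c₁, by rw [hc, hc']; ring⟩, Or.inr ⟨⟨a₁' * a + b' * c₁, by
      rw [ha', hc]; ring⟩, ⟨c₁' * b + d₁' * d, by rw [hc', hd₁']; ring⟩, by
      linear_combination hd' * (a * d - b * c) + 2 * hd⟩⟩, rfl⟩
  · exact ⟨_, _, _, _, ⟨⟨c₁' * a + d' * c₁, by rw [hc, hc']; ring⟩, Or.inr ⟨⟨a' * a₁ + b' * c₁, by
      rw [ha, hc]; ring⟩, ⟨c₁' * b + d' * d₁, by rw [hc', hd₁]; ring⟩, by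
      linear_combination hd' * (a * d - b * c) + hd⟩⟩, rfl⟩
  · refine ⟨a₁' * a + b' * c₁, a₁' * b + b' * d₁, c₁' * a + d₁' * c, c₁' * b + d₁' * d,
      ⟨⟨c₁' * a₁ + d₁' * c₁, by rw [ha, hc]; ring⟩, Or.inl ?_⟩, ?_⟩
    · have e : 4 * ((a₁' * a + b' * c₁) * (c₁' * b + d₁' * d) -
          (a₁' * b + b' * d₁) * (c₁' * a + d₁' * c)) = 4 * 1 := by
        subst ha hc hd₁ ha' hc' hd₁'
        linear_combination hd' * (2 * a₁ * (2 * d₁) - b * (2 * c₁)) + 2 * hd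
      linarith
    · rw [← mob_scale two_ne_zero]
      subst ha hc hd₁ ha' hc' hd₁'
      congr 1 <;> ring

theorem FrickeEquiv.symm {x y : ℂ} (hx : 0 < x.im) (h : FrickeEquiv x y) : FrickeEquiv y x := by
  obtain ⟨a, b, c, d, h, rfl⟩ := h
  have hI : IsFricke d (-b) (-c) a := by
    rcases h with ⟨h1, h2 | ⟨h2, h3, h4⟩⟩
    · exact ⟨h1.neg_right, Or.inl (by linarith)⟩
    · exact ⟨h1.neg_right, Or.inr ⟨h3, h2, by linarith⟩⟩
  refine ⟨d, -b, -c, a, hI, ?_⟩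
  rw [mob_mob (denom_ne_zero h.det_pos hx)]
  have h0 := h.det_pos
  rw [← mob_one x, mob_mob (by simp), ← mob_scale h0.ne' 1 0 0 1]
  congr 1 <;> ring

theorem FrickeEquiv.hauptmodul_eq {x y : ℂ} (hx : 0 < x.im) (h : FrickeEquiv x y) :
    hauptmodul x = hauptmodul y := by
  obtain ⟨a, b, c, d, h, rfl⟩ := h
  exact (hauptmodul_mob h hx).symm

/-- Values of the Hauptmodul taken at two inequivalent points. -/
def multipleValues : Set ℂ := {c | ∃ x y : ℂ, 0 < x.im ∧ 0 < y.im ∧ hauptmodul x = c ∧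
  hauptmodul y = c ∧ ¬ FrickeEquiv x y}

theorem isOpen_multipleValues : IsOpen multipleValues := by
  rw [isOpen_iff_mem_nhds]
  rintro c ⟨x, y, hx, hy, rfl, hc, hne⟩
  have h1 : ∀ᶠ z : ℂ × ℂ in nhds (x, y), ¬ FrickeEquiv z.1 z.2 := by
    by_contra h
    obtain ⟨a, b, c, d, h1, h2, -⟩ := exists_isFricke_of_frequently hx hy le_rfl h
    exact hne ⟨a, b, c, d, h1, h2⟩
  have hx' := isOpen_im_pos.mem_nhds hx
  have hy' := isOpen_im_pos.mem_nhds hy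
  obtain ⟨A, hA, B, hB, hAB⟩ := mem_nhds_prod_iff.1 (Filter.inter_mem h1 (prod_mem_nhds hx' hy'))
  have k1 : hauptmodul '' A ∈ nhds (hauptmodul x) :=
    hauptmodul_nhds_le hx (Filter.image_mem_map hA)
  have k2 : hauptmodul '' B ∈ nhds (hauptmodul x) :=
    hc ▸ hauptmodul_nhds_le hy (Filter.image_mem_map hB)
  filter_upwards [k1, k2]
  rintro _ ⟨x', hx', rfl⟩ ⟨y', hy', e⟩
  obtain ⟨k3, k4, k5⟩ := hAB (Set.mk_mem_prod hx' hy')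
  exact ⟨x', y', k4, k5, rfl, e, k3⟩

theorem exists_mem_strip_of_mem_multipleValues {c : ℂ} (hc : c ∈ multipleValues) :
    ∃ x y : ℂ, (2 / 5 ≤ x.im ∧ |x.re| ≤ 1) ∧ (2 / 5 ≤ y.im ∧ |y.re| ≤ 1) ∧ hauptmodul x = c ∧
      hauptmodul y = c ∧ ¬ FrickeEquiv x y := by
  obtain ⟨x, y, hx, hy, e1, e2, hne⟩ := hc
  obtain ⟨a, b, c, d, h, h1⟩ := exists_isFricke_mem_strip hx
  obtain ⟨a', b', c', d', h', h1'⟩ := exists_isFricke_mem_strip hy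
  refine ⟨_, _, h1, h1', ?_, ?_, fun h2 ↦ hne ?_⟩
  · rw [hauptmodul_mob h hx, e1]
  · rw [hauptmodul_mob h' hy, e2]
  · exact (FrickeEquiv.trans hx ⟨a, b, c, d, h, rfl⟩ h2).trans hx
      (FrickeEquiv.symm hy ⟨a', b', c', d', h', rfl⟩)

theorem multipleValues_bounded : ∃ R : ℝ, ∀ c ∈ multipleValues, ‖c‖ ≤ R := by
  obtain ⟨B, hB⟩ := exists_frickeEquiv_of_im_ge
  obtain ⟨R, hR⟩ := exists_norm_hauptmodul_le B
  refine ⟨R, fun c hc ↦ ?_⟩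
  by_contra! hlt
  obtain ⟨x, y, hx, hy, e1, e2, hne⟩ := exists_mem_strip_of_mem_multipleValues hc
  exact hne (hB x y (hR x hx.1 hx.2 (e1 ▸ hlt)).le (hR y hy.1 hy.2 (e2 ▸ hlt)).le (e1.trans e2.symm))

theorem exists_mem_closure_pairs {f : ℂ → ℂ} {K : Set ℂ} (hK : IsCompact K) (hf : ContinuousOn f K)
    (r : ℂ → ℂ → Prop) {S : Set ℂ} (hS : ∀ c ∈ S, ∃ x ∈ K, ∃ y ∈ K, f x = c ∧ f y = c ∧ r x y)
    {c : ℂ} (hc : c ∈ closure S) :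
    ∃ x ∈ K, ∃ y ∈ K, f x = c ∧ f y = c ∧
      ∃ᶠ z in nhds (x, y), z.1 ∈ K ∧ f z.1 = f z.2 ∧ r z.1 z.2 := by
  obtain ⟨A, hA⟩ : ∃ A : Set (ℂ × ℂ), ∀ z, z ∈ A ↔ z ∈ K ×ˢ K ∧ f z.1 = f z.2 ∧ r z.1 z.2 :=
    ⟨{z | z ∈ K ×ˢ K ∧ f z.1 = f z.2 ∧ r z.1 z.2}, fun z ↦ Iff.rfl⟩
  have hAK : closure A ⊆ K ×ˢ K :=
    closure_minimal (fun z hz ↦ ((hA z).1 hz).1) (hK.prod hK).isClosed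
  have hAc : IsCompact (closure A) := (hK.prod hK).of_isClosed_subset isClosed_closure hAK
  have hc1 : ContinuousOn (fun z : ℂ × ℂ ↦ f z.1) (closure A) :=
    hf.comp continuousOn_fst fun z hz ↦ (hAK hz).1
  have hc2 : ContinuousOn (fun z : ℂ × ℂ ↦ f z.2) (closure A) :=
    hf.comp continuousOn_snd fun z hz ↦ (hAK hz).2
  have himg : closure S ⊆ (fun z : ℂ × ℂ ↦ f z.1) '' closure A := by
    refine closure_minimal ?_ (hAc.image_of_continuousOn hc1).isClosed
    intro c hc
    obtain ⟨x, hx, y, hy, e1, e2, hne⟩ := hS c hc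
    exact ⟨(x, y), subset_closure ((hA _).2 ⟨⟨hx, hy⟩, e1.trans e2.symm, hne⟩), e1⟩
  obtain ⟨⟨x, y⟩, hz, e⟩ := himg hc
  have hEq : Set.EqOn (fun z : ℂ × ℂ ↦ f z.1) (fun z : ℂ × ℂ ↦ f z.2) (closure A) :=
    Set.EqOn.of_subset_closure (fun z hz ↦ ((hA z).1 hz).2.1) hc1 hc2 subset_closure subset_rfl
  have hxy : f x = f y := hEq hz
  refine ⟨x, (hAK hz).1, y, (hAK hz).2, e, hxy.symm.trans e, ?_⟩
  refine (mem_closure_iff_frequently.1 hz).mono fun z hz ↦ ?_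
  obtain ⟨h1, h2⟩ := (hA z).1 hz
  exact ⟨h1.1, h2⟩

theorem mem_multipleValues_of_mem_closure {c : ℂ} (hc : c ∈ closure multipleValues)
    (hcr : c ∉ criticalValues) : c ∈ multipleValues := by
  obtain ⟨R, hR⟩ := multipleValues_bounded
  obtain ⟨B, hB⟩ := exists_lt_norm_hauptmodul R
  obtain ⟨K, hK⟩ : ∃ K, K = Set.Icc (-1 : ℝ) 1 ×ℂ Set.Icc (2 / 5) B := ⟨_, rfl⟩
  have hKc : IsCompact K := hK ▸ isCompact_strip _ _
  have hpos : ∀ x ∈ K, 0 < x.im := fun x hx ↦ by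
    rw [hK] at hx
    have := (mem_strip.1 hx).2.1
    linarith
  have hcont : ContinuousOn hauptmodul K := differentiableOn_hauptmodul.continuousOn.mono hpos
  have hbd : ∀ c ∈ multipleValues, ∀ x : ℂ, hauptmodul x = c → x.im ≤ B := by
    intro c hc x e
    by_contra! h
    have h1 := hB x h.le
    rw [e] at h1
    exact absurd (hR c hc) (not_le.2 h1)
  obtain ⟨x, hxK, y, hyK, e, e', hfr⟩ := exists_mem_closure_pairs hKc hcont
    (fun x y ↦ ¬ FrickeEquiv x y) (fun c hc ↦ by
      obtain ⟨x, y, hx, hy, e1, e2, hne⟩ := exists_mem_strip_of_mem_multipleValues hc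
      refine ⟨x, ?_, y, ?_, e1, e2, hne⟩
      · rw [hK]
        exact mem_strip.2 ⟨hx.2, hx.1, hbd c hc x e1⟩
      · rw [hK]
        exact mem_strip.2 ⟨hy.2, hy.1, hbd c hc y e2⟩) hc
  have hx := hpos x hxK
  have hy := hpos y hyK
  refine ⟨x, y, hx, hy, e, e', ?_⟩
  rintro ⟨a, b, c', d, hM, hxy'⟩
  have hder : deriv hauptmodul y ≠ 0 := fun h0 ↦ hcr ⟨y, ⟨hy, h0⟩, e'⟩
  have hinj := hauptmodul_eventually_injective hy hder
  have hmob : ContinuousAt (fun z : ℂ × ℂ ↦ (mob a b c' d z.1, z.2)) (x, y) :=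
    ((continuousAt_mob hM.det_pos hx).comp (f := Prod.fst) (x := (x, y)) continuousAt_fst).prodMk
      continuousAt_snd
  have hmob2 : Filter.Tendsto (fun z : ℂ × ℂ ↦ (mob a b c' d z.1, z.2)) (nhds (x, y))
      (nhds (y, y)) := by
    have := hmob.tendsto
    simp only [hxy'] at this
    exact this
  refine hfr ?_
  filter_upwards [hmob2.eventually hinj] with z h1 h2
  have hz1 := hpos z.1 h2.1
  refine h2.2.2 ⟨a, b, c', d, hM, h1 ?_⟩
  rw [hauptmodul_mob hM hz1]
  exact h2.2.1

theorem multipleValues_eq_empty : multipleValues = ∅ := by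
  by_contra hne
  rw [← Ne, ← Set.nonempty_iff_ne_empty] at hne
  obtain ⟨R, hR⟩ := multipleValues_bounded
  have hconn : IsPreconnected criticalValuesᶜ :=
    (countable_criticalValues.isConnected_compl_of_one_lt_rank (by simp)).isPreconnected
  have hdense : Dense criticalValuesᶜ := countable_criticalValues.dense_compl ℝ
  have hO : IsOpen {c : ℂ | R < ‖c‖} := isOpen_lt continuous_const continuous_norm
  have hO2 : Disjoint {c : ℂ | R < ‖c‖} (closure multipleValues) := by
    refine Disjoint.closure_right (Set.disjoint_left.2 fun c h1 h2 ↦ ?_) hO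
    exact absurd (hR c h2) (not_le.2 h1)
  obtain ⟨c₁, h1, h1'⟩ := hdense.inter_open_nonempty _ isOpen_multipleValues hne
  obtain ⟨c₂, h2, h2'⟩ := hdense.inter_open_nonempty _ hO
    ⟨((|R| + 1 : ℝ) : ℂ), by
      rw [Set.mem_ofPred_eq, Complex.norm_real, Real.norm_eq_abs, abs_of_pos (by positivity)]
      linarith [le_abs_self R]⟩
  obtain ⟨c, hc, hu, hv⟩ := hconn multipleValues (closure multipleValues)ᶜ isOpen_multipleValues
    isClosed_closure.isOpen_compl (fun c hc ↦ by
      by_cases h : c ∈ closure multipleValues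
      · exact Or.inl (mem_multipleValues_of_mem_closure h hc)
      · exact Or.inr h) ⟨c₁, h1', h1⟩ ⟨c₂, h2', Set.disjoint_left.1 hO2 h2⟩
  exact hv (subset_closure hu)

/-- The Hauptmodul separates orbits of the Fricke group. -/
theorem frickeEquiv_of_hauptmodul_eq {x y : ℂ} (hx : 0 < x.im) (hy : 0 < y.im)
    (h : hauptmodul x = hauptmodul y) : FrickeEquiv x y := by
  by_contra hne
  have : hauptmodul x ∈ multipleValues := ⟨x, y, hx, hy, rfl, h.symm, hne⟩
  rw [multipleValues_eq_empty] at this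
  exact this

/-- A non-constant analytic function is not injective near a critical point. -/
theorem frequently_eq_of_deriv_eq_zero {f : ℂ → ℂ} {z₀ : ℂ} (hf : AnalyticAt ℂ f z₀)
    (hnc : ¬ ∀ᶠ z in nhds z₀, f z = f z₀) (hd : deriv f z₀ = 0) :
    ∃ᶠ z : ℂ × ℂ in nhds (z₀, z₀) ⊓ Filter.principal {z | z.1 ≠ z.2}, f z.1 = f z.2 := by
  have hfa : AnalyticAt ℂ (fun z ↦ f z - f z₀) z₀ := hf.sub analyticAt_const
  obtain ⟨n, g, hg, hg0, hev⟩ := (hfa.exists_eventuallyEq_pow_smul_nonzero_iff).2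
    (by simpa [sub_eq_zero] using hnc)
  simp only [smul_eq_mul] at hev
  have hn : n ≠ 0 := by
    rintro rfl
    have := hev.self_of_nhds
    simp at this
    exact hg0 this.symm
  have hn1 : n ≠ 1 := by
    rintro rfl
    have h1 : HasDerivAt (fun z ↦ (z - z₀) ^ 1 * g z) (1 * g z₀ + (z₀ - z₀) * deriv g z₀) z₀ := by
      simp only [pow_one]
      exact ((hasDerivAt_id z₀).sub_const z₀).mul hg.differentiableAt.hasDerivAt
    have h2 : HasDerivAt (fun z ↦ f z - f z₀) (deriv f z₀) z₀ :=
      hf.differentiableAt.hasDerivAt.sub_const _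
    have h3 := h2.unique (h1.congr_of_eventuallyEq hev)
    rw [hd] at h3
    simp at h3
    exact hg0 h3.symm
  set h : ℂ → ℂ := fun z ↦ Complex.exp (Complex.log (g z / g z₀) / n) with hh
  have hgd : AnalyticAt ℂ (fun z ↦ g z / g z₀) z₀ := hg.div_const
  have hha : AnalyticAt ℂ h z₀ := by
    refine AnalyticAt.cexp ((hgd.clog ?_).div_const)
    rw [div_self hg0]
    exact Complex.one_mem_slitPlane
  have hh0 : h z₀ = 1 := by simp [hh, div_self hg0]
  have hhn : ∀ᶠ z in nhds z₀, g z = g z₀ * h z ^ n := by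
    filter_upwards [hg.continuousAt.eventually_ne hg0] with z hz
    simp only [hh]
    rw [← Complex.exp_nat_mul, mul_div_cancel₀ _ (by exact_mod_cast hn),
      Complex.exp_log (div_ne_zero hz hg0), mul_div_cancel₀ _ hg0]
  set φ : ℂ → ℂ := fun z ↦ (z - z₀) * h z with hφ
  have hφd : HasStrictDerivAt φ (1 * h z₀ + (z₀ - z₀) * deriv h z₀) z₀ :=
    HasStrictDerivAt.mul (c := fun z ↦ z - z₀) (c' := 1) ((hasStrictDerivAt_id z₀).sub_const z₀)
      hha.hasStrictDerivAt
  have hφ0 : φ z₀ = 0 := by simp [hφ]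
  have hmap := hφd.map_nhds_eq (by simp [hh0])
  rw [hφ0] at hmap
  have hfφ : ∀ᶠ z in nhds z₀, f z = f z₀ + g z₀ * φ z ^ n := by
    filter_upwards [hev, hhn] with z h1 h2
    rw [hφ]
    simp only
    rw [mul_pow]
    linear_combination h1 + (z - z₀) ^ n * h2
  have hprim := Complex.isPrimitiveRoot_exp n hn
  set ζ := Complex.exp (2 * Real.pi * Complex.I / n)
  intro hcon
  rw [Filter.eventually_inf_principal] at hcon
  obtain ⟨A, hA, B, hB, hAB⟩ := mem_nhds_prod_iff.1 hcon
  have hN : A ∩ B ∩ {z | f z = f z₀ + g z₀ * φ z ^ n} ∈ nhds z₀ :=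
    Filter.inter_mem (Filter.inter_mem hA hB) hfφ
  have himg : φ '' (A ∩ B ∩ {z | f z = f z₀ + g z₀ * φ z ^ n}) ∈ nhds (0 : ℂ) := by
    rw [← hmap]; exact Filter.image_mem_map hN
  obtain ⟨r, hr, hball⟩ := Metric.mem_nhds_iff.1 himg
  have hw : ((r / 2 : ℝ) : ℂ) ∈ Metric.ball (0 : ℂ) r := by
    rw [mem_ball_zero_iff, Complex.norm_real, Real.norm_eq_abs, abs_of_pos (by linarith)]
    linarith
  have hw' : ζ * ((r / 2 : ℝ) : ℂ) ∈ Metric.ball (0 : ℂ) r := by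
    rw [mem_ball_zero_iff, norm_mul, hprim.norm'_eq_one hn, one_mul]
    exact mem_ball_zero_iff.1 hw
  obtain ⟨x, ⟨⟨hxA, -⟩, hx2⟩, hx3⟩ := hball hw
  obtain ⟨y, ⟨⟨-, hyB⟩, hy2⟩, hy3⟩ := hball hw'
  refine hAB (Set.mk_mem_prod hxA hyB) ?_ ?_
  · intro e
    simp only at e
    rw [← e, hx3] at hy3
    have h0 : ((r / 2 : ℝ) : ℂ) ≠ 0 := by
      rw [Complex.ofReal_ne_zero]; linarith
    have : ζ = 1 := mul_right_cancel₀ h0 (by rw [one_mul, ← hy3])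
    exact hn1 (by rw [hprim.eq_orderOf, this, orderOf_one])
  · simp only
    rw [show f x = _ from hx2, show f y = _ from hy2, hx3, hy3, mul_pow, hprim.pow_eq_one, one_mul]

/-- The Hauptmodul is unramified at points with trivial stabilizer. -/
theorem deriv_hauptmodul_ne_zero {τ : ℂ} (hτ : 0 < τ.im)
    (h : ∀ a b c d : ℤ, IsFricke a b c d → mob a b c d τ = τ → a = d ∧ b = 0 ∧ c = 0) :
    deriv hauptmodul τ ≠ 0 := by
  intro hd
  have hnc : ¬ ∀ᶠ z in nhds τ, hauptmodul z = hauptmodul τ := fun h1 ↦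
    hauptmodul_nonconstant _ (analyticOnNhd_hauptmodul.eqOn_of_preconnected_of_eventuallyEq
      analyticOnNhd_const isPreconnected_im_pos hτ h1)
  have hfr := frequently_eq_of_deriv_eq_zero (analyticOnNhd_hauptmodul τ hτ) hnc hd
  have hpos : ∀ᶠ z : ℂ × ℂ in nhds (τ, τ), 0 < z.1.im ∧ 0 < z.2.im :=
    prod_mem_nhds (isOpen_im_pos.mem_nhds hτ) (isOpen_im_pos.mem_nhds hτ)
  have hfr2 := (hfr.and_eventually (Filter.Eventually.filter_mono inf_le_left hpos)).mono
    fun z hz ↦ frickeEquiv_of_hauptmodul_eq hz.2.1 hz.2.2 hz.1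
  obtain ⟨a, b, c, d, hM, hfix, hfr3⟩ := exists_isFricke_of_frequently hτ hτ inf_le_left hfr2
  obtain ⟨rfl, rfl, rfl⟩ := h a b c d hM hfix
  refine hfr3 ?_
  rw [Filter.eventually_inf_principal]
  refine Filter.Eventually.of_forall fun z hz e ↦ hz ?_
  have ha : (a : ℂ) ≠ 0 := by
    have := hM.det_pos
    intro h0
    rw [Int.cast_eq_zero.1 h0] at this
    simp at this
  rw [← show mob a 0 0 a z.1 = z.2 from e, mob]
  push_cast
  rw [add_zero, zero_mul, zero_add, mul_div_cancel_left₀ _ ha]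

theorem cuspParam_add_div {p : ℕ} (hp : p ≠ 0) (τ : ℂ) (b : ℕ) :
    cuspParam ((τ + b) / p) = cuspParam (1 / p) ^ b * cuspParam (τ / p) := by
  rw [← cuspParam_natCast_mul, ← cuspParam_add]
  congr 1
  field_simp
  ring

theorem isPrimitiveRoot_cuspParam {p : ℕ} (hp : p ≠ 0) : IsPrimitiveRoot (cuspParam (1 / p)) p := by
  have := Complex.isPrimitiveRoot_exp p hp
  rwa [div_eq_mul_one_div] at this

theorem frickeInv_add_div {p : ℕ} (hp : p ≠ 0) {b b' e : ℤ} (h : 2 * b * b' + 1 = p * e) {τ : ℂ}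
    (hτ : τ ≠ 0) : (frickeInv τ + b) / p = mob (2 * b) (-e) (2 * p) (-2 * b') ((τ + b') / p) := by
  have h' : (2 * b * b' + 1 : ℂ) = p * e := by exact_mod_cast h
  have hp' : (p : ℂ) ≠ 0 := by exact_mod_cast hp
  have h1 : (2 * (p : ℂ) * ((τ + b') / p) + -2 * b') = 2 * τ := by
    field_simp
    ring
  simp only [mob, frickeInv]
  push_cast
  rw [h1, div_eq_div_iff hp' (by simpa using hτ)]
  field_simp
  linear_combination -h'

theorem isFricke_of_two_mul {p : ℕ} {b b' e : ℤ} (h : 2 * b * b' + 1 = p * e) :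
    IsFricke (2 * b) (-e) (2 * p) (-2 * b') :=
  ⟨⟨_, rfl⟩, Or.inr ⟨⟨_, rfl⟩, ⟨-b', by ring⟩, by linear_combination -2 * h⟩⟩

theorem form_frickeInv_add_div {p : ℕ} (hp : p ≠ 0) {b b' e : ℤ} (h : 2 * b * b' + 1 = p * e) {τ : ℂ}
    (hτ : 0 < τ.im) :
    formP ((frickeInv τ + b) / p) ^ 4 = 16 * τ ^ 8 * formP ((τ + b') / p) ^ 4 ∧
      formD ((frickeInv τ + b) / p) = 16 * τ ^ 8 * formD ((τ + b') / p) := by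
  have hp' : (p : ℂ) ≠ 0 := by exact_mod_cast hp
  have him : 0 < ((τ + b') / p : ℂ).im := by
    rw [Complex.div_natCast_im]
    have : (0 : ℝ) < p := by positivity
    simpa using div_pos hτ this
  have hM := isFricke_of_two_mul h
  have h' : (2 * b * b' + 1 : ℂ) = p * e := by exact_mod_cast h
  have h1 := formP_mob hM him
  have h2 := formD_mob hM him
  have h3 : (((2 * p : ℤ) : ℂ) * ((τ + b') / p) + ((-2 * b' : ℤ) : ℂ)) = 2 * τ := by
    push_cast
    field_simp
    ring
  have h4 : (((2 * b : ℤ) : ℂ) * ((-2 * b' : ℤ) : ℂ) - ((-e : ℤ) : ℂ) * ((2 * p : ℤ) : ℂ)) = 2 := by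
    push_cast
    linear_combination -2 * h'
  rw [h3, h4, ← frickeInv_add_div hp h (ne_zero_of_im_pos hτ)] at h1 h2
  constructor
  · linear_combination h1 / 16
  · linear_combination h2 / 16

theorem frickeInv_div {p : ℕ} (hp : p ≠ 0) {τ : ℂ} (hτ : τ ≠ 0) :
    frickeInv τ / p = frickeInv (p * τ) := by
  have hp' : (p : ℂ) ≠ 0 := by exact_mod_cast hp
  simp only [frickeInv]
  field_simp

theorem mul_frickeInv {p : ℕ} (hp : p ≠ 0) {τ : ℂ} (hτ : τ ≠ 0) :
    p * frickeInv τ = frickeInv (τ / p) := by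
  have hp' : (p : ℂ) ≠ 0 := by exact_mod_cast hp
  simp only [frickeInv]
  field_simp

/-- The involution of the residues mod `p` induced by the Fricke involution on the cosets. -/
def residueInv (p b : ℕ) : ℕ := (-(2 * (b : ZMod p))⁻¹).val

theorem residueInv_spec {p : ℕ} [hp : Fact p.Prime] (hp2 : p ≠ 2) {b : ℕ}
    (hb : b ∈ (Finset.range p).erase 0) :
    residueInv p b ∈ (Finset.range p).erase 0 ∧ residueInv p (residueInv p b) = b ∧
      ∃ e : ℤ, 2 * (b : ℤ) * (residueInv p b : ℤ) + 1 = p * e := by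
  rw [Finset.mem_erase, Finset.mem_range] at hb
  have h2 : (2 : ZMod p) ≠ 0 := by
    intro h
    have := (ZMod.natCast_eq_zero_iff 2 p).1 (by exact_mod_cast h)
    exact hp2 ((Nat.prime_dvd_prime_iff_eq hp.out Nat.prime_two).1 this)
  have hb0 : (b : ZMod p) ≠ 0 := by
    intro h
    exact hb.1 (Nat.eq_zero_of_dvd_of_lt ((ZMod.natCast_eq_zero_iff b p).1 h) hb.2)
  have hcast : (residueInv p b : ZMod p) = -(2 * (b : ZMod p))⁻¹ := by
    rw [residueInv, ZMod.natCast_val, ZMod.cast_id]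
  refine ⟨?_, ?_, ?_⟩
  · rw [Finset.mem_erase, Finset.mem_range]
    refine ⟨fun h ↦ ?_, ZMod.val_lt _⟩
    rw [h, Nat.cast_zero, eq_comm, neg_eq_zero, inv_eq_zero] at hcast
    exact mul_ne_zero h2 hb0 hcast
  · rw [residueInv, hcast]
    have : -(2 * -(2 * (b : ZMod p))⁻¹)⁻¹ = (b : ZMod p) := by
      field_simp
    rw [this, ZMod.val_natCast_of_lt hb.2]
  · have : ((2 * (b : ℤ) * (residueInv p b : ℤ) + 1 : ℤ) : ZMod p) = 0 := by
      push_cast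
      rw [hcast]
      field_simp
      ring
    exact (ZMod.intCast_zmod_eq_zero_iff_dvd _ p).1 this

theorem exists_hecke_form {p : ℕ} [hp : Fact p.Prime] (hp2 : p ≠ 2) {K : ℕ} {R : ℂ → ℂ → ℂ → ℂ → ℂ}
    (hR : ∀ l u v u' v', R (l * u) (l * v) (l * u') (l * v') = l ^ K * R u v u' v')
    {α β N : PowerSeries ℤ} (hα : α ∈ convergentSeries) (hN : N ∈ convergentSeries) {c : ℂ} (hc : c ≠ 0)
    (hα' : ∀ τ : ℂ, 0 < τ.im → c * seriesEval (cuspParam τ) α =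
      R (formP τ ^ 4) (formD τ) (p ^ 8 * formP (p * τ) ^ 4) (p ^ 8 * formD (p * τ)))
    (hβ' : ∀ τ : ℂ, 0 < τ.im → seriesEval (cuspParam (τ / p)) β =
      R (formP τ ^ 4) (formD τ) (formP (τ / p) ^ 4) (formD (τ / p)))
    (hβN : ∀ z : ℂ, ‖z‖ < 1 →
      ∏ b ∈ Finset.range p, seriesEval (cuspParam (1 / p) ^ b * z) β = seriesEval (z ^ p) N) :
    IsFrickeForm (K * (p + 1)) (α * N) ∧ ∀ τ : ℂ, 0 < τ.im → c * seriesEval (cuspParam τ) (α * N) =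
      R (formP τ ^ 4) (formD τ) (p ^ 8 * formP (p * τ) ^ 4) (p ^ 8 * formD (p * τ)) *
      ∏ b ∈ Finset.range p, R (formP τ ^ 4) (formD τ) (formP ((τ + b) / p) ^ 4) (formD ((τ + b) / p)) := by
  have hp0 := hp.out.ne_zero
  have hp0' : (p : ℂ) ≠ 0 := by exact_mod_cast hp0
  have hpr : (0 : ℝ) < p := by exact_mod_cast hp.out.pos
  have hper : ∀ (τ : ℂ) (b : ℕ), formP (τ + b) = formP τ ∧ formD (τ + b) = formD τ := by
    intro τ b
    induction b with
    | zero => simp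
    | succ b ih =>
      push_cast
      rw [← add_assoc, formP_add_one, formD_add_one]
      exact ih
  have key : ∀ τ : ℂ, 0 < τ.im → c * seriesEval (cuspParam τ) (α * N) =
      R (formP τ ^ 4) (formD τ) (p ^ 8 * formP (p * τ) ^ 4) (p ^ 8 * formD (p * τ)) *
      ∏ b ∈ Finset.range p,
        R (formP τ ^ 4) (formD τ) (formP ((τ + b) / p) ^ 4) (formD ((τ + b) / p)) := by
    intro τ hτ
    have hτp : 0 < (τ / p).im := by
      rw [Complex.div_natCast_im]
      positivity
    rw [seriesEval_mul (norm_cuspParam_lt_one hτ) hα hN, ← mul_assoc, hα' τ hτ]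
    congr 1
    have h1 := hβN _ (norm_cuspParam_lt_one hτp)
    rw [← cuspParam_natCast_mul, mul_div_cancel₀ _ hp0'] at h1
    rw [← h1]
    refine Finset.prod_congr rfl fun b _ ↦ ?_
    rw [← cuspParam_add_div hp0, hβ' (τ + b) (by simpa using hτ), (hper τ b).1, (hper τ b).2]
  refine ⟨⟨mul_mem hα hN, fun τ hτ ↦ ?_⟩, key⟩
  have hτ0 := ne_zero_of_im_pos hτ
  have hτp : 0 < (τ / p).im := by
    rw [Complex.div_natCast_im]
    positivity
  have hpτ : 0 < (p * τ).im := by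
    simpa using mul_pos hpr hτ
  apply mul_left_cancel₀ hc
  have hmem : 0 ∈ Finset.range p := Finset.mem_range.2 hp.out.pos
  rw [key _ (frickeInv_im_pos hτ), mul_left_comm, key τ hτ, ← Finset.mul_prod_erase _ _ hmem,
    ← Finset.mul_prod_erase _ _ hmem]
  have e1 : R (formP (frickeInv τ) ^ 4) (formD (frickeInv τ)) (p ^ 8 * formP (p * frickeInv τ) ^ 4)
      (p ^ 8 * formD (p * frickeInv τ)) = (16 * τ ^ 8) ^ K *
        R (formP τ ^ 4) (formD τ) (formP ((τ + (0 : ℕ)) / p) ^ 4) (formD ((τ + (0 : ℕ)) / p)) := by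
    rw [← hR, mul_frickeInv hp0 hτ0, formP_frickeInv hτ, formD_frickeInv hτ, formP_frickeInv hτp,
      formD_frickeInv hτp]
    congr 1
    · ring
    · simp only [Nat.cast_zero, add_zero]
      field_simp
      ring
    · simp only [Nat.cast_zero, add_zero]
      field_simp
  have e2 : R (formP (frickeInv τ) ^ 4) (formD (frickeInv τ)) (formP ((frickeInv τ + (0 : ℕ)) / p) ^ 4)
      (formD ((frickeInv τ + (0 : ℕ)) / p)) = (16 * τ ^ 8) ^ K *
        R (formP τ ^ 4) (formD τ) (p ^ 8 * formP (p * τ) ^ 4) (p ^ 8 * formD (p * τ)) := by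
    rw [← hR, Nat.cast_zero, add_zero, frickeInv_div hp0 hτ0, formP_frickeInv hτ, formD_frickeInv hτ,
      formP_frickeInv hpτ, formD_frickeInv hpτ]
    congr 1 <;> ring
  have e3 : ∏ b ∈ (Finset.range p).erase 0, R (formP (frickeInv τ) ^ 4) (formD (frickeInv τ))
      (formP ((frickeInv τ + b) / p) ^ 4) (formD ((frickeInv τ + b) / p)) =
      ((16 * τ ^ 8) ^ K) ^ (p - 1) * ∏ b ∈ (Finset.range p).erase 0,
        R (formP τ ^ 4) (formD τ) (formP ((τ + b) / p) ^ 4) (formD ((τ + b) / p)) := by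
    have hcard : ((Finset.range p).erase 0).card = p - 1 := by
      rw [Finset.card_erase_of_mem hmem, Finset.card_range]
    rw [← hcard, ← Finset.prod_const, ← Finset.prod_mul_distrib]
    refine Finset.prod_nbij' (residueInv p) (residueInv p) (fun b hb ↦ (residueInv_spec hp2 hb).1)
      (fun b hb ↦ (residueInv_spec hp2 hb).1) (fun b hb ↦ (residueInv_spec hp2 hb).2.1)
      (fun b hb ↦ (residueInv_spec hp2 hb).2.1) fun b hb ↦ ?_
    obtain ⟨e, he⟩ := (residueInv_spec hp2 hb).2.2
    obtain ⟨h1, h2⟩ := form_frickeInv_add_div hp0 he hτ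
    simp only [Int.cast_natCast] at h1 h2
    have h3 : formP (frickeInv τ) ^ 4 = 16 * τ ^ 8 * formP τ ^ 4 := by
      rw [formP_frickeInv hτ]
      ring
    rw [← hR, h1, h2, h3, formD_frickeInv hτ]
  rw [e1, e2, e3]
  have : (16 * τ ^ 8) ^ (K * (p + 1)) = (16 * τ ^ 8) ^ K * (16 * τ ^ 8) ^ K * ((16 * τ ^ 8) ^ K) ^ (p - 1) := by
    obtain ⟨k, hk⟩ := Nat.exists_eq_succ_of_ne_zero hp0
    rw [hk, Nat.succ_sub_one, Nat.succ_eq_add_one]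
    ring
  rw [this]
  ring

theorem IsPrimitiveRoot.prod_pow_mul_eq {p : ℕ} {ζ : ℂ} (hζ : IsPrimitiveRoot ζ p) (hp : Odd p) (z : ℂ) :
    ∏ b ∈ Finset.range p, (ζ ^ b * z) = z ^ p := by
  obtain ⟨k, rfl⟩ := hp
  rw [Finset.prod_mul_distrib, Finset.prod_const, Finset.card_range, Finset.prod_pow_eq_pow_sum]
  have : ∑ b ∈ Finset.range (2 * k + 1), b = (2 * k + 1) * k := by
    have := Finset.sum_range_id_mul_two (2 * k + 1)
    rw [Nat.add_sub_cancel] at this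
    linarith
  rw [this, pow_mul, hζ.pow_eq_one, one_pow, one_mul]

theorem seriesEval_homogEval {z : ℂ} (hz : ‖z‖ < 1) {N : ℕ} {Q : ℤ[X]} {f g : PowerSeries ℤ}
    (hf : f ∈ convergentSeries) (hg : g ∈ convergentSeries) :
    seriesEval z (homogEval N Q f g) = homogEval N Q (seriesEval z f) (seriesEval z g) := by
  have h1 := map_homogEval convergentSeries.subtype N Q ⟨f, hf⟩ ⟨g, hg⟩
  have h2 := map_homogEval (seriesEvalHom z hz) N Q ⟨f, hf⟩ ⟨g, hg⟩
  simp only [seriesEvalHom_apply] at h2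
  rw [← h2]
  exact congrArg (seriesEval z) h1.symm

theorem seriesEval_homogEval_form {N : ℕ} {Q : ℤ[X]} (hQ : Q.natDegree ≤ N) {τ : ℂ} (hτ : 0 < τ.im) :
    seriesEval (cuspParam τ) (homogEval N Q (frickeP ^ 4) frickeD) =
      formD τ ^ N * Q.eval₂ (Int.castRingHom ℂ) (hauptmodul τ) := by
  rw [seriesEval_homogEval (norm_cuspParam_lt_one hτ) (pow_mem frickeP_mem 4) frickeD_mem,
    seriesEval_pow (norm_cuspParam_lt_one hτ) frickeP_mem]
  exact homogEval_eq hQ _ (formD_ne_zero hτ)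

theorem seriesEval_expand_cuspParam {p : ℕ} (hp : p ≠ 0) (f : PowerSeries ℤ) (τ : ℂ) :
    seriesEval (cuspParam τ) (PowerSeries.expand p hp f) = seriesEval (cuspParam (p * τ)) f := by
  rw [seriesEval_expand, cuspParam_natCast_mul]

/-- The modular polynomial of prime level `p`, restricted to the diagonal. -/
theorem exists_modular_polynomial {p : ℕ} [hp : Fact p.Prime] (hp2 : p ≠ 2) :
    ∃ F : ℤ[X], F.natDegree ≤ 2 * p ∧ F.coeff (2 * p) = -1 ∧
      (∀ τ : ℂ, 0 < τ.im → formD τ ^ (2 * (p + 1)) * F.eval₂ (Int.castRingHom ℂ) (hauptmodul τ) =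
        (formP τ ^ 4 * formD (p * τ) - formP (p * τ) ^ 4 * formD τ) * ∏ b ∈ Finset.range p,
          (formP τ ^ 4 * formD ((τ + b) / p) - formP ((τ + b) / p) ^ 4 * formD τ)) ∧
      ∀ P D : PowerSeries (ZMod p), P = PowerSeries.map (Int.castRingHom (ZMod p)) (frickeP ^ 4) →
        D = PowerSeries.map (Int.castRingHom (ZMod p)) frickeD →
        homogEval (2 * (p + 1)) F P D = -(P * D ^ p - P ^ p * D) ^ 2 := by
  have hp0 := hp.out.ne_zero
  have hp0' : (p : ℂ) ≠ 0 := by exact_mod_cast hp0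
  have hpr : (0 : ℝ) < p := by exact_mod_cast hp.out.pos
  have hpodd : Odd p := hp.out.odd_of_ne_two hp2
  obtain ⟨e, he⟩ := Nat.exists_eq_succ_of_ne_zero hp0
  have he0 : e ≠ 0 := by
    rintro rfl
    exact hp.out.one_lt.ne' he
  set P4 : PowerSeries ℤ := frickeP ^ 4 with hP4
  have hP4m : P4 ∈ convergentSeries := pow_mem frickeP_mem 4
  set β' : PowerSeries ℤ := PowerSeries.expand p hp0 P4 * frickeDUnit -
    P4 * (PowerSeries.X ^ e * PowerSeries.expand p hp0 frickeDUnit) with hβ'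
  have hβ'm : β' ∈ convergentSeries := sub_mem
    (mul_mem (expand_mem_convergentSeries hp0 hP4m) frickeDUnit_mem)
    (mul_mem hP4m (mul_mem (pow_mem X_mem_convergentSeries e)
      (expand_mem_convergentSeries hp0 frickeDUnit_mem)))
  have hβ'0 : PowerSeries.constantCoeff β' = 1 := by
    simp [hβ', hP4, PowerSeries.constantCoeff_expand, constantCoeff_frickeDUnit,
      constantCoeff_frickeP, he0]
  have hXβ : PowerSeries.X * β' = PowerSeries.expand p hp0 P4 * frickeD -
      P4 * PowerSeries.expand p hp0 frickeD := by
    rw [hβ', frickeD_eq, map_mul, PowerSeries.expand_X,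
      show (PowerSeries.X : PowerSeries ℤ) ^ p = PowerSeries.X * PowerSeries.X ^ e by
        rw [he, Nat.succ_eq_add_one, pow_succ']]
    ring
  have hζ := isPrimitiveRoot_cuspParam hp0
  obtain ⟨N', hN'm, hN', hN'p⟩ := exists_series_norm hζ hβ'm
  have hN'0 : PowerSeries.constantCoeff N' = 1 := by
    have := hN' 0 (by simp)
    simp only [mul_zero, zero_pow hp0, seriesEval_zero_left, hβ'0, Int.cast_one,
      Finset.prod_const_one] at this
    exact_mod_cast this.symm
  have hβN : ∀ z : ℂ, ‖z‖ < 1 → ∏ b ∈ Finset.range p,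
      seriesEval (cuspParam (1 / p) ^ b * z) (PowerSeries.X * β') =
      seriesEval (z ^ p) (PowerSeries.X * N') := by
    intro z hz
    have hzp : ‖z ^ p‖ < 1 := by
      rw [norm_pow]
      exact pow_lt_one₀ (norm_nonneg _) hz hp0
    rw [seriesEval_mul hzp X_mem_convergentSeries hN'm, seriesEval_X, ← hN' z hz,
      ← hζ.prod_pow_mul_eq hpodd, ← Finset.prod_mul_distrib]
    refine Finset.prod_congr rfl fun b _ ↦ ?_
    have hb : ‖cuspParam (1 / p) ^ b * z‖ < 1 := by rwa [norm_root_of_unity_mul hζ hp0]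
    rw [seriesEval_mul hb X_mem_convergentSeries hβ'm, seriesEval_X]
  have hXm : PowerSeries.X * β' ∈ convergentSeries := mul_mem X_mem_convergentSeries hβ'm
  have heval : ∀ τ : ℂ, 0 < τ.im → seriesEval (cuspParam τ) (PowerSeries.X * β') =
      formP (p * τ) ^ 4 * formD τ - formP τ ^ 4 * formD (p * τ) := by
    intro τ hτ
    have hz := norm_cuspParam_lt_one hτ
    have hz' : ‖cuspParam (p * τ)‖ < 1 := by
      apply norm_cuspParam_lt_one
      simpa using mul_pos hpr hτ
    rw [hXβ, seriesEval_sub hz (mul_mem (expand_mem_convergentSeries hp0 hP4m) frickeD_mem)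
      (mul_mem hP4m (expand_mem_convergentSeries hp0 frickeD_mem)),
      seriesEval_mul hz (expand_mem_convergentSeries hp0 hP4m) frickeD_mem,
      seriesEval_mul hz hP4m (expand_mem_convergentSeries hp0 frickeD_mem),
      seriesEval_expand_cuspParam, seriesEval_expand_cuspParam, hP4, seriesEval_pow hz frickeP_mem,
      seriesEval_pow hz' frickeP_mem]
    rfl
  obtain ⟨hform, hval⟩ := exists_hecke_form (K := 2) hp2 (R := fun u v u' v' ↦ u * v' - u' * v)
    (fun l u v u' v' ↦ by ring) (α := -(PowerSeries.X * β')) (β := PowerSeries.X * β')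
    (N := PowerSeries.X * N') (neg_mem hXm) (mul_mem X_mem_convergentSeries hN'm)
    (c := (p : ℂ) ^ 8) (pow_ne_zero 8 hp0')
    (fun τ hτ ↦ by
      rw [← zero_sub, seriesEval_sub (norm_cuspParam_lt_one hτ) (zero_mem _) hXm, heval τ hτ,
        show seriesEval (cuspParam τ) 0 = 0 by simpa using seriesEval_natCast (z := cuspParam τ) 0]
      ring)
    (fun τ hτ ↦ by
      rw [heval _ (by rw [Complex.div_natCast_im]; positivity), mul_div_cancel₀ _ hp0']) hβN
  have hfac : -(PowerSeries.X * β') * (PowerSeries.X * N') =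
      PowerSeries.X ^ 2 * (-β' * N') := by ring
  have hk : 2 * (p + 1) - 2 * p = 2 := by omega
  obtain ⟨F, hF1, hF2, hF3⟩ := hform.exists_polynomial (k := 2 * p) (by omega)
    (by rw [hk, hfac]; exact dvd_mul_right _ _)
  refine ⟨F, hF1, ?_, fun τ hτ ↦ ?_, ?_⟩
  · rw [hF2, hk, hfac]
    have := PowerSeries.coeff_X_pow_mul (-β' * N') 2 0
    rw [zero_add] at this
    rw [this, PowerSeries.coeff_zero_eq_constantCoeff_apply]
    simp [hβ'0, hN'0]
  · have h1 := hval τ hτ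
    rw [hF3, seriesEval_homogEval_form (hF1.trans (by omega)) hτ] at h1
    apply mul_left_cancel₀ (pow_ne_zero 8 hp0')
    rw [h1]
    ring
  · rintro P D rfl rfl
    rw [← map_homogEval, ← hF3, map_mul, map_mul, hN'p, ← map_mul, hXβ]
    simp only [map_neg, map_sub, map_mul, PowerSeries.map_expand, ← powerSeries_zmod_pow_eq_expand]
    ring

/-- The characteristic polynomial of the multipliers of the weight `8 m` form at level `p`,
evaluated at an integer `n`. -/
theorem exists_multiplier_polynomial {p : ℕ} [hp : Fact p.Prime] (hp2 : p ≠ 2) {m : ℕ} (hm : m ≠ 0)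
    (n : ℤ) : ∃ Q : ℤ[X], Q.natDegree ≤ 2 * m * (p + 1) ∧
      (∀ τ : ℂ, 0 < τ.im → ∀ v : ℂ, n * formD τ ^ m * v ^ m - v ^ (2 * m) -
          p ^ (8 * m) * formD τ ^ (2 * m) = 0 →
        (v = p ^ 8 * formD (p * τ) ∨ ∃ b < p, v = formD ((τ + b) / p)) →
        Q.eval₂ (Int.castRingHom ℂ) (hauptmodul τ) = 0) ∧
      ∀ P D : PowerSeries (ZMod p), P = PowerSeries.map (Int.castRingHom (ZMod p)) (frickeP ^ 4) →
        D = PowerSeries.map (Int.castRingHom (ZMod p)) frickeD →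
        homogEval (2 * m * (p + 1)) Q P D = (n * D ^ m * D ^ (p * m) - D ^ (2 * m)) ^ 2 := by
  have hp0 := hp.out.ne_zero
  have hp0' : (p : ℂ) ≠ 0 := by exact_mod_cast hp0
  have hpr : (0 : ℝ) < p := by exact_mod_cast hp.out.pos
  set E : PowerSeries ℤ := PowerSeries.expand p hp0 frickeD with hE
  have hEm : E ∈ convergentSeries := expand_mem_convergentSeries hp0 frickeD_mem
  have hD := frickeD_mem
  set α : PowerSeries ℤ := n * (frickeD ^ m * E ^ m) - (p ^ (8 * m) : ℕ) * E ^ (2 * m) -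
    frickeD ^ (2 * m) with hα
  set β : PowerSeries ℤ := n * (E ^ m * frickeD ^ m) - frickeD ^ (2 * m) -
    (p ^ (8 * m) : ℕ) * E ^ (2 * m) with hβ
  have a1 := mul_mem (pow_mem hD m) (pow_mem hEm m)
  have a1' := mul_mem (pow_mem hEm m) (pow_mem hD m)
  have a2 := mul_mem (intCast_mem convergentSeries n) a1
  have a2' := mul_mem (intCast_mem convergentSeries n) a1'
  have a3 := pow_mem hEm (2 * m)
  have a4 := mul_mem (natCast_mem convergentSeries (p ^ (8 * m))) a3
  have a5 := pow_mem hD (2 * m)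
  have hαm : α ∈ convergentSeries := sub_mem (sub_mem a2 a4) a5
  have hβm : β ∈ convergentSeries := sub_mem (sub_mem a2' a5) a4
  have hζ := isPrimitiveRoot_cuspParam hp0
  obtain ⟨N, hNm, hN, hNp⟩ := exists_series_norm hζ hβm
  have hEeval : ∀ τ, seriesEval (cuspParam τ) E = formD (p * τ) :=
    fun τ ↦ seriesEval_expand_cuspParam hp0 frickeD τ
  obtain ⟨hform, hval⟩ := exists_hecke_form (K := 2 * m) hp2
    (R := fun _ v _ v' ↦ n * v ^ m * v' ^ m - v' ^ (2 * m) - p ^ (8 * m) * v ^ (2 * m))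
    (fun l u v u' v' ↦ by ring) (α := α) (β := β) (N := N) hαm hNm (c := (p : ℂ) ^ (8 * m))
    (pow_ne_zero _ hp0')
    (fun τ hτ ↦ by
      have hz := norm_cuspParam_lt_one hτ
      rw [hα, seriesEval_sub hz (sub_mem a2 a4) a5, seriesEval_sub hz a2 a4,
        seriesEval_mul hz (intCast_mem _ n) a1, seriesEval_mul hz (pow_mem hD m) (pow_mem hEm m),
        seriesEval_mul hz (natCast_mem _ _) a3, seriesEval_intCast, seriesEval_natCast,
        seriesEval_pow hz hEm, seriesEval_pow hz hEm, seriesEval_pow hz hD, seriesEval_pow hz hD,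
        hEeval]
      change _ * (_ * (formD τ ^ m * _) - _ - formD τ ^ (2 * m)) = _
      push_cast
      ring)
    (fun τ hτ ↦ by
      have hz : ‖cuspParam (τ / p)‖ < 1 :=
        norm_cuspParam_lt_one (by rw [Complex.div_natCast_im]; positivity)
      rw [hβ, seriesEval_sub hz (sub_mem a2' a5) a4, seriesEval_sub hz a2' a5,
        seriesEval_mul hz (intCast_mem _ n) a1', seriesEval_mul hz (pow_mem hEm m) (pow_mem hD m),
        seriesEval_mul hz (natCast_mem _ _) a3, seriesEval_intCast, seriesEval_natCast,
        seriesEval_pow hz hEm, seriesEval_pow hz hEm, seriesEval_pow hz hD, seriesEval_pow hz hD,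
        hEeval, mul_div_cancel₀ _ hp0']
      change _ * (_ * formD (τ / p) ^ m) - formD (τ / p) ^ (2 * m) - _ = _
      push_cast
      ring) hN
  obtain ⟨Q, hQ1, -, hQ3⟩ := hform.exists_polynomial le_rfl (by simp)
  refine ⟨Q, hQ1, fun τ hτ v hv hv' ↦ ?_, ?_⟩
  · have h1 := hval τ hτ
    rw [hQ3, seriesEval_homogEval_form hQ1 hτ] at h1
    have h2 : (p : ℂ) ^ (8 * m) * (formD τ ^ (2 * m * (p + 1)) *
        Q.eval₂ (Int.castRingHom ℂ) (hauptmodul τ)) = 0 := by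
      rw [h1]
      rcases hv' with rfl | ⟨b, hb, rfl⟩
      · exact mul_eq_zero_of_left hv _
      · exact mul_eq_zero_of_right _ (Finset.prod_eq_zero (Finset.mem_range.2 hb) hv)
    have h3 := (mul_eq_zero.1 h2).resolve_left (pow_ne_zero _ hp0')
    exact (mul_eq_zero.1 h3).resolve_left (pow_ne_zero _ (formD_ne_zero hτ))
  · rintro P D rfl rfl
    rw [← map_homogEval, ← hQ3, map_mul, hNp, hα, hβ, hE]
    have hp1 : 8 * m ≠ 0 := by omega
    simp only [map_sub, map_mul, map_pow, PowerSeries.map_expand, ← powerSeries_zmod_pow_eq_expand,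
      map_natCast, map_intCast, Nat.cast_pow]
    have : (p : PowerSeries (ZMod p)) = 0 := by
      rw [← map_natCast (PowerSeries.C (R := ZMod p)), CharP.cast_eq_zero, map_zero]
    rw [this, zero_pow hp1]
    ring

theorem legendreSym_cases {p : ℕ} [hp : Fact p.Prime] (hp2 : p ≠ 2) :
    (p % 8 = 1 ∧ legendreSym p (-1) = 1 ∧ legendreSym p (-2) = 1) ∨
    (p % 8 = 3 ∧ legendreSym p (-1) = -1 ∧ legendreSym p (-2) = 1) ∨
    (p % 8 = 5 ∧ legendreSym p (-1) = 1 ∧ legendreSym p (-2) = -1) ∨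
    (p % 8 = 7 ∧ legendreSym p (-1) = -1 ∧ legendreSym p (-2) = -1) := by
  have hodd := Nat.odd_iff.1 (hp.out.odd_of_ne_two hp2)
  rw [legendreSym.at_neg_one hp2, legendreSym.at_neg_two hp2, ZMod.χ₄_nat_eq_if_mod_four,
    ZMod.χ₈'_nat_eq_if_mod_eight]
  have h8 : p % 8 = 1 ∨ p % 8 = 3 ∨ p % 8 = 5 ∨ p % 8 = 7 := by omega
  rcases h8 with h | h | h | h
  · have h4 : p % 4 = 1 := by omega
    simp [h, h4, hodd]
  · have h4 : p % 4 = 3 := by omega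
    simp [h, h4, hodd]
  · have h4 : p % 4 = 1 := by omega
    simp [h, h4, hodd]
  · have h4 : p % 4 = 3 := by omega
    simp [h, h4, hodd]

theorem eps_nu_spec {p : ℕ} [hp : Fact p.Prime] (hp2 : p ≠ 2) :
    eps p ≤ 1 ∧ nu p ≤ 1 ∧ p = 8 * (p / 8) + 2 * eps p + 4 * nu p + 1 := by
  rw [eps, nu]
  rcases legendreSym_cases hp2 with ⟨h, h1, h2⟩ | ⟨h, h1, h2⟩ | ⟨h, h1, h2⟩ | ⟨h, h1, h2⟩ <;>
  · rw [h1, h2]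
    norm_num
    omega

/-- The coefficients of the level 2 Fricke supersingular polynomial. -/
def ssCoeff (p : ℕ) [Fact p.Prime] (n : ℕ) : ZMod p :=
  poch p (-(p / 8 : ℕ) : ZMod p) n *
    poch p ((3 : ZMod p) / 8 - ((((eps p : ℤ) - 2 * (nu p : ℤ)) : ℤ) : ZMod p) / 4) n /
    ((n.factorial : ZMod p)) ^ 2

theorem poch_succ (p : ℕ) [Fact p.Prime] (x : ZMod p) (n : ℕ) : poch p x (n + 1) = poch p x n * (x + n) := by
  rw [poch, poch, ascPochhammer_succ_eval]

theorem ssCoeff_succ {p : ℕ} [hp : Fact p.Prime] (hp2 : p ≠ 2) {n : ℕ} (hn : n < p / 8) :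
    64 * ((n : ZMod p) + 1) ^ 2 * ssCoeff p (n + 1) =
      (8 * n + 1 + 4 * nu p) * (8 * n + 3 + 4 * nu p) * ssCoeff p n := by
  obtain ⟨he, -, hp8⟩ := eps_nu_spec hp2
  have hsmall : ∀ k : ℕ, 0 < k → k < p → (k : ZMod p) ≠ 0 := fun k h0 h h' ↦
    Nat.not_dvd_of_pos_of_lt h0 h ((ZMod.natCast_eq_zero_iff k p).1 h')
  have h2 : (2 : ZMod p) ≠ 0 := by
    have := hsmall 2 two_pos (by omega)
    exact_mod_cast this
  have h8 : (8 : ZMod p) ≠ 0 := by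
    rw [show (8 : ZMod p) = 2 ^ 3 by norm_num]
    exact pow_ne_zero 3 h2
  have h4 : (4 : ZMod p) ≠ 0 := by
    rw [show (4 : ZMod p) = 2 ^ 2 by norm_num]
    exact pow_ne_zero 2 h2
  have hn1 : ((n : ZMod p) + 1) ≠ 0 := by
    have := hsmall (n + 1) (by omega) (by omega)
    exact_mod_cast this
  have hf : (n.factorial : ZMod p) ≠ 0 := by
    intro h
    have := (hp.out.dvd_factorial).1 ((ZMod.natCast_eq_zero_iff _ p).1 h)
    omega
  have hp8' : (8 * (p / 8 : ℕ) + 2 * eps p + 4 * nu p + 1 : ZMod p) = 0 := by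
    have : ((8 * (p / 8) + 2 * eps p + 4 * nu p + 1 : ℕ) : ZMod p) = 0 :=
      (ZMod.natCast_eq_zero_iff _ p).2 ⟨1, by omega⟩
    exact_mod_cast this
  have hm : (8 : ZMod p) * (-(p / 8 : ℕ) + n) = 8 * n + (1 + 2 * eps p + 4 * nu p) := by
    linear_combination -hp8'
  have hb : (8 : ZMod p) * ((3 : ZMod p) / 8 -
      ((((eps p : ℤ) - 2 * (nu p : ℤ)) : ℤ) : ZMod p) / 4 + n) =
      8 * n + (3 - 2 * eps p + 4 * nu p) := by
    push_cast
    field_simp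
    ring
  have key : 64 * ((n : ZMod p) + 1) ^ 2 * ssCoeff p (n + 1) =
      (8 * n + (1 + 2 * eps p + 4 * nu p)) * (8 * n + (3 - 2 * eps p + 4 * nu p)) *
        ssCoeff p n := by
    rw [← hm, ← hb, ssCoeff, ssCoeff, poch_succ, poch_succ, Nat.factorial_succ]
    push_cast
    generalize (3 : ZMod p) / 8 - ((eps p : ZMod p) - 2 * (nu p : ZMod p)) / 4 = b
    field_simp
    ring
  rw [key]
  interval_cases h : eps p
  · push_cast
    ring
  · push_cast
    ring

/-- The truncated hypergeometric factor of the supersingular polynomial. -/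
def ssFactor (p : ℕ) [Fact p.Prime] : (ZMod p)[X] :=
  ∑ n ∈ Finset.range (p / 8 + 1), C (ssCoeff p n * 256 ^ n) * X ^ (p / 8 - n)

/-- A product of powers of factors of the supersingular polynomial, which describes
the reduction of the Hasse invariant. -/
def hassePoly (p : ℕ) [Fact p.Prime] : (ZMod p)[X] :=
  X ^ eps p * (X - C 256) ^ (2 * nu p) * ssFactor p ^ 4

theorem ss2Star_eq {p : ℕ} [hp : Fact p.Prime] :
    ss2Star p = (X - C 256) ^ nu p * (X ^ eps p * ssFactor p) := by
  rw [ss2Star, ssFactor, Finset.mul_sum _ _ (X ^ eps p)]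
  refine congrArg _ (Finset.sum_congr rfl fun n hn ↦ ?_)
  rw [Finset.mem_range] at hn
  rw [ssCoeff, mul_left_comm, ← pow_add, show p / 8 + eps p - n = eps p + (p / 8 - n) by omega]

theorem eval_hassePoly_eq_zero_iff {p : ℕ} [hp : Fact p.Prime] (x : ZMod p) :
    (hassePoly p).eval x = 0 ↔ (ss2Star p).eval x = 0 := by
  rw [hassePoly, ss2Star_eq]
  simp only [eval_mul, eval_pow, mul_eq_zero, pow_eq_zero_iff', ne_eq, OfNat.ofNat_ne_zero,
    not_false_eq_true, and_true, false_or]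
  tauto

/-- A series with constant coefficient one divided by a nonzero one without constant coefficient
is transcendental. -/
theorem eq_zero_of_eval₂_div_eq_zero {K : Type*} [Field K] {P D : PowerSeries K}
    (hP : PowerSeries.constantCoeff P = 1) (hD : PowerSeries.constantCoeff D = 0) (hD0 : D ≠ 0)
    {G : K[X]} (h : G.eval₂ ((algebraMap (PowerSeries K) (FractionRing (PowerSeries K))).comp
      (PowerSeries.C (R := K))) (algebraMap _ _ P / algebraMap _ _ D) = 0) : G = 0 := by
  have hd : algebraMap (PowerSeries K) (FractionRing (PowerSeries K)) D ≠ 0 := by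
    simpa using hD0
  have hS : (∑ i ∈ Finset.range (G.natDegree + 1), PowerSeries.C (G.coeff i) * P ^ i *
      D ^ (G.natDegree - i)) = 0 := by
    apply IsFractionRing.injective (PowerSeries K) (FractionRing (PowerSeries K))
    rw [map_zero, ← mul_zero (algebraMap (PowerSeries K) (FractionRing (PowerSeries K)) D ^ G.natDegree),
      ← h, eval₂_eq_sum_range, Finset.mul_sum, map_sum]
    refine Finset.sum_congr rfl fun i hi ↦ ?_
    have hi : i ≤ G.natDegree := Nat.lt_succ_iff.1 (Finset.mem_range.1 hi)
    rw [map_mul, map_mul, map_pow, map_pow, div_pow, ← pow_sub_mul_pow _ hi, RingHom.comp_apply]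
    have := pow_ne_zero i hd
    field_simp
  have h0 := congrArg PowerSeries.constantCoeff hS
  rw [map_sum, map_zero, Finset.sum_range_succ, Finset.sum_eq_zero, zero_add] at h0
  · simpa [hP] using h0
  · intro i hi
    have : G.natDegree - i ≠ 0 := by
      have := Finset.mem_range.1 hi
      omega
    simp [hD, this]

theorem frickeSeries_map {p : ℕ} [hp : Fact p.Prime] :
    PowerSeries.constantCoeff (PowerSeries.map (Int.castRingHom (ZMod p)) (frickeP ^ 4)) = 1 ∧
    PowerSeries.constantCoeff (PowerSeries.map (Int.castRingHom (ZMod p)) frickeD) = 0 ∧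
    PowerSeries.map (Int.castRingHom (ZMod p)) frickeD ≠ 0 := by
  refine ⟨constantCoeff_map_of_eq_one (by rw [map_pow, constantCoeff_frickeP, one_pow]), ?_, ?_⟩
  · rw [frickeD_eq, map_mul, PowerSeries.map_X]
    simp
  · rw [frickeD_eq, map_mul, PowerSeries.map_X]
    refine mul_ne_zero PowerSeries.X_ne_zero fun h ↦ ?_
    have := constantCoeff_map_of_eq_one (K := ZMod p) constantCoeff_frickeDUnit
    rw [h, map_zero] at this
    exact zero_ne_one this

section FractionField

variable {p : ℕ} [hp : Fact p.Prime] {P D : PowerSeries (ZMod p)}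

theorem hassePoly_eval₂ (hp2 : 2 < p)
    (hP : P = PowerSeries.map (Int.castRingHom (ZMod p)) (frickeP ^ 4))
    (hD : D = PowerSeries.map (Int.castRingHom (ZMod p)) frickeD) (hD0 : D ≠ 0) {m : ℕ}
    (hm : p = 2 * m + 1) :
    algebraMap _ (FractionRing (PowerSeries (ZMod p))) D ^ m * (hassePoly p).eval₂
      ((algebraMap (PowerSeries (ZMod p)) (FractionRing (PowerSeries (ZMod p)))).comp
        (PowerSeries.C (R := ZMod p))) (algebraMap _ _ P / algebraMap _ _ D) = 1 := by
  obtain ⟨he, hv, hp8⟩ := eps_nu_spec (p := p) hp2.ne'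
  have hm₂ : m = 4 * (p / 8) + eps p + 2 * nu p := by omega
  have hend : (8 * ((p / 8 : ℕ) : ZMod p) + 1 + 4 * nu p) * (8 * (p / 8 : ℕ) + 3 + 4 * nu p) = 0 := by
    have : ((8 * (p / 8) + 2 * eps p + 4 * nu p + 1 : ℕ) : ZMod p) = 0 :=
      (ZMod.natCast_eq_zero_iff _ p).2 ⟨1, by omega⟩
    push_cast at this
    interval_cases h : eps p
    · apply mul_eq_zero_of_left
      rw [← this]
      push_cast
      ring
    · apply mul_eq_zero_of_right
      rw [← this]
      push_cast
      ring
  have key := fricke_series_identity hp2 hm hv hm₂ (ssCoeff p)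
    (by simp [ssCoeff, poch]) (fun n hn ↦ ssCoeff_succ hp2.ne' hn) hend rfl hD
  rw [← map_pow, ← hP] at key
  set ι := algebraMap (PowerSeries (ZMod p)) (FractionRing (PowerSeries (ZMod p)))
  have hd : ι D ≠ 0 := by simpa [ι] using hD0
  have key2 := congrArg ι key
  rw [map_one, map_mul, map_mul, map_pow, map_pow, map_pow, map_sub, map_mul, map_sum] at key2
  rw [← key2, hassePoly, eval₂_mul, eval₂_mul, eval₂_pow, eval₂_pow, eval₂_pow, eval₂_sub, eval₂_X,
    eval₂_C, ssFactor, eval₂_finsetSum]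
  have e1 : ι (∑ n ∈ Finset.range (p / 8 + 1), PowerSeries.C (ssCoeff p n * 256 ^ n) * D ^ n *
      P ^ (p / 8 - n)) = ι D ^ (p / 8) * ∑ n ∈ Finset.range (p / 8 + 1),
        eval₂ (ι.comp PowerSeries.C) (ι P / ι D) (C (ssCoeff p n * 256 ^ n) * X ^ (p / 8 - n)) := by
    rw [map_sum, Finset.mul_sum]
    refine Finset.sum_congr rfl fun n hn ↦ ?_
    have hn : n ≤ p / 8 := Nat.lt_succ_iff.1 (Finset.mem_range.1 hn)
    rw [eval₂_mul, eval₂_C, eval₂_X_pow, map_mul, map_mul, map_pow, map_pow, div_pow,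
      ← pow_mul_pow_sub _ hn, RingHom.comp_apply]
    have := pow_ne_zero (p / 8 - n) hd
    field_simp
  rw [← map_sum, e1]
  have e2 : ι P - ι 256 * ι D = ι D * (ι P / ι D - (ι.comp PowerSeries.C) 256) := by
    rw [RingHom.comp_apply, map_ofNat PowerSeries.C, map_ofNat]
    field_simp
  have e3 : ι P = ι D * (ι P / ι D) := by field_simp
  rw [e2, show ι P ^ eps p = (ι D * (ι P / ι D)) ^ eps p by rw [← e3], mul_pow, mul_pow, mul_pow,
    hm₂, pow_add, pow_add, ← pow_mul]
  ring

theorem eval₂_map_castRingHom {K L : Type*} [Field K] [Field L] (φ : K →+* L) (Q : ℤ[X]) (x : L) :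
    (Q.map (Int.castRingHom K)).eval₂ φ x = Q.eval₂ (Int.castRingHom L) x := by
  rw [eval₂_map]
  congr 1
  exact RingHom.ext_int _ _

end FractionField

/-- Reduction of the diagonal modular polynomial (Kronecker's congruence). -/
theorem map_modular_polynomial {p : ℕ} [hp : Fact p.Prime] {F : ℤ[X]} (hF : F.natDegree ≤ 2 * p)
    (h : ∀ P D : PowerSeries (ZMod p), P = PowerSeries.map (Int.castRingHom (ZMod p)) (frickeP ^ 4) →
        D = PowerSeries.map (Int.castRingHom (ZMod p)) frickeD →
        homogEval (2 * (p + 1)) F P D = -(P * D ^ p - P ^ p * D) ^ 2) :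
    F.map (Int.castRingHom (ZMod p)) = -(X ^ p - X) ^ 2 := by
  obtain ⟨hP, hD, hD0⟩ := frickeSeries_map (p := p)
  set P := PowerSeries.map (Int.castRingHom (ZMod p)) (frickeP ^ 4) with hP'
  set D := PowerSeries.map (Int.castRingHom (ZMod p)) frickeD with hD'
  have h1 := congrArg (algebraMap _ (FractionRing (PowerSeries (ZMod p)))) (h P D rfl rfl)
  rw [← sub_eq_zero]
  apply eq_zero_of_eval₂_div_eq_zero hP hD hD0
  rw [map_homogEval] at h1
  set ι := algebraMap (PowerSeries (ZMod p)) (FractionRing (PowerSeries (ZMod p)))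
  have hd : ι D ≠ 0 := by simpa [ι] using hD0
  rw [homogEval_eq (hF.trans (by omega)) _ hd] at h1
  rw [eval₂_sub, eval₂_map_castRingHom, eval₂_neg, eval₂_pow, eval₂_sub, eval₂_X_pow, eval₂_X]
  apply mul_left_cancel₀ (pow_ne_zero (2 * (p + 1)) hd)
  obtain ⟨t, ht⟩ : ∃ t, t = ι P / ι D := ⟨_, rfl⟩
  have ht' : ι P = ι D * t := by
    rw [ht]
    field_simp
  rw [mul_sub, h1, ← ht]
  simp only [map_neg, map_sub, map_mul, map_pow]
  rw [ht']
  ring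

theorem map_multiplier_polynomial {p : ℕ} [hp : Fact p.Prime] (hp2 : 2 < p) {m : ℕ}
    (hm : p = 2 * m + 1) {n : ℤ} {Q : ℤ[X]} (hQ : Q.natDegree ≤ 2 * m * (p + 1))
    (h : ∀ P D : PowerSeries (ZMod p), P = PowerSeries.map (Int.castRingHom (ZMod p)) (frickeP ^ 4) →
        D = PowerSeries.map (Int.castRingHom (ZMod p)) frickeD →
        homogEval (2 * m * (p + 1)) Q P D = (n * D ^ m * D ^ (p * m) - D ^ (2 * m)) ^ 2) :
    Q.map (Int.castRingHom (ZMod p)) = (C (n : ZMod p) - hassePoly p ^ (p - 1)) ^ 2 := by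
  obtain ⟨hP, hD, hD0⟩ := frickeSeries_map (p := p)
  set P := PowerSeries.map (Int.castRingHom (ZMod p)) (frickeP ^ 4) with hP'
  set D := PowerSeries.map (Int.castRingHom (ZMod p)) frickeD with hD'
  have h1 := congrArg (algebraMap _ (FractionRing (PowerSeries (ZMod p)))) (h P D rfl rfl)
  have h2 := hassePoly_eval₂ hp2 hP' hD' hD0 hm
  rw [← sub_eq_zero]
  apply eq_zero_of_eval₂_div_eq_zero hP hD hD0
  rw [map_homogEval] at h1
  set ι := algebraMap (PowerSeries (ZMod p)) (FractionRing (PowerSeries (ZMod p)))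
  have hd : ι D ≠ 0 := by simpa [ι] using hD0
  rw [homogEval_eq hQ _ hd] at h1
  rw [eval₂_sub, eval₂_map_castRingHom, eval₂_pow, eval₂_sub, eval₂_C, eval₂_pow]
  set y := eval₂ (ι.comp PowerSeries.C) (ι P / ι D) (hassePoly p)
  apply mul_left_cancel₀ (pow_ne_zero (2 * m * (p + 1)) hd)
  have hexp : m + p * m = 2 * m + m * (2 * m) := by
    rw [hm]
    ring
  rw [mul_sub, h1, mul_zero, map_intCast, show p - 1 = 2 * m by omega]
  simp only [map_sub, map_mul, map_pow, map_intCast]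
  have e1 : ι D ^ (2 * m * (p + 1)) = (ι D ^ m * ι D ^ (p * m)) ^ 2 := by ring
  have e2 : ι D ^ m * ι D ^ (p * m) * y ^ (2 * m) = ι D ^ (2 * m) := by
    rw [← pow_add, hexp, pow_add, pow_mul _ m, mul_assoc, ← mul_pow, h2, one_pow, mul_one]
  rw [e1, ← e2]
  ring

theorem exists_reduction (p : ℕ) [hp : Fact p.Prime] : ∃ (κ : Type) (_ : Field κ)
    (_ : integralClosure ℤ ℂ →+* κ) (_ : ZMod p →+* κ), True := by
  have hprime : Prime (p : ℤ) := Nat.prime_iff_prime_int.1 hp.out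
  have hirr : Irreducible (p : ℤ) := hprime.irreducible
  have hmax : (Ideal.span {(p : ℤ)}).IsMaximal :=
    PrincipalIdealRing.isMaximal_of_irreducible hirr
  obtain ⟨Q, hQ, hQ'⟩ := Ideal.exists_maximal_ideal_liesOver_of_isIntegral
    (Ideal.span {(p : ℤ)}) (S := integralClosure ℤ ℂ)
  let _ := Ideal.Quotient.field Q
  have hpQ : ((p : ℕ) : integralClosure ℤ ℂ ⧸ Q) = 0 := by
    have h1 : (p : ℤ) ∈ Ideal.comap (algebraMap ℤ (integralClosure ℤ ℂ)) Q := by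
      rw [← Ideal.under_def, ← hQ'.over]
      exact Ideal.mem_span_singleton_self _
    have h2 := Ideal.Quotient.eq_zero_iff_mem.2 (Ideal.mem_comap.1 h1)
    simpa using h2
  have : CharP (integralClosure ℤ ℂ ⧸ Q) p := by
    obtain ⟨q, hq⟩ := CharP.exists (integralClosure ℤ ℂ ⧸ Q)
    have h1 : q ∣ p := (CharP.cast_eq_zero_iff _ q p).1 hpQ
    rcases (Nat.dvd_prime hp.out).1 h1 with h | h
    · subst h
      exact absurd rfl (CharP.char_ne_one (integralClosure ℤ ℂ ⧸ Q) 1)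
    · exact h ▸ hq
  exact ⟨_, inferInstance, Ideal.Quotient.mk Q, ZMod.castHom dvd_rfl _, trivial⟩

theorem map_multiset_prod_X_sub_C {A B : Type*} [CommRing A] [CommRing B] (f : A →+* B)
    (s : Multiset A) : ((s.map fun z => X - C z).prod).map f =
      ((s.map f).map fun y => X - C y).prod := by
  rw [Polynomial.map_multiset_prod, Multiset.map_map, Multiset.map_map]
  congr 1
  exact Multiset.map_congr rfl fun z _ => by simp

/-- Counting the complex roots of an integral polynomial congruent to `-(X ^ p - X) ^ 2` which
reduce to roots of `H`. -/
theorem ncard_eq_two_mul_card_filter {p : ℕ} [hp : Fact p.Prime] {F : ℤ[X]} (hF : F.natDegree ≤ 2 * p)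
    (hFl : F.coeff (2 * p) = -1) (hFp : F.map (Int.castRingHom (ZMod p)) = -(X ^ p - X) ^ 2)
    (H : (ZMod p)[X]) (S : Set ℂ)
    (h : ∀ z, F.eval₂ (Int.castRingHom ℂ) z = 0 → ∃ (n : ℤ) (Q : ℤ[X]),
      Q.eval₂ (Int.castRingHom ℂ) z = 0 ∧
      Q.map (Int.castRingHom (ZMod p)) = (C (n : ZMod p) - H ^ (p - 1)) ^ 2 ∧
      ((n : ZMod p) = 0 ↔ z ∈ S))
    (hS : ∀ z ∈ S, F.eval₂ (Int.castRingHom ℂ) z = 0 ∧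
      (derivative F).eval₂ (Int.castRingHom ℂ) z ≠ 0) :
    S.ncard = 2 * (Finset.univ.filter fun x : ZMod p => H.eval x = 0).card := by
  classical
  obtain ⟨κ, _, φ, ι, -⟩ := exists_reduction p
  have hdeg : F.natDegree = 2 * p :=
    le_antisymm hF (le_natDegree_of_ne_zero (by rw [hFl]; norm_num))
  have hmonic : (-F).Monic := by
    rw [Monic, leadingCoeff, natDegree_neg, hdeg, coeff_neg, hFl, neg_neg]
  set R := ((-F).map (Int.castRingHom ℂ)).roots with hR
  have hmonicC : ((-F).map (Int.castRingHom ℂ)).Monic := hmonic.map _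
  have hR0 : (-F).map (Int.castRingHom ℂ) ≠ 0 := hmonicC.ne_zero
  have hmem : ∀ z, z ∈ R ↔ F.eval₂ (Int.castRingHom ℂ) z = 0 := by
    intro z
    rw [hR, mem_roots hR0, IsRoot, eval_map, eval₂_neg, neg_eq_zero]
  have h_int : ∀ z ∈ R, z ∈ integralClosure ℤ ℂ := by
    intro z hz
    refine ⟨-F, hmonic, ?_⟩
    have := (hmem z).1 hz
    rw [show algebraMap ℤ ℂ = Int.castRingHom ℂ from rfl, eval₂_neg, this, neg_zero]
  set R' : Multiset (integralClosure ℤ ℂ) := R.pmap (fun z hz => ⟨z, hz⟩) h_int with hR'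
  have hval : R'.map Subtype.val = R := by
    rw [hR', Multiset.map_pmap, Multiset.pmap_eq_map, Multiset.map_id']
  have hprodC : (R.map fun z => X - C z).prod = (-F).map (Int.castRingHom ℂ) := by
    have := (IsAlgClosed.splits ((-F).map (Int.castRingHom ℂ))).eq_prod_roots
    rw [hmonicC.leadingCoeff, map_one, one_mul] at this
    exact this.symm
  have hprodO : (R'.map fun z => X - C z).prod =
      (-F).map (Int.castRingHom (integralClosure ℤ ℂ)) := by
    apply map_injective (algebraMap (integralClosure ℤ ℂ) ℂ) Subtype.val_injective
    rw [Polynomial.map_map, map_multiset_prod_X_sub_C, RingHom.ext_int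
      ((algebraMap (integralClosure ℤ ℂ) ℂ).comp (Int.castRingHom _)) (Int.castRingHom ℂ), ← hprodC,
      ← hval]
    rfl
  have hprodκ : ((R'.map φ).map fun y => X - C y).prod = ((X ^ p - X) ^ 2 : κ[X]) := by
    have h1 := congrArg (Polynomial.map φ) hprodO
    rw [Polynomial.map_map, RingHom.ext_int (φ.comp _) (ι.comp (Int.castRingHom (ZMod p))),
      ← Polynomial.map_map, Polynomial.map_neg, hFp, map_multiset_prod_X_sub_C] at h1
    simpa using h1
  have hroots : R'.map φ = 2 • (Finset.univ.val.map ι) := by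
    have h1 : (R'.map φ) = ((X ^ p - X) ^ 2 : κ[X]).roots := by
      rw [← hprodκ, roots_multiset_prod_X_sub_C]
    have h2 : ((X ^ p - X) ^ 2 : κ[X]) =
        ((2 • (Finset.univ.val.map ι)).map fun y => X - C y).prod := by
      have h3 : (X ^ p - X : (ZMod p)[X]) = (Finset.univ.val.map fun y => X - C y).prod := by
        have h5 := FiniteField.roots_X_pow_card_sub_X (ZMod p)
        rw [ZMod.card p] at h5
        rw [← h5]
        refine (prod_multiset_X_sub_C_of_monic_of_roots_card_eq (monic_X_pow_sub ?_) ?_).symm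
        · rw [degree_X]
          exact_mod_cast hp.out.one_lt
        · rw [h5, FiniteField.X_pow_card_sub_X_natDegree_eq _ hp.out.one_lt]
          simp
      have h4 := congrArg (Polynomial.map ι) h3
      rw [map_multiset_prod_X_sub_C] at h4
      rw [Multiset.map_nsmul, Multiset.prod_nsmul]
      congr 1
      simpa using h4
    rw [h1, h2, roots_multiset_prod_X_sub_C]
  have hkey : ∀ r ∈ R', ((H.map ι).eval (φ r) = 0 ↔ (r : ℂ) ∈ S) := by
    intro r hr
    have hrR : (r : ℂ) ∈ R := hval ▸ Multiset.mem_map_of_mem _ hr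
    obtain ⟨n, Q, hQ0, hQp, hn⟩ := h r ((hmem _).1 hrR)
    have hQO : Q.eval₂ (Int.castRingHom (integralClosure ℤ ℂ)) r = 0 := by
      apply Subtype.val_injective (p := fun z => z ∈ integralClosure ℤ ℂ)
      have h3 := hom_eval₂ Q (Int.castRingHom _) (algebraMap (integralClosure ℤ ℂ) ℂ) r
      rw [RingHom.ext_int ((algebraMap (integralClosure ℤ ℂ) ℂ).comp (Int.castRingHom _))
        (Int.castRingHom ℂ)] at h3
      exact h3.trans hQ0
    have h1 : (H.map ι).eval (φ r) ^ (p - 1) = ι n := by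
      have h2 := congrArg φ hQO
      rw [hom_eval₂, map_zero, RingHom.ext_int (φ.comp _) (ι.comp (Int.castRingHom (ZMod p))),
        ← eval₂_map, hQp, eval₂_pow, sq_eq_zero_iff, eval₂_sub, eval₂_C, eval₂_pow, sub_eq_zero] at h2
      rw [h2, eval_map]
    rw [← hn, ← map_eq_zero_iff ι ι.injective, ← h1, pow_eq_zero_iff]
    have := hp.out.two_le
    omega
  have hcount : (R'.countP fun r => (H.map ι).eval (φ r) = 0) =
      2 * (Finset.univ.filter fun x : ZMod p => H.eval x = 0).card := by
    have h1 : (R'.countP fun r => (H.map ι).eval (φ r) = 0) =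
        (R'.map φ).countP fun y => (H.map ι).eval y = 0 := by
      rw [Multiset.countP_map, Multiset.countP_eq_card_filter]
    rw [h1, hroots, Multiset.countP_nsmul, Multiset.countP_map]
    congr 1
    rw [Finset.card_def, Finset.filter_val]
    congr 1
    refine Multiset.filter_congr fun x _ => ?_
    rw [eval_map, eval₂_at_apply, map_eq_zero_iff ι ι.injective]
  have hcount' : (R'.countP fun r => (H.map ι).eval (φ r) = 0) = R.countP (· ∈ S) := by
    rw [← hval, Multiset.countP_map, ← Multiset.countP_eq_card_filter]
    exact Multiset.countP_congr rfl fun r hr => by simpa using hkey r hr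
  rw [← hcount, hcount', Multiset.countP_eq_card_filter]
  have hnodup : (R.filter (· ∈ S)).Nodup := by
    rw [Multiset.nodup_iff_count_le_one]
    intro z
    by_cases hz : z ∈ S
    · rw [Multiset.count_filter_of_pos hz, hR, count_roots]
      by_contra! hlt
      have h1 := (one_lt_rootMultiplicity_iff_isRoot hR0).1 hlt
      apply (hS z hz).2
      have := h1.2
      rwa [IsRoot, derivative_map, eval_map, derivative_neg, eval₂_neg, neg_eq_zero] at this
    · rw [Multiset.count_filter_of_neg hz]
      exact zero_le_one
  have hset : S = ((R.filter (· ∈ S)).toFinset : Set ℂ) := by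
    ext z
    simp only [Finset.mem_coe, Multiset.mem_toFinset, Multiset.mem_filter]
    exact ⟨fun hz => ⟨(hmem z).2 (hS z hz).1, hz⟩, fun hz => hz.2⟩
  conv_lhs => rw [hset]
  rw [Set.ncard_coe_finset, Multiset.toFinset_card_of_nodup hnodup]

theorem mob_eq_self_iff {a b c d : ℤ} {τ : ℂ} (h : (c * τ + d : ℂ) ≠ 0) :
    mob a b c d τ = τ ↔ (a * τ + b : ℂ) = τ * (c * τ + d) := by
  rw [mob, div_eq_iff h]

/-- Integral matrices of determinant `n` up to the level two Fricke group. -/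
def IsFrickeNorm (n a b c d : ℤ) : Prop :=
  2 ∣ c ∧ (a * d - b * c = n ∨ (2 ∣ a ∧ 2 ∣ d ∧ a * d - b * c = 2 * n))

theorem IsFrickeNorm.det_pos {n a b c d : ℤ} (hn : 0 < n) (h : IsFrickeNorm n a b c d) :
    0 < a * d - b * c := by
  rcases h with ⟨-, h | ⟨-, -, h⟩⟩ <;> omega

/-- Standard representatives `[A, B; 0, D]` of the matrices of determinant `p`. -/
def heckeA (p i : ℕ) : ℤ := if i < p then 1 else p
def heckeB (p i : ℕ) : ℤ := if i < p then i else 0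
def heckeD (p i : ℕ) : ℤ := if i < p then p else 1

theorem heckeA_mul_heckeD (p i : ℕ) : heckeA p i * heckeD p i = p := by
  unfold heckeA heckeD
  split_ifs <;> simp

def heckePoint (p i : ℕ) (τ : ℂ) : ℂ := mob (heckeA p i) (heckeB p i) 0 (heckeD p i) τ

theorem heckePoint_of_lt {p i : ℕ} (h : i < p) (τ : ℂ) : heckePoint p i τ = (τ + i) / p := by
  simp [heckePoint, heckeA, heckeB, heckeD, h, mob]

theorem heckePoint_self (p : ℕ) (τ : ℂ) : heckePoint p p τ = p * τ := by
  simp [heckePoint, heckeA, heckeB, heckeD, mob]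

theorem hecke_det_pos {p : ℕ} (hp : 0 < p) (i : ℕ) :
    0 < heckeA p i * heckeD p i - heckeB p i * 0 := by
  rw [mul_zero, sub_zero, heckeA_mul_heckeD]
  exact_mod_cast hp

theorem heckePoint_im_pos {p : ℕ} (hp : 0 < p) (i : ℕ) {τ : ℂ} (hτ : 0 < τ.im) :
    0 < (heckePoint p i τ).im := mob_im_pos (hecke_det_pos hp i) hτ

theorem IsFricke.isFrickeNorm_hecke {a b c d : ℤ} (h : IsFricke a b c d) {p i : ℕ} :
    IsFrickeNorm p (a * heckeA p i) (a * heckeB p i + b * heckeD p i) (c * heckeA p i)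
      (c * heckeB p i + d * heckeD p i) := by
  have e : a * heckeA p i * (c * heckeB p i + d * heckeD p i) -
      (a * heckeB p i + b * heckeD p i) * (c * heckeA p i) = (a * d - b * c) * p := by
    rw [← heckeA_mul_heckeD p i]
    ring
  refine ⟨h.1.mul_right _, ?_⟩
  rcases h with ⟨hc, h | ⟨ha, hd, h⟩⟩
  · exact .inl (by rw [e, h, one_mul])
  · exact .inr ⟨ha.mul_right _, dvd_add (hc.mul_right _) (hd.mul_right _), by rw [e, h]⟩

theorem IsFrickeNorm.exists_eq {p : ℕ} [hp : Fact p.Prime] (hp2 : p ≠ 2) {a b c d : ℤ}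
    (h : IsFrickeNorm p a b c d) : ∃ i ≤ p, ∃ a' b' c' d' : ℤ, IsFricke a' b' c' d' ∧
      a = a' * heckeA p i ∧ b = a' * heckeB p i + b' * heckeD p i ∧ c = c' * heckeA p i ∧
      d = c' * heckeB p i + d' * heckeD p i := by
  have hprime : Prime (p : ℤ) := Nat.prime_iff_prime_int.1 hp.out
  have hp0 : (p : ℤ) ≠ 0 := hprime.ne_zero
  have hodd : ¬ (2 : ℤ) ∣ p := by
    intro h2
    have : 2 ∣ p := by exact_mod_cast h2
    exact hp2 ((Nat.prime_dvd_prime_iff_eq Nat.prime_two hp.out).1 this).symm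
  have h2p : ∀ x : ℤ, 2 ∣ x * p → 2 ∣ x := fun x hx =>
    (Int.prime_two.dvd_or_dvd hx).resolve_right hodd
  have hdvd : (p : ℤ) ∣ a * d - b * c := by
    rcases h.2 with h | ⟨-, -, h⟩ <;> rw [h]
    exact dvd_mul_left _ _
  by_cases hac : (p : ℤ) ∣ a ∧ (p : ℤ) ∣ c
  · obtain ⟨⟨a', rfl⟩, ⟨c', rfl⟩⟩ := hac
    refine ⟨p, le_rfl, a', b, c', d, ⟨?_, ?_⟩, ?_, ?_, ?_, ?_⟩
    · exact h2p _ (mul_comm (p : ℤ) c' ▸ h.1)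
    · rcases h.2 with h | ⟨h1, h2, h⟩
      · exact .inl (mul_left_cancel₀ hp0 (by linear_combination h))
      · exact .inr ⟨h2p _ (mul_comm (p : ℤ) a' ▸ h1), h2,
          mul_left_cancel₀ hp0 (by linear_combination h)⟩
    all_goals simp [heckeA, heckeB, heckeD, mul_comm]
  · have hi : ∃ i : ℕ, i < p ∧ (p : ℤ) ∣ b - a * i ∧ (p : ℤ) ∣ d - c * i := by
      simp only [← ZMod.intCast_zmod_eq_zero_iff_dvd] at hac hdvd ⊢
      push_cast at hac hdvd ⊢
      by_cases ha : (a : ZMod p) = 0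
      · have hc : (c : ZMod p) ≠ 0 := fun hc => hac ⟨ha, hc⟩
        have hb : (b : ZMod p) = 0 := by
          rw [ha, zero_mul, zero_sub, neg_eq_zero] at hdvd
          exact (mul_eq_zero.1 hdvd).resolve_right hc
        refine ⟨(d / c : ZMod p).val, ZMod.val_lt _, ?_, ?_⟩
        · rw [ha, hb, zero_mul, sub_zero]
        · rw [ZMod.natCast_zmod_val, mul_div_cancel₀ _ hc, sub_self]
      · refine ⟨(b / a : ZMod p).val, ZMod.val_lt _, ?_, ?_⟩
        · rw [ZMod.natCast_zmod_val, mul_div_cancel₀ _ ha, sub_self]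
        · rw [ZMod.natCast_zmod_val]
          field_simp
          linear_combination hdvd
    obtain ⟨i, hi, ⟨b', hb⟩, ⟨d', hd⟩⟩ := hi
    refine ⟨i, hi.le, a, b', c, d', ⟨h.1, ?_⟩, ?_, ?_, ?_, ?_⟩
    · rw [show b = a * i + p * b' by linarith, show d = c * i + p * d' by linarith] at h
      obtain ⟨hc, h⟩ := h
      rcases h with h | ⟨h1, h2, h⟩
      · exact .inl (mul_left_cancel₀ hp0 (by linear_combination h))
      · refine .inr ⟨h1, ?_, mul_left_cancel₀ hp0 (by linear_combination h)⟩
        have h3 : 2 ∣ d' * p := by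
          have := dvd_sub h2 (hc.mul_right (i : ℤ))
          rwa [add_sub_cancel_left, mul_comm] at this
        exact h2p _ h3
    all_goals simp only [heckeA, heckeB, heckeD, hi, if_true]; linarith

/-- Two product matrices which agree up to sign come from the same representative. -/
theorem hecke_index_eq {p : ℕ} [hp : Fact p.Prime] (hp2 : p ≠ 2) {a b c d a' b' c' d' : ℤ} {i j : ℕ}
    (hi : i ≤ p) (hj : j ≤ p) (h : IsFricke a b c d) (h' : IsFricke a' b' c' d') {e : ℤ}
    (he : IsUnit e)
    (h1 : a * heckeA p i = e * (a' * heckeA p j))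
    (h2 : a * heckeB p i + b * heckeD p i = e * (a' * heckeB p j + b' * heckeD p j))
    (h3 : c * heckeA p i = e * (c' * heckeA p j))
    (h4 : c * heckeB p i + d * heckeD p i = e * (c' * heckeB p j + d' * heckeD p j)) : i = j := by
  have hprime : Prime (p : ℤ) := Nat.prime_iff_prime_int.1 hp.out
  have key : ∀ a b c d : ℤ, IsFricke a b c d → (p : ℤ) ∣ a → (p : ℤ) ∣ c → False := by
    intro a b c d h ha hc
    have h5 : (p : ℤ) ∣ 2 := by
      have h6 : (p : ℤ) ∣ a * d - b * c := dvd_sub (ha.mul_right _) (hc.mul_left _)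
      rcases h.2 with h | ⟨-, -, h⟩ <;> rw [h] at h6
      · exact h6.trans (one_dvd _)
      · exact h6
    have h6 : p ∣ 2 := by exact_mod_cast h5
    exact hp2 ((Nat.prime_dvd_prime_iff_eq hp.out Nat.prime_two).1 h6)
  rcases hi.lt_or_eq with hi | rfl <;> rcases hj.lt_or_eq with hj | rfl
  · simp only [heckeA, heckeB, heckeD, hi, hj, if_true, mul_one] at h1 h2 h3 h4
    have h5 : (p : ℤ) ∣ a * ((i : ℤ) - j) := ⟨e * b' - b, by rw [h1] at h2 ⊢; linear_combination h2⟩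
    have h6 : (p : ℤ) ∣ c * ((i : ℤ) - j) := ⟨e * d' - d, by rw [h3] at h4 ⊢; linear_combination h4⟩
    rcases hprime.dvd_or_dvd h5 with h7 | h7
    · rcases hprime.dvd_or_dvd h6 with h8 | h8
      · exact (key _ _ _ _ h h7 h8).elim
      · have := Int.eq_zero_of_abs_lt_dvd h8 (by rw [abs_lt]; omega)
        omega
    · have := Int.eq_zero_of_abs_lt_dvd h7 (by rw [abs_lt]; omega)
      omega
  · simp only [heckeA, hi, if_true, lt_irrefl, if_false, mul_one] at h1 h3
    exact (key _ _ _ _ h ⟨e * a', by rw [h1]; ring⟩ ⟨e * c', by rw [h3]; ring⟩).elim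
  · simp only [heckeA, hj, if_true, lt_irrefl, if_false, mul_one] at h1 h3
    refine (key _ _ _ _ h' ?_ ?_).elim
    · exact he.dvd_mul_left.1 ⟨a, by rw [← h1]; ring⟩
    · exact he.dvd_mul_left.1 ⟨c, by rw [← h3]; ring⟩
  · rfl

/-- Power sums of the roots of an integral quadratic polynomial. -/
theorem exists_power_sum (S N : ℤ) {k : ℕ} (hk : k ≠ 0) : ∃ n : ℤ, N ∣ n - S ^ k ∧
    ∀ x y : ℂ, x + y = S → x * y = N → x ^ k + y ^ k = n := by
  have key : ∀ k : ℕ, ∃ m n : ℤ, N ∣ m - S ^ (k + 1) ∧ N ∣ n - S ^ (k + 2) ∧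
      ∀ x y : ℂ, x + y = S → x * y = N → x ^ (k + 1) + y ^ (k + 1) = m ∧
        x ^ (k + 2) + y ^ (k + 2) = n := by
    intro k
    induction k with
    | zero =>
      refine ⟨S, S ^ 2 - 2 * N, by simp, ⟨-2, by ring⟩, fun x y h1 h2 => ⟨by simpa using h1, ?_⟩⟩
      push_cast
      rw [← h1, ← h2]
      ring
    | succ k ih =>
      obtain ⟨m, n, hm, ⟨w, hn⟩, h⟩ := ih
      refine ⟨n, S * n - N * m, ⟨w, hn⟩, ⟨S * w - m, by rw [pow_succ S (k + 2)] at *; linear_combination S * hn⟩,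
        fun x y h1 h2 => ⟨(h x y h1 h2).2, ?_⟩⟩
      push_cast
      rw [← (h x y h1 h2).1, ← (h x y h1 h2).2, ← h1, ← h2]
      ring
  obtain ⟨j, rfl⟩ := Nat.exists_eq_succ_of_ne_zero hk
  obtain ⟨m, n, h1, -, h2⟩ := key j
  exact ⟨m, h1, fun x y hx hy => (h2 x y hx hy).1⟩

theorem eq_of_fix_of_eq_zero {a b c d : ℤ} {τ : ℂ} (hτ : 0 < τ.im)
    (h : (a * τ + b : ℂ) = τ * (c * τ + d)) (hc : c = 0) : a = d ∧ b = 0 := by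
  subst hc
  have h1 := congrArg Complex.im h
  have h2 := congrArg Complex.re h
  simp at h1 h2
  have had : (a : ℝ) = d := by
    rw [mul_comm τ.im] at h1
    exact mul_right_cancel₀ hτ.ne' h1
  rw [had] at h2
  refine ⟨by exact_mod_cast had, ?_⟩
  have : (b : ℝ) = 0 := by linarith
  exact_mod_cast this

theorem disc_neg_of_fix {a b c d : ℤ} {τ : ℂ} (hτ : 0 < τ.im)
    (h : (a * τ + b : ℂ) = τ * (c * τ + d)) (hc : c ≠ 0) :
    (a + d) ^ 2 < 4 * (a * d - b * c) := by
  have h1 : (2 * c * τ + d - a : ℂ) ^ 2 = (((a + d) ^ 2 - 4 * (a * d - b * c) : ℤ) : ℂ) := by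
    push_cast
    linear_combination -4 * c * h
  have him : (2 * c * τ + d - a : ℂ).im = 2 * c * τ.im := by simp
  set z : ℂ := 2 * c * τ + d - a
  have hc' : (c : ℝ) ≠ 0 := by exact_mod_cast hc
  have hz : z.im ≠ 0 := by
    rw [him]
    positivity
  have h2 := congrArg Complex.im h1
  have h3 := congrArg Complex.re h1
  rw [sq, Complex.mul_im, Complex.intCast_im] at h2
  rw [sq, Complex.mul_re, Complex.intCast_re] at h3
  have hre : z.re = 0 := by
    have : z.re * z.im = 0 := by linarith
    exact (mul_eq_zero.1 this).resolve_right hz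
  rw [hre] at h3
  have h4 : (((a + d) ^ 2 - 4 * (a * d - b * c) : ℤ) : ℝ) < 0 := by
    rw [← h3]
    have := mul_self_pos.2 hz
    linarith
  have h5 : (a + d) ^ 2 - 4 * (a * d - b * c) < 0 := by exact_mod_cast h4
  linarith

theorem IsFrickeNorm.ne_zero_of_fix {p : ℕ} [hp : Fact p.Prime] (hp2 : p ≠ 2) {a b c d : ℤ}
    (h : IsFrickeNorm p a b c d) {τ : ℂ} (hτ : 0 < τ.im)
    (hfix : (a * τ + b : ℂ) = τ * (c * τ + d)) : c ≠ 0 := by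
  intro hc
  obtain ⟨rfl, rfl⟩ := eq_of_fix_of_eq_zero hτ hfix hc
  subst hc
  have hprime : Prime (p : ℤ) := Nat.prime_iff_prime_int.1 hp.out
  have key : ∀ k : ℤ, ¬ (p : ℤ) ∣ k → a * a = k * p → False := by
    intro k hk h
    have ha : (p : ℤ) ∣ a := by
      rcases hprime.dvd_or_dvd (Dvd.intro_left k h.symm) with h | h <;> exact h
    obtain ⟨e, rfl⟩ := ha
    exact hk ⟨e * e, mul_right_cancel₀ hprime.ne_zero (by linear_combination -h)⟩
  rcases h.2 with h | ⟨-, -, h⟩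
  · exact key 1 (fun h1 => hprime.not_isUnit (isUnit_of_dvd_one h1)) (by linarith)
  · refine key 2 (fun h1 => hp2 ?_) (by linarith)
    have h6 : p ∣ 2 := by exact_mod_cast h1
    exact (Nat.prime_dvd_prime_iff_eq hp.out Nat.prime_two).1 h6

theorem IsFrickeNorm.trace_eq_zero_of_dvd {p : ℕ} [hp : Fact p.Prime] (hp5 : 5 ≤ p) {a b c d : ℤ}
    (h : IsFrickeNorm p a b c d) {τ : ℂ} (hτ : 0 < τ.im)
    (hfix : (a * τ + b : ℂ) = τ * (c * τ + d)) (hdvd : (p : ℤ) ∣ a + d) : a + d = 0 := by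
  have hdisc := disc_neg_of_fix hτ hfix (h.ne_zero_of_fix (by omega) hτ hfix)
  have hp5' : (5 : ℤ) ≤ p := by exact_mod_cast hp5
  rcases h.2 with h | ⟨ha, hd, h⟩
  · obtain ⟨k, hk⟩ := hdvd
    rw [h, hk] at hdisc
    rw [hk]
    by_contra hne
    have hk0 : k ≠ 0 := fun h0 => hne (by rw [h0, mul_zero])
    have h1 : 1 ≤ k ^ 2 := by
      have : 0 < k ^ 2 := by positivity
      omega
    have := mul_le_mul_of_nonneg_left h1 (mul_self_nonneg (p : ℤ))
    nlinarith
  · obtain ⟨s, hs⟩ := dvd_add ha hd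
    have hprime : Prime (p : ℤ) := Nat.prime_iff_prime_int.1 hp.out
    rw [hs] at hdvd
    have h2 : ¬ (p : ℤ) ∣ 2 := fun h1 => by
      have := Int.le_of_dvd two_pos h1
      omega
    obtain ⟨k, rfl⟩ := (hprime.dvd_or_dvd hdvd).resolve_left h2
    rw [h, hs] at hdisc
    rw [hs]
    by_contra hne
    have hk0 : k ≠ 0 := fun h0 => hne (by rw [h0]; ring)
    have h1 : 1 ≤ k ^ 2 := by
      have : 0 < k ^ 2 := by positivity
      omega
    have := mul_le_mul_of_nonneg_left h1 (mul_self_nonneg (p : ℤ))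
    nlinarith

/-- The multiplier of a fixed point of a Hecke correspondence. -/
theorem exists_multiplier {p : ℕ} [hp : Fact p.Prime] (hp5 : 5 ≤ p) {m : ℕ} (hm : m ≠ 0)
    {a b c d : ℤ} (h : IsFricke a b c d) {i : ℕ} (hi : i ≤ p) {τ : ℂ} (hτ : 0 < τ.im)
    (hfix : mob a b c d (heckePoint p i τ) = τ) : ∃ (n : ℤ) (v : ℂ),
      ((n : ZMod p) = 0 ↔ a * heckeA p i + (c * heckeB p i + d * heckeD p i) = 0) ∧
      n * formD τ ^ m * v ^ m - v ^ (2 * m) - p ^ (8 * m) * formD τ ^ (2 * m) = 0 ∧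
      (v = p ^ 8 * formD (p * τ) ∨ ∃ b < p, v = formD ((τ + b) / p)) := by
  have hpp := hp.out.pos
  have hM := h.isFrickeNorm_hecke (p := p) (i := i)
  have hw := heckePoint_im_pos hpp i hτ
  have hfix' : mob (a * heckeA p i) (a * heckeB p i + b * heckeD p i) (c * heckeA p i)
      (c * heckeB p i + d * heckeD p i) τ = τ := by
    have := mob_mob (a := a) (b := b) (c := c) (d := d) (a' := heckeA p i)
      (b' := heckeB p i) (denom_ne_zero (hecke_det_pos hpp i) hτ)
    rw [mul_zero, add_zero, mul_zero, add_zero] at this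
    rw [← this]
    exact hfix
  have hdetp := hM.det_pos (by exact_mod_cast hpp)
  have hden := denom_ne_zero hdetp hτ
  rw [mob_eq_self_iff hden] at hfix'
  have hAD : (heckeA p i : ℂ) * heckeD p i = p := by exact_mod_cast heckeA_mul_heckeD p i
  have hp0 : (p : ℂ) ≠ 0 := by exact_mod_cast hpp.ne'
  have hD0 : (heckeD p i : ℂ) ≠ 0 := right_ne_zero_of_mul (hAD ▸ hp0)
  set v : ℂ := heckeA p i ^ 8 * formD (heckePoint p i τ) with hv
  have hv' : v = p ^ 8 * formD (p * τ) ∨ ∃ b < p, v = formD ((τ + b) / p) := by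
    rcases hi.lt_or_eq with hi | rfl
    · exact .inr ⟨i, hi, by rw [hv, heckePoint_of_lt hi]; simp [heckeA, hi]⟩
    · exact .inl (by rw [hv, heckePoint_self]; simp [heckeA])
  have htr : (p : ℤ) ∣ a * heckeA p i + (c * heckeB p i + d * heckeD p i) →
      a * heckeA p i + (c * heckeB p i + d * heckeD p i) = 0 :=
    hM.trace_eq_zero_of_dvd hp5 hτ hfix'
  obtain ⟨l, hl⟩ : ∃ l : ℂ, l = c * heckeA p i * τ + (c * heckeB p i + d * heckeD p i) := ⟨_, rfl⟩
  obtain ⟨l', hl'⟩ : ∃ l' : ℂ, l' = a * heckeA p i - c * heckeA p i * τ := ⟨_, rfl⟩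
  have hl0 : l ≠ 0 := by
    rw [hl]
    exact_mod_cast hden
  have hll : l * l' = p * (a * d - b * c : ℤ) := by
    push_cast at hfix' ⊢
    rw [hl, hl', ← hAD]
    linear_combination c * heckeA p i * hfix'
  have hsum : l + l' = ((a * heckeA p i + (c * heckeB p i + d * heckeD p i) : ℤ) : ℂ) := by
    push_cast
    rw [hl, hl']
    ring
  have hform := formD_mob h hw
  rw [hfix] at hform
  have hlw : (c * heckePoint p i τ + d : ℂ) * heckeD p i = l := by
    rw [hl, heckePoint, mob, Int.cast_zero, zero_mul, zero_add]
    field_simp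
    ring
  have hvl : v * l ^ 8 = p ^ 8 * (a * d - b * c : ℂ) ^ 4 * formD τ := by
    rw [hv, ← hlw, ← hAD]
    linear_combination -(heckeA p i * heckeD p i : ℂ) ^ 8 * hform
  have hg0 : (a * d - b * c : ℂ) ≠ 0 := by
    have := h.det_pos.ne'
    exact_mod_cast this
  have hvg : v * (a * d - b * c : ℂ) ^ 4 = l' ^ 8 * formD τ := by
    push_cast at hll
    apply mul_left_cancel₀ (pow_ne_zero 8 hl0)
    linear_combination (a * d - b * c : ℂ) ^ 4 * hvl -
      formD τ * ((l * l') ^ 7 + (l * l') ^ 6 * (p * (a * d - b * c)) +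
        (l * l') ^ 5 * (p * (a * d - b * c)) ^ 2 + (l * l') ^ 4 * (p * (a * d - b * c)) ^ 3 +
        (l * l') ^ 3 * (p * (a * d - b * c)) ^ 4 + (l * l') ^ 2 * (p * (a * d - b * c)) ^ 5 +
        (l * l') * (p * (a * d - b * c)) ^ 6 + (p * (a * d - b * c)) ^ 7) * hll
  have final : ∀ (y y' : ℂ) (n : ℤ), v = y * formD τ → y * y' = p ^ 8 → y ^ m + y' ^ m = n →
      n * formD τ ^ m * v ^ m - v ^ (2 * m) - p ^ (8 * m) * formD τ ^ (2 * m) = 0 := by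
    intro y y' n h1 h2 h3
    rw [← h3, pow_mul (p : ℂ) 8 m, ← h2, h1]
    ring
  set r := a * heckeA p i + (c * heckeB p i + d * heckeD p i) with hr
  have hzero : ∀ x : ℤ, ∀ k : ℕ, k ≠ 0 → ((x : ZMod p) ^ k = 0 ↔ (p : ℤ) ∣ x) := fun x k hk => by
    rw [pow_eq_zero_iff hk, ZMod.intCast_zmod_eq_zero_iff_dvd]
  rcases h.2 with hdet | ⟨ha, hd, hdet⟩
  · obtain ⟨n, hn, hn'⟩ := exists_power_sum r p (k := 8 * m) (by omega)
    rw [← ZMod.intCast_zmod_eq_zero_iff_dvd, Int.cast_sub, sub_eq_zero, Int.cast_pow] at hn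
    refine ⟨n, v, ?_, final (l' ^ 8) (l ^ 8) n ?_ ?_ ?_, hv'⟩
    · rw [hn, hzero _ _ (by omega)]
      exact ⟨htr, fun h => h ▸ dvd_zero _⟩
    · have hdet' : (a * d - b * c : ℂ) = 1 := by exact_mod_cast hdet
      simpa [hdet'] using hvg
    · rw [hdet, Int.cast_one, mul_one] at hll
      rw [← mul_pow, mul_comm, hll]
    · rw [← pow_mul, ← pow_mul]
      refine hn' l' l (by rw [add_comm, hsum]) ?_
      rw [mul_comm, hll, hdet]
      simp
  · obtain ⟨s, hs⟩ : (2 : ℤ) ∣ r :=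
      dvd_add (ha.mul_right _) (dvd_add (h.1.mul_right _) (hd.mul_right _))
    obtain ⟨n, hn, hn'⟩ := exists_power_sum (2 * s ^ 2 - 2 * p) ((p : ℤ) ^ 2) (k := 4 * m) (by omega)
    have hn := (Dvd.intro_left _ (sq (p : ℤ)).symm).trans hn
    rw [← ZMod.intCast_zmod_eq_zero_iff_dvd, Int.cast_sub, sub_eq_zero, Int.cast_pow] at hn
    have hdet' : (a * d - b * c : ℂ) = 2 := by exact_mod_cast hdet
    rw [hdet] at hll
    rw [hs] at hsum
    push_cast at hll hsum
    refine ⟨n, v, ?_, final ((l' ^ 2 / 2) ^ 4) ((l ^ 2 / 2) ^ 4) n ?_ ?_ ?_, hv'⟩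
    · rw [hn, hzero _ _ (by omega)]
      constructor
      · intro h
        have h1 : (p : ℤ) ∣ r ^ 2 := by
          rw [hs]
          have h2 : (2 * s) ^ 2 = 2 * (2 * s ^ 2 - 2 * p) + p * 4 := by ring
          rw [h2]
          exact dvd_add (h.mul_left 2) (dvd_mul_right _ _)
        exact htr ((Nat.prime_iff_prime_int.1 hp.out).dvd_of_dvd_pow h1)
      · intro h
        rw [h] at hs
        have : s = 0 := by omega
        subst this
        exact ⟨-2, by ring⟩
    · rw [hdet'] at hvg
      linear_combination hvg / 16
    · have : (l' ^ 2 / 2) ^ 4 * (l ^ 2 / 2) ^ 4 = (l * l') ^ 8 / 2 ^ 8 := by ring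
      rw [this, hll]
      ring
    · rw [← pow_mul, ← pow_mul]
      refine hn' _ _ ?_ ?_
      · push_cast
        linear_combination (l + l' + 2 * s) / 2 * hsum - hll
      · push_cast
        have : (l' ^ 2 / 2) * (l ^ 2 / 2) = (l * l') ^ 2 / 4 := by ring
        rw [this, hll]
        ring

/-- An infinite descent argument comparing `p`-adic valuations. -/
theorem eq_zero_of_sq_mul_eq {p : ℕ} (hp : p.Prime) {x y U K : ℤ} (h : x ^ 2 * (U * p) = y ^ 2 * K)
    (hUK : ¬ (p : ℤ) ∣ U * K) : x = 0 := by
  by_contra hx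
  have hprime : Prime (p : ℤ) := Nat.prime_iff_prime_int.1 hp
  have h1 : x ^ 2 ∣ (y * K) ^ 2 := ⟨U * p * K, by linear_combination -K * h⟩
  obtain ⟨w, hw⟩ := (Int.pow_dvd_pow_iff two_ne_zero).1 h1
  have h2 : w ^ 2 = U * K * p := by
    apply mul_left_cancel₀ (pow_ne_zero 2 hx)
    rw [← mul_pow, ← hw]
    linear_combination -K * h
  obtain ⟨e, rfl⟩ := hprime.dvd_of_dvd_pow (h2 ▸ dvd_mul_left _ _ : (p : ℤ) ∣ w ^ 2)
  exact hUK ⟨e ^ 2, mul_right_cancel₀ hprime.ne_zero (by linear_combination -h2)⟩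

theorem fix_proportional {a b c d a' b' c' d' : ℤ} {τ : ℂ} (hτ : 0 < τ.im)
    (h : (a * τ + b : ℂ) = τ * (c * τ + d)) (h' : (a' * τ + b' : ℂ) = τ * (c' * τ + d')) :
    c * (a' - d') = c' * (a - d) ∧ c * b' = c' * b := by
  have h1 : ((c * (a' - d') - c' * (a - d) : ℤ) : ℂ) * τ + ((c * b' - c' * b : ℤ) : ℂ) =
      τ * ((0 : ℤ) * τ + (0 : ℤ)) := by
    push_cast
    linear_combination c * h' - c' * h
  have := eq_of_fix_of_eq_zero hτ h1 rfl
  omega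

/-- Points of the upper half plane fixed by a trace zero matrix of determinant `p` or `2 * p`
in the level two Fricke order. -/
def frickeFixedPoints (p : ℕ) : Set ℂ :=
  {τ | 0 < τ.im ∧ ∃ a b c : ℤ, IsFrickeNorm p a b c (-a) ∧ (a * τ + b : ℂ) = τ * (c * τ - a)}

theorem IsFrickeNorm.exists_det_eq {n a b c d : ℤ} (h : IsFrickeNorm n a b c d) :
    ∃ u : ℤ, (u = 1 ∨ u = 2) ∧ a * d - b * c = u * n := by
  rcases h.2 with h | ⟨-, -, h⟩
  · exact ⟨1, .inl rfl, by rw [h, one_mul]⟩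
  · exact ⟨2, .inr rfl, h⟩

theorem not_dvd_of_lt {p : ℕ} {k : ℤ} (h0 : 0 < k) (h : k < p) : ¬ (p : ℤ) ∣ k := fun h' => by
  have := Int.le_of_dvd h0 h'
  omega

theorem frickeFixedPoints_centralizer {p : ℕ} [hp : Fact p.Prime] (hp5 : 5 ≤ p) {τ : ℂ}
    (hτ : τ ∈ frickeFixedPoints p) {a' b' c' d' : ℤ}
    (h' : a' * d' - b' * c' = 1 ∨ (2 ∣ a' ∧ 2 ∣ d' ∧ a' * d' - b' * c' = 2))
    (hfix : mob a' b' c' d' τ = τ) : a' = d' ∧ b' = 0 ∧ c' = 0 := by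
  obtain ⟨him, a, b, c, h, hfix0⟩ := hτ
  rw [mob_eq_self_iff (denom_ne_zero (by rcases h' with h | ⟨-, -, h⟩ <;> rw [h] <;> norm_num) him)]
    at hfix
  have hprime : Prime (p : ℤ) := Nat.prime_iff_prime_int.1 hp.out
  have hfix0' : (a * τ + b : ℂ) = τ * (c * τ + (-a : ℤ)) := by
    rw [hfix0]
    push_cast
    ring
  have hc := h.ne_zero_of_fix (by omega) him hfix0'
  obtain ⟨h1, h2⟩ := fix_proportional him hfix0' hfix
  suffices hc' : c' = 0 from ⟨(eq_of_fix_of_eq_zero him hfix hc').1,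
    (eq_of_fix_of_eq_zero him hfix hc').2, hc'⟩
  by_contra hc'
  have hdisc := disc_neg_of_fix him hfix hc'
  obtain ⟨u, hu, hdet⟩ := h.exists_det_eq
  have hkey : c' ^ 2 * (4 * u * p) = c ^ 2 * (4 * (a' * d' - b' * c') - (a' + d') ^ 2) := by
    rw [mul_assoc 4 u, ← hdet]
    linear_combination (c * (a' - d') + c' * (2 * a)) * h1 + 4 * c' * c * h2
  refine hc' (eq_zero_of_sq_mul_eq hp.out hkey fun hdvd => ?_)
  have hp5' : (5 : ℤ) ≤ p := by exact_mod_cast hp5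
  have h2p : ¬ (p : ℤ) ∣ 2 := not_dvd_of_lt two_pos (by omega)
  have h3p : ¬ (p : ℤ) ∣ 3 := not_dvd_of_lt three_pos (by omega)
  have h4p : ¬ (p : ℤ) ∣ 4 := not_dvd_of_lt four_pos (by omega)
  have h8p : ¬ (p : ℤ) ∣ 8 := fun h => (hprime.dvd_or_dvd (show (p : ℤ) ∣ 2 * 4 from h)).elim h2p h4p
  rcases hprime.dvd_or_dvd hdvd with h3 | h3
  · rcases hprime.dvd_or_dvd h3 with h3 | h3
    · exact h4p h3
    · rcases hu with rfl | rfl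
      · exact hprime.not_isUnit (isUnit_of_dvd_one h3)
      · exact h2p h3
  · rcases h' with hd | ⟨ha, hd', hd⟩
    · rw [hd] at hdisc h3
      have h4 : a' + d' < 2 := by nlinarith
      have h5 : -2 < a' + d' := by nlinarith
      generalize a' + d' = r at *
      interval_cases r
      · exact h3p (by simpa using h3)
      · exact h4p (by simpa using h3)
      · exact h3p (by simpa using h3)
    · obtain ⟨s, hs⟩ := dvd_add ha hd'
      rw [hd, hs] at hdisc h3
      have h4 : s < 2 := by nlinarith
      have h5 : -2 < s := by nlinarith
      interval_cases s
      · exact h4p (by simpa using h3)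
      · exact h8p (by simpa using h3)
      · exact h4p (by simpa using h3)

theorem frickeFixedPoints_stabilizer {p : ℕ} [hp : Fact p.Prime] (hp5 : 5 ≤ p) {τ : ℂ}
    (hτ : τ ∈ frickeFixedPoints p) {a' b' c' d' : ℤ} (h' : IsFricke a' b' c' d')
    (hfix : mob a' b' c' d' τ = τ) : a' = d' ∧ b' = 0 ∧ c' = 0 :=
  frickeFixedPoints_centralizer hp5 hτ h'.2 hfix

/-- Trace zero matrices of determinant `p` or `2 * p` fixing the same point agree up to sign. -/
theorem eq_unit_mul_of_fix {p : ℕ} [hp : Fact p.Prime] (hp5 : 5 ≤ p) {τ : ℂ} (hτ : 0 < τ.im)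
    {a b c a' b' c' d' : ℤ} (h : IsFrickeNorm p a b c (-a))
    (hfix : (a * τ + b : ℂ) = τ * (c * τ - a)) (h' : IsFrickeNorm p a' b' c' d')
    (hfix' : (a' * τ + b' : ℂ) = τ * (c' * τ + d')) :
    ∃ e : ℤ, IsUnit e ∧ a' = e * a ∧ b' = e * b ∧ c' = e * c ∧ d' = e * (-a) := by
  have hprime : Prime (p : ℤ) := Nat.prime_iff_prime_int.1 hp.out
  have hp5' : (5 : ℤ) ≤ p := by exact_mod_cast hp5
  have h2p : ¬ (p : ℤ) ∣ 2 := not_dvd_of_lt two_pos (by omega)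
  have h4p : ¬ (p : ℤ) ∣ 4 := not_dvd_of_lt four_pos (by omega)
  have hfix0 : (a * τ + b : ℂ) = τ * (c * τ + (-a : ℤ)) := by
    rw [hfix]
    push_cast
    ring
  have hc := h.ne_zero_of_fix (by omega) hτ hfix0
  have hc' := h'.ne_zero_of_fix (by omega) hτ hfix'
  obtain ⟨h1, h2⟩ := fix_proportional hτ hfix0 hfix'
  obtain ⟨u, hu, hdet⟩ := h.exists_det_eq
  obtain ⟨u', hu', hdet'⟩ := h'.exists_det_eq
  have htr : a' + d' = 0 := by
    refine h'.trace_eq_zero_of_dvd hp5 hτ hfix' ?_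
    by_contra hr
    have hkey : c' ^ 2 * (4 * u * p) = c ^ 2 * (4 * (a' * d' - b' * c') - (a' + d') ^ 2) := by
      rw [mul_assoc 4 u, ← hdet]
      linear_combination (c * (a' - d') + c' * (2 * a)) * h1 + 4 * c' * c * h2
    refine hc' (eq_zero_of_sq_mul_eq hp.out hkey fun hdvd => ?_)
    rcases hprime.dvd_or_dvd hdvd with h3 | h3
    · rcases hprime.dvd_or_dvd h3 with h3 | h3
      · exact h4p h3
      · rcases hu with rfl | rfl
        · exact hprime.not_isUnit (isUnit_of_dvd_one h3)
        · exact h2p h3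
    · rw [hdet'] at h3
      have h4 := dvd_sub ((dvd_mul_left (p : ℤ) u').mul_left 4) h3
      rw [sub_sub_cancel] at h4
      exact hr (hprime.dvd_of_dvd_pow h4)
  obtain rfl : d' = -a' := by omega
  have h1' : c * a' = c' * a := by linarith
  have hsq : c' ^ 2 * u = c ^ 2 * u' := by
    apply mul_right_cancel₀ hprime.ne_zero
    rw [mul_assoc, mul_assoc, ← hdet, ← hdet']
    linear_combination (c * a' + c' * a) * h1' + c * c' * h2
  have hcc : c' ^ 2 = c ^ 2 := by
    rcases hu with rfl | rfl <;> rcases hu' with rfl | rfl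
    · linarith
    · exact (hc (eq_zero_of_sq_mul_eq Nat.prime_two (x := c) (y := c') (U := 1) (K := 1)
        (by push_cast; linarith) (by norm_num))).elim
    · exact (hc' (eq_zero_of_sq_mul_eq Nat.prime_two (x := c') (y := c) (U := 1) (K := 1)
        (by push_cast; linarith) (by norm_num))).elim
    · linarith
  obtain ⟨e, he, rfl⟩ : ∃ e : ℤ, IsUnit e ∧ c' = e * c := by
    rcases sq_eq_sq_iff_eq_or_eq_neg.1 hcc with h | h
    · exact ⟨1, isUnit_one, by rw [h, one_mul]⟩
    · exact ⟨-1, isUnit_one.neg, by rw [h]; ring⟩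
  refine ⟨e, he, ?_, ?_, rfl, ?_⟩
  · exact mul_left_cancel₀ hc (by linear_combination h1')
  · exact mul_left_cancel₀ hc (by linear_combination h2)
  · exact mul_left_cancel₀ hc (by linear_combination -h1')

/-- The point `τ` is fixed by the integral matrix with rows `(a, b)` and `(c, s - a)` of trace `s`
and determinant `n`. -/
def FixedBy (s n a b c : ℤ) (τ : ℂ) : Prop :=
  a * (s - a) - b * c = n ∧ (a * τ + b : ℂ) = τ * (c * τ + (s - a : ℤ))

theorem FixedBy.disc_pos {s n a b c : ℤ} {τ : ℂ} (h : FixedBy s n a b c τ) (hτ : 0 < τ.im)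
    (hc : c ≠ 0) : s ^ 2 < 4 * n := by
  have h1 := disc_neg_of_fix hτ h.2 hc
  rwa [h.1, add_sub_cancel] at h1

theorem FixedBy.ne_zero {s n a b c : ℤ} {τ : ℂ} (h : FixedBy s n a b c τ) (hτ : 0 < τ.im)
    (hs : s ^ 2 < 4 * n) : c ≠ 0 := by
  intro hc
  obtain ⟨h1, h2⟩ := eq_of_fix_of_eq_zero hτ h.2 hc
  obtain ⟨h3, -⟩ := h
  obtain rfl : s = 2 * a := by omega
  rw [h2] at h3
  nlinarith

theorem FixedBy.unique {s n a b c a' b' c' : ℤ} {τ : ℂ} (hτ : 0 < τ.im) (hs : s ^ 2 < 4 * n)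
    (h : FixedBy s n a b c τ) (h' : FixedBy s n a' b' c' τ) :
    (a' = a ∧ b' = b ∧ c' = c) ∨ (a' = s - a ∧ b' = -b ∧ c' = -c) := by
  have hc := h.ne_zero hτ hs
  obtain ⟨h1, h2⟩ := fix_proportional hτ h.2 h'.2
  have h3 : c' ^ 2 = c ^ 2 := by
    refine mul_left_cancel₀ (show 4 * n - s ^ 2 ≠ 0 by omega) ?_
    have e1 := h.1
    have e2 := h'.1
    linear_combination -4 * c' ^ 2 * e1 + 4 * c ^ 2 * e2 +
      (c * (2 * a' - s) + c' * (2 * a - s)) * h1 + 4 * c' * c * h2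
  rcases sq_eq_sq_iff_eq_or_eq_neg.1 h3 with rfl | rfl
  · left
    have h4 := mul_left_cancel₀ hc h1
    exact ⟨by omega, mul_left_cancel₀ hc h2, rfl⟩
  · right
    rw [neg_mul, ← mul_neg] at h1 h2
    have h4 := mul_left_cancel₀ hc h1
    exact ⟨by omega, mul_left_cancel₀ hc h2, rfl⟩

theorem FixedBy.unique_of_pos {s n a b c a' b' c' : ℤ} {τ : ℂ} (hτ : 0 < τ.im)
    (h : FixedBy s n a b c τ) (h' : FixedBy s n a' b' c' τ) (hc : 0 < c) (hc' : 0 < c') :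
    a' = a ∧ b' = b ∧ c' = c := by
  rcases h.unique hτ (h.disc_pos hτ hc.ne') h' with h1 | h1
  · exact h1
  · omega

theorem FixedBy.adjugate {s n a b c : ℤ} {τ : ℂ} (h : FixedBy s n a b c τ) :
    FixedBy s n (s - a) (-b) (-c) τ := by
  obtain ⟨h1, h2⟩ := h
  refine ⟨by linarith, ?_⟩
  push_cast at h2 ⊢
  linear_combination -h2

theorem FixedBy.conj {s n a b c A B C D : ℤ} {τ : ℂ} (h : FixedBy s n a b c τ) (hτ : 0 < τ.im)
    (hdet : A * D - B * C = 1) :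
    FixedBy s n ((A * a + B * c) * D - (A * b + B * (s - a)) * C)
      ((A * b + B * (s - a)) * A - (A * a + B * c) * B)
      ((C * a + D * c) * D - (C * b + D * (s - a)) * C) (mob A B C D τ) := by
  have hden : (C * τ + D : ℂ) ≠ 0 := denom_ne_zero (by rw [hdet]; exact one_pos) hτ
  obtain ⟨h1, h2⟩ := h
  have htr : s - ((A * a + B * c) * D - (A * b + B * (s - a)) * C) =
      (C * b + D * (s - a)) * A - (C * a + D * c) * B := by
    linear_combination -s * hdet
  rw [FixedBy, htr]
  refine ⟨?_, ?_⟩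
  · linear_combination (A * D - B * C + 1) * (a * (s - a) - b * c) * hdet + h1
  · rw [mob]
    push_cast at h2 ⊢
    field_simp
    linear_combination (A * D - B * C) ^ 2 * h2

theorem FixedBy.conj_two {s n a b c A B C D : ℤ} {τ : ℂ} (h : FixedBy s n a b (2 * c) τ)
    (hτ : 0 < τ.im) (hdet : 2 * A * D - B * C = 1) :
    FixedBy s n ((2 * A * a + 2 * B * c) * D - (2 * A * b + B * (s - a)) * C)
      ((2 * A * b + B * (s - a)) * A - (A * a + B * c) * B)
      (2 * ((C * a + 2 * D * c) * D - (C * b + D * (s - a)) * C))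
      (mob (2 * A) B (2 * C) (2 * D) τ) := by
  have hden : ((2 * C : ℤ) * τ + (2 * D : ℤ) : ℂ) ≠ 0 :=
    denom_ne_zero (a := 2 * A) (b := B) (by linarith) hτ
  obtain ⟨h1, h2⟩ := h
  have htr : s - ((2 * A * a + 2 * B * c) * D - (2 * A * b + B * (s - a)) * C) =
      (C * b + D * (s - a)) * (2 * A) - (C * a + D * (2 * c)) * B := by
    linear_combination -s * hdet
  rw [FixedBy, htr]
  refine ⟨?_, ?_⟩
  · linear_combination (2 * A * D - B * C + 1) * (a * (s - a) - b * (2 * c)) * hdet + h1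
  · rw [mob]
    push_cast at h2 hden ⊢
    have hden' : (C * τ + D : ℂ) ≠ 0 := fun h0 ↦ hden (by linear_combination 2 * h0)
    rw [show (2 * C * τ + 2 * D : ℂ) = 2 * (C * τ + D) by ring]
    field_simp
    linear_combination (2 * (A : ℂ) * D - B * C) ^ 2 * h2

/-- Positivity of values of the quadratic form attached to a fixed point. -/
theorem FixedBy.conj_pos {s n a b c C D c' : ℤ} {τ : ℂ} (h : FixedBy s n a b c τ) (hτ : 0 < τ.im)
    (hc : 0 < c) (h0 : c' ≠ 0) (hc' : c' = (C * a + D * c) * D - (C * b + D * (s - a)) * C) :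
    0 < c' := by
  have h1 := h.disc_pos hτ hc.ne'
  have h2 : 4 * c * c' = (2 * c * D + (2 * a - s) * C) ^ 2 + (4 * n - s ^ 2) * C ^ 2 := by
    rw [hc']
    have e := h.1
    linear_combination 4 * C ^ 2 * e
  have h3 : 0 ≤ 4 * c * c' := by
    rw [h2]
    have : 0 ≤ 4 * n - s ^ 2 := by omega
    positivity
  have h4 : 0 ≤ c' := nonneg_of_mul_nonneg_right h3 (by omega)
  omega

/-- Points of the upper half plane fixed by a trace zero matrix of determinant `n` with even lower
left entry. -/
def evenFixedPoints (n : ℤ) : Set ℂ := {τ | 0 < τ.im ∧ ∃ a b c : ℤ, FixedBy 0 n a b (2 * c) τ}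

theorem IsFricke.mem_evenFixedPoints {n a b c d : ℤ} (h : IsFricke a b c d) {τ : ℂ}
    (hτ : τ ∈ evenFixedPoints n) : mob a b c d τ ∈ evenFixedPoints n := by
  obtain ⟨him, x, y, z, hN⟩ := hτ
  refine ⟨mob_im_pos h.det_pos him, ?_⟩
  obtain ⟨⟨c', rfl⟩, h | ⟨⟨a', rfl⟩, ⟨d', rfl⟩, h⟩⟩ := h
  · refine ⟨(a * x + b * (2 * z)) * d - (a * y + b * (0 - x)) * (2 * c'),
      (a * y + b * (0 - x)) * a - (a * x + b * (2 * z)) * b,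
      2 * c' * x * d + z * d ^ 2 - 2 * y * c' ^ 2, ?_⟩
    convert hN.conj him h using 1
    ring
  · exact ⟨_, _, _, hN.conj_two him (by linarith)⟩

theorem frickeFixedPoints_eq (p : ℕ) :
    frickeFixedPoints p = evenFixedPoints p ∪ evenFixedPoints (2 * p) := by
  ext τ
  constructor
  · rintro ⟨him, a, b, _, ⟨⟨c, rfl⟩, h | ⟨-, -, h⟩⟩, hfix⟩
    · refine .inl ⟨him, a, b, c, by simpa using h, hfix.trans ?_⟩
      push_cast
      ring
    · refine .inr ⟨him, a, b, c, by simpa using h, hfix.trans ?_⟩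
      push_cast
      ring
  · rintro (⟨him, a, b, c, h, hfix⟩ | ⟨him, a, b, c, h, hfix⟩)
    · refine ⟨him, a, b, 2 * c, ⟨dvd_mul_right _ _, .inl (by simpa using h)⟩, hfix.trans ?_⟩
      push_cast
      ring
    · have ha : 2 ∣ a := by
        refine Int.prime_two.dvd_of_dvd_pow (n := 2) ⟨-(p + b * c), ?_⟩
        linear_combination -h
      refine ⟨him, a, b, 2 * c, ⟨dvd_mul_right _ _, .inr ⟨ha, ha.neg_right, by simpa using h⟩⟩,
        hfix.trans ?_⟩
      push_cast
      ring

theorem IsFricke.mem_frickeFixedPoints {p : ℕ} {a b c d : ℤ} (h : IsFricke a b c d)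
    {τ : ℂ} (hτ : τ ∈ frickeFixedPoints p) : mob a b c d τ ∈ frickeFixedPoints p := by
  rw [frickeFixedPoints_eq] at hτ ⊢
  exact hτ.imp h.mem_evenFixedPoints h.mem_evenFixedPoints

/-- The local factor of the diagonal modular polynomial at one representative. -/
def heckeFactor (p i : ℕ) (τ : ℂ) : ℂ :=
  formP τ ^ 4 * formD (heckePoint p i τ) - formP (heckePoint p i τ) ^ 4 * formD τ

theorem heckeFactor_eq {p : ℕ} (hp : 0 < p) (i : ℕ) {τ : ℂ} (hτ : 0 < τ.im) :
    heckeFactor p i τ =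
      formD τ * formD (heckePoint p i τ) * (hauptmodul τ - hauptmodul (heckePoint p i τ)) := by
  have h1 := formD_ne_zero hτ
  have h2 := formD_ne_zero (heckePoint_im_pos hp i hτ)
  rw [heckeFactor, hauptmodul, hauptmodul]
  field_simp

theorem heckeFactor_eq_zero_iff {p : ℕ} (hp : 0 < p) (i : ℕ) {τ : ℂ} (hτ : 0 < τ.im) :
    heckeFactor p i τ = 0 ↔ hauptmodul (heckePoint p i τ) = hauptmodul τ := by
  rw [heckeFactor_eq hp i hτ, mul_eq_zero, or_iff_right
    (mul_ne_zero (formD_ne_zero hτ) (formD_ne_zero (heckePoint_im_pos hp i hτ))), sub_eq_zero, eq_comm]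

theorem differentiableAt_formD {τ : ℂ} (hτ : 0 < τ.im) : DifferentiableAt ℂ formD τ :=
  (differentiableOn_form frickeD_mem).differentiableAt (isOpen_im_pos.mem_nhds hτ)

theorem differentiableAt_formP {τ : ℂ} (hτ : 0 < τ.im) : DifferentiableAt ℂ formP τ :=
  (differentiableOn_form frickeP_mem).differentiableAt (isOpen_im_pos.mem_nhds hτ)

theorem differentiableAt_hauptmodul {τ : ℂ} (hτ : 0 < τ.im) : DifferentiableAt ℂ hauptmodul τ :=
  differentiableOn_hauptmodul.differentiableAt (isOpen_im_pos.mem_nhds hτ)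

theorem hasDerivAt_mob {a b c d : ℤ} {τ : ℂ} (h : (c * τ + d : ℂ) ≠ 0) :
    HasDerivAt (mob a b c d) ((a * d - b * c) / (c * τ + d) ^ 2) τ := by
  have h1 : HasDerivAt (fun τ : ℂ => (a * τ + b : ℂ)) a τ := by
    simpa using ((hasDerivAt_id τ).const_mul (a : ℂ)).add_const (b : ℂ)
  have h2 : HasDerivAt (fun τ : ℂ => (c * τ + d : ℂ)) c τ := by
    simpa using ((hasDerivAt_id τ).const_mul (c : ℂ)).add_const (d : ℂ)
  have h3 := h1.div h2 h
  exact h3.congr_deriv (by ring)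

theorem differentiableAt_heckePoint {p : ℕ} (hp : 0 < p) (i : ℕ) {τ : ℂ} (hτ : 0 < τ.im) :
    DifferentiableAt ℂ (heckePoint p i) τ :=
  (hasDerivAt_mob (denom_ne_zero (hecke_det_pos hp i) hτ)).differentiableAt

theorem differentiableAt_heckeFactor {p : ℕ} (hp : 0 < p) (i : ℕ) {τ : ℂ} (hτ : 0 < τ.im) :
    DifferentiableAt ℂ (heckeFactor p i) τ := by
  have h1 := differentiableAt_heckePoint hp i hτ
  have hw := heckePoint_im_pos hp i hτ
  exact (((differentiableAt_formP hτ).pow 4).mul ((differentiableAt_formD hw).comp τ h1)).sub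
    ((((differentiableAt_formP hw).comp τ h1).pow 4).mul (differentiableAt_formD hτ))

theorem HasDerivAt.mul_of_eq_zero {f g : ℂ → ℂ} {f' z : ℂ} (hf : HasDerivAt f f' z) (h0 : f z = 0)
    (hg : DifferentiableAt ℂ g z) : HasDerivAt (fun w => f w * g w) (f' * g z) z := by
  have h := hf.fun_mul hg.hasDerivAt
  rwa [h0, zero_mul, add_zero] at h

/-- Composite of a Fricke transformation with a standard representative. -/
theorem mob_heckePoint {p : ℕ} (hp : 0 < p) (i : ℕ) (a b c d : ℤ) {τ : ℂ} (hτ : 0 < τ.im) :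
    mob a b c d (heckePoint p i τ) = mob (a * heckeA p i) (a * heckeB p i + b * heckeD p i)
      (c * heckeA p i) (c * heckeB p i + d * heckeD p i) τ := by
  rw [heckePoint, mob_mob (denom_ne_zero (hecke_det_pos hp i) hτ)]
  simp

/-- A local factor vanishes exactly to first order at a fixed point of trace zero. -/
theorem hasDerivAt_heckeFactor {p : ℕ} [hp : Fact p.Prime] (hp5 : 5 ≤ p) {i : ℕ} {τ : ℂ}
    (hτ : τ ∈ frickeFixedPoints p) {a b c d : ℤ} (h : IsFricke a b c d)
    (hfix : mob a b c d (heckePoint p i τ) = τ)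
    (htr : a * heckeA p i + (c * heckeB p i + d * heckeD p i) = 0) :
    ∃ f' : ℂ, f' ≠ 0 ∧ HasDerivAt (heckeFactor p i) f' τ := by
  have hpp := hp.out.pos
  have him := hτ.1
  have hw := heckePoint_im_pos hpp i him
  have hdet := (h.isFrickeNorm_hecke (p := p) (i := i)).det_pos (by exact_mod_cast hpp)
  have hden := denom_ne_zero hdet him
  have ht := differentiableAt_hauptmodul him
  have ht0 : deriv hauptmodul τ ≠ 0 := deriv_hauptmodul_ne_zero him fun _ _ _ _ h h' =>
    frickeFixedPoints_stabilizer hp5 hτ h h'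
  set a₀ := a * heckeA p i
  set b₀ := a * heckeB p i + b * heckeD p i
  set c₀ := c * heckeA p i
  set d₀ := c * heckeB p i + d * heckeD p i
  have hmob : mob a₀ b₀ c₀ d₀ τ = τ := by rw [← mob_heckePoint hpp i a b c d him, hfix]
  have hM := hasDerivAt_mob (a := a₀) (b := b₀) hden
  have hM1 : ((a₀ * d₀ - b₀ * c₀) / (c₀ * τ + d₀) ^ 2 : ℂ) = -1 := by
    rw [mob_eq_self_iff hden] at hmob
    have ha : (a₀ : ℂ) = -d₀ := by
      have : a₀ = -d₀ := by linarith
      rw [this]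
      push_cast
      rfl
    rw [div_eq_iff (pow_ne_zero 2 hden)]
    rw [ha] at hmob ⊢
    linear_combination -c₀ * hmob
  rw [hM1] at hM
  have hcomp : HasDerivAt (fun σ => hauptmodul (mob a₀ b₀ c₀ d₀ σ)) (deriv hauptmodul τ * -1) τ := by
    have h1 : HasDerivAt hauptmodul (deriv hauptmodul τ) (mob a₀ b₀ c₀ d₀ τ) := by
      rw [hmob]
      exact ht.hasDerivAt
    exact h1.comp τ hM
  have hsub := ht.hasDerivAt.sub hcomp
  have hprod := hsub.mul_of_eq_zero (by simp [hmob])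
    ((differentiableAt_formD him).mul ((differentiableAt_formD hw).comp τ
      (differentiableAt_heckePoint hpp i him)))
  refine ⟨_, ?_, hprod.congr_of_eventuallyEq ?_⟩
  · refine mul_ne_zero ?_ (mul_ne_zero (formD_ne_zero him) (formD_ne_zero hw))
    rw [mul_neg_one, sub_neg_eq_add, ← two_mul]
    exact mul_ne_zero two_ne_zero ht0
  · filter_upwards [isOpen_im_pos.mem_nhds him] with σ hσ
    rw [heckeFactor_eq hpp i hσ, ← hauptmodul_mob h (heckePoint_im_pos hpp i hσ),
      mob_heckePoint hpp i a b c d hσ, mul_comm]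
    rfl

theorem ss2Star_ne_zero (p : ℕ) [hp : Fact p.Prime] : ss2Star p ≠ 0 := by
  rw [ss2Star_eq]
  refine mul_ne_zero (pow_ne_zero _ (X_sub_C_ne_zero _))
    (mul_ne_zero (pow_ne_zero _ X_ne_zero) fun h => ?_)
  have h1 := congrArg (fun f => coeff f (p / 8)) h
  rw [ssFactor] at h1
  simp only [finsetSum_coeff, coeff_C_mul, coeff_X_pow, coeff_zero] at h1
  rw [Finset.sum_eq_single 0] at h1
  · simp [ssCoeff, poch] at h1
  · intro n hn hn0
    rw [Finset.mem_range] at hn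
    rw [if_neg (by omega), mul_zero]
  · simp

theorem L2Star_eq_card_filter (p : ℕ) [hp : Fact p.Prime] :
    L2Star p = (Finset.univ.filter fun x : ZMod p => (hassePoly p).eval x = 0).card := by
  rw [L2Star]
  congr 1
  ext x
  rw [Multiset.mem_toFinset, mem_roots (ss2Star_ne_zero p), Finset.mem_filter,
    eval_hassePoly_eq_zero_iff]
  simp

theorem two_mul_L2Star {p : ℕ} [hp : Fact p.Prime] (hp5 : 5 ≤ p) :
    (hauptmodul '' frickeFixedPoints p).ncard = 2 * L2Star p := by
  have hpp := hp.out.pos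
  have hp2 : p ≠ 2 := by omega
  obtain ⟨m, hm⟩ := hp.out.odd_of_ne_two hp2
  have hm0 : m ≠ 0 := by omega
  obtain ⟨F, hF, hFl, hFH, hFp⟩ := exists_modular_polynomial hp2
  have hprod : ∀ τ : ℂ, 0 < τ.im →
      formD τ ^ (2 * (p + 1)) * F.eval₂ (Int.castRingHom ℂ) (hauptmodul τ) =
        ∏ i ∈ Finset.range (p + 1), heckeFactor p i τ := by
    intro τ hτ
    rw [hFH τ hτ, Finset.prod_range_succ, mul_comm]
    congr 1
    · refine Finset.prod_congr rfl fun i hi => ?_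
      rw [heckeFactor, heckePoint_of_lt (Finset.mem_range.1 hi)]
    · rw [heckeFactor, heckePoint_self]
  have hroot : ∀ τ : ℂ, 0 < τ.im → (F.eval₂ (Int.castRingHom ℂ) (hauptmodul τ) = 0 ↔
      ∃ i ≤ p, ∃ a b c d, IsFricke a b c d ∧ mob a b c d (heckePoint p i τ) = τ) := by
    intro τ hτ
    rw [← mul_eq_zero_iff_left (pow_ne_zero (2 * (p + 1)) (formD_ne_zero hτ)), hprod τ hτ,
      Finset.prod_eq_zero_iff]
    constructor
    · rintro ⟨i, hi, h⟩
      rw [heckeFactor_eq_zero_iff hpp i hτ] at h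
      exact ⟨i, Nat.lt_succ_iff.1 (Finset.mem_range.1 hi),
        frickeEquiv_of_hauptmodul_eq (heckePoint_im_pos hpp i hτ) hτ h⟩
    · rintro ⟨i, hi, h⟩
      refine ⟨i, Finset.mem_range.2 (Nat.lt_succ_iff.2 hi), ?_⟩
      rw [heckeFactor_eq_zero_iff hpp i hτ]
      exact FrickeEquiv.hauptmodul_eq (heckePoint_im_pos hpp i hτ) h
  rw [L2Star_eq_card_filter]
  refine ncard_eq_two_mul_card_filter hF hFl (map_modular_polynomial hF hFp) (hassePoly p) _ ?_ ?_
  · intro z hz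
    obtain ⟨τ, hτ, rfl⟩ := exists_hauptmodul_eq z
    obtain ⟨i, hi, a, b, c, d, h, hfix⟩ := (hroot τ hτ).1 hz
    obtain ⟨n, v, hn, hv, hv'⟩ := exists_multiplier hp5 hm0 h hi hτ hfix
    obtain ⟨Q, hQ, hQ0, hQp⟩ := exists_multiplier_polynomial hp2 hm0 n
    refine ⟨n, Q, hQ0 τ hτ v hv hv', map_multiplier_polynomial (by omega) hm hQ hQp, hn.trans ?_⟩
    have hM := h.isFrickeNorm_hecke (p := p) (i := i)
    rw [mob_heckePoint hpp i _ _ _ _ hτ, mob_eq_self_iff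
      (denom_ne_zero (hM.det_pos (by exact_mod_cast hpp)) hτ)] at hfix
    constructor
    · intro htr
      refine ⟨τ, ⟨hτ, _, _, _, (neg_eq_of_add_eq_zero_right htr).symm ▸ hM, ?_⟩, rfl⟩
      rw [hfix, ← neg_eq_of_add_eq_zero_right htr]
      push_cast
      ring
    · rintro ⟨τ', hτ', ht⟩
      obtain ⟨a₁, b₁, c₁, d₁, hI, rfl⟩ := frickeEquiv_of_hauptmodul_eq hτ'.1 hτ ht
      obtain ⟨-, x, y, z, hN, hfix'⟩ := hI.mem_frickeFixedPoints hτ'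
      obtain ⟨e, -, h1, -, -, h4⟩ := eq_unit_mul_of_fix hp5 hτ hN hfix' hM hfix
      rw [h1, h4]
      ring
  · rintro _ ⟨τ, hτ, rfl⟩
    obtain ⟨him, a, b, c, h, hfix⟩ := id hτ
    obtain ⟨i, hi, a', b', c', d', hI, ha, hb, hc, hd⟩ := h.exists_eq hp2
    have hfix0 : mob a' b' c' d' (heckePoint p i τ) = τ := by
      rw [mob_heckePoint hpp i _ _ _ _ him, ← ha, ← hb, ← hc, ← hd, mob_eq_self_iff
        (denom_ne_zero (h.det_pos (by exact_mod_cast hpp)) him), hfix]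
      push_cast
      ring
    have hF0 := (hroot τ him).2 ⟨i, hi, a', b', c', d', hI, hfix0⟩
    refine ⟨hF0, fun hF' => ?_⟩
    obtain ⟨f', hf', hder⟩ := hasDerivAt_heckeFactor hp5 hτ hI hfix0 (by rw [← ha, ← hd]; ring)
    have hi' : i ∈ Finset.range (p + 1) := Finset.mem_range.2 (Nat.lt_succ_iff.2 hi)
    have hz : heckeFactor p i τ = 0 := by
      rw [heckeFactor_eq_zero_iff hpp i him]
      exact FrickeEquiv.hauptmodul_eq (heckePoint_im_pos hpp i him) ⟨_, _, _, _, hI, hfix0⟩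
    have hother : ∏ j ∈ (Finset.range (p + 1)).erase i, heckeFactor p j τ ≠ 0 := by
      rw [Finset.prod_ne_zero_iff]
      intro j hj hj0
      rw [heckeFactor_eq_zero_iff hpp j him] at hj0
      obtain ⟨a₁, b₁, c₁, d₁, hI₁, hfix₁⟩ :=
        frickeEquiv_of_hauptmodul_eq (heckePoint_im_pos hpp j him) him hj0
      have hM₁ := hI₁.isFrickeNorm_hecke (p := p) (i := j)
      rw [mob_heckePoint hpp j _ _ _ _ him, mob_eq_self_iff
        (denom_ne_zero (hM₁.det_pos (by exact_mod_cast hpp)) him)] at hfix₁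
      obtain ⟨e, he, h1, h2, h3, h4⟩ := eq_unit_mul_of_fix hp5 him h hfix hM₁ hfix₁
      rw [ha] at h1
      rw [hb] at h2
      rw [hc] at h3
      rw [hd] at h4
      exact (Finset.ne_of_mem_erase hj) (hecke_index_eq hp2
        (Nat.lt_succ_iff.1 (Finset.mem_range.1 (Finset.mem_of_mem_erase hj))) hi hI₁ hI he h1 h2 h3 h4)
    have hd1 := hder.mul_of_eq_zero hz (g := fun σ => ∏ j ∈ (Finset.range (p + 1)).erase i,
      heckeFactor p j σ) (DifferentiableAt.fun_finsetProd fun j _ => differentiableAt_heckeFactor hpp j him)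
    have hd2 : HasDerivAt (fun σ => F.eval₂ (Int.castRingHom ℂ) (hauptmodul σ) *
        formD σ ^ (2 * (p + 1))) (0 * formD τ ^ (2 * (p + 1))) τ := by
      refine HasDerivAt.mul_of_eq_zero ?_ hF0 ((differentiableAt_formD him).pow _)
      have h1 := ((F.map (Int.castRingHom ℂ)).hasDerivAt (hauptmodul τ)).comp τ
        (differentiableAt_hauptmodul him).hasDerivAt
      rw [derivative_map, eval_map, hF', zero_mul] at h1
      refine h1.congr_of_eventuallyEq (Filter.Eventually.of_forall fun σ => ?_)
      simp [eval_map]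
    rw [zero_mul] at hd2
    refine mul_ne_zero hf' hother (hd1.unique (hd2.congr_of_eventuallyEq ?_))
    filter_upwards [isOpen_im_pos.mem_nhds him] with σ hσ
    rw [mul_comm (eval₂ _ _ _), hprod σ hσ]
    exact Finset.mul_prod_erase _ (fun j => heckeFactor p j σ) hi'

theorem eq_zero_of_int_combination {τ : ℂ} (hτ : 0 < τ.im) {u v : ℤ} (h : (u * τ + v : ℂ) = 0) :
    u = 0 ∧ v = 0 := by
  refine eq_of_fix_of_eq_zero hτ (d := 0) (c := 0) ?_ rfl
  rw [h]
  simp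

theorem eq_of_int_combination {τ : ℂ} (hτ : 0 < τ.im) {u v u' v' : ℤ}
    (h : (u * τ + v : ℂ) = u' * τ + v') : u = u' ∧ v = v' := by
  have := eq_zero_of_int_combination hτ (u := u - u') (v := v - v') (by
    push_cast
    linear_combination h)
  omega

/-- Homothetic lattices in the complex plane come from equivalent points. -/
theorem exists_mob_eq_of_homothetic {τ τ' l l' : ℂ} (hτ : 0 < τ.im) (hτ' : 0 < τ'.im) (hl : l ≠ 0)
    (hl' : l' ≠ 0) (h : ∀ z : ℂ, (∃ u v : ℤ, z = l * (u * τ + v)) ↔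
      ∃ u v : ℤ, z = l' * (u * τ' + v)) :
    ∃ a b c d : ℤ, a * d - b * c = 1 ∧ mob a b c d τ = τ' := by
  obtain ⟨a, b, h1⟩ := (h _).2 ⟨1, 0, rfl⟩
  obtain ⟨c, d, h2⟩ := (h _).2 ⟨0, 1, rfl⟩
  obtain ⟨a', b', h3⟩ := (h _).1 ⟨1, 0, rfl⟩
  obtain ⟨c', d', h4⟩ := (h _).1 ⟨0, 1, rfl⟩
  push_cast at h1 h2 h3 h4
  have e1 := eq_of_int_combination hτ (u := a' * a + b' * c) (v := a' * b + b' * d) (u' := 1) (v' := 0)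
    (mul_left_cancel₀ hl (by
      push_cast
      linear_combination -h3 - a' * h1 - b' * h2))
  have e2 := eq_of_int_combination hτ (u := c' * a + d' * c) (v := c' * b + d' * d) (u' := 0) (v' := 1)
    (mul_left_cancel₀ hl (by
      push_cast
      linear_combination -h4 - c' * h1 - d' * h2))
  have hdet : (a' * d' - b' * c') * (a * d - b * c) = 1 := by
    linear_combination (c' * b + d' * d) * e1.1 + e2.2 - (c' * a + d' * c) * e1.2
  have hden : (c * τ + d : ℂ) ≠ 0 := fun h0 => hl' (by linear_combination h2 + l * h0)
  have hmob : mob a b c d τ = τ' := by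
    rw [mob, div_eq_iff hden]
    refine mul_left_cancel₀ hl ?_
    linear_combination -h1 + τ' * h2
  refine ⟨a, b, c, d, ?_, hmob⟩
  rcases Int.isUnit_iff.1 (IsUnit.of_mul_eq_one _ ((mul_comm _ _).trans hdet)) with h5 | h5
  · exact h5
  · exfalso
    have h6 := mob_im a b c d τ
    rw [hmob, h5] at h6
    have h8 : ((-1 : ℤ) : ℝ) * τ.im / Complex.normSq (c * τ + d) ≤ 0 :=
      div_nonpos_of_nonpos_of_nonneg (by push_cast; linarith) (Complex.normSq_nonneg _)
    linarith

/-- Points of the upper half plane fixed by an integral matrix of trace `s` and determinant `n`. -/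
def integralFixedPoints (s n : ℤ) : Set ℂ :=
  {τ | 0 < τ.im ∧ ∃ a b c : ℤ, FixedBy s n a b c τ}

/-- Multiplier of a fixed point. -/
theorem multiplier_eq {s n a b c : ℤ} {τ ω : ℂ} (hω : ω ^ 2 = s * ω - n) (hω' : 0 < ω.im)
    (hτ : 0 < τ.im) (hc : 0 < c) (hdet : a * (s - a) - b * c = n)
    (hfix : (a * τ + b : ℂ) = τ * (c * τ + (s - a : ℤ))) : (c * τ + (s - a : ℤ) : ℂ) = ω := by
  have h1 : ((c * τ + (s - a : ℤ)) - ω : ℂ) * ((c * τ + (s - a : ℤ)) - (s - ω)) = 0 := by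
    rw [← hdet] at hω
    push_cast at hω hfix ⊢
    linear_combination -c * hfix - hω
  have h2 : 0 < (c * τ + (s - a : ℤ) : ℂ).im := by
    have : 0 < (c : ℝ) := by exact_mod_cast hc
    simpa using mul_pos this hτ
  rcases mul_eq_zero.1 h1 with h | h
  · exact sub_eq_zero.1 h
  · rw [sub_eq_zero.1 h] at h2
    simp at h2
    linarith

theorem exists_fix_pos {s n : ℤ} {τ ω : ℂ} (hω : ω ^ 2 = s * ω - n) (hω' : 0 < ω.im)
    (hτ : τ ∈ integralFixedPoints s n) : ∃ a b c : ℤ, 0 < c ∧ a * (s - a) - b * c = n ∧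
      (a * τ + b : ℂ) = τ * (c * τ + (s - a : ℤ)) := by
  obtain ⟨him, a, b, c, hdet, hfix⟩ := hτ
  rcases lt_trichotomy c 0 with hc | hc | hc
  · refine ⟨s - a, -b, -c, by omega, by linarith, ?_⟩
    push_cast at hfix ⊢
    linear_combination -hfix
  · exfalso
    obtain ⟨h1, h2⟩ := eq_of_fix_of_eq_zero him hfix hc
    have h3 : (ω - a) ^ 2 = 0 := by
      rw [← hdet, h2, hc] at hω
      have : (s : ℂ) = 2 * a := by
        have : s = 2 * a := by omega
        rw [this]
        push_cast
        rfl
      rw [this] at hω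
      push_cast at hω
      rw [this] at hω
      linear_combination hω
    rw [sub_eq_zero.1 (pow_eq_zero_iff two_ne_zero |>.1 h3)] at hω'
    simp at hω'
  · exact ⟨a, b, c, hc, hdet, hfix⟩

section LatticeIdeal

variable {O : Type*} [CommRing O]

/-- The image of the ideal in the complex numbers is homothetic to the lattice of the point. -/
def IsLatticeIdeal (ι : O →+* ℂ) (τ : ℂ) (J : Ideal O) : Prop :=
  ∃ l : ℂ, l ≠ 0 ∧ ∀ z : ℂ, (∃ x ∈ J, ι x = z) ↔ ∃ u v : ℤ, z = l * (u * τ + v)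

theorem exists_isLatticeIdeal {ι : O →+* ℂ} {s n : ℤ} {τ ω : ℂ} (hω : ω ^ 2 = s * ω - n)
    (hω' : 0 < ω.im) (hO : ∀ z : ℂ, (∃ x, ι x = z) ↔ ∃ u v : ℤ, z = u * ω + v)
    (hτ : τ ∈ integralFixedPoints s n) : ∃ J : Ideal O, IsLatticeIdeal ι τ J := by
  obtain ⟨a, b, c, hc, hdet, hfix⟩ := exists_fix_pos hω hω' hτ
  have hmul := multiplier_eq hω hω' hτ.1 hc hdet hfix
  rw [hmul] at hfix
  refine ⟨{ carrier := {x | ∃ u v : ℤ, ι x = c * (u * τ + v)}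
            add_mem' := ?_
            zero_mem' := ⟨0, 0, by simp⟩
            smul_mem' := ?_ }, c, by exact_mod_cast hc.ne', fun z => ?_⟩
  · rintro x y ⟨u, v, h⟩ ⟨u', v', h'⟩
    refine ⟨u + u', v + v', ?_⟩
    rw [map_add, h, h']
    push_cast
    ring
  · rintro r x ⟨u, v, h⟩
    obtain ⟨u', v', h'⟩ := (hO _).1 ⟨r, rfl⟩
    refine ⟨u' * (u * a + v * c) + v' * u, u' * (u * b + v * (s - a)) + v' * v, ?_⟩
    rw [smul_eq_mul, map_mul, h, h']
    push_cast at hmul ⊢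
    linear_combination -c * u' * u * hfix - c * u' * v * hmul
  · constructor
    · rintro ⟨x, ⟨u, v, h⟩, rfl⟩
      exact ⟨u, v, h⟩
    · rintro ⟨u, v, rfl⟩
      obtain ⟨x, hx⟩ := (hO _).2 ⟨u, v * c - u * (s - a), rfl⟩
      refine ⟨x, ⟨u, v, ?_⟩, ?_⟩ <;>
      · rw [hx]
        push_cast at hmul ⊢
        linear_combination -u * hmul

theorem IsLatticeIdeal.ne_bot {ι : O →+* ℂ} {τ : ℂ} {J : Ideal O} (h : IsLatticeIdeal ι τ J) :
    J ≠ ⊥ := by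
  rintro rfl
  obtain ⟨l, hl, h⟩ := h
  obtain ⟨x, hx, hx'⟩ := (h l).2 ⟨0, 1, by simp⟩
  rw [Ideal.mem_bot.1 hx, map_zero] at hx'
  exact hl hx'.symm

theorem exists_integralFixedPoints_of_ideal {ι : O →+* ℂ} (hι : Function.Injective ι) {s n : ℤ} {ω : ℂ}
    (hω : ω ^ 2 = s * ω - n) (hω' : 0 < ω.im)
    (hO : ∀ z : ℂ, (∃ x, ι x = z) ↔ ∃ u v : ℤ, z = u * ω + v) {J : Ideal O} (hJ : J ≠ ⊥) :
    ∃ τ ∈ integralFixedPoints s n, IsLatticeIdeal ι τ J := by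
  obtain ⟨w, hw⟩ := (hO ω).2 ⟨1, 0, by simp⟩
  have hval : ∀ u v : ℤ, ι ((u : O) * w + v) = u * ω + v := fun u v => by simp [hw]
  have hrep : ∀ x : O, ∃ u v : ℤ, x = u * w + v := fun x => by
    obtain ⟨u, v, h⟩ := (hO _).1 ⟨x, rfl⟩
    exact ⟨u, v, hι (by rw [h, hval])⟩
  have hww : w * w = s * w - n := hι (by
    simp only [map_mul, map_sub, map_intCast, hw]
    linear_combination hω)
  let U : Ideal ℤ := J.comap (Int.castRingHom O)
  let V : Ideal ℤ :=
    { carrier := {u | ∃ v : ℤ, (u * w + v : O) ∈ J}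
      add_mem' := by
        rintro u u' ⟨v, h⟩ ⟨v', h'⟩
        refine ⟨v + v', ?_⟩
        convert J.add_mem h h' using 1
        push_cast
        ring
      zero_mem' := ⟨0, by simp⟩
      smul_mem' := by
        rintro r u ⟨v, h⟩
        refine ⟨r * v, ?_⟩
        convert J.mul_mem_left (r : O) h using 1
        push_cast [smul_eq_mul]
        ring }
  have hpos : ∀ I : Ideal ℤ, I ≠ ⊥ → ∃ g : ℤ, 0 < g ∧ ∀ k, k ∈ I ↔ g ∣ k := by
    intro I hI
    obtain ⟨g, hg⟩ := (IsPrincipalIdealRing.principal I).principal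
    have hg' : I = Ideal.span {g} := hg
    have hg0 : g ≠ 0 := by
      rintro rfl
      exact hI (by simpa using hg')
    refine ⟨|g|, abs_pos.2 hg0, fun k => ?_⟩
    rw [hg', Ideal.mem_span_singleton, abs_dvd]
  have hU0 : U ≠ ⊥ := by
    intro h0
    refine hJ ((Submodule.eq_bot_iff _).2 fun x hx => ?_)
    obtain ⟨u, v, rfl⟩ := hrep x
    have h1 : u ^ 2 * n + u * v * s + v ^ 2 ∈ U := by
      change Int.castRingHom O _ ∈ J
      convert J.mul_mem_left ((u : O) * (s - w) + v) hx using 1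
      push_cast [eq_intCast]
      linear_combination u ^ 2 * hww
    rw [h0, Ideal.mem_bot] at h1
    have h2 : (u * ω + v : ℂ) * (u * (s - ω) + v) = 0 := by
      have : ((u ^ 2 * n + u * v * s + v ^ 2 : ℤ) : ℂ) = 0 := by rw [h1, Int.cast_zero]
      push_cast at this
      linear_combination this - u ^ 2 * hω
    rcases mul_eq_zero.1 h2 with h3 | h3
    · obtain ⟨rfl, rfl⟩ := eq_zero_of_int_combination hω' h3
      simp
    · obtain ⟨h4, h5⟩ := eq_zero_of_int_combination hω' (u := -u) (v := u * s + v) (by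
        push_cast
        linear_combination h3)
      obtain rfl : u = 0 := by omega
      obtain rfl : v = 0 := by simpa using h5
      simp
  have hUV : ∀ g ∈ U, g ∈ V := fun g hg => ⟨0, by
    have := J.mul_mem_left w (show Int.castRingHom O g ∈ J from hg)
    rw [eq_intCast, mul_comm] at this
    simpa using this⟩
  have hV0 : V ≠ ⊥ := fun h0 => hU0 (eq_bot_iff.2 fun g hg => h0 ▸ hUV g hg)
  obtain ⟨g, hg, hgU⟩ := hpos U hU0
  obtain ⟨e, he, heV⟩ := hpos V hV0
  obtain ⟨f, hf⟩ := (heV e).2 dvd_rfl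
  have hgJ : (g : O) ∈ J := (hgU g).2 dvd_rfl
  have hmem : ∀ x ∈ J, ∃ u v : ℤ, x = u * (e * w + f) + v * g := by
    intro x hx
    obtain ⟨u, v, rfl⟩ := hrep x
    obtain ⟨k, rfl⟩ := (heV u).1 ⟨v, hx⟩
    have h1 : v - k * f ∈ U := by
      change Int.castRingHom O _ ∈ J
      convert J.sub_mem hx (J.mul_mem_left (k : O) hf) using 1
      push_cast [eq_intCast]
      ring
    obtain ⟨k', hk'⟩ := (hgU _).1 h1
    refine ⟨k, k', ?_⟩
    have : v = k * f + g * k' := by linarith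
    rw [this]
    push_cast
    ring
  obtain ⟨a, b, h1⟩ := hmem _ (J.mul_mem_left w hf)
  obtain ⟨c, d, h2⟩ := hmem _ (J.mul_mem_left w hgJ)
  replace h1 := congrArg ι h1
  replace h2 := congrArg ι h2
  simp only [map_mul, map_add, map_intCast, hw] at h1 h2
  have hg0 : (g : ℂ) ≠ 0 := by exact_mod_cast hg.ne'
  set τ : ℂ := (e * ω + f) / g with hτ
  have hτ' : (e * ω + f : ℂ) = g * τ := by
    rw [hτ]
    field_simp
  have him : 0 < τ.im := by
    have h3 : τ = ((e / g : ℝ) : ℂ) * ω + ((f / g : ℝ) : ℂ) := by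
      rw [hτ]
      push_cast
      field_simp
    have h4 : 0 < (e / g : ℝ) := div_pos (by exact_mod_cast he) (by exact_mod_cast hg)
    rw [h3, Complex.add_im, Complex.im_ofReal_mul]
    simpa using mul_pos h4 hω'
  rw [hτ'] at h1 h2
  have h3 : (a * τ + b : ℂ) = τ * ω := mul_left_cancel₀ hg0 (by linear_combination -h1)
  have h4 : (c * τ + d : ℂ) = ω := mul_left_cancel₀ hg0 (by linear_combination -h2)
  have h5 : ((s - (a + d) : ℤ) * ω + (a * d - b * c - n : ℤ) : ℂ) = 0 := by
    push_cast
    linear_combination -hω - (ω - a) * h4 - c * h3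
  obtain ⟨h6, h7⟩ := eq_zero_of_int_combination hω' h5
  obtain rfl : d = s - a := by omega
  refine ⟨τ, ⟨him, a, b, c, by omega, by rw [h3, h4]⟩, g, hg0, fun z => ?_⟩
  constructor
  · rintro ⟨x, hx, rfl⟩
    obtain ⟨u, v, rfl⟩ := hmem x hx
    refine ⟨u, v, ?_⟩
    simp only [map_mul, map_add, map_intCast, hw]
    rw [hτ']
    ring
  · rintro ⟨u, v, rfl⟩
    refine ⟨u * (e * w + f) + v * g, J.add_mem (J.mul_mem_left _ hf) (J.mul_mem_left _ hgJ), ?_⟩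
    simp only [map_mul, map_add, map_intCast, hw]
    rw [hτ']
    ring

end LatticeIdeal

section ClassMap

variable {O : Type*} [CommRing O]

theorem isLatticeIdeal_span_mul {ι : O →+* ℂ} {τ l : ℂ} {J : Ideal O}
    (h : ∀ z : ℂ, (∃ x ∈ J, ι x = z) ↔ ∃ u v : ℤ, z = l * (u * τ + v)) (x : O) (z : ℂ) :
    (∃ k ∈ Ideal.span {x} * J, ι k = z) ↔ ∃ u v : ℤ, z = ι x * l * (u * τ + v) := by
  constructor
  · rintro ⟨k, hk, rfl⟩
    obtain ⟨j, hj, rfl⟩ := Ideal.mem_span_singleton_mul.1 hk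
    obtain ⟨u, v, huv⟩ := (h _).1 ⟨j, hj, rfl⟩
    exact ⟨u, v, by rw [map_mul, huv, mul_assoc]⟩
  · rintro ⟨u, v, rfl⟩
    obtain ⟨j, hj, hj'⟩ := (h _).2 ⟨u, v, rfl⟩
    exact ⟨x * j, Ideal.mem_span_singleton_mul.2 ⟨j, hj, rfl⟩, by rw [map_mul, hj', mul_assoc]⟩

theorem IsLatticeIdeal.mob {ι : O →+* ℂ} {τ : ℂ} {J : Ideal O} (hτ : 0 < τ.im) {a b c d : ℤ}
    (hdet : a * d - b * c = 1) (h : IsLatticeIdeal ι (mob a b c d τ) J) : IsLatticeIdeal ι τ J := by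
  obtain ⟨l, hl, h⟩ := h
  have hden : (c * τ + d : ℂ) ≠ 0 := denom_ne_zero (by rw [hdet]; exact one_pos) hτ
  refine ⟨l / (c * τ + d), div_ne_zero hl hden, fun z => (h z).trans ?_⟩
  have hmob : (c * τ + d) * _root_.mob a b c d τ = a * τ + b := by
    rw [_root_.mob, mul_div_cancel₀ _ hden]
  have hdet' : (a * d - b * c : ℂ) = 1 := by exact_mod_cast hdet
  constructor
  · rintro ⟨u, v, rfl⟩
    refine ⟨u * a + v * c, u * b + v * d, ?_⟩
    rw [div_mul_eq_mul_div, eq_div_iff hden]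
    push_cast
    linear_combination l * u * hmob
  · rintro ⟨u, v, rfl⟩
    refine ⟨u * d - v * c, v * a - u * b, ?_⟩
    rw [div_mul_eq_mul_div, div_eq_iff hden]
    push_cast
    linear_combination -l * (u * d - v * c) * hmob - l * (u * τ + v) * hdet'

theorem mk0_eq_mk0_iff_exists_mob [IsDedekindDomain O] {ι : O →+* ℂ}
    (hι : Function.Injective ι) {τ τ' : ℂ} (hτ : 0 < τ.im) (hτ' : 0 < τ'.im) {J J' : nonZeroDivisors (Ideal O)}
    (h : IsLatticeIdeal ι τ J) (h' : IsLatticeIdeal ι τ' J') :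
    ClassGroup.mk0 J = ClassGroup.mk0 J' ↔
      ∃ a b c d : ℤ, a * d - b * c = 1 ∧ mob a b c d τ = τ' := by
  rw [ClassGroup.mk0_eq_mk0_iff]
  constructor
  · rintro ⟨x, y, hx, hy, hxy⟩
    obtain ⟨l, hl, h⟩ := h
    obtain ⟨l', hl', h'⟩ := h'
    refine exists_mob_eq_of_homothetic hτ hτ' (mul_ne_zero ((map_ne_zero_iff ι hι).2 hx) hl)
      (mul_ne_zero ((map_ne_zero_iff ι hι).2 hy) hl') fun z => ?_
    rw [← isLatticeIdeal_span_mul h, ← isLatticeIdeal_span_mul h', hxy]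
  · rintro ⟨a, b, c, d, hdet, rfl⟩
    replace h' := h'.mob hτ hdet
    obtain ⟨l, hl, h⟩ := h
    obtain ⟨l', hl', h'⟩ := h'
    obtain ⟨x, hx, hx'⟩ := (h' l').2 ⟨0, 1, by simp⟩
    obtain ⟨y, hy, hy'⟩ := (h l).2 ⟨0, 1, by simp⟩
    refine ⟨x, y, fun h0 => hl' (by rw [← hx', h0, map_zero]),
      fun h0 => hl (by rw [← hy', h0, map_zero]), ?_⟩
    have key : ∀ z, (∃ k ∈ Ideal.span {x} * (J : Ideal O), ι k = z) ↔
        ∃ k ∈ Ideal.span {y} * (J' : Ideal O), ι k = z := fun z => by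
      rw [isLatticeIdeal_span_mul h, isLatticeIdeal_span_mul h', hx', hy', mul_comm l l']
    ext k
    constructor
    · intro hk
      obtain ⟨k', hk', he⟩ := (key _).1 ⟨k, hk, rfl⟩
      rwa [← hι he]
    · intro hk
      obtain ⟨k', hk', he⟩ := (key _).2 ⟨k, hk, rfl⟩
      rwa [← hι he]

/-- Ideal classes of a quadratic order classify fixed points of integral matrices up to the
modular group. -/
theorem exists_class_map [IsDedekindDomain O] {ι : O →+* ℂ} (hι : Function.Injective ι)
    {s n : ℤ} {ω : ℂ} (hω : ω ^ 2 = s * ω - n) (hω' : 0 < ω.im)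
    (hO : ∀ z : ℂ, (∃ x, ι x = z) ↔ ∃ u v : ℤ, z = u * ω + v) :
    ∃ cl : ℂ → ClassGroup O, (∀ C, ∃ τ ∈ integralFixedPoints s n, cl τ = C) ∧
      ∀ τ ∈ integralFixedPoints s n, ∀ τ' ∈ integralFixedPoints s n,
        (cl τ = cl τ' ↔ ∃ a b c d : ℤ, a * d - b * c = 1 ∧ mob a b c d τ = τ') := by
  classical
  have hex : ∀ τ : ℂ, ∃ J : nonZeroDivisors (Ideal O), τ ∈ integralFixedPoints s n →
      IsLatticeIdeal ι τ J := fun τ => by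
    by_cases hτ : τ ∈ integralFixedPoints s n
    · obtain ⟨J, hJ⟩ := exists_isLatticeIdeal hω hω' hO hτ
      exact ⟨⟨J, mem_nonZeroDivisors_of_ne_zero hJ.ne_bot⟩, fun _ => hJ⟩
    · exact ⟨1, fun h => absurd h hτ⟩
  choose J hJ using hex
  refine ⟨fun τ => ClassGroup.mk0 (J τ), fun C => ?_, fun τ hτ τ' hτ' =>
    mk0_eq_mk0_iff_exists_mob hι hτ.1 hτ'.1 (hJ τ hτ) (hJ τ' hτ')⟩
  obtain ⟨I, rfl⟩ := ClassGroup.mk0_surjective C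
  obtain ⟨τ, hτ, hI⟩ := exists_integralFixedPoints_of_ideal hι hω hω' hO (nonZeroDivisors.ne_zero I.2)
  exact ⟨τ, hτ, (mk0_eq_mk0_iff_exists_mob hι hτ.1 hτ.1 (hJ τ hτ) hI).2
    ⟨1, 0, 0, 1, by norm_num, by simp [_root_.mob]⟩⟩

end ClassMap

theorem exists_int_of_sq_mul_eq {d : ℕ} (hd : Squarefree d) {q : ℚ} {N : ℤ} (h : q ^ 2 * d = N) :
    ∃ w : ℤ, q = w := by
  have h0 : (q.den : ℚ) ≠ 0 := by exact_mod_cast q.den_ne_zero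
  have h1 : q.num ^ 2 * d = N * (q.den : ℤ) ^ 2 := by
    have : (q.num : ℚ) ^ 2 * d = N * (q.den : ℚ) ^ 2 := by
      rw [← h]
      nth_rewrite 2 [← Rat.num_div_den q]
      field_simp
    exact_mod_cast this
  have hcop : IsCoprime ((q.den : ℤ) ^ 2) (q.num ^ 2) :=
    (Int.isCoprime_iff_gcd_eq_one.2 (by simpa [Int.gcd, Nat.Coprime] using q.reduced)).symm.pow
  have h2 : (q.den : ℤ) ^ 2 ∣ d := hcop.dvd_of_dvd_mul_left (Dvd.intro_left _ h1.symm)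
  have h3 : q.den * q.den ∣ d := by
    rw [← pow_two]
    exact_mod_cast h2
  have h4 := Nat.isUnit_iff.1 (hd _ h3)
  exact ⟨q.num, (Rat.coe_int_num_of_den_eq_one h4).symm⟩

/-- The purely imaginary generator of an imaginary quadratic field. -/
def imagSqrt (d : ℕ) : ℂ := Complex.I * Real.sqrt d

theorem imagSqrt_sq (d : ℕ) : imagSqrt d ^ 2 = -d := by
  rw [imagSqrt, mul_pow, Complex.I_sq, ← Complex.ofReal_pow, Real.sq_sqrt (Nat.cast_nonneg d)]
  simp

theorem imagSqrt_im_pos {d : ℕ} (hd : 0 < d) : 0 < (imagSqrt d).im := by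
  simpa [imagSqrt] using hd

theorem conj_imagSqrt (d : ℕ) : starRingEnd ℂ (imagSqrt d) = -imagSqrt d := by
  simp [imagSqrt]

theorem isIntegral_imagSqrt (d : ℕ) : IsIntegral ℚ (imagSqrt d) :=
  ⟨X ^ 2 + C (d : ℚ), monic_X_pow_add_C _ two_ne_zero, by simp [imagSqrt_sq]⟩

/-- The imaginary quadratic subfield of the complex numbers. -/
abbrev imagQuadratic (d : ℕ) : IntermediateField ℚ ℂ := IntermediateField.adjoin ℚ {imagSqrt d}

instance (d : ℕ) : NumberField (imagQuadratic d) :=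
  have : FiniteDimensional ℚ (imagQuadratic d) :=
    IntermediateField.adjoin.finiteDimensional (isIntegral_imagSqrt d)
  ⟨⟩

theorem classNumberSqrtNeg_eq (d : ℕ) :
    classNumberSqrtNeg d = NumberField.classNumber (imagQuadratic d) := rfl

theorem exists_rat_of_mem_imagQuadratic {d : ℕ} {z : ℂ} (hz : z ∈ imagQuadratic d) :
    ∃ r q : ℚ, z = r + q * imagSqrt d := by
  have h1 : z ∈ Algebra.adjoin ℚ {imagSqrt d} := by
    rw [← IntermediateField.adjoin_simple_toSubalgebra_of_isAlgebraic
      (isIntegral_imagSqrt d).isAlgebraic]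
    exact hz
  clear hz
  induction h1 using Algebra.adjoin_induction with
  | mem x hx => exact ⟨0, 1, by rw [Set.mem_singleton_iff.1 hx]; simp⟩
  | algebraMap r => exact ⟨r, 0, by simp⟩
  | add x y _ _ hx hy =>
    obtain ⟨r, q, rfl⟩ := hx
    obtain ⟨r', q', rfl⟩ := hy
    refine ⟨r + r', q + q', ?_⟩
    push_cast
    ring
  | mul x y _ _ hx hy =>
    obtain ⟨r, q, rfl⟩ := hx
    obtain ⟨r', q', rfl⟩ := hy
    refine ⟨r * r' - d * (q * q'), r * q' + q * r', ?_⟩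
    push_cast
    linear_combination q * q' * imagSqrt_sq d

/-- The embedding of the ring of integers of an imaginary quadratic field. -/
def imagEmbedding (d : ℕ) : NumberField.RingOfIntegers (imagQuadratic d) →+* ℂ :=
  (algebraMap (imagQuadratic d) ℂ).comp (algebraMap _ (imagQuadratic d))

theorem imagEmbedding_injective (d : ℕ) : Function.Injective (imagEmbedding d) :=
  (algebraMap (imagQuadratic d) ℂ).injective.comp NumberField.RingOfIntegers.coe_injective

theorem exists_imagEmbedding_eq {d : ℕ} {z : ℂ} :
    (∃ x, imagEmbedding d x = z) ↔ z ∈ imagQuadratic d ∧ IsIntegral ℤ z := by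
  constructor
  · rintro ⟨x, rfl⟩
    exact ⟨(x : imagQuadratic d).2, (NumberField.RingOfIntegers.isIntegral_coe x).map
      ((algebraMap (imagQuadratic d) ℂ).toIntAlgHom)⟩
  · rintro ⟨h, h'⟩
    have : IsIntegral ℤ (⟨z, h⟩ : imagQuadratic d) :=
      (isIntegral_algHom_iff ((algebraMap (imagQuadratic d) ℂ).toIntAlgHom)
        (algebraMap (imagQuadratic d) ℂ).injective).1 h'
    exact ⟨⟨_, this⟩, rfl⟩

theorem exists_int_eq_of_isIntegral {r : ℚ} (h : IsIntegral ℤ (r : ℂ)) : ∃ t : ℤ, r = t := by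
  have h1 : IsIntegral ℤ r :=
    (isIntegral_algHom_iff ((algebraMap ℚ ℂ).toIntAlgHom) (algebraMap ℚ ℂ).injective).1 h
  obtain ⟨t, ht⟩ := IsIntegrallyClosed.isIntegral_iff.1 h1
  exact ⟨t, ht.symm⟩

theorem exists_half_int {d : ℕ} (hd : Squarefree d) {z : ℂ} (hz : ∃ x, imagEmbedding d x = z) :
    ∃ t w N : ℤ, 2 * z = t + w * imagSqrt d ∧ t ^ 2 + d * w ^ 2 = 4 * N := by
  obtain ⟨hz, h_int⟩ := exists_imagEmbedding_eq.1 hz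
  obtain ⟨r, q, hrq⟩ := exists_rat_of_mem_imagQuadratic hz
  have hconj : IsIntegral ℤ (starRingEnd ℂ z) := h_int.map (starRingEnd ℂ).toIntAlgHom
  have hc : starRingEnd ℂ z = r - q * imagSqrt d := by
    rw [hrq, map_add, map_mul, conj_imagSqrt]
    simp
    ring
  obtain ⟨t, ht⟩ := exists_int_eq_of_isIntegral (r := 2 * r) (by
    have : ((2 * r : ℚ) : ℂ) = z + starRingEnd ℂ z := by
      rw [hc, hrq]
      push_cast
      ring
    rw [this]
    exact h_int.add hconj)
  obtain ⟨N, hN⟩ := exists_int_eq_of_isIntegral (r := r ^ 2 + d * q ^ 2) (by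
    have : ((r ^ 2 + d * q ^ 2 : ℚ) : ℂ) = z * starRingEnd ℂ z := by
      rw [hc, hrq]
      push_cast
      linear_combination q ^ 2 * imagSqrt_sq d
    rw [this]
    exact h_int.mul hconj)
  obtain ⟨w, hw⟩ := exists_int_of_sq_mul_eq hd (q := 2 * q) (N := 4 * N - t ^ 2) (by
    push_cast
    rw [← hN, ← ht]
    ring)
  refine ⟨t, w, N, ?_, ?_⟩
  · have h1 : (2 * r : ℂ) = t := by exact_mod_cast congrArg (Rat.cast : ℚ → ℂ) ht
    have h2 : (2 * q : ℂ) = w := by exact_mod_cast congrArg (Rat.cast : ℚ → ℂ) hw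
    rw [hrq, ← h1, ← h2]
    ring
  · have : (t ^ 2 + d * w ^ 2 : ℚ) = 4 * N := by
      rw [← hN, ← ht, ← hw]
      ring
    exact_mod_cast this

theorem exists_imagEmbedding_of_root {d : ℕ} {ω : ℂ} (hω : ω ∈ imagQuadratic d) {s n : ℤ}
    (h : ω ^ 2 = s * ω - n) (u v : ℤ) : ∃ x, imagEmbedding d x = u * ω + v := by
  refine exists_imagEmbedding_eq.2 ⟨add_mem (mul_mem (intCast_mem _ u) hω) (intCast_mem _ v), ?_⟩
  have : IsIntegral ℤ ω := ⟨X ^ 2 - C s * X + C n, by monicity!, by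
    rw [eval₂_add, eval₂_sub, eval₂_mul, eval₂_X_pow, eval₂_C, eval₂_C, eval₂_X, h]
    simp⟩
  exact ((isIntegral_algebraMap (x := u)).mul this).add (isIntegral_algebraMap (x := v))

theorem imagSqrt_mem (d : ℕ) : imagSqrt d ∈ imagQuadratic d :=
  IntermediateField.mem_adjoin_simple_self ℚ _

theorem sq_emod_four (t : ℤ) : (t % 2 = 0 ∧ t ^ 2 % 4 = 0) ∨ (t % 2 = 1 ∧ t ^ 2 % 4 = 1) := by
  rcases Int.even_or_odd' t with ⟨k, rfl | rfl⟩
  · left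
    have : (2 * k) ^ 2 = 4 * k ^ 2 := by ring
    omega
  · right
    have : (2 * k + 1) ^ 2 = 4 * (k ^ 2 + k) + 1 := by ring
    omega

theorem exists_imagEmbedding_iff {d : ℕ} (hd : Squarefree d) (hd4 : d % 4 ≠ 3) (z : ℂ) :
    (∃ x, imagEmbedding d x = z) ↔ ∃ u v : ℤ, z = u * imagSqrt d + v := by
  constructor
  · intro hz
    obtain ⟨t, w, N, h1, h2⟩ := exists_half_int hd hz
    have hd0 : d % 4 ≠ 0 := fun h0 => by
      have := Nat.isUnit_iff.1 (hd 2 (Nat.dvd_of_mod_eq_zero h0))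
      omega
    have h3 : 2 ∣ t ∧ 2 ∣ w := by
      have h4 : (t ^ 2 + (d : ℤ) * w ^ 2) % 4 = 0 := by omega
      rw [Int.add_emod, Int.mul_emod] at h4
      have h5 : (d : ℤ) % 4 = 1 ∨ (d : ℤ) % 4 = 2 := by omega
      rcases sq_emod_four t with ⟨ht, ht'⟩ | ⟨ht, ht'⟩ <;>
        rcases sq_emod_four w with ⟨hw, hw'⟩ | ⟨hw, hw'⟩ <;>
        rcases h5 with h5 | h5 <;> rw [ht', hw', h5] at h4 <;> omega
    obtain ⟨⟨t', rfl⟩, ⟨w', rfl⟩⟩ := h3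
    refine ⟨w', t', ?_⟩
    push_cast at h1
    linear_combination h1 / 2
  · rintro ⟨u, v, rfl⟩
    exact exists_imagEmbedding_of_root (s := 0) (n := d) (imagSqrt_mem d)
      (by rw [imagSqrt_sq]; simp) u v

theorem exists_imagEmbedding_iff_of_three {d : ℕ} (hd : Squarefree d) (hd4 : d % 4 = 3) (z : ℂ) :
    (∃ x, imagEmbedding d x = z) ↔ ∃ u v : ℤ, z = u * ((1 + imagSqrt d) / 2) + v := by
  constructor
  · intro hz
    obtain ⟨t, w, N, h1, h2⟩ := exists_half_int hd hz
    have h3 : 2 ∣ t - w := by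
      have h4 : (t ^ 2 + (d : ℤ) * w ^ 2) % 4 = 0 := by omega
      rw [Int.add_emod, Int.mul_emod, show (d : ℤ) % 4 = 3 by omega] at h4
      rcases sq_emod_four t with ⟨ht, ht'⟩ | ⟨ht, ht'⟩ <;>
        rcases sq_emod_four w with ⟨hw, hw'⟩ | ⟨hw, hw'⟩ <;>
        rw [ht', hw'] at h4 <;> omega
    obtain ⟨v, hv⟩ := h3
    obtain rfl : t = w + 2 * v := by omega
    refine ⟨w, v, ?_⟩
    push_cast at h1
    linear_combination h1 / 2
  · rintro ⟨u, v, rfl⟩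
    refine exists_imagEmbedding_of_root (s := 1) (n := (d + 1) / 4) ?_ ?_ u v
    · exact div_mem (add_mem (one_mem _) (imagSqrt_mem d)) (ofNat_mem _ 2)
    · obtain ⟨k, hk⟩ : 4 ∣ (d + 1 : ℤ) := by omega
      have hk' : (d : ℂ) + 1 = 4 * k := by exact_mod_cast hk
      rw [hk, Int.mul_ediv_cancel_left _ (by norm_num)]
      push_cast
      linear_combination imagSqrt_sq d / 4 - hk' / 4

/-- `cl` induces a bijection between the `SL₂(ℤ)`-classes of points fixed by matrices of trace `s`
and determinant `n` and the set `Fin h`. -/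
def IsClassMap (s n : ℤ) {h : ℕ} (cl : ℂ → Fin h) : Prop :=
  (∀ C, ∃ τ ∈ integralFixedPoints s n, cl τ = C) ∧
    ∀ τ ∈ integralFixedPoints s n, ∀ τ' ∈ integralFixedPoints s n,
      (cl τ = cl τ' ↔ ∃ a b c d : ℤ, a * d - b * c = 1 ∧ mob a b c d τ = τ')

theorem exists_isClassMap_of_embedding {d : ℕ} {s n : ℤ} {ω : ℂ} (hω : ω ^ 2 = s * ω - n)
    (hω' : 0 < ω.im)
    (hO : ∀ z : ℂ, (∃ x, imagEmbedding d x = z) ↔ ∃ u v : ℤ, z = u * ω + v) :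
    ∃ cl : ℂ → Fin (classNumberSqrtNeg d), IsClassMap s n cl := by
  obtain ⟨cl, h1, h2⟩ := exists_class_map (imagEmbedding_injective d) hω hω' hO
  have e := Fintype.equivFin (ClassGroup (NumberField.RingOfIntegers (imagQuadratic d)))
  rw [classNumberSqrtNeg_eq, NumberField.classNumber]
  refine ⟨fun τ ↦ e (cl τ), fun C ↦ ?_, fun τ hτ τ' hτ' ↦ ?_⟩
  · obtain ⟨τ, hτ, h⟩ := h1 (e.symm C)
    exact ⟨τ, hτ, (congrArg e h).trans (e.apply_symm_apply C)⟩
  · exact e.apply_eq_iff_eq.trans (h2 τ hτ τ' hτ')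

theorem exists_isClassMap {d : ℕ} (hd : Squarefree d) (hd4 : d % 4 ≠ 3) :
    ∃ cl : ℂ → Fin (classNumberSqrtNeg d), IsClassMap 0 d cl := by
  refine exists_isClassMap_of_embedding ?_ (imagSqrt_im_pos (Nat.pos_of_ne_zero hd.ne_zero))
    (exists_imagEmbedding_iff hd hd4)
  simp [imagSqrt_sq]

theorem exists_isClassMap_of_three {d : ℕ} (hd : Squarefree d) (hd4 : d % 4 = 3) {m : ℤ}
    (hm : (d : ℤ) = 4 * m - 1) : ∃ cl : ℂ → Fin (classNumberSqrtNeg d), IsClassMap 1 m cl := by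
  refine exists_isClassMap_of_embedding ?_ ?_ (exists_imagEmbedding_iff_of_three hd hd4)
  · have h : (d : ℂ) = 4 * m - 1 := by exact_mod_cast hm
    push_cast
    linear_combination (imagSqrt_sq d) / 4 - h / 4
  · have := imagSqrt_im_pos (d := d) (by omega)
    simpa using this

theorem ncard_image_of_injective {ι α β : Type*} {Z : Set α} {t : α → β} {F : ι → β}
    (hF : Function.Injective F) (hZ : t '' Z = Set.range F) : (t '' Z).ncard = Nat.card ι := by
  rw [hZ, ← Nat.card_coe_set_eq, Nat.card_range_of_injective hF]

theorem ncard_image_of_iff {α β : Type*} {h : ℕ} {Z : Set α} {t : α → β} {cl : α → Fin h}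
    (hsurj : ∀ C, ∃ x ∈ Z, cl x = C) (hcl : ∀ x ∈ Z, ∀ y ∈ Z, (cl x = cl y ↔ t x = t y)) :
    (t '' Z).ncard = h := by
  choose r hrZ hr using hsurj
  rw [ncard_image_of_injective (F := t ∘ r), Nat.card_fin]
  · intro C C' hC
    rw [← hr C, ← hr C', hcl _ (hrZ C) _ (hrZ C')]
    exact hC
  · ext b
    constructor
    · rintro ⟨x, hx, rfl⟩
      exact ⟨cl x, (hcl _ (hrZ _) _ hx).1 (hr _)⟩
    · rintro ⟨C, rfl⟩
      exact ⟨r C, hrZ C, rfl⟩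

theorem two_mul_ncard_image {α β : Type*} {h : ℕ} {Z : Set α} {t : α → β} {cl : α → Fin h}
    {w : α → α} (hw : ∀ x ∈ Z, w x ∈ Z) (htw : ∀ x ∈ Z, t (w x) = t x)
    (hclw : ∀ x ∈ Z, cl (w x) ≠ cl x) (hsurj : ∀ C, ∃ x ∈ Z, cl x = C)
    (hcl : ∀ x ∈ Z, ∀ y ∈ Z, cl x = cl y → t x = t y)
    (ht : ∀ x ∈ Z, ∀ y ∈ Z, t x = t y → cl y = cl x ∨ cl y = cl (w x)) :
    2 * (t '' Z).ncard = h := by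
  classical
  choose r hrZ hr using hsurj
  have hZ : t '' Z = (Finset.univ.image (t ∘ r) : Finset β) := by
    ext b
    simp only [Set.mem_image, Finset.coe_image, Finset.coe_univ, Set.image_univ, Set.mem_range,
      Function.comp_apply]
    constructor
    · rintro ⟨x, hx, rfl⟩
      exact ⟨cl x, hcl _ (hrZ _) _ hx (hr _)⟩
    · rintro ⟨C, rfl⟩
      exact ⟨r C, hrZ C, rfl⟩
  rw [hZ, Set.ncard_coe_finset]
  have key := Finset.card_eq_sum_card_image (t ∘ r) Finset.univ
  rw [Finset.card_univ, Fintype.card_fin] at key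
  refine (key.trans ((Finset.sum_const_nat (m := 2) fun b hb ↦ ?_).trans (mul_comm _ _))).symm
  obtain ⟨C, -, rfl⟩ := Finset.mem_image.1 hb
  refine Finset.card_eq_two.2 ⟨C, cl (w (r C)), ?_, ?_⟩
  · have := hclw _ (hrZ C)
    rw [hr C] at this
    exact this.symm
  · ext C'
    simp only [Finset.mem_filter, Finset.mem_univ, true_and, Function.comp_apply,
      Finset.mem_insert, Finset.mem_singleton]
    constructor
    · intro h'
      have := ht _ (hrZ C) _ (hrZ C') h'.symm
      rwa [hr, hr] at this
    · rintro (rfl | rfl)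
      · rfl
      · rw [← htw _ (hrZ C)]
        exact hcl _ (hrZ _) _ (hw _ (hrZ _)) (hr _)

theorem hauptmodul_eq_of_mob {A B C D : ℤ} (h : A * D - B * C = 1) (hC : Even C) {x : ℂ}
    (hx : 0 < x.im) : hauptmodul (mob A B C D x) = hauptmodul x :=
  hauptmodul_mob ⟨even_iff_two_dvd.1 hC, .inl h⟩ hx

/-- Points with the same Hauptmodul value are related by a matrix of `Γ₀(2)` or by an
Atkin–Lehner matrix. -/
theorem exists_mob_of_hauptmodul_eq {x y : ℂ} (hx : 0 < x.im) (hy : 0 < y.im)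
    (h : hauptmodul x = hauptmodul y) :
    (∃ A B C D : ℤ, A * D - B * C = 1 ∧ Even C ∧ mob A B C D x = y) ∨
      ∃ A B C D : ℤ, 2 * A * D - B * C = 1 ∧ mob (2 * A) B (2 * C) (2 * D) x = y := by
  obtain ⟨a, b, c, d, ⟨h1, h2 | ⟨⟨a', rfl⟩, ⟨d', rfl⟩, h2⟩⟩, hxy⟩ :=
    frickeEquiv_of_hauptmodul_eq hx hy h
  · exact .inl ⟨a, b, c, d, h2, even_iff_two_dvd.2 h1, hxy⟩
  · obtain ⟨c', rfl⟩ := h1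
    exact .inr ⟨a', b, c', d', by linarith, hxy⟩

theorem isFricke_atkinLehner : IsFricke 0 (-1) 2 0 :=
  ⟨dvd_rfl, .inr ⟨dvd_zero _, dvd_zero _, by norm_num⟩⟩

theorem odd_of_fixedBy {n a b c : ℤ} {τ : ℂ} (hn : n % 4 = 1 ∨ n % 4 = 2)
    (h : FixedBy 0 n a b (2 * c) τ) : ¬ Even b := by
  rintro ⟨k, rfl⟩
  have h1 := h.1
  have h2 : n = -a ^ 2 - 4 * (k * c) := by linarith
  rcases sq_emod_four a with h3 | h3 <;> omega

theorem even_of_mob_mem {n A B C D : ℤ} (hn : n % 4 = 1 ∨ n % 4 = 2) (hn0 : 0 < n) {x : ℂ}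
    (hx : x ∈ evenFixedPoints n) (hdet : A * D - B * C = 1)
    (hy : mob A B C D x ∈ evenFixedPoints n) : Even C := by
  obtain ⟨hx, a, b, c, h⟩ := hx
  obtain ⟨hy, a', b', c', h'⟩ := hy
  have hb := odd_of_fixedBy hn h
  have h1 := (h'.unique hy (by linarith) (h.conj hx hdet))
  have h2 : Even ((C * a + D * (2 * c)) * D - (C * b + D * (0 - a)) * C) := by
    rcases h1 with ⟨-, -, e⟩ | ⟨-, -, e⟩ <;> rw [e] <;> simp
  have h3 : C * C * b = 2 * (C * a * D + D * c * D) -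
      ((C * a + D * (2 * c)) * D - (C * b + D * (0 - a)) * C) := by ring
  have h4 : Even (C * C * b) := by
    rw [h3]
    exact (even_two_mul _).sub h2
  simp only [Int.even_mul, hb, or_false, or_self] at h4
  exact h4

theorem evenFixedPoints_subset {n : ℤ} : evenFixedPoints n ⊆ integralFixedPoints 0 n :=
  fun _ ⟨h, a, b, c, h'⟩ ↦ ⟨h, a, b, 2 * c, h'⟩

theorem FixedBy.mem_evenFixedPoints {n a b c : ℤ} {τ : ℂ} (h : FixedBy 0 n a b c τ)
    (hτ : 0 < τ.im) (hc : Even c) : τ ∈ evenFixedPoints n := by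
  obtain ⟨k, rfl⟩ := even_iff_two_dvd.1 hc
  exact ⟨hτ, a, b, k, h⟩

theorem two_mul_ncard_hauptmodul_evenFixedPoints {p : ℕ} [hp : Fact p.Prime] (hp5 : 5 ≤ p) {n : ℤ}
    (hn : n % 4 = 1 ∨ n % 4 = 2) (hn0 : 0 < n) (hE : evenFixedPoints n ⊆ frickeFixedPoints p)
    {h : ℕ} {cl : ℂ → Fin h} (hcl : IsClassMap 0 n cl) :
    2 * (hauptmodul '' evenFixedPoints n).ncard = h := by
  have hsub := evenFixedPoints_subset (n := n)
  refine two_mul_ncard_image (cl := cl) (w := mob 0 (-1) 2 0)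
    (fun x hx ↦ isFricke_atkinLehner.mem_evenFixedPoints hx)
    (fun x hx ↦ hauptmodul_mob isFricke_atkinLehner hx.1) ?_ ?_ ?_ ?_
  · intro x hx hc
    have hwx := isFricke_atkinLehner.mem_evenFixedPoints hx
    obtain ⟨A, B, C, D, hdet, hm⟩ := (hcl.2 _ (hsub hwx) _ (hsub hx)).1 hc
    have hC := even_of_mob_mem hn hn0 hwx hdet (by rwa [hm])
    rw [mob_mob (denom_ne_zero isFricke_atkinLehner.det_pos hx.1)] at hm
    have := frickeFixedPoints_stabilizer hp5 (hE hx) (a' := A * 0 + B * 2)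
      ⟨⟨D, by ring⟩, .inr ⟨⟨B, by ring⟩, by simpa using even_iff_two_dvd.1 hC,
        by linear_combination 2 * hdet⟩⟩ hm
    obtain ⟨h1, h2, h3⟩ := this
    have hA : A = 0 := by omega
    rw [hA] at hdet
    obtain ⟨k, rfl⟩ := hC
    have : 2 * (-(B * k)) = 1 := by linarith
    omega
  · intro C
    obtain ⟨τ, ⟨hτ, a, b, c, hf⟩, rfl⟩ := hcl.1 C
    have key : ∀ A B C D : ℤ, A * D - B * C = 1 →
        Even ((C * a + D * c) * D - (C * b + D * (0 - a)) * C) →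
        ∃ x ∈ evenFixedPoints n, cl x = cl τ := by
      intro A B C D hdet he
      have h1 := (hf.conj hτ hdet).mem_evenFixedPoints
        (mob_im_pos (by rw [hdet]; exact one_pos) hτ) he
      exact ⟨_, h1, ((hcl.2 _ ⟨hτ, a, b, c, hf⟩ _ (hsub h1)).2 ⟨A, B, C, D, hdet, rfl⟩).symm⟩
    by_cases hc : Even c
    · exact ⟨τ, hf.mem_evenFixedPoints hτ hc, rfl⟩
    · by_cases hb : Even b
      · exact key 0 (-1) 1 0 (by norm_num) (by simpa using hb)
      · refine key 1 0 1 1 (by norm_num) ?_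
        simp only [Int.even_sub, Int.even_add, Int.even_mul]
        simp [hb, hc]
  · intro x hx y hy hxy
    obtain ⟨A, B, C, D, hdet, rfl⟩ := (hcl.2 _ (hsub hx) _ (hsub hy)).1 hxy
    exact (hauptmodul_eq_of_mob hdet (even_of_mob_mem hn hn0 hx hdet hy) hx.1).symm
  · intro x hx y hy hxy
    rcases exists_mob_of_hauptmodul_eq hx.1 hy.1 hxy with
      ⟨A, B, C, D, hdet, -, hm⟩ | ⟨A, B, C, D, hdet, hm⟩
    · exact .inl ((hcl.2 _ (hsub hx) _ (hsub hy)).2 ⟨A, B, C, D, hdet, hm⟩).symm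
    · right
      have hwx := isFricke_atkinLehner.mem_evenFixedPoints hx
      refine ((hcl.2 _ (hsub hwx) _ (hsub hy)).2
        ⟨-B, A, -2 * D, C, by linear_combination hdet, ?_⟩).symm
      rw [mob_mob (denom_ne_zero isFricke_atkinLehner.det_pos hx.1), ← hm]
      congr 1 <;> ring

theorem FixedBy.two_mul {m n a b c : ℤ} {τ : ℂ} (hn : n = 4 * m - 1) (h : FixedBy 1 m a b c τ) :
    FixedBy 0 n (2 * a - 1) (2 * b) (2 * c) τ := by
  obtain ⟨h1, h2⟩ := h
  refine ⟨by rw [hn]; linear_combination 4 * h1, ?_⟩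
  push_cast at h2 ⊢
  linear_combination 2 * h2

theorem FixedBy.of_two_mul {m n a b c : ℤ} {τ : ℂ} (hn : n = 4 * m - 1)
    (h : FixedBy 0 n (2 * a - 1) (2 * b) (2 * c) τ) : FixedBy 1 m a b c τ := by
  obtain ⟨h1, h2⟩ := h
  refine ⟨?_, ?_⟩
  · rw [hn] at h1
    have : 4 * (a * (1 - a) - b * c) = 4 * m := by linear_combination h1
    omega
  · push_cast at h2 ⊢
    linear_combination h2 / 2

theorem integralFixedPoints_subset {m n : ℤ} (hn : n = 4 * m - 1) :
    integralFixedPoints 1 m ⊆ evenFixedPoints n :=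
  fun _ ⟨h, a, b, c, h'⟩ ↦ ⟨h, 2 * a - 1, 2 * b, c, h'.two_mul hn⟩

theorem even_of_mem_integralFixedPoints {m n a b c : ℤ} (hm : 0 < m) (hn : n = 4 * m - 1) {τ : ℂ}
    (hτ : τ ∈ integralFixedPoints 1 m) (h : FixedBy 0 n a b c τ) : Even b := by
  obtain ⟨him, a', b', c', h'⟩ := hτ
  rcases (h'.two_mul hn).unique him (by omega) h with ⟨-, rfl, -⟩ | ⟨-, rfl, -⟩ <;> simp

theorem FixedBy.odd {n a b c : ℤ} {m : ℤ} (hn : n = 4 * m - 1) {τ : ℂ}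
    (h : FixedBy 0 n a b (2 * c) τ) : ∃ k, a = 2 * k - 1 := by
  have h1 := h.1
  have h2 : a ^ 2 = 2 * (-2 * m - b * c) + 1 := by linarith
  rcases sq_emod_four a with h3 | h3
  · omega
  · exact ⟨(a + 1) / 2, by omega⟩

theorem exists_integralFixedPoints_hauptmodul {m n : ℤ} (hn : n = 4 * m - 1) {τ : ℂ}
    (hτ : τ ∈ evenFixedPoints n) :
    ∃ τ' ∈ integralFixedPoints 1 m, hauptmodul τ' = hauptmodul τ := by
  obtain ⟨him, a, b, c, h⟩ := hτ
  obtain ⟨k, rfl⟩ := h.odd hn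
  by_cases hb : Even b
  · obtain ⟨b, rfl⟩ := even_iff_two_dvd.1 hb
    exact ⟨τ, ⟨him, k, b, c, h.of_two_mul hn⟩, rfl⟩
  · refine ⟨mob 0 (-1) 2 0 τ, ⟨mob_im_pos isFricke_atkinLehner.det_pos him, ?_⟩,
      hauptmodul_mob isFricke_atkinLehner him⟩
    have hc : Even c := by
      have h1 : b * c = 2 * (k - k ^ 2 - m) := by
        have := h.1
        rw [hn] at this
        linarith
      have h2 : Even (b * c) := by
        rw [h1]
        exact even_two_mul _
      exact (Int.even_mul.1 h2).resolve_left hb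
    obtain ⟨c, rfl⟩ := even_iff_two_dvd.1 hc
    have h1 := h.conj_two (A := 0) (B := -1) (C := 1) (D := 0) him (by norm_num)
    refine ⟨1 - k, -c, -b, FixedBy.of_two_mul hn ?_⟩
    convert h1 using 1 <;> first | ring1 | norm_num

theorem hauptmodul_image_evenFixedPoints {m n : ℤ} (hn : n = 4 * m - 1) :
    hauptmodul '' evenFixedPoints n = hauptmodul '' integralFixedPoints 1 m := by
  refine (Set.image_subset_iff.2 fun τ hτ ↦ ?_).antisymm
    (Set.image_mono (integralFixedPoints_subset hn))
  obtain ⟨τ', h, h'⟩ := exists_integralFixedPoints_hauptmodul hn hτ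
  exact ⟨τ', h, h'⟩

/-- An Atkin–Lehner matrix does not map a fixed point of a form with odd last coefficient to
another fixed point of the maximal order. -/
theorem mob_two_notMem {m a b c A B C D : ℤ} (hm : 0 < m) {τ : ℂ} (hτ : 0 < τ.im)
    (h : FixedBy 1 m a b c τ) (hc : ¬ Even c) (hdet : 2 * A * D - B * C = 1) :
    mob (2 * A) B (2 * C) (2 * D) τ ∉ integralFixedPoints 1 m := fun hmem ↦ by
  have h1 := even_of_mem_integralFixedPoints hm rfl hmem ((h.two_mul rfl).conj_two hτ hdet)
  have hB : ¬ Even B := fun hB ↦ by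
    obtain ⟨k, rfl⟩ := even_iff_two_dvd.1 hB
    have : 2 * (A * D - k * C) = 1 := by linarith
    omega
  revert h1
  simp only [Int.even_sub, Int.even_add, Int.even_mul]
  tauto

theorem exists_mob_of_hauptmodul_eq_of_odd {m a b c : ℤ} (hm : 0 < m) {x y : ℂ} (hx : 0 < x.im)
    (h : FixedBy 1 m a b c x) (hc : ¬ Even c) (hy : y ∈ integralFixedPoints 1 m)
    (hxy : hauptmodul x = hauptmodul y) :
    ∃ A B C D : ℤ, A * D - B * C = 1 ∧ Even C ∧ mob A B C D x = y := by
  rcases exists_mob_of_hauptmodul_eq hx hy.1 hxy with h1 | ⟨A, B, C, D, hdet, rfl⟩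
  · exact h1
  · exact absurd hy (mob_two_notMem hm hx h hc hdet)

theorem FixedBy.even_mul {m a b c : ℤ} {τ : ℂ} (h : FixedBy 1 m a b c τ) :
    Even (b * c) ↔ Even m := by
  have h1 : m = a * (1 - a) - b * c := h.1.symm
  have h2 : Even (a * (1 - a)) := by
    simp only [Int.even_sub, Int.even_mul, Int.not_even_one]
    tauto
  rw [h1, Int.even_sub]
  tauto

def oddPoints (m : ℤ) : Set ℂ :=
  {τ | 0 < τ.im ∧ ∃ a b c : ℤ, FixedBy 1 m a b c τ ∧ ¬ Even c}

def evenPoints (m : ℤ) : Set ℂ :=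
  {τ | 0 < τ.im ∧ ∃ a b c : ℤ, FixedBy 1 m a b c τ ∧ 0 < c ∧ Even c ∧ Even a}

theorem oddPoints_subset {m : ℤ} : oddPoints m ⊆ integralFixedPoints 1 m :=
  fun _ ⟨h, a, b, c, h', _⟩ ↦ ⟨h, a, b, c, h'⟩

theorem evenPoints_subset {m : ℤ} : evenPoints m ⊆ integralFixedPoints 1 m :=
  fun _ ⟨h, a, b, c, h', _⟩ ↦ ⟨h, a, b, c, h'⟩

theorem odd_or_odd_of_det {A B C D : ℤ} (h : A * D - B * C = 1) :
    ¬ Even (A * D) ∧ Even (B * C) ∨ Even (A * D) ∧ ¬ Even (B * C) := by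
  have : ¬ Even (A * D - B * C) := by rw [h]; decide
  rw [Int.even_sub] at this
  tauto

theorem ncard_hauptmodul_oddPoints {m : ℤ} (hm : 0 < m) (hm2 : Even m) {h : ℕ} {cl : ℂ → Fin h}
    (hcl : IsClassMap 1 m cl) : (hauptmodul '' oddPoints m).ncard = h := by
  have hsub := oddPoints_subset (m := m)
  refine ncard_image_of_iff (cl := cl) (fun C ↦ ?_) fun x hx y hy ↦ ⟨fun hxy ↦ ?_, fun hxy ↦ ?_⟩
  · obtain ⟨τ, ⟨hτ, a, b, c, hf⟩, rfl⟩ := hcl.1 C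
    have hbc := hf.even_mul.2 hm2
    rw [Int.even_mul] at hbc
    have key : ∀ A B C D : ℤ, A * D - B * C = 1 →
        ¬ Even ((C * a + D * c) * D - (C * b + D * (1 - a)) * C) →
        ∃ x ∈ oddPoints m, cl x = cl τ := by
      intro A B C D hdet he
      have h1 : mob A B C D τ ∈ oddPoints m :=
        ⟨mob_im_pos (by rw [hdet]; exact one_pos) hτ, _, _, _, hf.conj hτ hdet, he⟩
      exact ⟨_, h1, ((hcl.2 _ ⟨hτ, a, b, c, hf⟩ _ (hsub h1)).2 ⟨A, B, C, D, hdet, rfl⟩).symm⟩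
    by_cases hc : Even c
    · by_cases hb : Even b
      · refine key 1 0 1 1 (by norm_num) ?_
        simp only [Int.even_sub, Int.even_add, Int.even_mul, Int.not_even_one]
        tauto
      · refine key 0 (-1) 1 0 (by norm_num) ?_
        simpa using hb
    · exact ⟨τ, ⟨hτ, a, b, c, hf, hc⟩, rfl⟩
  · obtain ⟨A, B, C, D, hdet, rfl⟩ := (hcl.2 _ (hsub hx) _ (hsub hy)).1 hxy
    refine (hauptmodul_eq_of_mob hdet ?_ hx.1).symm
    obtain ⟨hx, a, b, c, hf, hc⟩ := hx
    obtain ⟨hy, a', b', c', hf', hc'⟩ := hy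
    have hb : Even b := (Int.even_mul.1 (hf.even_mul.2 hm2)).resolve_right hc
    have h1 : ¬ Even ((C * a + D * c) * D - (C * b + D * (1 - a)) * C) := by
      rcases hf'.unique hy (by omega) (hf.conj hx hdet) with ⟨-, -, e⟩ | ⟨-, -, e⟩ <;>
        rw [e] <;> simpa using hc'
    have h2 := odd_or_odd_of_det hdet
    simp only [Int.even_sub, Int.even_add, Int.even_mul, Int.not_even_one] at h1 h2
    tauto
  · obtain ⟨hx', a, b, c, hf, hc⟩ := id hx
    obtain ⟨A, B, C, D, hdet, -, h1⟩ :=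
      exists_mob_of_hauptmodul_eq_of_odd hm hx' hf hc (hsub hy) hxy
    exact (hcl.2 _ (hsub hx) _ (hsub hy)).2 ⟨A, B, C, D, hdet, h1⟩

theorem FixedBy.conj_mem_evenPoints {m a b c A B C D : ℤ} {τ : ℂ} (h : FixedBy 1 m a b c τ)
    (hm : 0 < m) (hτ : 0 < τ.im) (hc : 0 < c) (hdet : A * D - B * C = 1)
    (h1 : Even ((C * a + D * c) * D - (C * b + D * (1 - a)) * C))
    (h2 : Even ((A * a + B * c) * D - (A * b + B * (1 - a)) * C)) :
    mob A B C D τ ∈ evenPoints m := by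
  have him : 0 < (mob A B C D τ).im := mob_im_pos (by rw [hdet]; exact one_pos) hτ
  have hf := h.conj hτ hdet
  exact ⟨him, _, _, _, hf, h.conj_pos hτ hc (hf.ne_zero him (by omega)) rfl, h1, h2⟩

theorem even_of_conj_even {a b c A B C D : ℤ} (hdet : A * D - B * C = 1) (ha : Even a)
    (hc : Even c) (ha' : Even ((A * a + B * c) * D - (A * b + B * (1 - a)) * C))
    (hc' : Even ((C * a + D * c) * D - (C * b + D * (1 - a)) * C)) : Even C := by
  have h := odd_or_odd_of_det hdet
  by_contra hC
  simp only [Int.even_sub, Int.even_add, Int.even_mul, Int.not_even_one, ha, hc, hC, or_true,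
    or_false, false_or, true_or, iff_true, true_iff] at ha' hc' h
  tauto

theorem ncard_hauptmodul_evenPoints {m : ℤ} (hm : 0 < m) (hm2 : Even m) {h : ℕ} {cl : ℂ → Fin h}
    (hcl : IsClassMap 1 m cl) : (hauptmodul '' evenPoints m).ncard = h := by
  have hsub := evenPoints_subset (m := m)
  refine ncard_image_of_iff (cl := cl) (fun C ↦ ?_) fun x hx y hy ↦ ⟨fun hxy ↦ ?_, fun hxy ↦ ?_⟩
  · obtain ⟨τ, hτ, rfl⟩ := hcl.1 C
    obtain ⟨him, a, b, c, hc, hf⟩ : 0 < τ.im ∧ ∃ a b c : ℤ, 0 < c ∧ FixedBy 1 m a b c τ := by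
      obtain ⟨him, a, b, c, hf⟩ := hτ
      refine ⟨him, ?_⟩
      rcases (hf.ne_zero him (by omega)).lt_or_gt with hc | hc
      · exact ⟨_, _, _, neg_pos.2 hc, hf.adjugate⟩
      · exact ⟨_, _, _, hc, hf⟩
    have hbc := hf.even_mul.2 hm2
    rw [Int.even_mul] at hbc
    have key : ∀ A B C D : ℤ, A * D - B * C = 1 →
        Even ((C * a + D * c) * D - (C * b + D * (1 - a)) * C) →
        Even ((A * a + B * c) * D - (A * b + B * (1 - a)) * C) →
        ∃ x ∈ evenPoints m, cl x = cl τ := by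
      intro A B C D hdet h1 h2
      have h3 := hf.conj_mem_evenPoints hm him hc hdet h1 h2
      exact ⟨_, h3, ((hcl.2 _ hτ _ (hsub h3)).2 ⟨A, B, C, D, hdet, rfl⟩).symm⟩
    by_cases h1 : Even c ∧ Even a
    · exact ⟨τ, ⟨him, a, b, c, hf, hc, h1⟩, rfl⟩
    · by_cases h2 : Even b ∧ ¬ Even a
      · refine key 0 (-1) 1 0 (by norm_num) (by simpa using h2.1) ?_
        simpa [Int.even_sub] using h2.2
      · refine key 1 0 1 1 (by norm_num) ?_ ?_ <;>
          simp only [Int.even_sub, Int.even_add, Int.even_mul, Int.not_even_one, Even.zero] <;>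
          tauto
  · obtain ⟨A, B, C, D, hdet, rfl⟩ := (hcl.2 _ (hsub hx) _ (hsub hy)).1 hxy
    refine (hauptmodul_eq_of_mob hdet ?_ hx.1).symm
    obtain ⟨hx, a, b, c, hf, hc, hc2, ha⟩ := hx
    obtain ⟨hy, a', b', c', hf', hc', hc2', ha'⟩ := hy
    have hg := hf.conj hx hdet
    obtain ⟨e1, -, e2⟩ := hf'.unique_of_pos hy hg hc'
      (hf.conj_pos hx hc (hg.ne_zero hy (by omega)) rfl)
    rw [← e1] at ha'
    rw [← e2] at hc2'
    exact even_of_conj_even hdet ha hc2 ha' hc2'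
  · rcases exists_mob_of_hauptmodul_eq hx.1 hy.1 hxy with
      ⟨A, B, C, D, hdet, -, h1⟩ | ⟨A, B, C, D, hdet, rfl⟩
    · exact (hcl.2 _ (hsub hx) _ (hsub hy)).2 ⟨A, B, C, D, hdet, h1⟩
    · exfalso
      obtain ⟨hx, a, b, c, hf, hc, hc2, ha⟩ := hx
      obtain ⟨hy, a', b', c', hf', hc', hc2', ha'⟩ := hy
      have hf := hf.two_mul rfl
      have hf' := hf'.two_mul rfl
      have hg := hf.conj_two hx hdet
      obtain ⟨e, -, -⟩ := hf'.unique_of_pos hy hg (by omega) (by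
        have h1 := hf.conj_pos (C := 2 * C) (D := 2 * D) (c' := 2 * _) hx (by omega)
          (mul_ne_zero two_ne_zero (hg.ne_zero hy (by omega))) (by ring)
        omega)
      obtain ⟨c, rfl⟩ := even_iff_two_dvd.1 hc2
      obtain ⟨a, rfl⟩ := even_iff_two_dvd.1 ha
      obtain ⟨a', rfl⟩ := even_iff_two_dvd.1 ha'
      have : 4 * (4 * A * D * a - A * D - a + B * c * D - A * b * C - a') = -2 := by
        linear_combination e + (4 * a - 1) * hdet
      omega

theorem ncard_hauptmodul_of_even {m n : ℤ} (hm : 0 < m) (hn : n = 4 * m - 1) (hm2 : Even m) {h : ℕ}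
    {cl : ℂ → Fin h} (hcl : IsClassMap 1 m cl) (h0 : 0 < h) :
    (hauptmodul '' evenFixedPoints n).ncard = 2 * h := by
  have h1 := ncard_hauptmodul_oddPoints hm hm2 hcl
  have h2 := ncard_hauptmodul_evenPoints hm hm2 hcl
  have h3 : hauptmodul '' evenFixedPoints n =
      hauptmodul '' oddPoints m ∪ hauptmodul '' evenPoints m := by
    rw [hauptmodul_image_evenFixedPoints hn]
    refine (Set.image_subset_iff.2 fun τ hτ ↦ ?_).antisymm (Set.union_subset
      (Set.image_mono oddPoints_subset) (Set.image_mono evenPoints_subset))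
    obtain ⟨him, a, b, c, hc, hf⟩ : 0 < τ.im ∧ ∃ a b c : ℤ, 0 < c ∧ FixedBy 1 m a b c τ := by
      obtain ⟨him, a, b, c, hf⟩ := hτ
      refine ⟨him, ?_⟩
      rcases (hf.ne_zero him (by omega)).lt_or_gt with hc | hc
      · exact ⟨_, _, _, neg_pos.2 hc, hf.adjugate⟩
      · exact ⟨_, _, _, hc, hf⟩
    by_cases hc2 : Even c
    · right
      by_cases ha : Even a
      · exact ⟨τ, ⟨him, a, b, c, hf, hc, hc2, ha⟩, rfl⟩
      · have him' : 0 < (mob 0 (-1) 2 0 τ).im := mob_im_pos isFricke_atkinLehner.det_pos him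
        refine ⟨mob 0 (-1) 2 0 τ, ⟨him', 1 - a, -(c / 2), -(2 * b), ?_⟩,
          hauptmodul_mob isFricke_atkinLehner him⟩
        have hf2 := hf.two_mul hn
        have h4 := hf2.conj_two (A := 0) (B := -1) (C := 1) (D := 0) him (by norm_num)
        have h5 : FixedBy 1 m (1 - a) (-(c / 2)) (-(2 * b)) (mob 0 (-1) 2 0 τ) := by
          refine FixedBy.of_two_mul hn ?_
          obtain ⟨c, rfl⟩ := even_iff_two_dvd.1 hc2
          rw [Int.mul_ediv_cancel_left _ two_ne_zero]
          convert h4 using 1 <;> first | ring1 | norm_num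
        have h6 := h5.ne_zero him' (by omega)
        refine ⟨h5, ?_, by simp, ?_⟩
        · have := hf.conj_pos (C := 2) (D := 0) (c' := 2 * -(2 * b)) him hc (by omega) (by ring)
          omega
        · rw [Int.even_sub]
          simp [ha]
    · exact .inl ⟨τ, ⟨him, a, b, c, hf, hc2⟩, rfl⟩
  rw [h3, Set.ncard_union_eq ?_ (Set.finite_of_ncard_pos (by omega))
    (Set.finite_of_ncard_pos (by omega)), h1, h2, two_mul]
  rw [Set.disjoint_left]
  rintro _ ⟨x, ⟨hx, a, b, c, hf, hc⟩, rfl⟩ ⟨y, hy, hxy⟩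
  obtain ⟨A, B, C, D, hdet, hC, rfl⟩ :=
    exists_mob_of_hauptmodul_eq_of_odd hm hx hf hc (evenPoints_subset hy) hxy.symm
  obtain ⟨hy, a', b', c', hf', hc', hc2', -⟩ := hy
  have h4 : Even ((C * a + D * c) * D - (C * b + D * (1 - a)) * C) := by
    rcases hf'.unique hy (by omega) (hf.conj hx hdet) with ⟨-, -, e⟩ | ⟨-, -, e⟩ <;>
      rw [e] <;> simpa using hc2'
  have h5 := odd_or_odd_of_det hdet
  simp only [Int.even_sub, Int.even_add, Int.even_mul, Int.not_even_one] at h4 h5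
  tauto

/-- If `g x` and `g' x` are related by `Γ₀(2)`, then `g` and `g'` have the same bottom row
modulo two. -/
theorem two_dvd_sub_of_mob_mob {p : ℕ} [hp : Fact p.Prime] (hp5 : 5 ≤ p) {x : ℂ}
    (hx : x ∈ frickeFixedPoints p) {A B C D A' B' C' D' e f k l : ℤ} (h : A * D - B * C = 1)
    (h' : A' * D' - B' * C' = 1) (hdet : e * l - f * k = 1) (hk : Even k)
    (hm : mob e f k l (mob A B C D x) = mob A' B' C' D' x) : Even (C - C') ∧ Even (D - D') := by
  have him : 0 < x.im := hx.1
  have hd : (C * x + D : ℂ) ≠ 0 := denom_ne_zero (by rw [h]; exact one_pos) him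
  have hd' : (C' * x + D' : ℂ) ≠ 0 := denom_ne_zero (by rw [h']; exact one_pos) him
  obtain ⟨P, hP⟩ : ∃ P, P = e * A + f * C := ⟨_, rfl⟩
  obtain ⟨Q, hQ⟩ : ∃ Q, Q = e * B + f * D := ⟨_, rfl⟩
  obtain ⟨R, hR⟩ : ∃ R, R = k * A + l * C := ⟨_, rfl⟩
  obtain ⟨T, hT⟩ : ∃ T, T = k * B + l * D := ⟨_, rfl⟩
  have hPQ : P * T - Q * R = 1 := by
    rw [hP, hQ, hR, hT]
    linear_combination (A * D - B * C) * hdet + h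
  have hRT : (R * x + T : ℂ) ≠ 0 := denom_ne_zero (by rw [hPQ]; exact one_pos) him
  rw [mob_mob hd, ← hP, ← hQ, ← hR, ← hT] at hm
  have h1 := congrArg (mob D' (-B') (-C') A') hm
  rw [mob_mob hRT, mob_mob hd'] at h1
  have h2 : mob (D' * A' + -B' * C') (D' * B' + -B' * D') (-C' * A' + A' * C')
      (-C' * B' + A' * D') x = x := by
    rw [show D' * A' + -B' * C' = 1 by linarith, show D' * B' + -B' * D' = 0 by ring,
      show -C' * A' + A' * C' = 0 by ring, show -C' * B' + A' * D' = 1 by linarith, mob_one]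
  obtain ⟨e1, e2, e3⟩ := frickeFixedPoints_centralizer hp5 hx
    (.inl (by linear_combination (A' * D' - B' * C') * hPQ + h')) (h1.trans h2)
  obtain ⟨u, hu⟩ : ∃ u, u = D' * P + -B' * R := ⟨_, rfl⟩
  have hC : R = u * C' := by rw [hu]; linear_combination -R * h' + D' * e3
  have hD : T = u * D' := by rw [hu, e1]; linear_combination -T * h' + C' * e2
  have hu' : ¬ Even u := fun hu' ↦ by
    have : Even (P * T - Q * R) := by
      rw [hC, hD]
      simp [Int.even_sub, hu']
    rw [hPQ] at this
    exact absurd this (by decide)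
  have hl : ¬ Even l := by
    have := odd_or_odd_of_det hdet
    simp only [Int.even_mul, hk] at this
    tauto
  have hC2 : Even (k * A + l * C) ↔ Even (u * C') := by rw [← hR, hC]
  have hD2 : Even (k * B + l * D) ↔ Even (u * D') := by rw [← hT, hD]
  simp only [Int.even_add, Int.even_mul, hk, hl, hu', true_or, false_or, true_iff] at hC2 hD2
  exact ⟨Int.even_sub.2 hC2, Int.even_sub.2 hD2⟩

/-- Representatives of the right cosets of `Γ₀(2)` in `SL₂(ℤ)`. -/
def cosetMob : Fin 3 → ℂ → ℂ :=
  ![mob 1 0 0 1, mob 0 (-1) 1 0, mob 1 0 1 1]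

theorem exists_cosetMob (i : Fin 3) : ∃ A B C D : ℤ, A * D - B * C = 1 ∧
    cosetMob i = mob A B C D ∧ (Even C ↔ i = 0) ∧ (Even D ↔ i = 1) := by
  fin_cases i
  · exact ⟨1, 0, 0, 1, by norm_num, rfl, by decide, by decide⟩
  · exact ⟨0, -1, 1, 0, by norm_num, rfl, by decide, by decide⟩
  · exact ⟨1, 0, 1, 1, by norm_num, rfl, by decide, by decide⟩

theorem hauptmodul_mob_eq_of_even {A B C D A' B' C' D' : ℤ} (h : A * D - B * C = 1)
    (h' : A' * D' - B' * C' = 1) (he : Even (C * D' - D * C')) {x : ℂ} (hx : 0 < x.im) :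
    hauptmodul (mob A' B' C' D' x) = hauptmodul (mob A B C D x) := by
  have hd : 0 < A' * D' - B' * C' := by rw [h']; exact one_pos
  rw [← hauptmodul_eq_of_mob (A := A * D' - B * C') (B := B * A' - A * B') (D := D * A' - C * B')
    (by linear_combination (A' * D' - B' * C') * h + h') he (mob_im_pos hd hx),
    mob_mob (denom_ne_zero hd hx)]
  congr 2
  · linear_combination A * h'
  · linear_combination B * h'
  · linear_combination C * h'
  · linear_combination D * h'

theorem exists_hauptmodul_cosetMob {A B C D : ℤ} (h : A * D - B * C = 1) {x : ℂ}
    (hx : 0 < x.im) : ∃ i, hauptmodul (cosetMob i x) = hauptmodul (mob A B C D x) := by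
  by_cases hC : Even C
  · exact ⟨0, hauptmodul_mob_eq_of_even h (by norm_num) (by simpa using hC) hx⟩
  · by_cases hD : Even D
    · exact ⟨1, hauptmodul_mob_eq_of_even h (by norm_num) (by simpa using hD) hx⟩
    · exact ⟨2, hauptmodul_mob_eq_of_even h (by norm_num) (by simp [Int.even_sub, hC, hD]) hx⟩

theorem mob_mem_integralFixedPoints {s n : ℤ} {A B C D : ℤ} (hdet : A * D - B * C = 1) {τ : ℂ}
    (hτ : τ ∈ integralFixedPoints s n) : mob A B C D τ ∈ integralFixedPoints s n := by
  obtain ⟨him, a, b, c, h⟩ := hτ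
  exact ⟨mob_im_pos (by rw [hdet]; exact one_pos) him, _, _, _, h.conj him hdet⟩

theorem ncard_hauptmodul_of_odd {p : ℕ} [hp : Fact p.Prime] (hp5 : 5 ≤ p) {m n : ℤ} (hm : 0 < m)
    (hn : n = 4 * m - 1) (hm2 : ¬ Even m) (hE : evenFixedPoints n ⊆ frickeFixedPoints p) {h : ℕ}
    {cl : ℂ → Fin h} (hcl : IsClassMap 1 m cl) :
    (hauptmodul '' evenFixedPoints n).ncard = 3 * h := by
  obtain ⟨hsurj, hcl⟩ := hcl
  choose r hrZ hr using hsurj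
  rw [hauptmodul_image_evenFixedPoints hn,
    ncard_image_of_injective (F := fun z : Fin h × Fin 3 ↦ hauptmodul (cosetMob z.2 (r z.1)))]
  · simp [mul_comm]
  · rintro ⟨K, i⟩ ⟨K', j⟩ hK
    obtain ⟨A, B, C, D, h1, h2, h3, h4⟩ := exists_cosetMob i
    obtain ⟨A', B', C', D', h1', h2', h3', h4'⟩ := exists_cosetMob j
    simp only [h2, h2'] at hK
    have hx := mob_mem_integralFixedPoints h1 (hrZ K)
    have hy := mob_mem_integralFixedPoints h1' (hrZ K')
    obtain ⟨him, a, b, c, hf⟩ := id hx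
    have hc : ¬ Even c := fun hc ↦ hm2 (hf.even_mul.1 (hc.mul_left b))
    obtain ⟨e, f, k, l, hdet, hk, hxy⟩ := exists_mob_of_hauptmodul_eq_of_odd hm him hf hc hy hK
    have hKK : K = K' := by
      rw [← hr K, ← hr K', (hcl _ (hrZ K) _ hx).2 ⟨A, B, C, D, h1, rfl⟩,
        (hcl _ (hrZ K') _ hy).2 ⟨A', B', C', D', h1', rfl⟩]
      exact (hcl _ hx _ hy).2 ⟨e, f, k, l, hdet, hxy⟩
    subst hKK
    obtain ⟨h5, h6⟩ := two_dvd_sub_of_mob_mob hp5 (hE (integralFixedPoints_subset hn (hrZ K)))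
      h1 h1' hdet hk hxy
    rw [Int.even_sub, h3, h3'] at h5
    rw [Int.even_sub, h4, h4'] at h6
    have key : ∀ i j : Fin 3, (i = 0 ↔ j = 0) → (i = 1 ↔ j = 1) → i = j := by decide
    rw [key i j h5 h6]
  · ext z
    constructor
    · rintro ⟨y, hy, rfl⟩
      obtain ⟨A, B, C, D, hdet, hAy⟩ := (hcl _ (hrZ (cl y)) _ hy).1 (hr (cl y))
      obtain ⟨i, hi⟩ := exists_hauptmodul_cosetMob hdet (hrZ (cl y)).1
      exact ⟨(cl y, i), by rw [← hAy, ← hi, hAy]⟩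
    · rintro ⟨⟨K, i⟩, rfl⟩
      obtain ⟨A, B, C, D, h1, h2, -⟩ := exists_cosetMob i
      exact ⟨_, mob_mem_integralFixedPoints h1 (hrZ K), by simp only [h2]⟩

theorem disjoint_hauptmodul_evenFixedPoints {n : ℤ} (hn : 0 < n) :
    Disjoint (hauptmodul '' evenFixedPoints n) (hauptmodul '' evenFixedPoints (2 * n)) := by
  rw [Set.disjoint_left]
  rintro _ ⟨x, hx, rfl⟩ ⟨y, hy, hxy⟩
  obtain ⟨A, B, C, D, hI, rfl⟩ := frickeEquiv_of_hauptmodul_eq hx.1 hy.1 hxy.symm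
  obtain ⟨him, a, b, c, h⟩ := hI.mem_evenFixedPoints hx
  obtain ⟨-, a', b', c', h'⟩ := hy
  have hc := h.ne_zero him (by linarith)
  obtain ⟨h1, h2⟩ := fix_proportional him h.2 h'.2
  have h3 : (2 * c') ^ 2 = 2 * (2 * c) ^ 2 := by
    refine mul_left_cancel₀ hn.ne' ?_
    have e1 := h.1
    have e2 := h'.1
    linear_combination -(2 * c') ^ 2 * e1 + (2 * c) ^ 2 * e2 +
      (c * a' + c' * a) * h1 + 4 * c' * c * h2
  have h4 : (((2 * c' : ℤ) : ℝ) / (2 * c : ℤ)) ^ 2 = 2 := by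
    have hc' : ((2 * c : ℤ) : ℝ) ≠ 0 := by exact_mod_cast hc
    rw [div_pow, div_eq_iff (pow_ne_zero 2 hc')]
    exact_mod_cast h3
  refine irrational_sqrt_two ⟨|((2 * c' : ℤ) : ℚ) / (2 * c : ℤ)|, ?_⟩
  rw [← h4, Real.sqrt_sq_eq_abs]
  push_cast
  rfl

theorem classNumberSqrtNeg_pos (d : ℕ) : 0 < classNumberSqrtNeg d := by
  rw [classNumberSqrtNeg_eq, NumberField.classNumber]
  exact Fintype.card_pos

theorem two_mul_ncard_evenFixedPoints_two_mul {p : ℕ} [hp : Fact p.Prime] (hp5 : 5 ≤ p) :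
    2 * (hauptmodul '' evenFixedPoints (2 * p)).ncard = classNumberSqrtNeg (2 * p) := by
  have hodd := Nat.odd_iff.1 (hp.out.odd_of_ne_two (by omega))
  have hsq : Squarefree (2 * p) := (Nat.squarefree_mul ((Nat.coprime_primes Nat.prime_two hp.out).2
    (by omega))).2 ⟨Nat.prime_two.prime.squarefree, hp.out.prime.squarefree⟩
  obtain ⟨cl, hcl⟩ := exists_isClassMap hsq (by omega)
  push_cast at hcl
  refine two_mul_ncard_hauptmodul_evenFixedPoints hp5 (by omega) (by omega) ?_ hcl
  rw [frickeFixedPoints_eq]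
  exact Set.subset_union_right

theorem two_mul_ncard_evenFixedPoints {p : ℕ} [hp : Fact p.Prime] (hp5 : 5 ≤ p) :
    2 * (hauptmodul '' evenFixedPoints p).ncard =
      (if p % 4 = 1 then 1 else if p % 8 = 7 then 4 else 6) * classNumberSqrtNeg p := by
  have hodd := Nat.odd_iff.1 (hp.out.odd_of_ne_two (by omega))
  have hsq := hp.out.prime.squarefree
  have hE : evenFixedPoints p ⊆ frickeFixedPoints p := by
    rw [frickeFixedPoints_eq]
    exact Set.subset_union_left
  split_ifs with h1 h2
  · obtain ⟨cl, hcl⟩ := exists_isClassMap hsq (by omega)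
    rw [one_mul]
    exact two_mul_ncard_hauptmodul_evenFixedPoints hp5 (by omega) (by omega) hE hcl
  all_goals
    obtain ⟨m, hm⟩ : ∃ m : ℤ, (p : ℤ) = 4 * m - 1 := ⟨((p : ℤ) + 1) / 4, by omega⟩
    obtain ⟨cl, hcl⟩ := exists_isClassMap_of_three hsq (by omega) hm
  · rw [ncard_hauptmodul_of_even (by omega) hm (Int.even_iff.2 (by omega)) hcl
      (classNumberSqrtNeg_pos p)]
    ring
  · rw [ncard_hauptmodul_of_odd hp5 (by omega) hm (fun h ↦ by have := Int.even_iff.1 h; omega) hE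
      hcl]
    ring

theorem four_mul_L2Star {p : ℕ} [hp : Fact p.Prime] (hp5 : 5 ≤ p) :
    4 * L2Star p = (if p % 4 = 1 then 1 else if p % 8 = 7 then 4 else 6) * classNumberSqrtNeg p +
      classNumberSqrtNeg (2 * p) := by
  have h1 := two_mul_ncard_evenFixedPoints hp5
  have h2 := two_mul_ncard_evenFixedPoints_two_mul hp5
  have h3 := two_mul_L2Star hp5
  have h4 := classNumberSqrtNeg_pos p
  have h5 := classNumberSqrtNeg_pos (2 * p)
  have h6 : 0 < (hauptmodul '' evenFixedPoints p).ncard := by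
    rw [Nat.pos_iff_ne_zero]
    intro h0
    rw [h0] at h1
    split_ifs at h1 <;> omega
  rw [frickeFixedPoints_eq, Set.image_union, Set.ncard_union_eq
    (disjoint_hauptmodul_evenFixedPoints (by omega)) (Set.finite_of_ncard_pos h6)
    (Set.finite_of_ncard_pos (by omega))] at h3
  rw [← h1, ← h2]
  omega

/-- For every prime p ≥ 5, the number L^{(2*)}(p) of distinct roots of ss_p^{(2*)}(X) in 𝔽_p
equals (1/8)·(2 + (1 − (−1|p))·(4 + (−2|p)))·h(√−p) + (1/4)·h(√−2p). -/
theorem number_of_linear_factors_of_ss2star (hp : 5 ≤ p) :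
    (L2Star p : ℚ) =
      1 / 8 * (2 + (1 - (legendreSym p (-1) : ℚ)) * (4 + (legendreSym p (-2) : ℚ))) *
          (classNumberSqrtNeg p : ℚ)
        + 1 / 4 * (classNumberSqrtNeg (2 * p) : ℚ) := by
  have h := congrArg (Nat.cast : ℕ → ℚ) (four_mul_L2Star hp)
  push_cast at h
  rcases legendreSym_cases (p := p) (by omega) with
    ⟨h8, h1, h2⟩ | ⟨h8, h1, h2⟩ | ⟨h8, h1, h2⟩ | ⟨h8, h1, h2⟩
  · rw [if_pos (by omega)] at h
    rw [h1, h2]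
    push_cast
    linarith
  · rw [if_neg (by omega), if_neg (by omega)] at h
    rw [h1, h2]
    push_cast
    linarith
  · rw [if_pos (by omega)] at h
    rw [h1, h2]
    push_cast
    linarith
  · rw [if_neg (by omega), if_pos (by omega)] at h
    rw [h1, h2]
    push_cast
    linarith
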